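/- Let d ≥ 1 be a natural number and 1 < p < ∞. Then there is a constant C(p,d) such that for every f ∈ C¹(𝕋), the polynomial Carleson operator satisfies ‖C_d f‖_{L^p(𝕋)} ≤ C(p,d)·‖f‖_{L^p(𝕋)}. In particular C_d is of strong type (p,p) for all 1 < p < ∞. -/

import Mathlib

open MeasureTheory Set Filter Topology
open scoped ENNReal NNReal

noncomputable section

namespace PolyCarleson

/-- The principal value integral `p.v. ∫_𝕋 (1/y)·e^{iQ(y)}·f(x−y) dy`, where
`𝕋 = [−1/2,1/2]`, taken as the limit of the truncated integrals as `ε → 0⁺`. -/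
def pvCarleson (Q : Polynomial ℝ) (f : ℝ → ℂ) (x : ℝ) : ℂ :=
  limUnder (𝓝[>] (0 : ℝ)) fun ε : ℝ =>
    ∫ y in {y : ℝ | ε < |y| ∧ |y| ≤ 1 / 2},
      ((1 / y : ℝ) : ℂ) * Complex.exp (Complex.I * ((Q.eval y : ℝ) : ℂ)) * f (x - y)

/-- The polynomial Carleson operator
`C_d f(x) = sup_{Q ∈ 𝒬_d} | p.v. ∫_𝕋 (1/y)·e^{iQ(y)}·f(x−y) dy |`. -/
def CarlesonOp (d : ℕ) (f : ℝ → ℂ) (x : ℝ) : ℝ≥0∞ :=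
  ⨆ Q : {Q : Polynomial ℝ // Q.natDegree ≤ d}, (‖pvCarleson Q.1 f x‖₊ : ℝ≥0∞)

section

/-- oscillation of a polynomial on a half-open interval -/
def osc (a b : ℝ) (q : Polynomial ℝ) : ℝ := Metric.diam ((fun x => q.eval x) '' Ico a b)

theorem osc_bdd (a b : ℝ) (q : Polynomial ℝ) : Bornology.IsBounded ((fun x => q.eval x) '' Ico a b) := by
  have h : IsCompact ((fun x => q.eval x) '' Icc a b) := isCompact_Icc.image q.continuous
  exact h.isBounded.subset (image_mono Ico_subset_Icc_self)

theorem osc_nonneg (a b : ℝ) (q : Polynomial ℝ) : 0 ≤ osc a b q := Metric.diam_nonneg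

theorem le_osc {a b : ℝ} (q : Polynomial ℝ) {x y : ℝ} (hx : x ∈ Ico a b) (hy : y ∈ Ico a b) :
    |q.eval x - q.eval y| ≤ osc a b q := by
  have := Metric.dist_le_diam_of_mem (osc_bdd a b q) (mem_image_of_mem _ hx) (mem_image_of_mem _ hy)
  simpa [Real.dist_eq, osc] using this

theorem osc_le {a b B : ℝ} (q : Polynomial ℝ) (hB : 0 ≤ B)
    (h : ∀ x ∈ Ico a b, ∀ y ∈ Ico a b, |q.eval x - q.eval y| ≤ B) : osc a b q ≤ B := by
  apply Metric.diam_le_of_forall_dist_le hB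
  rintro _ ⟨x, hx, rfl⟩ _ ⟨y, hy, rfl⟩
  simpa [Real.dist_eq] using h x hx y hy

theorem osc_mono {a b a' b' : ℝ} (h : Ico a b ⊆ Ico a' b') (q : Polynomial ℝ) :
    osc a b q ≤ osc a' b' q :=
  Metric.diam_mono (image_mono h) (osc_bdd a' b' q)

theorem osc_add (a b : ℝ) (p q : Polynomial ℝ) : osc a b (p + q) ≤ osc a b p + osc a b q := by
  apply osc_le _ (add_nonneg (osc_nonneg _ _ _) (osc_nonneg _ _ _))
  intro x hx y hy
  have h1 := le_osc p hx hy
  have h2 := le_osc q hx hy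
  rw [Polynomial.eval_add, Polynomial.eval_add]
  calc _ = |(p.eval x - p.eval y) + (q.eval x - q.eval y)| := by ring_nf
    _ ≤ _ := (abs_add_le _ _).trans (add_le_add h1 h2)

theorem osc_sub_comm (a b : ℝ) (p q : Polynomial ℝ) : osc a b (p - q) = osc a b (q - p) := by
  have key : ∀ p q : Polynomial ℝ, osc a b (p - q) ≤ osc a b (q - p) := by
    intro p q
    apply osc_le _ (osc_nonneg _ _ _)
    intro x hx y hy
    have h1 := le_osc (q - p) hx hy
    simp only [Polynomial.eval_sub] at *
    rw [abs_sub_comm] at h1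
    convert h1 using 2; ring
  exact le_antisymm (key p q) (key q p)

theorem osc_tri (a b : ℝ) (p q r : Polynomial ℝ) :
    osc a b (p - r) ≤ osc a b (p - q) + osc a b (q - r) := by
  have := osc_add a b (p - q) (q - r)
  simpa using this

theorem osc_self (a b : ℝ) (p : Polynomial ℝ) : osc a b (p - p) = 0 := by
  apply le_antisymm _ (osc_nonneg _ _ _)
  apply osc_le _ le_rfl
  simp

/-- coefficients controlled by sup on the unit interval -/
theorem coeff_bound (d : ℕ) : ∃ C : ℝ, 1 ≤ C ∧ ∀ p : Polynomial ℝ, p.natDegree ≤ d → ∀ B : ℝ,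
    (∀ y ∈ Ico (0:ℝ) 1, |p.eval y| ≤ B) → ∀ j, |p.coeff j| ≤ C * B := by
  classical
  set v : ℕ → ℝ := fun i => (i:ℝ) / (d+1) with hv
  set s := Finset.range (d+1) with hs
  have hinj : Set.InjOn v s := by
    intro i _ j _ h
    have hd : (d:ℝ) + 1 ≠ 0 := by positivity
    simp only [hv] at h
    field_simp at h
    exact_mod_cast h
  refine ⟨1 + ∑ i ∈ s, ∑ j ∈ Finset.range (d+1), |(Lagrange.basis s v i).coeff j|, ?_, ?_⟩
  · have : 0 ≤ ∑ i ∈ s, ∑ j ∈ Finset.range (d+1), |(Lagrange.basis s v i).coeff j| := by positivity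
    linarith
  intro p hp B hB j
  have hB0 : 0 ≤ B := (abs_nonneg _).trans (hB 0 (by simp))
  by_cases hj : d < j
  · rw [Polynomial.coeff_eq_zero_of_natDegree_lt (by omega)]
    simp only [abs_zero]
    positivity
  push Not at hj
  have hdeg : p.degree < s.card := by
    rw [hs, Finset.card_range]
    exact lt_of_le_of_lt (Polynomial.degree_le_of_natDegree_le hp) (by exact_mod_cast Nat.lt_succ_self d)
  have e := Lagrange.eq_interpolate hinj hdeg
  have e2 : p.coeff j = ∑ i ∈ s, p.eval (v i) * (Lagrange.basis s v i).coeff j := by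
    conv_lhs => rw [e]
    rw [Lagrange.interpolate_apply, Polynomial.finsetSum_coeff]
    apply Finset.sum_congr rfl
    intro i _
    rw [Polynomial.coeff_C_mul]
  rw [e2]
  calc |∑ i ∈ s, p.eval (v i) * (Lagrange.basis s v i).coeff j|
      ≤ ∑ i ∈ s, |p.eval (v i) * (Lagrange.basis s v i).coeff j| := Finset.abs_sum_le_sum_abs _ _
    _ ≤ ∑ i ∈ s, B * ∑ j ∈ Finset.range (d+1), |(Lagrange.basis s v i).coeff j| := by
        apply Finset.sum_le_sum
        intro i hi
        rw [abs_mul]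
        apply mul_le_mul _ _ (abs_nonneg _) hB0
        · apply hB
          have hi' : i < d + 1 := by simpa [hs] using hi
          have : (i:ℝ) < d + 1 := by exact_mod_cast hi'
          constructor
          · simp only [hv]; positivity
          · simp only [hv]; rw [div_lt_one (by positivity)]; exact this
        · exact Finset.single_le_sum (f := fun j => |(Lagrange.basis s v i).coeff j|)
            (fun _ _ => abs_nonneg _) (by simp; omega)
    _ = (∑ i ∈ s, ∑ j ∈ Finset.range (d+1), |(Lagrange.basis s v i).coeff j|) * B := by
        rw [← Finset.mul_sum, mul_comm]
    _ ≤ _ := by nlinarith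

/-- rescaled polynomial, vanishing at 0 -/
def resc (a l : ℝ) (q : Polynomial ℝ) : Polynomial ℝ :=
  q.comp (Polynomial.C a + Polynomial.C l * Polynomial.X) - Polynomial.C (q.eval a)

theorem resc_eval (a l : ℝ) (q : Polynomial ℝ) (y : ℝ) :
    (resc a l q).eval y = q.eval (a + l * y) - q.eval a := by
  simp [resc]

theorem resc_deg {d : ℕ} (a l : ℝ) (q : Polynomial ℝ) (hq : q.natDegree ≤ d) :
    (resc a l q).natDegree ≤ d := by
  unfold resc
  apply (Polynomial.natDegree_sub_le _ _).trans
  rw [Polynomial.natDegree_C]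
  simp only [zero_le, sup_of_le_left]
  rw [Polynomial.natDegree_comp]
  have : (Polynomial.C a + Polynomial.C l * Polynomial.X).natDegree ≤ 1 := by
    rw [add_comm]; exact Polynomial.natDegree_linear_le
  nlinarith

theorem resc_sub (a l : ℝ) (p q : Polynomial ℝ) : resc a l (p - q) = resc a l p - resc a l q := by
  simp only [resc, Polynomial.sub_comp, Polynomial.eval_sub, Polynomial.C_sub]; ring

theorem resc_coeff_bound (d : ℕ) : ∃ C : ℝ, 1 ≤ C ∧ ∀ q : Polynomial ℝ, q.natDegree ≤ d →
    ∀ a b : ℝ, a < b → ∀ j, |(resc a (b - a) q).coeff j| ≤ C * osc a b q := by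
  obtain ⟨C, hC, h⟩ := coeff_bound d
  refine ⟨C, hC, fun q hq a b hab j => h _ (resc_deg _ _ _ hq) _ ?_ j⟩
  intro y hy
  rw [resc_eval]
  apply le_osc
  · constructor
    · nlinarith [hy.1, hy.2]
    · nlinarith [hy.1, hy.2]
  · exact ⟨le_rfl, hab⟩

theorem abs_sub_le_abs_add_abs' (a b : ℝ) : |a - b| ≤ |a| + |b| := by
  rw [sub_eq_add_neg]; exact (abs_add_le _ _).trans (by rw [abs_neg])

theorem abs_pow_sub_le (s t : ℝ) (hs : |s| ≤ 1) (ht : |t| ≤ 1) (j : ℕ) :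
    |s^j - t^j| ≤ j * |s - t| := by
  induction j with
  | zero => simp
  | succ j ih =>
    have : s^(j+1) - t^(j+1) = s * (s^j - t^j) + (s - t) * t^j := by ring
    rw [this]
    have h1 : |s * (s^j - t^j)| ≤ 1 * (j * |s - t|) := by
      rw [abs_mul]; exact mul_le_mul hs ih (abs_nonneg _) zero_le_one
    have h2 : |(s-t) * t^j| ≤ |s-t| * 1 := by
      rw [abs_mul, abs_pow]
      exact mul_le_mul_of_nonneg_left (pow_le_one₀ (abs_nonneg _) ht) (abs_nonneg _)
    refine (abs_add_le _ _).trans ?_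
    push_cast; linarith

theorem osc_contract (d : ℕ) : ∃ C : ℝ, 1 ≤ C ∧ ∀ q : Polynomial ℝ, q.natDegree ≤ d →
    ∀ a b a' b' : ℝ, a < b → a' ≤ a → b ≤ b' →
      osc a b q ≤ C * ((b - a) / (b' - a')) * osc a' b' q := by
  obtain ⟨C, hC, h⟩ := resc_coeff_bound d
  refine ⟨C * (d+1) * (d+1), ?_, ?_⟩
  · have : (1:ℝ) ≤ d + 1 := by linarith [(Nat.cast_nonneg d : (0:ℝ) ≤ d)]
    have h2 : 1 ≤ C * (d+1) := by nlinarith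
    nlinarith
  intro q hq a b a' b' hab ha hb
  have hl : 0 < b' - a' := by linarith
  have ho := osc_nonneg a' b' q
  apply osc_le
  · have : 0 ≤ (b - a)/(b'-a') := div_nonneg (by linarith) hl.le
    positivity
  intro x hx y hy
  set p := resc a' (b' - a') q with hp
  set s := (x - a')/(b'-a') with hs
  set t := (y - a')/(b'-a') with ht
  have es : a' + (b'-a') * s = x := by rw [hs]; field_simp; ring
  have et : a' + (b'-a') * t = y := by rw [ht]; field_simp; ring
  have e : q.eval x - q.eval y = p.eval s - p.eval t := by
    rw [hp, resc_eval, resc_eval, es, et]; ring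
  have hs1 : |s| ≤ 1 := by
    rw [abs_le]; constructor
    · have : 0 ≤ s := div_nonneg (by linarith [hx.1]) hl.le
      linarith
    · rw [hs, div_le_one hl]; linarith [hx.2]
  have ht1 : |t| ≤ 1 := by
    rw [abs_le]; constructor
    · have : 0 ≤ t := div_nonneg (by linarith [hy.1]) hl.le
      linarith
    · rw [ht, div_le_one hl]; linarith [hy.2]
  have hst : |s - t| ≤ (b-a)/(b'-a') := by
    rw [hs, ht, ← sub_div, abs_div, abs_of_pos hl]
    apply div_le_div_of_nonneg_right _ hl.le
    rw [abs_le]; constructor <;> linarith [hx.1, hx.2, hy.1, hy.2]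
  have hdeg : p.natDegree ≤ d := resc_deg a' (b'-a') q hq
  rw [e, Polynomial.eval_eq_sum_range' (n := d+1) (by omega), Polynomial.eval_eq_sum_range' (n := d+1) (by omega),
    ← Finset.sum_sub_distrib]
  calc |∑ i ∈ Finset.range (d+1), (p.coeff i * s^i - p.coeff i * t^i)|
      ≤ ∑ i ∈ Finset.range (d+1), |p.coeff i * s^i - p.coeff i * t^i| := Finset.abs_sum_le_sum_abs _ _
    _ ≤ ∑ i ∈ Finset.range (d+1), (C * osc a' b' q) * ((d+1) * ((b-a)/(b'-a'))) := by
        apply Finset.sum_le_sum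
        intro i hi
        rw [← mul_sub, abs_mul]
        apply mul_le_mul (h q hq a' b' (by linarith) i) _ (abs_nonneg _) (by positivity)
        refine (abs_pow_sub_le s t hs1 ht1 i).trans ?_
        apply mul_le_mul _ hst (abs_nonneg _) (by positivity)
        have : i < d + 1 := by simpa using hi
        exact_mod_cast this.le
    _ = _ := by rw [Finset.sum_const, Finset.card_range, nsmul_eq_mul]; push_cast; ring

theorem osc_doubling (d : ℕ) : ∃ C : ℝ, 1 ≤ C ∧ ∀ q : Polynomial ℝ, q.natDegree ≤ d →
    ∀ a b a' b' : ℝ, a < b → a' ≤ a → b ≤ b' →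
      osc a' b' q ≤ C * ((b' - a') / (b - a))^d * osc a b q := by
  obtain ⟨C, hC, h⟩ := resc_coeff_bound d
  refine ⟨2 * (C * (d+1)), ?_, ?_⟩
  · have : (1:ℝ) ≤ d + 1 := by linarith [(Nat.cast_nonneg d : (0:ℝ) ≤ d)]
    nlinarith
  intro q hq a b a' b' hab ha hb
  have hl : 0 < b - a := by linarith
  have ho := osc_nonneg a b q
  set T := (b'-a')/(b-a) with hT
  have hT1 : 1 ≤ T := by rw [hT, one_le_div hl]; linarith
  set p := resc a (b - a) q with hp
  have hdeg : p.natDegree ≤ d := resc_deg a (b-a) q hq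
  have key : ∀ x ∈ Ico a' b', |q.eval x - q.eval a| ≤ C * (d+1) * T^d * osc a b q := by
    intro x hx
    set s := (x - a)/(b-a) with hs
    have es : a + (b-a) * s = x := by rw [hs]; field_simp; ring
    have e : q.eval x - q.eval a = p.eval s := by rw [hp, resc_eval, es]
    have hsT : |s| ≤ T := by
      rw [hs, hT, abs_div, abs_of_pos hl]
      apply div_le_div_of_nonneg_right _ hl.le
      rw [abs_le]; constructor <;> linarith [hx.1, hx.2]
    rw [e, Polynomial.eval_eq_sum_range' (n := d+1) (by omega)]
    calc |∑ i ∈ Finset.range (d+1), p.coeff i * s^i|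
        ≤ ∑ i ∈ Finset.range (d+1), |p.coeff i * s^i| := Finset.abs_sum_le_sum_abs _ _
      _ ≤ ∑ i ∈ Finset.range (d+1), (C * osc a b q) * T^d := by
          apply Finset.sum_le_sum
          intro i hi
          rw [abs_mul, abs_pow]
          apply mul_le_mul (h q hq a b hab i) _ (by positivity) (by positivity)
          have : i < d + 1 := by simpa using hi
          exact (pow_le_pow_left₀ (abs_nonneg _) hsT i).trans (pow_le_pow_right₀ hT1 (by omega))
      _ = _ := by rw [Finset.sum_const, Finset.card_range, nsmul_eq_mul]; push_cast; ring
  apply osc_le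
  · positivity
  intro x hx y hy
  have h1 := key x hx
  have h2 := key y hy
  calc |q.eval x - q.eval y| = |(q.eval x - q.eval a) - (q.eval y - q.eval a)| := by ring_nf
    _ ≤ _ := (abs_sub_le_abs_add_abs' _ _).trans (by linarith)

theorem osc_key (d : ℕ) : ∃ C : ℝ, 1 ≤ C ∧ ∀ a b : ℝ, a < b → ∀ q0 : Polynomial ℝ, q0.natDegree ≤ d →
    ∀ lam : ℝ, 1 ≤ lam → ∃ (κ : Polynomial ℝ → (Fin d → ℤ)) (S : Finset (Fin d → ℤ)),
      (S.card : ℝ) ≤ C * lam^d ∧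
      (∀ q : Polynomial ℝ, q.natDegree ≤ d → osc a b (q - q0) ≤ lam → κ q ∈ S) ∧
      (∀ q q' : Polynomial ℝ, q.natDegree ≤ d → q'.natDegree ≤ d → κ q = κ q' → osc a b (q - q') ≤ 1) := by
  obtain ⟨C, hC, h⟩ := resc_coeff_bound d
  refine ⟨(2 * (C * (2 * (d+1)) + 1) + 1)^d, ?_, ?_⟩
  · apply one_le_pow₀
    have : 0 ≤ C * (2 * (d+1)) := by positivity
    linarith
  intro a b hab q0 hq0 lam hlam
  set κ : Polynomial ℝ → (Fin d → ℤ) := fun q i =>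
    ⌊(2 * ((d:ℝ)+1)) * (resc a (b-a) (q - q0)).coeff (i+1)⌋ with hκ
  set M : ℤ := ⌈C * lam * (2 * ((d:ℝ)+1))⌉ with hM
  have hM0 : 0 ≤ M := Int.ceil_nonneg (by positivity)
  refine ⟨κ, Fintype.piFinset (fun _ => Finset.Icc (-M) M), ?_, ?_, ?_⟩
  · rw [Fintype.card_piFinset, Finset.prod_const, Finset.card_univ, Fintype.card_fin, Int.card_Icc]
    push_cast
    rw [← mul_pow]
    apply pow_le_pow_left₀ (by positivity)
    have e : (((M + 1 - -M).toNat : ℕ) : ℝ) = 2 * (M:ℝ) + 1 := by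
      have : ((M + 1 - -M).toNat : ℤ) = 2 * M + 1 := by omega
      exact_mod_cast this
    rw [e]
    have : (M:ℝ) < C * lam * (2 * ((d:ℝ)+1)) + 1 := Int.ceil_lt_add_one _
    nlinarith
  · intro q hq ho
    rw [Fintype.mem_piFinset]
    intro i
    rw [Finset.mem_Icc]
    have hb := h (q - q0) ((Polynomial.natDegree_sub_le _ _).trans (max_le hq hq0)) a b hab (i+1)
    have hb2 : |(resc a (b-a) (q - q0)).coeff (i+1)| ≤ C * lam :=
      hb.trans (mul_le_mul_of_nonneg_left ho (by linarith))
    rw [abs_le] at hb2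
    have hceil : C * lam * (2 * ((d:ℝ)+1)) ≤ M := Int.le_ceil _
    have hd : (0:ℝ) ≤ 2 * (d+1) := by positivity
    constructor
    · rw [hκ]; apply Int.le_floor.2; push_cast; nlinarith [hb2.1]
    · rw [hκ]; apply Int.floor_le_iff.2; nlinarith [hb2.2]
  · intro q q' hq hq' hk
    have hc : ∀ i, |(resc a (b-a) (q - q')).coeff (i+1)| ≤ 1 / (2 * (d+1)) := by
      intro i
      by_cases hi : i < d
      · have hk' := congrFun hk ⟨i, hi⟩
        simp only [hκ] at hk'
        have h1 := Int.abs_sub_lt_one_of_floor_eq_floor hk'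
        rw [← mul_sub, abs_mul, abs_of_pos (by positivity : (0:ℝ) < 2 * (d+1))] at h1
        have e : (resc a (b-a) (q - q')).coeff (i+1) =
          (resc a (b-a) (q - q0)).coeff (i+1) - (resc a (b-a) (q' - q0)).coeff (i+1) := by
          rw [resc_sub, resc_sub, resc_sub]; simp
        rw [e, le_div_iff₀ (by positivity)]
        linarith
      · rw [Polynomial.coeff_eq_zero_of_natDegree_lt]
        · simp; positivity
        · have := resc_deg a (b-a) (q-q') ((Polynomial.natDegree_sub_le _ _).trans (max_le hq hq'))
          omega
    have hdeg := resc_deg a (b-a) (q-q') ((Polynomial.natDegree_sub_le _ _).trans (max_le hq hq'))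
    have hl : 0 < b - a := by linarith
    have key : ∀ x ∈ Ico a b, |(q-q').eval x - (q-q').eval a| ≤ 1/2 := by
      intro x hx
      set s := (x - a)/(b-a) with hs
      have es : a + (b-a) * s = x := by rw [hs]; field_simp; ring
      have hs1 : |s| ≤ 1 := by
        rw [hs, abs_div, abs_of_pos hl, div_le_one hl, abs_le]; constructor <;> linarith [hx.1, hx.2]
      have e : (q-q').eval x - (q-q').eval a = (resc a (b-a) (q - q')).eval s := by rw [resc_eval, es]
      rw [e, Polynomial.eval_eq_sum_range' (n := d+1) (by omega), Finset.sum_range_succ']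
      have h0 : (resc a (b-a) (q-q')).coeff 0 = 0 := by
        rw [Polynomial.coeff_zero_eq_eval_zero, resc_eval]; simp
      rw [h0, zero_mul, add_zero]
      calc _ ≤ ∑ i ∈ Finset.range d, |(resc a (b-a) (q-q')).coeff (i+1) * s^(i+1)| :=
            Finset.abs_sum_le_sum_abs _ _
        _ ≤ ∑ i ∈ Finset.range d, 1 / (2 * ((d:ℝ)+1)) := by
            apply Finset.sum_le_sum
            intro i _
            rw [abs_mul, abs_pow]
            calc _ ≤ 1 / (2 * ((d:ℝ)+1)) * 1 :=
                  mul_le_mul (hc i) (pow_le_one₀ (abs_nonneg _) hs1) (by positivity) (by positivity)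
              _ = _ := mul_one _
        _ ≤ 1/2 := by
            rw [Finset.sum_const, Finset.card_range, nsmul_eq_mul, mul_one_div, div_le_iff₀ (by positivity)]
            linarith
    apply osc_le _ zero_le_one
    intro x hx y hy
    have h1 := key x hx
    have h2 := key y hy
    calc _ = |((q-q').eval x - (q-q').eval a) - ((q-q').eval y - (q-q').eval a)| := by ring_nf
      _ ≤ _ := (abs_sub_le_abs_add_abs' _ _).trans (by linarith)

end

section

theorem deriv_coeff_bound {d : ℕ} {p : Polynomial ℝ} (hp : p.natDegree ≤ d) {K : ℝ} (hK : 0 ≤ K)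
    (h : ∀ j, |p.coeff j| ≤ K) (j : ℕ) : |p.derivative.coeff j| ≤ K * d := by
  rw [Polynomial.coeff_derivative]
  by_cases hj : j + 1 ≤ d
  · rw [abs_mul]
    apply mul_le_mul (h _) _ (abs_nonneg _) hK
    have : ((j:ℝ) + 1) ≤ d := by exact_mod_cast hj
    rw [abs_of_nonneg (by positivity)]
    exact this
  · rw [Polynomial.coeff_eq_zero_of_natDegree_lt (by omega)]
    simp only [zero_mul, abs_zero]; positivity

theorem eval_bound {d : ℕ} {p : Polynomial ℝ} (hp : p.natDegree ≤ d) {K : ℝ} (hK : 0 ≤ K)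
    (h : ∀ j, |p.coeff j| ≤ K) {y : ℝ} (hy : |y| ≤ 1) : |p.eval y| ≤ (d+1) * K := by
  rw [Polynomial.eval_eq_sum_range' (n := d+1) (by omega)]
  calc _ ≤ ∑ i ∈ Finset.range (d+1), |p.coeff i * y^i| := Finset.abs_sum_le_sum_abs _ _
    _ ≤ ∑ i ∈ Finset.range (d+1), K := by
        apply Finset.sum_le_sum
        intro i _
        rw [abs_mul, abs_pow]
        calc _ ≤ K * 1 := mul_le_mul (h i) (pow_le_one₀ (abs_nonneg _) hy) (by positivity) hK
          _ = K := mul_one K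
    _ = _ := by rw [Finset.sum_const, Finset.card_range, nsmul_eq_mul]; push_cast; ring

theorem sep_points {E : Set ℝ} {s : ℝ} (hs : 0 < s) (d : ℕ) (hE : ENNReal.ofReal (2 * s * d) < volume E) :
    ∃ F : Finset ℝ, F.card = d + 1 ∧ (∀ x ∈ F, x ∈ E) ∧ ∀ x ∈ F, ∀ y ∈ F, x ≠ y → s ≤ |x - y| := by
  classical
  have key : ∀ n ≤ d + 1, ∃ F : Finset ℝ, F.card = n ∧ (∀ x ∈ F, x ∈ E) ∧
      ∀ x ∈ F, ∀ y ∈ F, x ≠ y → s ≤ |x - y| := by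
    intro n
    induction n with
    | zero => intro _; exact ⟨∅, by simp⟩
    | succ n ih =>
      intro hn
      obtain ⟨F, hc, hF, hsep⟩ := ih (by omega)
      have : ∃ x ∈ E, ∀ y ∈ F, s ≤ |x - y| := by
        by_contra hcon
        push Not at hcon
        have hsub : E ⊆ ⋃ y ∈ F, Metric.ball y s := by
          intro x hx
          obtain ⟨y, hy, hxy⟩ := hcon x hx
          simp only [mem_iUnion]
          exact ⟨y, hy, by rw [Metric.mem_ball, Real.dist_eq]; exact hxy⟩
        have h1 : volume E ≤ ENNReal.ofReal (2 * s * d) := by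
          calc volume E ≤ volume (⋃ y ∈ F, Metric.ball y s) := measure_mono hsub
            _ ≤ ∑ y ∈ F, volume (Metric.ball y s) := measure_biUnion_finset_le _ _
            _ = F.card * ENNReal.ofReal (2 * s) := by simp [Real.volume_ball]
            _ ≤ ENNReal.ofReal (2 * s * d) := by
                rw [mul_comm (2 * s), ENNReal.ofReal_mul (Nat.cast_nonneg d), ENNReal.ofReal_natCast]
                gcongr; omega
        exact absurd h1 (not_le.2 hE)
      obtain ⟨x, hx, hxs⟩ := this
      have hxF : x ∉ F := by
        intro h
        have := hxs x h
        simp at this; linarith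
      refine ⟨insert x F, by rw [Finset.card_insert_of_notMem hxF, hc], ?_, ?_⟩
      · intro y hy
        rcases Finset.mem_insert.1 hy with rfl | hy
        · exact hx
        · exact hF y hy
      · intro y hy z hz hyz
        rcases Finset.mem_insert.1 hy with h | h <;> rcases Finset.mem_insert.1 hz with h' | h'
        · exact absurd (h.trans h'.symm) hyz
        · rw [h]; exact hxs z h'
        · rw [abs_sub_comm, h']; exact hxs y h
        · exact hsep y h z h' hyz
  exact key (d+1) le_rfl

theorem sublevel {d : ℕ} {p : Polynomial ℝ} (hp : p.natDegree ≤ d) {ε s B y : ℝ} (hε : 0 ≤ ε) (hs : 0 < s)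
    (hy : y ∈ Icc (0:ℝ) 1) (hB : B ≤ |p.eval y|) (hlt : (d+1) * ε < B * s^d) :
    volume {x | x ∈ Icc (0:ℝ) 1 ∧ |p.eval x| ≤ ε} ≤ ENNReal.ofReal (2 * s * d) := by
  classical
  by_contra hcon
  push Not at hcon
  obtain ⟨F, hc, hF, hsep⟩ := sep_points hs d hcon
  have hdeg : p.degree < F.card := by
    rw [hc]
    exact lt_of_le_of_lt (Polynomial.degree_le_of_natDegree_le hp) (by exact_mod_cast Nat.lt_succ_self d)
  have e := Lagrange.eq_interpolate (s := F) (v := id) (fun _ _ _ _ h => h) hdeg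
  have e2 : p.eval y = ∑ i ∈ F, p.eval i * (Lagrange.basis F id i).eval y := by
    conv_lhs => rw [e]
    rw [Lagrange.interpolate_apply, Polynomial.eval_finsetSum]
    apply Finset.sum_congr rfl
    intro i _
    simp
  have hbas : ∀ i ∈ F, |(Lagrange.basis F id i).eval y| ≤ (s⁻¹)^d := by
    intro i hi
    rw [Lagrange.basis, Polynomial.eval_prod, Finset.abs_prod]
    calc _ ≤ ∏ j ∈ F.erase i, s⁻¹ := by
          apply Finset.prod_le_prod (fun _ _ => abs_nonneg _)
          intro j hj
          rw [Lagrange.basisDivisor]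
          simp only [id, Polynomial.eval_mul, Polynomial.eval_C, Polynomial.eval_sub, Polynomial.eval_X]
          rw [abs_mul, abs_inv]
          have h1 : s ≤ |i - j| := hsep i hi j (Finset.mem_of_mem_erase hj) (Finset.ne_of_mem_erase hj).symm
          have h2 : |y - j| ≤ 1 := by
            have := (hF j (Finset.mem_of_mem_erase hj)).1
            rw [abs_le]; constructor <;> linarith [this.1, this.2, hy.1, hy.2]
          calc _ ≤ s⁻¹ * 1 := mul_le_mul (inv_anti₀ hs h1) h2 (abs_nonneg _) (by positivity)
            _ = _ := mul_one _
      _ = _ := by rw [Finset.prod_const, Finset.card_erase_of_mem hi, hc]; simp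
  have h3 : |p.eval y| ≤ (d+1) * (ε * (s⁻¹)^d) := by
    rw [e2]
    calc _ ≤ ∑ i ∈ F, |p.eval i * (Lagrange.basis F id i).eval y| := Finset.abs_sum_le_sum_abs _ _
      _ ≤ ∑ i ∈ F, ε * (s⁻¹)^d := by
          apply Finset.sum_le_sum
          intro i hi
          rw [abs_mul]
          exact mul_le_mul (hF i hi).2 (hbas i hi) (abs_nonneg _) hε
      _ = _ := by rw [Finset.sum_const, hc, nsmul_eq_mul]; push_cast; ring
  have h4 : B ≤ (d+1) * ε / s^d := by
    refine (hB.trans h3).trans (le_of_eq ?_)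
    rw [inv_pow]; field_simp
  rw [le_div_iff₀ (by positivity)] at h4
  linarith

theorem vdc01 {d : ℕ} (hd : 1 ≤ d) {p : Polynomial ℝ} (hp : p.natDegree ≤ d) {K t y : ℝ} (hK : 0 ≤ K) (ht : 1 ≤ t)
    (hc : ∀ j, |p.coeff j| ≤ K * t^(8*d)) (hy : y ∈ Icc (0:ℝ) 1) (hB : t^(8*d) / 2 ≤ |p.derivative.eval y|) :
    ‖∫ x in Icc (0:ℝ) 1, Complex.exp (Complex.I * (p.eval x : ℝ))‖ ≤
      (3 + (d+1) * (K * d * d) + 2 * (4*(d+1)) * d) / t := by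
  have ht0 : 0 < t := by linarith
  set μ := t^(6*d) with hμ
  have hμ0 : 0 < μ := by positivity
  set p1 := p.derivative with hp1
  set p2 := p1.derivative with hp2
  have hden : ∀ x, 0 < (p1.eval x)^2 + μ^2 := fun x => by positivity
  set u : ℝ → ℝ := fun x => p1.eval x / ((p1.eval x)^2 + μ^2) with hu
  set u' : ℝ → ℝ := fun x => (p2.eval x * ((p1.eval x)^2 + μ^2) - p1.eval x * (2 * p1.eval x * p2.eval x)) / ((p1.eval x)^2 + μ^2)^2 with hu'
  have hud : ∀ x, HasDerivAt u (u' x) x := by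
    intro x
    have h1 : HasDerivAt (fun x => p1.eval x) (p2.eval x) x := p1.hasDerivAt x
    have h2 : HasDerivAt (fun x => (p1.eval x)^2 + μ^2) (2 * p1.eval x * p2.eval x) x := by
      have := (h1.pow 2).add_const (μ^2)
      simpa using this
    exact h1.div h2 (hden x).ne'
  set E : ℝ → ℂ := fun x => Complex.exp (Complex.I * (p.eval x : ℝ)) with hE
  have hEn : ∀ x, ‖E x‖ = 1 := by
    intro x; rw [hE]; simp only; rw [mul_comm, Complex.norm_exp_ofReal_mul_I]
  have hEd : ∀ x, HasDerivAt E (Complex.I * (p1.eval x : ℝ) * E x) x := by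
    intro x
    have h1 : HasDerivAt (fun x : ℝ => Complex.I * ((p.eval x : ℝ) : ℂ)) (Complex.I * (p1.eval x : ℝ)) x :=
      ((p.hasDerivAt x).ofReal_comp).const_mul _
    have := h1.cexp
    rw [hE]; convert this using 1; ring
  set G : ℝ → ℂ := fun x => -Complex.I * (u x : ℝ) * E x with hG
  set G' : ℝ → ℂ := fun x => -Complex.I * (u' x : ℝ) * E x + (u x * p1.eval x : ℝ) * E x with hG'
  have hGd : ∀ x, HasDerivAt G (G' x) x := by
    intro x
    have h1 : HasDerivAt (fun x => -Complex.I * ((u x : ℝ) : ℂ)) (-Complex.I * ((u' x : ℝ):ℂ)) x :=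
      ((hud x).ofReal_comp).const_mul _
    have := h1.mul (hEd x)
    refine this.congr_deriv ?_
    rw [hG']; simp only
    push_cast
    ring_nf
    rw [Complex.I_sq]; ring
  have cp : ∀ q : Polynomial ℝ, Continuous (fun x => q.eval x) := fun q => q.continuous
  have cu : Continuous u := (cp p1).div (((cp p1).pow 2).add continuous_const) (fun x => (hden x).ne')
  have cu' : Continuous u' := by
    apply Continuous.div
    · exact ((cp p2).mul (((cp p1).pow 2).add continuous_const)).sub ((cp p1).mul ((continuous_const.mul (cp p1)).mul (cp p2)))
    · exact (((cp p1).pow 2).add continuous_const).pow 2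
    · intro x; exact (pow_pos (hden x) 2).ne'
  have cE : Continuous E := continuous_iff_continuousAt.2 fun x => (hEd x).continuousAt
  have cG' : Continuous G' := by
    apply Continuous.add
    · exact (continuous_const.mul (Complex.continuous_ofReal.comp cu')).mul cE
    · exact (Complex.continuous_ofReal.comp (cu.mul (cp p1))).mul cE
  have hub : ∀ x, |u x| ≤ 1 / μ := by
    intro x
    rw [hu]; simp only
    rw [abs_div, abs_of_pos (hden x), div_le_div_iff₀ (hden x) hμ0]
    nlinarith [sq_abs (p1.eval x), sq_nonneg (|p1.eval x| - μ), abs_nonneg (p1.eval x)]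
  have htd : t ≤ t^d := le_self_pow₀ ht (by omega)
  have hd1 : 1 ≤ t^d := ht.trans htd
  have hb2 : ∀ x ∈ Icc (0:ℝ) 1, |p2.eval x| ≤ (d+1) * (K * d * d) * t^(8*d) := by
    intro x hx
    have h1 := deriv_coeff_bound hp (by positivity) hc
    have hdp1 : p1.natDegree ≤ d := (Polynomial.natDegree_derivative_le p).trans (by omega)
    have h2 := deriv_coeff_bound hdp1 (by positivity) h1
    have hdp2 : p2.natDegree ≤ d := (Polynomial.natDegree_derivative_le p1).trans (by omega)
    have := eval_bound hdp2 (by positivity) h2 (y := x) (by rw [abs_le]; constructor <;> linarith [hx.1, hx.2])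
    linarith
  have hu'b : ∀ x ∈ Icc (0:ℝ) 1, |u' x| ≤ (d+1) * (K * d * d) / t := by
    intro x hx
    have h1 : |u' x| ≤ |p2.eval x| / μ^2 := by
      rw [hu']; simp only
      rw [abs_div, abs_of_pos (pow_pos (hden x) 2), div_le_div_iff₀ (pow_pos (hden x) 2) (by positivity)]
      have e : p2.eval x * ((p1.eval x)^2 + μ^2) - p1.eval x * (2 * p1.eval x * p2.eval x) =
        p2.eval x * (μ^2 - (p1.eval x)^2) := by ring
      rw [e, abs_mul, mul_assoc]
      apply mul_le_mul_of_nonneg_left _ (abs_nonneg _)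
      have h3 : |μ^2 - (p1.eval x)^2| ≤ (p1.eval x)^2 + μ^2 := by
        rw [abs_le]; constructor <;> nlinarith [sq_nonneg (p1.eval x), sq_nonneg μ]
      have h4 := sq_nonneg (p1.eval x)
      nlinarith [sq_nonneg μ, hden x]
    refine h1.trans ?_
    rw [div_le_div_iff₀ (by positivity) ht0]
    have h5 : t^(8*d) * t ≤ μ^2 := by
      rw [hμ, ← pow_mul, show 6*d*2 = 8*d + 4*d by ring, pow_add]
      apply mul_le_mul_of_nonneg_left _ (by positivity)
      exact le_self_pow₀ ht (by omega)
    have h6 := hb2 x hx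
    have h7 : 0 ≤ ((d:ℝ)+1) * (K * d * d) := by positivity
    nlinarith
  set S : Set ℝ := {x | x ∈ Icc (0:ℝ) 1 ∧ |p1.eval x| ≤ t^(7*d)} with hS
  have hSm : MeasurableSet S := by
    apply (measurableSet_Icc).inter
    exact measurableSet_le (cp p1).abs.measurable measurable_const
  have hvol : volume S ≤ ENNReal.ofReal (2 * (4*(d+1)/t) * d) := by
    have hdp1 : p1.natDegree ≤ d := (Polynomial.natDegree_derivative_le p).trans (by omega)
    apply sublevel hdp1 (by positivity) (by positivity) hy hB
    rw [div_pow]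
    have e1 : t^(8*d) = t^(7*d) * t^d := by rw [← pow_add]; ring_nf
    rw [e1]
    have e2 : t^(7*d) * t^d / 2 * ((4*((d:ℝ)+1))^d / t^d) = t^(7*d) * ((4*((d:ℝ)+1))^d / 2) := by
      field_simp
    rw [e2, mul_comm]
    apply mul_lt_mul_of_pos_left _ (by positivity)
    have : 4*((d:ℝ)+1) ≤ (4*((d:ℝ)+1))^d := le_self_pow₀ (by linarith [(Nat.cast_nonneg d : (0:ℝ) ≤ d)]) (by omega)
    have : (0:ℝ) ≤ d := Nat.cast_nonneg d
    linarith
  have hw : ∀ x, 0 ≤ 1 - u x * p1.eval x ∧ 1 - u x * p1.eval x ≤ 1 ∧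
      (t^(7*d) < |p1.eval x| → 1 - u x * p1.eval x ≤ 1/t) := by
    intro x
    have e : 1 - u x * p1.eval x = μ^2 / ((p1.eval x)^2 + μ^2) := by
      rw [hu]; simp only
      have := (hden x).ne'
      field_simp; ring
    rw [e]
    refine ⟨by positivity, ?_, ?_⟩
    · rw [div_le_one (hden x)]; nlinarith [sq_nonneg (p1.eval x)]
    · intro h
      rw [div_le_div_iff₀ (hden x) ht0]
      have h5 : (t^(7*d))^2 ≤ (p1.eval x)^2 := by
        rw [← sq_abs (p1.eval x)]; exact pow_le_pow_left₀ (by positivity) h.le 2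
      have h6 : μ^2 * t ≤ (t^(7*d))^2 := by
        rw [hμ, ← pow_mul, ← pow_mul, show 7*d*2 = 6*d*2 + 2*d by ring, pow_add]
        apply mul_le_mul_of_nonneg_left _ (by positivity)
        exact le_self_pow₀ ht (by omega)
      nlinarith [sq_nonneg μ]
  have FTC : ∫ x in Icc (0:ℝ) 1, G' x = G 1 - G 0 := by
    rw [integral_Icc_eq_integral_Ioc, ← intervalIntegral.integral_of_le zero_le_one]
    exact intervalIntegral.integral_eq_sub_of_hasDerivAt (fun x _ => hGd x) (cG'.intervalIntegrable _ _)
  set H : ℝ → ℂ := fun x => (Complex.I * (u' x : ℝ) + ((1 - u x * p1.eval x : ℝ) : ℂ)) * E x with hH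
  have cH : Continuous H :=
    ((continuous_const.mul (Complex.continuous_ofReal.comp cu')).add
      (Complex.continuous_ofReal.comp (continuous_const.sub (cu.mul (cp p1))))).mul cE
  have hsplit : ∀ x, E x = G' x + H x := by
    intro x; simp only [hG', hH]; push_cast; ring
  have iG : IntegrableOn G' (Icc 0 1) := cG'.continuousOn.integrableOn_Icc
  have iH : IntegrableOn H (Icc 0 1) := cH.continuousOn.integrableOn_Icc
  have e0 : ∫ x in Icc (0:ℝ) 1, E x = (G 1 - G 0) + ∫ x in Icc (0:ℝ) 1, H x := by
    rw [← FTC, ← integral_add iG iH]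
    exact integral_congr_ae (Eventually.of_forall hsplit)
  have hGn : ∀ x, ‖G x‖ ≤ 1/t := by
    intro x
    simp only [hG]
    rw [norm_mul, norm_mul, hEn, norm_neg, Complex.norm_I, one_mul, mul_one, Complex.norm_real, Real.norm_eq_abs]
    refine (hub x).trans ?_
    apply one_div_le_one_div_of_le ht0
    exact le_self_pow₀ ht (by omega)
  set a1 : ℝ := (d+1) * (K * d * d) / t with ha1
  have ha1n : 0 ≤ a1 := by positivity
  have hHn : ‖∫ x in Icc (0:ℝ) 1, H x‖ ≤ ∫ x in Icc (0:ℝ) 1, ((a1 + 1/t) + S.indicator (fun _ => (1:ℝ)) x) := by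
    apply norm_integral_le_of_norm_le
    · apply Integrable.add
      · exact integrable_const _
      · exact (integrable_const (1:ℝ)).indicator hSm
    · rw [ae_restrict_iff' measurableSet_Icc]
      apply Eventually.of_forall
      intro x hx
      simp only [hH]
      rw [norm_mul, hEn, mul_one]
      refine (norm_add_le _ _).trans ?_
      rw [norm_mul, Complex.norm_I, one_mul, Complex.norm_real, Complex.norm_real, Real.norm_eq_abs, Real.norm_eq_abs,
        abs_of_nonneg (hw x).1]
      have h1 := hu'b x hx
      have h2 := hw x
      have h3 : 0 < 1/t := by positivity
      by_cases hxS : x ∈ S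
      · rw [indicator_of_mem hxS]; linarith [h2.2.1]
      · rw [indicator_of_notMem hxS]
        have : t^(7*d) < |p1.eval x| := by
          by_contra hcon; exact hxS ⟨hx, not_lt.1 hcon⟩
        linarith [h2.2.2 this]
  have hI : ∫ x in Icc (0:ℝ) 1, ((a1 + 1/t) + S.indicator (fun _ => (1:ℝ)) x) ≤ (a1 + 1/t) + 2 * (4*(d+1)/t) * d := by
    rw [integral_add (integrable_const _) ((integrable_const (1:ℝ)).indicator hSm)]
    rw [integral_indicator hSm, setIntegral_const, setIntegral_const]
    simp only [smul_eq_mul, mul_one]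
    have h1 : volume.real (Icc (0:ℝ) 1) = 1 := by simp
    rw [h1, one_mul]
    have h2 : (volume.restrict (Icc (0:ℝ) 1)).real S ≤ 2 * (4*(d+1)/t) * d := by
      apply ENNReal.toReal_le_of_le_ofReal (by positivity)
      exact (Measure.restrict_apply_le _ _).trans hvol
    linarith
  change ‖∫ x in Icc (0:ℝ) 1, E x‖ ≤ _
  rw [e0]
  calc _ ≤ ‖G 1 - G 0‖ + ‖∫ x in Icc (0:ℝ) 1, H x‖ := norm_add_le _ _
    _ ≤ (1/t + 1/t) + ((a1 + 1/t) + 2 * (4*(d+1)/t) * d) :=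
      add_le_add ((norm_sub_le _ _).trans (add_le_add (hGn 1) (hGn 0))) (hHn.trans hI)
    _ = (3 + (d+1) * (K * d * d) + 2 * (4*(d+1)) * d) / t := by rw [ha1]; ring

theorem vdc (d : ℕ) (hd : 1 ≤ d) : ∃ C κ : ℝ, 1 ≤ C ∧ 0 < κ ∧ κ ≤ 1 ∧ ∀ q : Polynomial ℝ, q.natDegree ≤ d →
    ∀ a b : ℝ, a < b → ∀ R : ℝ, 1 ≤ R → R ≤ osc a b q →
      ‖∫ x in Ico a b, Complex.exp (Complex.I * (q.eval x : ℝ))‖ ≤ C * (b - a) * R ^ (-κ) := by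
  obtain ⟨K, hK, hcb⟩ := resc_coeff_bound d
  have hd0 : (1:ℝ) ≤ d := by exact_mod_cast hd
  refine ⟨3 + (d+1) * (K * d * d) + 2 * (4*(d+1)) * d, 1/(8*d), ?_, by positivity, ?_, ?_⟩
  · have : 0 ≤ ((d:ℝ)+1) * (K * d * d) + 2 * (4*(d+1)) * d := by positivity
    linarith
  · rw [div_le_one (by positivity)]; linarith
  intro q hq a b hab R hR hRo
  set Λ := osc a b q with hΛ
  have hΛ1 : 1 ≤ Λ := hR.trans hRo
  set t := Λ ^ (1/(8*(d:ℝ))) with ht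
  have ht1 : 1 ≤ t := Real.one_le_rpow hΛ1 (by positivity)
  have htp : t^(8*d) = Λ := by
    rw [ht, ← Real.rpow_natCast, ← Real.rpow_mul (by linarith)]
    push_cast
    rw [one_div, inv_mul_cancel₀ (by positivity), Real.rpow_one]
  have hl : 0 < b - a := by linarith
  set p := resc a (b-a) q with hp
  have hpt : ∃ x ∈ Ico a b, ∃ y ∈ Ico a b, Λ / 2 < |q.eval x - q.eval y| := by
    by_contra hcon
    push Not at hcon
    have := osc_le q (by linarith) hcon
    linarith
  obtain ⟨x, hx, y, hy, hxy⟩ := hpt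
  have hder : ∃ z ∈ Icc (0:ℝ) 1, Λ/2 ≤ |p.derivative.eval z| := by
    by_contra hcon
    push Not at hcon
    set s1 := (x - a)/(b-a) with hs1
    set s2 := (y - a)/(b-a) with hs2
    have e1 : a + (b-a) * s1 = x := by rw [hs1]; field_simp; ring
    have e2 : a + (b-a) * s2 = y := by rw [hs2]; field_simp; ring
    have m : ∀ x ∈ Ico a b, (x - a)/(b-a) ∈ Icc (0:ℝ) 1 := fun x hx =>
      ⟨div_nonneg (by linarith [hx.1]) hl.le, by rw [div_le_one hl]; linarith [hx.2]⟩
    have := Convex.norm_image_sub_le_of_norm_hasDerivWithin_le (f := fun x => p.eval x) (f' := fun x => p.derivative.eval x)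
      (C := Λ/2) (s := Icc (0:ℝ) 1) (fun z _ => (p.hasDerivAt z).hasDerivWithinAt) (fun z hz => (hcon z hz).le)
      (convex_Icc 0 1) (m y hy) (m x hx)
    have e3 : p.eval s1 - p.eval s2 = q.eval x - q.eval y := by
      rw [hp, resc_eval, resc_eval, e1, e2]; ring
    rw [← hs1, ← hs2] at this
    simp only [Real.norm_eq_abs] at this
    rw [e3] at this
    have h4 : |s1 - s2| ≤ 1 := by
      have h5 := m x hx
      have h6 := m y hy
      rw [abs_le]; constructor <;> linarith [h5.1, h5.2, h6.1, h6.2]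
    nlinarith
  obtain ⟨z, hz, hzb⟩ := hder
  have main := vdc01 hd (resc_deg a (b-a) q hq) (K := K) (t := t) (y := z) (by linarith) ht1
    (by rw [htp]; exact hcb q hq a b hab) hz (by rw [htp]; exact hzb)
  have ecv : ∫ x in Ico a b, Complex.exp (Complex.I * (q.eval x : ℝ)) =
      ((b - a : ℝ) : ℂ) * (Complex.exp (Complex.I * (q.eval a : ℝ)) *
        ∫ x in Icc (0:ℝ) 1, Complex.exp (Complex.I * (p.eval x : ℝ))) := by
    rw [integral_Ico_eq_integral_Ioc, integral_Icc_eq_integral_Ioc, ← intervalIntegral.integral_of_le hab.le,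
      ← intervalIntegral.integral_of_le zero_le_one]
    have := intervalIntegral.integral_comp_add_mul (a := 0) (b := 1) (fun x => Complex.exp (Complex.I * (q.eval x : ℝ))) hl.ne' a
    rw [mul_zero, mul_one, add_zero, add_sub_cancel] at this
    rw [← intervalIntegral.integral_const_mul]
    have e : ∀ x : ℝ, Complex.exp (Complex.I * (q.eval a : ℝ)) * Complex.exp (Complex.I * (p.eval x : ℝ)) =
        Complex.exp (Complex.I * (q.eval (a + (b-a) * x) : ℝ)) := by
      intro x
      rw [← Complex.exp_add, hp, resc_eval]; push_cast; ring_nf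
    simp_rw [e]
    rw [this, Complex.real_smul, ← mul_assoc, ← Complex.ofReal_mul, mul_inv_cancel₀ hl.ne']
    simp
  rw [ecv, norm_mul, norm_mul, mul_comm Complex.I, Complex.norm_exp_ofReal_mul_I, one_mul, Complex.norm_real, Real.norm_eq_abs,
    abs_of_pos hl]
  have hC : 0 ≤ 3 + ((d:ℝ)+1) * (K * d * d) + 2 * (4*(d+1)) * d := by positivity
  have hRt : 1/t ≤ R ^ (-(1/(8*(d:ℝ)))) := by
    rw [Real.rpow_neg (by linarith), ← one_div]
    apply one_div_le_one_div_of_le (by positivity)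
    exact Real.rpow_le_rpow (by linarith) hRo (by positivity)
  calc _ ≤ (b-a) * ((3 + (d+1) * (K * d * d) + 2 * (4*(d+1)) * d) / t) := mul_le_mul_of_nonneg_left main hl.le
    _ = (3 + (d+1) * (K * d * d) + 2 * (4*(d+1)) * d) * (b-a) * (1/t) := by ring
    _ ≤ _ := by gcongr

end

section

/-- dyadic cell of scale `s` containing `x` -/
def cell (s x : ℕ) : Finset ℕ := Finset.Ico (x / 2^s * 2^s) (x / 2^s * 2^s + 2^s)

theorem mem_cell {s x y : ℕ} : y ∈ cell s x ↔ y / 2^s = x / 2^s := by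
  have h : 0 < 2^s := by positivity
  rw [cell, Finset.mem_Ico]
  constructor
  · rintro ⟨h1, h2⟩
    rw [Nat.div_eq_iff h]
    constructor <;> omega
  · intro e
    rw [← e]
    constructor
    · exact Nat.div_mul_le_self y _
    · have := Nat.lt_div_mul_add h (a := y); omega

theorem self_mem_cell (s x : ℕ) : x ∈ cell s x := mem_cell.2 rfl

theorem cell_card (s x : ℕ) : (cell s x).card = 2^s := by simp [cell]

theorem cell_congr {s x y : ℕ} (h : y / 2^s = x / 2^s) : cell s y = cell s x := by
  rw [cell, cell, h]

theorem cell_eq {s x y : ℕ} (h : y ∈ cell s x) : cell s y = cell s x := cell_congr (mem_cell.1 h)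

theorem div_mono_scale {s s' x y : ℕ} (hs : s ≤ s') (h : y / 2^s = x / 2^s) : y / 2^s' = x / 2^s' := by
  obtain ⟨k, rfl⟩ := Nat.exists_eq_add_of_le hs
  rw [pow_add, ← Nat.div_div_eq_div_mul, ← Nat.div_div_eq_div_mul, h]

theorem cell_mono {s s' x : ℕ} (hs : s ≤ s') : cell s x ⊆ cell s' x := fun _ hy =>
  mem_cell.2 (div_mono_scale hs (mem_cell.1 hy))

theorem cell_zero (x : ℕ) : cell 0 x = {x} := by
  ext y; rw [mem_cell]; simp

theorem cell_symm {s x y : ℕ} (h : y ∈ cell s x) : x ∈ cell s y := mem_cell.2 (mem_cell.1 h).symm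

theorem cell_top {M x : ℕ} (hx : x < 2^M) : cell M x = Finset.range (2^M) := by
  ext y
  rw [mem_cell, Nat.div_eq_of_lt hx, Finset.mem_range, Nat.div_eq_zero_iff]
  simp

theorem cell_lt {M s x y : ℕ} (hs : s ≤ M) (hx : x < 2^M) (hy : y ∈ cell s x) : y < 2^M := by
  have := cell_mono hs hy
  rw [cell_top hx] at this
  simpa using this

/-- left and right child representatives -/
def lc (s x : ℕ) : ℕ := x / 2^(s+1) * 2^(s+1)
def rc (s x : ℕ) : ℕ := x / 2^(s+1) * 2^(s+1) + 2^s

theorem lc_div (s x : ℕ) : lc s x / 2^s = 2 * (x / 2^(s+1)) := by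
  rw [lc]
  have h : 0 < 2^s := by positivity
  rw [pow_succ, ← mul_assoc, mul_right_comm, Nat.mul_div_cancel _ h, mul_comm]

theorem rc_div (s x : ℕ) : rc s x / 2^s = 2 * (x / 2^(s+1)) + 1 := by
  have h : 0 < 2^s := by positivity
  have := lc_div s x
  rw [lc] at this
  rw [rc, Nat.add_div_right _ h, this]

theorem lc_mem (s x : ℕ) : lc s x ∈ cell (s+1) x := by
  rw [mem_cell, lc, Nat.mul_div_cancel _ (by positivity)]

theorem rc_mem (s x : ℕ) : rc s x ∈ cell (s+1) x := by
  rw [mem_cell, pow_succ, ← Nat.div_div_eq_div_mul, rc_div, ← pow_succ]; omega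

theorem cell_succ (s x : ℕ) : cell (s+1) x = cell s (lc s x) ∪ cell s (rc s x) := by
  ext y
  rw [Finset.mem_union, mem_cell, mem_cell, mem_cell, lc_div, rc_div, pow_succ, ← Nat.div_div_eq_div_mul]
  omega

theorem cell_disj (s x : ℕ) : Disjoint (cell s (lc s x)) (cell s (rc s x)) := by
  rw [Finset.disjoint_left]
  intro y h1 h2
  rw [mem_cell, lc_div] at h1
  rw [mem_cell, rc_div] at h2
  omega

theorem sum_cell_succ {β : Type*} [AddCommMonoid β] (s x : ℕ) (u : ℕ → β) :
    ∑ y ∈ cell (s+1) x, u y = ∑ y ∈ cell s (lc s x), u y + ∑ y ∈ cell s (rc s x), u y := by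
  rw [cell_succ, Finset.sum_union (cell_disj s x)]

theorem mem_child {s x y : ℕ} (h : y ∈ cell (s+1) x) : cell s y = cell s (lc s x) ∨ cell s y = cell s (rc s x) := by
  rw [cell_succ, Finset.mem_union] at h
  exact h.imp cell_eq cell_eq

theorem card_filter_cell_succ (s x : ℕ) (E : Finset ℕ) :
    (E ∩ cell (s+1) x).card = (E ∩ cell s (lc s x)).card + (E ∩ cell s (rc s x)).card := by
  rw [cell_succ, Finset.inter_union_distrib_left, Finset.card_union_of_disjoint]
  exact (cell_disj s x).mono Finset.inter_subset_right Finset.inter_subset_right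

/-- average -/
def av (s : ℕ) (u : ℕ → ℝ) (x : ℕ) : ℝ := (∑ y ∈ cell s x, u y) / 2^s

theorem av_congr {s x y : ℕ} (u : ℕ → ℝ) (h : y ∈ cell s x) : av s u y = av s u x := by
  rw [av, av, cell_eq h]

theorem av_nonneg {s x : ℕ} {u : ℕ → ℝ} (h : ∀ y, 0 ≤ u y) : 0 ≤ av s u x :=
  div_nonneg (Finset.sum_nonneg fun y _ => h y) (by positivity)

theorem av_zero (u : ℕ → ℝ) (x : ℕ) : av 0 u x = u x := by simp [av, cell_zero]

theorem av_succ (s : ℕ) (u : ℕ → ℝ) (x : ℕ) : av (s+1) u x = (av s u (lc s x) + av s u (rc s x)) / 2 := by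
  rw [av, av, av, sum_cell_succ, pow_succ]; field_simp

theorem av_const {s x : ℕ} {u : ℕ → ℝ} {c : ℝ} (h : ∀ y ∈ cell s x, u y = c) : av s u x = c := by
  rw [av, Finset.sum_congr rfl h, Finset.sum_const, cell_card, nsmul_eq_mul]; push_cast; field_simp

/-- running maximal function -/
def MF (u : ℕ → ℝ) : ℕ → ℕ → ℝ
  | 0, x => av 0 u x
  | (s+1), x => max (av (s+1) u x) (MF u s x)

theorem av_le_MF (u : ℕ → ℝ) {s σ x : ℕ} (h : s ≤ σ) : av s u x ≤ MF u σ x := by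
  induction σ with
  | zero => have : s = 0 := by omega
            subst this; rfl
  | succ σ ih =>
    rcases Nat.lt_or_ge σ s with h1 | h1
    · have : s = σ + 1 := by omega
      subst this; exact le_max_left _ _
    · exact (ih h1).trans (le_max_right _ _)

theorem MF_le {u : ℕ → ℝ} {σ x : ℕ} {B : ℝ} (h : ∀ s ≤ σ, av s u x ≤ B) : MF u σ x ≤ B := by
  induction σ with
  | zero => exact h 0 le_rfl
  | succ σ ih => exact max_le (h _ le_rfl) (ih fun s hs => h s (by omega))

theorem MF_nonneg {u : ℕ → ℝ} (hu : ∀ y, 0 ≤ u y) (σ x : ℕ) : 0 ≤ MF u σ x :=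
  (av_nonneg hu).trans (av_le_MF u (Nat.zero_le σ))

theorem le_MF (u : ℕ → ℝ) (σ x : ℕ) : u x ≤ MF u σ x := by
  have := av_le_MF u (Nat.zero_le σ) (x := x)
  rwa [av_zero] at this

theorem MF_mono_scale (u : ℕ → ℝ) {σ σ' : ℕ} (h : σ ≤ σ') (x : ℕ) : MF u σ x ≤ MF u σ' x :=
  MF_le fun _ hs => av_le_MF u (hs.trans h)

/-- maximal function of a function constant on a cell is constant there -/
theorem MF_const {u : ℕ → ℝ} {l x : ℕ} (h : ∀ y ∈ cell l x, u y = u x) (σ : ℕ) {y : ℕ} (hy : y ∈ cell l x) :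
    MF u σ y = MF u σ x := by
  have key : ∀ y ∈ cell l x, ∀ s, av s u y = av s u x := by
    intro y hy s
    rcases le_total s l with hs | hs
    · have h1 : ∀ z ∈ cell l x, av s u z = u x := by
        intro z hz
        apply av_const
        intro w hw
        apply h
        have := cell_mono hs hw
        rwa [cell_eq hz] at this
      rw [h1 y hy, h1 x (self_mem_cell l x)]
    · exact av_congr u (cell_mono hs hy)
  apply le_antisymm
  · apply MF_le; intro s hs; rw [key y hy]; exact av_le_MF u hs
  · apply MF_le; intro s hs; rw [← key y hy]; exact av_le_MF u hs

theorem young_aux {p : ℝ} (hp : 1 < p) {u m : ℝ} (hu : 0 ≤ u) (hm : 0 ≤ m) :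
    2 * p / (p - 1) * (u * m^(p-1)) ≤ m^p + (2 * p / (p-1))^p * u^p := by
  set β := 2 * p / (p-1) with hβ
  have hβ0 : 0 < β := div_pos (by linarith) (by linarith)
  rcases le_total (β * u) m with h | h
  · have : β * (u * m^(p-1)) ≤ m^p := by
      rcases hm.eq_or_lt with h0 | h0
      · rw [← h0] at h ⊢
        rw [Real.zero_rpow (by linarith), Real.zero_rpow (by linarith)]; simp
      · calc β * (u * m^(p-1)) = (β * u) * m^(p-1) := by ring
          _ ≤ m * m^(p-1) := by gcongr
          _ = m^p := by
            nth_rewrite 1 [← Real.rpow_one m]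
            rw [← Real.rpow_add h0]; ring_nf
    have : 0 ≤ β^p * u^p := by positivity
    linarith
  · have : β * (u * m^(p-1)) ≤ β^p * u^p := by
      rw [← Real.mul_rpow hβ0.le hu]
      have h0 : 0 ≤ β * u := by positivity
      rcases h0.eq_or_lt with h1 | h1
      · have hm0 : m = 0 := by linarith
        have hu0 : u = 0 := by
          rcases mul_eq_zero.1 h1.symm with h2 | h2
          · linarith
          · exact h2
        rw [hu0]; simp [Real.zero_rpow (by linarith : p ≠ 0)]
      calc β * (u * m^(p-1)) = (β * u) * m^(p-1) := by ring
        _ ≤ (β * u) * (β * u)^(p-1) := by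
            apply mul_le_mul_of_nonneg_left _ h0
            exact Real.rpow_le_rpow hm h (by linarith)
        _ = (β*u)^p := by
            nth_rewrite 1 [← Real.rpow_one (β * u)]
            rw [← Real.rpow_add h1]; ring_nf
    have : 0 ≤ m^p := by positivity
    linarith

theorem tangent_aux {p : ℝ} (hp : 1 < p) {s m : ℝ} (hs : 0 ≤ s) (hm : 0 ≤ m) :
    p * (s * m^(p-1)) ≤ s^p + (p-1) * m^p := by
  have h := Real.young_inequality_of_nonneg hs (Real.rpow_nonneg hm (p-1)) (p := p) (q := p/(p-1))
    (by constructor <;> [skip; linarith; exact div_pos (by linarith) (by linarith)]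
        have : p - 1 ≠ 0 := by linarith
        have : p ≠ 0 := by linarith
        field_simp; ring)
  rw [← Real.rpow_mul hm] at h
  have e : (p-1) * (p/(p-1)) = p := by
    have : p - 1 ≠ 0 := by linarith
    field_simp
  rw [e] at h
  have e2 : s^p/p + m^p/(p/(p-1)) = (s^p + (p-1) * m^p)/p := by
    have : p - 1 ≠ 0 := by linarith
    have : p ≠ 0 := by linarith
    field_simp
  rw [e2, le_div_iff₀ (by linarith)] at h
  linarith

/-- Doob potential -/
def Yp (p s m : ℝ) : ℝ := 2 * m^p - 2 * p/(p-1) * (s * m^(p-1))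

theorem Yp_max {p : ℝ} (hp : 1 < p) {s m : ℝ} (hs : 0 ≤ s) (hm : 0 ≤ m) : Yp p s (max s m) ≤ Yp p s m := by
  rcases le_total s m with h | h
  · rw [max_eq_right h]
  · rw [max_eq_left h, Yp, Yp]
    have e : s * s^(p-1) = s^p := by
      rcases hs.eq_or_lt with h0 | h0
      · rw [← h0, Real.zero_rpow (by linarith : p ≠ 0)]; simp
      · nth_rewrite 1 [← Real.rpow_one s]
        rw [← Real.rpow_add h0]; ring_nf
    rw [e]
    have h1 := tangent_aux hp hs hm
    have hp1 : 0 < p - 1 := by linarith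
    have e3 : 2 * m^p - 2 * p/(p-1) * (s * m^(p-1)) - (2 * s^p - 2*p/(p-1) * s^p) =
      2/(p-1) * (s^p + (p-1) * m^p - p * (s * m^(p-1))) := by field_simp; ring
    have : 0 ≤ 2/(p-1) * (s^p + (p-1) * m^p - p * (s * m^(p-1))) := by
      apply mul_nonneg (by positivity); linarith
    linarith

theorem doob_aux {p : ℝ} (hp : 1 < p) {u : ℕ → ℝ} (hu : ∀ y, 0 ≤ u y) (s : ℕ) : ∀ x : ℕ, ∀ m : ℝ, 0 ≤ m →
    ∑ y ∈ cell s x, ((max m (MF u s y))^p - (2 * p/(p-1))^p * (u y)^p) ≤ 2^s * Yp p (av s u x) (max (av s u x) m) := by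
  induction s with
  | zero =>
    intro x m hm
    rw [cell_zero, Finset.sum_singleton, MF, av_zero, pow_zero, one_mul, max_comm]
    have := young_aux hp (hu x) (le_max_of_le_right hm : 0 ≤ max (u x) m)
    rw [Yp]; linarith
  | succ s ih =>
    intro x m hm
    set m' := max (av (s+1) u x) m with hm'
    have hm'0 : 0 ≤ m' := le_max_of_le_right hm
    have e : ∀ y ∈ cell (s+1) x, ((max m (MF u (s+1) y))^p - (2 * p/(p-1))^p * (u y)^p) =
        ((max m' (MF u s y))^p - (2 * p/(p-1))^p * (u y)^p) := by
      intro y hy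
      rw [MF, av_congr u hy, hm', ← max_assoc, max_comm m]
    rw [Finset.sum_congr rfl e, sum_cell_succ]
    have h1 := (ih (lc s x) m' hm'0).trans (mul_le_mul_of_nonneg_left (Yp_max hp (av_nonneg hu) hm'0) (by positivity))
    have h2 := (ih (rc s x) m' hm'0).trans (mul_le_mul_of_nonneg_left (Yp_max hp (av_nonneg hu) hm'0) (by positivity))
    refine (add_le_add h1 h2).trans (le_of_eq ?_)
    rw [av_succ, Yp, Yp, Yp, pow_succ]; ring

theorem doob {p : ℝ} (hp : 1 < p) {u : ℕ → ℝ} (hu : ∀ y, 0 ≤ u y) (s x : ℕ) :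
    ∑ y ∈ cell s x, (MF u s y)^p ≤ (2 * p/(p-1))^p * ∑ y ∈ cell s x, (u y)^p := by
  have h := doob_aux hp hu s x 0 le_rfl
  have ha : 0 ≤ av s u x := av_nonneg hu
  rw [max_eq_left ha] at h
  have h2 : Yp p (av s u x) (av s u x) ≤ 0 := by
    have h3 := Yp_max hp ha le_rfl
    rw [max_eq_left ha] at h3
    refine h3.trans (le_of_eq ?_)
    rw [Yp, Real.zero_rpow (by linarith), Real.zero_rpow (by linarith)]; simp
  rw [Finset.sum_sub_distrib, ← Finset.mul_sum] at h
  have h4 : ∑ y ∈ cell s x, (max 0 (MF u s y))^p = ∑ y ∈ cell s x, (MF u s y)^p :=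
    Finset.sum_congr rfl fun y _ => by rw [max_eq_right (MF_nonneg hu s y)]
  rw [h4] at h
  have : (2:ℝ)^s * Yp p (av s u x) (av s u x) ≤ 0 := mul_nonpos_of_nonneg_of_nonpos (by positivity) h2
  linarith

theorem doob2 {u : ℕ → ℝ} (hu : ∀ y, 0 ≤ u y) (s x : ℕ) :
    ∑ y ∈ cell s x, (MF u s y)^2 ≤ 16 * ∑ y ∈ cell s x, (u y)^2 := by
  have := doob (p := 2) (by norm_num) hu s x
  norm_num at this
  exact_mod_cast this

/-- tree-leaf summation lemma -/
theorem leafsum {V : ℕ → ℕ → Prop} (E : Finset ℕ) {D : ℝ} (hD : 0 ≤ D) {W : ℕ → ℝ} (hW : ∀ y, 0 ≤ W y)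
    (h0 : ∀ x, V 0 x → ((E ∩ cell 0 x).card : ℝ) ≤ D)
    (h1 : ∀ s x, V (s+1) x → ∀ y ∈ cell (s+1) x, ¬ V s y →
      ((E ∩ cell s y).card : ℝ) ≤ D * 2^s ∧ ∀ z ∈ cell s y, W z = W y)
    (hV : ∀ s x y, y ∈ cell s x → V s x → V s y) (s : ℕ) :
    ∀ x, V s x → ∑ y ∈ E ∩ cell s x, W y ≤ D * ∑ y ∈ cell s x, W y := by
  induction s with
  | zero =>
    intro x hx
    have := h0 x hx
    rw [cell_zero] at this ⊢
    by_cases hxE : x ∈ E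
    · have e : E ∩ {x} = {x} := by simpa using hxE
      rw [e] at this ⊢
      simp at this ⊢
      nlinarith [hW x]
    · have e : E ∩ {x} = ∅ := Finset.inter_singleton_of_notMem hxE
      rw [e]; simp; exact mul_nonneg hD (hW x)
  | succ s ih =>
    intro x hx
    have hc : ∀ y ∈ cell (s+1) x, ∑ z ∈ E ∩ cell s y, W z ≤ D * ∑ z ∈ cell s y, W z := by
      intro y hy
      by_cases hVy : V s y
      · exact ih y hVy
      · obtain ⟨h2, h3⟩ := h1 s x hx y hy hVy
        have e1 : ∑ z ∈ E ∩ cell s y, W z = (E ∩ cell s y).card * W y := by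
          rw [Finset.sum_congr rfl fun z hz => h3 z (Finset.mem_inter.1 hz).2]; simp
        have e2 : ∑ z ∈ cell s y, W z = 2^s * W y := by
          rw [Finset.sum_congr rfl fun z hz => h3 z hz]; simp [cell_card]
        rw [e1, e2]
        have := mul_le_mul_of_nonneg_right h2 (hW y)
        linarith
    have e : ∑ y ∈ E ∩ cell (s+1) x, W y = ∑ y ∈ E ∩ cell s (lc s x), W y + ∑ y ∈ E ∩ cell s (rc s x), W y := by
      rw [cell_succ, Finset.inter_union_distrib_left, Finset.sum_union]
      exact (cell_disj s x).mono Finset.inter_subset_right Finset.inter_subset_right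
    rw [e, sum_cell_succ, mul_add]
    exact add_le_add (hc _ (lc_mem s x)) (hc _ (rc_mem s x))

end

section

/-- left endpoint of the cell -/
def lo (s x : ℕ) : ℝ := ((x / 2^s * 2^s : ℕ) : ℝ)
/-- oscillation on the real interval of the cell -/
def os (s x : ℕ) (q : Polynomial ℝ) : ℝ := osc (lo s x) (lo s x + 2^s) q

theorem mem_real {s x y : ℕ} (h : y ∈ cell s x) : (y:ℝ) ∈ Ico (lo s x) (lo s x + 2^s) := by
  rw [cell, Finset.mem_Ico] at h
  constructor
  · rw [lo]; exact_mod_cast h.1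
  · rw [lo]; exact_mod_cast h.2

theorem lo_congr {s x y : ℕ} (h : y ∈ cell s x) : lo s y = lo s x := by
  rw [lo, lo, mem_cell.1 h]

theorem os_congr {s x y : ℕ} (h : y ∈ cell s x) (q : Polynomial ℝ) : os s y q = os s x q := by
  rw [os, os, lo_congr h]

theorem os_nonneg (s x : ℕ) (q : Polynomial ℝ) : 0 ≤ os s x q := osc_nonneg _ _ _

theorem lo_nest {s s' : ℕ} (h : s ≤ s') (x : ℕ) : lo s' x ≤ lo s x ∧ lo s x + 2^s ≤ lo s' x + 2^s' := by
  obtain ⟨k, rfl⟩ := Nat.exists_eq_add_of_le h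
  have e : x / 2^(s+k) = x / 2^s / 2^k := by rw [pow_add, Nat.div_div_eq_div_mul]
  simp only [lo, e]
  generalize x / 2^s = z
  have h1 := Nat.div_mul_le_self z (2^k)
  have h2 : z < z / 2^k * 2^k + 2^k := Nat.lt_div_mul_add (by positivity)
  constructor
  · have : z / 2^k * 2^(s+k) ≤ z * 2^s := by
      rw [pow_add]; nlinarith [Nat.zero_le (2^s)]
    exact_mod_cast this
  · have : z * 2^s + 2^s ≤ z / 2^k * 2^(s+k) + 2^(s+k) := by
      rw [pow_add]; nlinarith [Nat.zero_le (2^s)]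
    exact_mod_cast this

theorem os_mono {s s' : ℕ} (h : s ≤ s') (x : ℕ) (q : Polynomial ℝ) : os s x q ≤ os s' x q := by
  apply osc_mono
  obtain ⟨h1, h2⟩ := lo_nest h x
  exact Ico_subset_Ico h1 h2

theorem os_pt {s x y z : ℕ} (hy : y ∈ cell s x) (hz : z ∈ cell s x) (q : Polynomial ℝ) :
    |q.eval (y:ℝ) - q.eval (z:ℝ)| ≤ os s x q := le_osc q (mem_real hy) (mem_real hz)

theorem os_comm (s x : ℕ) (p q : Polynomial ℝ) : os s x (p - q) = os s x (q - p) := osc_sub_comm _ _ _ _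
theorem os_tri (s x : ℕ) (p q r : Polynomial ℝ) : os s x (p - r) ≤ os s x (p - q) + os s x (q - r) := osc_tri _ _ _ _ _
theorem os_self (s x : ℕ) (p : Polynomial ℝ) : os s x (p - p) = 0 := osc_self _ _ _

theorem os_consts (d : ℕ) : ∃ K : ℝ, 1 ≤ K ∧
    (∀ q : Polynomial ℝ, q.natDegree ≤ d → ∀ s k x : ℕ, os s x q ≤ K / 2^k * os (s+k) x q) ∧
    (∀ q : Polynomial ℝ, q.natDegree ≤ d → ∀ s k x : ℕ, os (s+k) x q ≤ K * (2^k)^d * os s x q) ∧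
    (∀ s x : ℕ, ∀ q0 : Polynomial ℝ, q0.natDegree ≤ d →
      ∀ lam : ℝ, 1 ≤ lam → ∃ (κ : Polynomial ℝ → (Fin d → ℤ)) (S : Finset (Fin d → ℤ)),
      (S.card : ℝ) ≤ K * lam^d ∧
      (∀ q : Polynomial ℝ, q.natDegree ≤ d → os s x (q - q0) ≤ lam → κ q ∈ S) ∧
      (∀ q q' : Polynomial ℝ, q.natDegree ≤ d → q'.natDegree ≤ d → κ q = κ q' → os s x (q - q') ≤ 1)) := by
  obtain ⟨C1, hC1, h1⟩ := osc_contract d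
  obtain ⟨C2, hC2, h2⟩ := osc_doubling d
  obtain ⟨C3, hC3, h3⟩ := osc_key d
  refine ⟨C1 + C2 + C3, by linarith, ?_, ?_, ?_⟩
  · intro q hq s k x
    obtain ⟨h4, h5⟩ := lo_nest (Nat.le_add_right s k) x
    have := h1 q hq (lo s x) (lo s x + 2^s) (lo (s+k) x) (lo (s+k) x + 2^(s+k)) (by simp) h4 h5
    refine this.trans ?_
    rw [add_sub_cancel_left, add_sub_cancel_left]
    have e : (2:ℝ)^s / 2^(s+k) = 1 / 2^k := by rw [pow_add]; field_simp
    rw [e]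
    apply mul_le_mul_of_nonneg_right _ (osc_nonneg _ _ _)
    rw [mul_one_div]
    gcongr; linarith
  · intro q hq s k x
    obtain ⟨h4, h5⟩ := lo_nest (Nat.le_add_right s k) x
    have := h2 q hq (lo s x) (lo s x + 2^s) (lo (s+k) x) (lo (s+k) x + 2^(s+k)) (by simp) h4 h5
    refine this.trans ?_
    rw [add_sub_cancel_left, add_sub_cancel_left]
    have e : (2:ℝ)^(s+k) / 2^s = 2^k := by rw [pow_add]; field_simp
    rw [e]
    apply mul_le_mul_of_nonneg_right _ (osc_nonneg _ _ _)
    gcongr; linarith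
  · intro s x q0 hq0 lam hlam
    obtain ⟨κ, S, a, b, c⟩ := h3 (lo s x) (lo s x + 2^s) (by simp) q0 hq0 lam hlam
    refine ⟨κ, S, a.trans ?_, b, c⟩
    gcongr; linarith

/-- structural constant -/
def KK (d : ℕ) : ℝ := (os_consts d).choose
theorem KK_one (d : ℕ) : 1 ≤ KK d := (os_consts d).choose_spec.1
theorem os_contract {d : ℕ} {q : Polynomial ℝ} (hq : q.natDegree ≤ d) (s k x : ℕ) :
    os s x q ≤ KK d / 2^k * os (s+k) x q := (os_consts d).choose_spec.2.1 q hq s k x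
theorem os_double {d : ℕ} {q : Polynomial ℝ} (hq : q.natDegree ≤ d) (s k x : ℕ) :
    os (s+k) x q ≤ KK d * (2^k)^d * os s x q := (os_consts d).choose_spec.2.2.1 q hq s k x
theorem os_key {d : ℕ} (s x : ℕ) {q0 : Polynomial ℝ} (hq : q0.natDegree ≤ d) {lam : ℝ} (hl : 1 ≤ lam) :
    ∃ (κ : Polynomial ℝ → (Fin d → ℤ)) (S : Finset (Fin d → ℤ)),
      (S.card : ℝ) ≤ KK d * lam^d ∧
      (∀ q : Polynomial ℝ, q.natDegree ≤ d → os s x (q - q0) ≤ lam → κ q ∈ S) ∧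
      (∀ q q' : Polynomial ℝ, q.natDegree ≤ d → q'.natDegree ≤ d → κ q = κ q' → os s x (q - q') ≤ 1) :=
  (os_consts d).choose_spec.2.2.2 s x q0 hq lam hl

/-- signs -/
def sg (j x : ℕ) : ℝ := (-1)^(x / 2^j)
theorem sg_congr {j s x y : ℕ} (hs : s ≤ j) (h : y ∈ cell s x) : sg j y = sg j x := by
  rw [sg, sg, div_mono_scale hs (mem_cell.1 h)]
theorem abs_sg (j x : ℕ) : |sg j x| = 1 := by rw [sg, abs_pow]; simp
theorem sg_sq (j x : ℕ) : sg j x * sg j x = 1 := by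
  rw [sg, ← mul_pow]; simp
theorem sg_lc (j x : ℕ) : sg j (lc j x) = 1 := by
  rw [sg, lc_div, pow_mul]; simp
theorem sg_rc (j x : ℕ) : sg j (rc j x) = -1 := by
  rw [sg, rc_div, pow_succ, pow_mul]; simp
def hh (s x : ℕ) : ℝ := sg (s-1) x
def gg (s x : ℕ) : ℝ := sg (s-1) x * sg (s-2) x
theorem abs_hh (s x : ℕ) : |hh s x| = 1 := abs_sg _ _
theorem abs_gg (s x : ℕ) : |gg s x| = 1 := by rw [gg, abs_mul, abs_sg, abs_sg, one_mul]
theorem gg_congr {s s' x y : ℕ} (hs : s' + 2 ≤ s) (h : y ∈ cell s' x) : gg s y = gg s x := by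
  rw [gg, gg, sg_congr (by omega) h, sg_congr (by omega) h]
theorem hh_congr {s s' x y : ℕ} (hs : s' + 1 ≤ s) (h : y ∈ cell s' x) : hh s y = hh s x := by
  rw [hh, hh, sg_congr (by omega) h]

/-- exponential -/
def ex (q : Polynomial ℝ) (y : ℕ) : ℂ := Complex.exp (Complex.I * (q.eval (y:ℝ) : ℝ))
theorem norm_ex (q : Polynomial ℝ) (y : ℕ) : ‖ex q y‖ = 1 := by
  rw [ex, mul_comm, Complex.norm_exp_ofReal_mul_I]
theorem ex_add (p q : Polynomial ℝ) (y : ℕ) : ex (p + q) y = ex p y * ex q y := by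
  rw [ex, ex, ex, ← Complex.exp_add, Polynomial.eval_add]; push_cast; ring_nf
theorem ex_conj (q : Polynomial ℝ) (y : ℕ) : (starRingEnd ℂ) (ex q y) = ex (-q) y := by
  rw [ex, ex, ← Complex.exp_conj]; simp
theorem ex_sub (p q : Polynomial ℝ) (y : ℕ) : ex (p - q) y = ex p y * (starRingEnd ℂ) (ex q y) := by
  rw [ex_conj, ← ex_add, sub_eq_add_neg]
theorem ex_diff (q : Polynomial ℝ) (y z : ℕ) : ‖ex q y - ex q z‖ ≤ |q.eval (y:ℝ) - q.eval (z:ℝ)| := by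
  have e : ex q y - ex q z = ex q z * (Complex.exp (Complex.I * ((q.eval (y:ℝ) - q.eval (z:ℝ) : ℝ) : ℂ)) - 1) := by
    rw [ex, ex, mul_sub, ← Complex.exp_add, mul_one]; push_cast; ring_nf
  rw [e, norm_mul, norm_ex, one_mul]
  exact Real.norm_exp_I_mul_ofReal_sub_one_le

/-- the finite model -/
structure Mdl (d : ℕ) (C0 κ : ℝ) where
  M : ℕ
  s0 : ℕ
  Q : ℕ → Polynomial ℝ
  deg : ∀ x, (Q x).natDegree ≤ d
  small : ∀ x y z, z < 2^M → os s0 z (Q x - Q y) ≤ 1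
  vdc : ∀ x y z s, z < 2^M → s0 ≤ s → s ≤ M → ∀ R : ℝ, 1 ≤ R → R ≤ os s z (Q x - Q y) →
    ‖∑ w ∈ cell s z, ex (Q x - Q y) w‖ ≤ C0 * 2^s * R^(-κ)

namespace Mdl
variable {d : ℕ} {C0 κ : ℝ} (m : Mdl d C0 κ)

theorem degs (x y : ℕ) : (m.Q x - m.Q y).natDegree ≤ d :=
  (Polynomial.natDegree_sub_le _ _).trans (max_le (m.deg x) (m.deg y))

/-- all points -/
def Om : Finset ℕ := Finset.range (2^m.M)

/-- kernel -/
def ker (s x y : ℕ) : ℂ := if y ∈ cell s x then ((hh s x * gg s y / 2^s : ℝ) : ℂ) * ex (m.Q x) y else 0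

def T (S : ℕ → Finset ℕ) (f : ℕ → ℂ) (x : ℕ) : ℂ := ∑ s ∈ S x, ∑ y ∈ m.Om, m.ker s x y * f y
def Tt (S : ℕ → Finset ℕ) (g : ℕ → ℂ) (y : ℕ) : ℂ := ∑ x ∈ m.Om, ∑ s ∈ S x, m.ker s x y * g x

theorem duality (S : ℕ → Finset ℕ) (f g : ℕ → ℂ) :
    ∑ x ∈ m.Om, g x * m.T S f x = ∑ y ∈ m.Om, f y * m.Tt S g y := by
  simp only [T, Tt, Finset.mul_sum]
  rw [Finset.sum_comm' (s := m.Om) (t := fun _ => m.Om) (t' := m.Om) (s' := fun _ => m.Om) (by simp [and_comm])]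
  apply Finset.sum_congr rfl
  intro x _
  rw [Finset.sum_comm]
  apply Finset.sum_congr rfl; intro s _
  apply Finset.sum_congr rfl; intro y _
  ring

theorem cell_sub {s x : ℕ} (hs : s ≤ m.M) (hx : x ∈ m.Om) : cell s x ⊆ m.Om := by
  intro y hy
  rw [Om, Finset.mem_range] at *
  exact cell_lt hs hx hy

theorem norm_ker_le (s x y : ℕ) : ‖m.ker s x y‖ ≤ if y ∈ cell s x then 1 / 2^s else 0 := by
  rw [ker]
  split_ifs
  · rw [norm_mul, norm_ex, mul_one, Complex.norm_real, Real.norm_eq_abs, abs_div, abs_mul, abs_hh, abs_gg,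
      abs_of_pos (by positivity), one_mul]
  · simp

theorem sum_ker {s x : ℕ} (hs : s ≤ m.M) (hx : x ∈ m.Om) (f : ℕ → ℂ) :
    ∑ y ∈ m.Om, m.ker s x y * f y =
      ∑ y ∈ cell s x, ((hh s x * gg s y / 2^s : ℝ) : ℂ) * ex (m.Q x) y * f y := by
  rw [← Finset.sum_subset (m.cell_sub hs hx)]
  · apply Finset.sum_congr rfl
    intro y hy; rw [ker, if_pos hy]
  · intro y _ hy; rw [ker, if_neg hy, zero_mul]

theorem norm_sum_ker_le {s x : ℕ} (hs : s ≤ m.M) (hx : x ∈ m.Om) (f : ℕ → ℂ) :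
    ‖∑ y ∈ m.Om, m.ker s x y * f y‖ ≤ av s (fun y => ‖f y‖) x := by
  rw [m.sum_ker hs hx, av, Finset.sum_div]
  refine (norm_sum_le _ _).trans (Finset.sum_le_sum ?_)
  intro y _
  rw [norm_mul, norm_mul, norm_ex, mul_one, Complex.norm_real, Real.norm_eq_abs, abs_div, abs_mul, abs_hh, abs_gg,
      abs_of_pos (by positivity), one_mul]
  apply le_of_eq; ring

/-- kernel pairing -/
def pk (s x s' x' : ℕ) : ℝ := ‖∑ y ∈ m.Om, m.ker s x y * (starRingEnd ℂ) (m.ker s' x' y)‖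

theorem pk_symm (s x s' x' : ℕ) : m.pk s x s' x' = m.pk s' x' s x := by
  rw [pk, pk, ← Complex.norm_conj, map_sum]
  congr 1
  apply Finset.sum_congr rfl; intro y _
  rw [map_mul, Complex.conj_conj, mul_comm]

theorem pk_zero {s x s' x' : ℕ} (h : s' ≤ s) (hx : x' ∉ cell s x) : m.pk s x s' x' = 0 := by
  rw [pk, Finset.sum_eq_zero, norm_zero]
  intro y _
  rw [ker, ker]
  split_ifs with h1 h2
  · exfalso; apply hx
    have := cell_mono h h2
    rw [mem_cell] at *
    rw [← this, h1]
  all_goals simp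

theorem pk_le {s x s' x' : ℕ} (hs' : s' ≤ m.M) (hx' : x' ∈ m.Om) : m.pk s x s' x' ≤ 1 / 2^s := by
  rw [pk]
  calc _ ≤ ∑ y ∈ m.Om, (1/2^s) * (if y ∈ cell s' x' then 1/2^s' else 0 : ℝ) := by
        refine (norm_sum_le _ _).trans (Finset.sum_le_sum ?_)
        intro y _
        rw [norm_mul, Complex.norm_conj]
        apply mul_le_mul _ (m.norm_ker_le _ _ _) (norm_nonneg _) (by positivity)
        refine (m.norm_ker_le _ _ _).trans ?_
        split_ifs <;> simp
    _ = 1/2^s := by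
        rw [← Finset.mul_sum, Finset.sum_ite_mem, Finset.inter_eq_right.2 (m.cell_sub hs' hx'), Finset.sum_const, cell_card]
        simp

theorem pk_vdc (hC0 : 1 ≤ C0) (hκ : 0 < κ) (hκ1 : κ ≤ 1) {s x s' x' : ℕ} (h : s' ≤ s) (hs : s ≤ m.M) (hs0 : m.s0 + 2 ≤ s')
    (hx : x ∈ m.Om) (hx' : x' ∈ m.Om) {R : ℝ} (hR : 1 ≤ R) (hos : R ≤ os s' x' (m.Q x - m.Q x')) :
    m.pk s x s' x' ≤ C0 * (KK d * 4^d) * R^(-κ) / 2^s := by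
  have hK := KK_one d
  set B := KK d * 4^d with hB
  have hB1 : 1 ≤ B := by
    have : (1:ℝ) ≤ 4^d := one_le_pow₀ (by norm_num)
    nlinarith
  by_cases hxx : x' ∈ cell s x
  swap
  · rw [m.pk_zero h hxx]
    have : 0 < R^(-κ) := by positivity
    positivity
  rcases lt_or_ge R B with hRB | hRB
  · refine (m.pk_le (h.trans hs) hx').trans ?_
    apply div_le_div_of_nonneg_right _ (by positivity)
    have h1 : 1 ≤ B * R^(-κ) := by
      rw [Real.rpow_neg (by linarith), ← div_eq_mul_inv, one_le_div (by positivity)]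
      calc R^κ ≤ R^(1:ℝ) := Real.rpow_le_rpow_of_exponent_le hR hκ1
        _ = R := Real.rpow_one R
        _ ≤ B := hRB.le
    have : B * R^(-κ) ≤ C0 * (B * R^(-κ)) := le_mul_of_one_le_left (by linarith) hC0
    linarith
  obtain ⟨k, rfl⟩ : ∃ k, s' = k + 2 := ⟨s' - 2, by omega⟩
  have hsub : cell (k+2) x' ⊆ cell s x := by
    rw [← cell_eq hxx]; exact cell_mono h
  have hterm : ∀ z ∈ cell (k+2) x', ‖∑ y ∈ cell k z, m.ker s x y * (starRingEnd ℂ) (m.ker (k+2) x' y)‖ ≤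
      1/2^s * (1/2^(k+2)) * (C0 * 2^k * (B * R^(-κ))) := by
    intro z hz
    have hsubz : cell k z ⊆ cell (k+2) x' := by
      rw [← cell_eq hz]; exact cell_mono (by omega)
    have e : ∑ y ∈ cell k z, m.ker s x y * (starRingEnd ℂ) (m.ker (k+2) x' y) =
        ((hh s x * gg s z / 2^s * (hh (k+2) x' * gg (k+2) z / 2^(k+2)) : ℝ) : ℂ) *
          ∑ y ∈ cell k z, ex (m.Q x - m.Q x') y := by
      rw [Finset.mul_sum]
      apply Finset.sum_congr rfl
      intro y hy
      rw [ker, ker, if_pos (hsub (hsubz hy)), if_pos (hsubz hy), map_mul, Complex.conj_ofReal, ex_sub,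
        gg_congr (s := s) (by omega) hy, gg_congr (s := k+2) (by omega) hy]
      push_cast; ring
    rw [e, norm_mul, Complex.norm_real, Real.norm_eq_abs, abs_mul, abs_div, abs_div, abs_mul, abs_mul, abs_hh, abs_gg,
      abs_hh, abs_gg, abs_of_pos (by positivity : (0:ℝ) < 2^s), abs_of_pos (by positivity : (0:ℝ) < 2^(k+2)), one_mul]
    apply mul_le_mul_of_nonneg_left _ (by positivity)
    have hzM : z < 2^m.M := by
      have := m.cell_sub (h.trans hs) hx' hz
      rwa [Om, Finset.mem_range] at this
    have hosz : R / B ≤ os k z (m.Q x - m.Q x') := by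
      rw [div_le_iff₀ (by linarith)]
      have h1 := os_double (m.degs x x') k 2 z
      rw [os_congr hz] at h1
      norm_num at h1
      rw [hB]; linarith
    have h2 := m.vdc x x' z k hzM (by omega) (by omega) (R/B) (by rw [one_le_div (by linarith)]; exact hRB) hosz
    refine h2.trans ?_
    apply mul_le_mul_of_nonneg_left _ (by positivity)
    rw [Real.div_rpow (by linarith) (by linarith), Real.rpow_neg (by linarith : (0:ℝ) ≤ B), div_inv_eq_mul, mul_comm]
    apply mul_le_mul_of_nonneg_right _ (by positivity)
    calc B^κ ≤ B^(1:ℝ) := Real.rpow_le_rpow_of_exponent_le hB1 hκ1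
      _ = B := Real.rpow_one B
  have e0 : m.pk s x (k+2) x' = ‖∑ y ∈ cell (k+2) x', m.ker s x y * (starRingEnd ℂ) (m.ker (k+2) x' y)‖ := by
    rw [pk]
    congr 1
    rw [← Finset.sum_subset (m.cell_sub (h.trans hs) hx')]
    intro y _ hy
    rw [ker, ker, if_neg hy]; simp
  rw [e0, sum_cell_succ, sum_cell_succ, sum_cell_succ]
  have hl := lc_mem (k+1) x'
  have hr := rc_mem (k+1) x'
  have m1 : lc k (lc (k+1) x') ∈ cell (k+2) x' := by
    rw [← cell_eq hl]; exact cell_mono (by omega) (lc_mem _ _)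
  have m2 : rc k (lc (k+1) x') ∈ cell (k+2) x' := by
    rw [← cell_eq hl]; exact cell_mono (by omega) (rc_mem _ _)
  have m3 : lc k (rc (k+1) x') ∈ cell (k+2) x' := by
    rw [← cell_eq hr]; exact cell_mono (by omega) (lc_mem _ _)
  have m4 : rc k (rc (k+1) x') ∈ cell (k+2) x' := by
    rw [← cell_eq hr]; exact cell_mono (by omega) (rc_mem _ _)
  have t1 := hterm _ m1
  have t2 := hterm _ m2
  have t3 := hterm _ m3
  have t4 := hterm _ m4
  have hfin : 4 * (1/2^s * (1/2^(k+2)) * (C0 * 2^k * (B * R^(-κ)))) = C0 * B * R^(-κ) / 2^s := by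
    rw [pow_add]; field_simp; norm_num
  rw [← hfin]
  refine (norm_add_le _ _).trans ?_
  have u1 := norm_add_le (∑ y ∈ cell k (lc k (lc (k+1) x')), m.ker s x y * (starRingEnd ℂ) (m.ker (k+2) x' y))
    (∑ y ∈ cell k (rc k (lc (k+1) x')), m.ker s x y * (starRingEnd ℂ) (m.ker (k+2) x' y))
  have u2 := norm_add_le (∑ y ∈ cell k (lc k (rc (k+1) x')), m.ker s x y * (starRingEnd ℂ) (m.ker (k+2) x' y))
    (∑ y ∈ cell k (rc k (rc (k+1) x')), m.ker s x y * (starRingEnd ℂ) (m.ker (k+2) x' y))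
  linarith

end Mdl

end

section

namespace Mdl
variable {d : ℕ} {C0 κ : ℝ} (m : Mdl d C0 κ)

/-- set of points of `G` in the cell with close phase -/
def Es (G : Finset ℕ) (s x : ℕ) (q : Polynomial ℝ) (lam : ℝ) : Finset ℕ :=
  (G ∩ cell s x).filter fun y => os s x (m.Q y - q) ≤ lam

/-- high density at level `n` -/
def H (G : Finset ℕ) (n s x : ℕ) : Prop :=
  ∃ s', s ≤ s' ∧ s' ≤ m.M ∧ ∃ lam : ℝ, 1 ≤ lam ∧ ∃ z, os s x (m.Q z - m.Q x) ≤ lam ∧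
    lam^d * (1/2)^n * 2^s' < ((m.Es G s' x (m.Q z) lam).card : ℝ)

variable {G : Finset ℕ}

theorem Es_card_le (s x : ℕ) (q : Polynomial ℝ) (lam : ℝ) : ((m.Es G s x q lam).card : ℝ) ≤ 2^s := by
  have h : (m.Es G s x q lam).card ≤ (cell s x).card :=
    Finset.card_le_card ((Finset.filter_subset _ _).trans Finset.inter_subset_right)
  rw [cell_card] at h
  exact_mod_cast h

theorem Es_congr {s x y : ℕ} (h : y ∈ cell s x) (q : Polynomial ℝ) (lam : ℝ) :
    m.Es G s y q lam = m.Es G s x q lam := by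
  rw [Es, Es, cell_eq h]
  apply Finset.filter_congr
  intro z _
  rw [os_congr h]

theorem H_zero (s x : ℕ) : ¬ m.H G 0 s x := by
  rintro ⟨s', _, _, lam, hl, z, _, h⟩
  have h1 := m.Es_card_le (G := G) s' x (m.Q z) lam
  have h2 : (1:ℝ) ≤ lam^d := one_le_pow₀ hl
  have h3 : (0:ℝ) < 2^s' := by positivity
  rw [pow_zero, mul_one] at h
  nlinarith

theorem H_succ {n s x : ℕ} (h : m.H G n s x) : m.H G (n+1) s x := by
  obtain ⟨s', h1, h2, lam, hl, z, h3, h⟩ := h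
  refine ⟨s', h1, h2, lam, hl, z, h3, lt_of_le_of_lt ?_ h⟩
  have : (0:ℝ) ≤ lam^d * (1/2)^n * 2^s' := by positivity
  rw [pow_succ]; nlinarith

theorem H_down {n s t x : ℕ} (hs : s ≤ t) (h : m.H G n t x) : m.H G n s x := by
  obtain ⟨s', h1, h2, lam, hl, z, h3, h⟩ := h
  exact ⟨s', hs.trans h1, h2, lam, hl, z, (os_mono hs _ _).trans h3, h⟩

theorem H_top {s x : ℕ} (hx : x ∈ G) (hs : s ≤ m.M) : m.H G (m.M+1) s x := by
  refine ⟨s, le_rfl, hs, 1, le_rfl, x, ?_, ?_⟩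
  · rw [os_self]; norm_num
  · have h1 : (1:ℝ) ≤ ((m.Es G s x (m.Q x) 1).card : ℝ) := by
      have : 0 < (m.Es G s x (m.Q x) 1).card := by
        apply Finset.card_pos.2 ⟨x, ?_⟩
        rw [Es, Finset.mem_filter, Finset.mem_inter]
        refine ⟨⟨hx, self_mem_cell _ _⟩, ?_⟩
        rw [os_self]; norm_num
      exact_mod_cast this
    refine lt_of_lt_of_le ?_ h1
    rw [one_pow, one_mul, one_div, inv_pow, inv_mul_lt_iff₀ (by positivity), mul_one]
    exact pow_lt_pow_right₀ (by norm_num) (by omega)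

/-- consequence of low density -/
theorem notH {n s x : ℕ} (h : ¬ m.H G n s x) {s' : ℕ} (h1 : s ≤ s') (h2 : s' ≤ m.M) {lam : ℝ} (hl : 1 ≤ lam)
    {z : ℕ} (hz : os s x (m.Q x - m.Q z) ≤ lam) :
    ((m.Es G s' x (m.Q z) lam).card : ℝ) ≤ lam^d * (1/2)^n * 2^s' := by
  by_contra hc
  push Not at hc
  exact h ⟨s', h1, h2, lam, hl, z, by rw [os_comm]; exact hz, hc⟩

/-- general tree leaf summation using density -/
theorem dens_leaf {n σ x0 : ℕ} (hσ : σ ≤ m.M) {E : Finset ℕ} (hE : E ⊆ G)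
    (t : ℕ → ℕ) (ht : ∀ x ∈ E, t x ≤ σ ∧ ¬ m.H G n (t x) x) {R : ℝ} (hR : 1 ≤ R) (z : ℕ)
    (hos : ∀ x ∈ E, os (t x) x (m.Q x - m.Q z) ≤ R) {W : ℕ → ℝ} (hW : ∀ y, 0 ≤ W y)
    (hWc : ∀ s y, s < σ → y ∈ cell σ x0 → (∀ x ∈ E ∩ cell s y, s < t x) → (∃ x ∈ E ∩ cell (s+1) y, t x ≤ s+1) →
       ∀ w ∈ cell s y, W w = W y) :
    ∑ y ∈ E ∩ cell σ x0, W y ≤ 2 * R^d * (1/2)^n * ∑ y ∈ cell σ x0, W y := by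
  classical
  by_cases hne : (E ∩ cell σ x0).Nonempty
  swap
  · rw [Finset.not_nonempty_iff_eq_empty.1 hne, Finset.sum_empty]
    exact mul_nonneg (by positivity) (Finset.sum_nonneg fun y _ => hW y)
  refine leafsum (V := fun s y => s ≤ σ ∧ y ∈ cell σ x0 ∧ ∃ x ∈ E ∩ cell s y, t x ≤ s) E (by positivity) hW ?_ ?_ ?_ σ x0 ?_
  · rintro x ⟨_, _, x', hx', htx⟩
    rw [Finset.mem_inter, cell_zero, Finset.mem_singleton] at hx'
    obtain ⟨hx', rfl⟩ := hx'
    have h1 := m.notH (ht _ hx').2 (Nat.le_refl _) ((ht _ hx').1.trans hσ) hR (hos _ hx')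
    have h0 : t x' = 0 := by omega
    have h2 : ((E ∩ cell 0 x').card : ℝ) ≤ ((m.Es G (t x') x' (m.Q z) R).card : ℝ) := by
      have : E ∩ cell 0 x' ⊆ m.Es G (t x') x' (m.Q z) R := by
        intro y hy
        rw [Finset.mem_inter] at hy
        have hy2 := hy.2
        rw [cell_zero, Finset.mem_singleton] at hy2
        subst hy2
        rw [Es, Finset.mem_filter, Finset.mem_inter]
        exact ⟨⟨hE hy.1, self_mem_cell _ _⟩, hos _ hy.1⟩
      exact_mod_cast Finset.card_le_card this
    refine h2.trans (h1.trans ?_)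
    rw [h0]
    have : 0 ≤ R^d * (1/2)^n := by positivity
    linarith
  · rintro s x ⟨hs, hx, x', hx', htx⟩ y hy hnV
    have hyσ : y ∈ cell σ x0 := by
      have := cell_mono hs hy
      rwa [cell_eq hx] at this
    have hlt : ∀ w ∈ E ∩ cell s y, s < t w := by
      intro w hw
      by_contra hc
      exact hnV ⟨by omega, hyσ, w, hw, by omega⟩
    constructor
    · rw [Finset.mem_inter] at hx'
      have h1 := m.notH (ht _ hx'.1).2 htx (hs.trans hσ) hR (hos _ hx'.1)
      have h2 : ((E ∩ cell s y).card : ℝ) ≤ ((m.Es G (s+1) x' (m.Q z) R).card : ℝ) := by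
        have : E ∩ cell s y ⊆ m.Es G (s+1) x' (m.Q z) R := by
          intro w hw
          have hlw := hlt w hw
          rw [Finset.mem_inter] at hw
          have hwc : w ∈ cell (s+1) x' := by
            rw [cell_eq hx'.2, ← cell_eq hy]
            exact cell_mono (by omega) hw.2
          rw [Es, Finset.mem_filter, Finset.mem_inter]
          refine ⟨⟨hE hw.1, hwc⟩, ?_⟩
          rw [← os_congr hwc]
          exact (os_mono (by omega) _ _).trans (hos _ hw.1)
        exact_mod_cast Finset.card_le_card this
      refine h2.trans (h1.trans (le_of_eq ?_))
      rw [pow_succ]; ring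
    · refine hWc s y (by omega) hyσ hlt ⟨x', ?_, htx⟩
      rwa [cell_eq hy]
  · rintro s x y hy ⟨h1, h2, x', hx', h3⟩
    refine ⟨h1, ?_, x', by rwa [cell_eq hy], h3⟩
    have := cell_mono h1 hy
    rwa [cell_eq h2] at this
  · obtain ⟨x', hx'⟩ := hne
    exact ⟨le_rfl, self_mem_cell _ _, x', hx', (ht _ (Finset.mem_inter.1 hx').1).1⟩

theorem dens_card {n σ x0 : ℕ} (hσ : σ ≤ m.M) {E : Finset ℕ} (hE : E ⊆ G)
    (hEt : ∀ x ∈ E, ∃ t ≤ σ, ¬ m.H G n t x ∧ os t x (m.Q x - m.Q z) ≤ R) (hR : 1 ≤ R) :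
    ((E ∩ cell σ x0).card : ℝ) ≤ 2 * R^d * (1/2)^n * 2^σ := by
  choose! t h1 h2 h3 using hEt
  have := m.dens_leaf (x0 := x0) hσ hE t (fun x hx => ⟨h1 x hx, h2 x hx⟩) hR z h3 (W := fun _ => 1) (fun _ => zero_le_one)
    (fun _ _ _ _ _ _ _ _ => rfl)
  simpa [cell_card] using this

/-- squared norm of the transpose through kernel pairings -/
theorem Tt_sq (S : ℕ → Finset ℕ) (g : ℕ → ℂ) (hg : ∀ x, ‖g x‖ ≤ 1) (hG : ∀ x, x ∉ G → g x = 0) (hGO : G ⊆ m.Om) :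
    ∑ y ∈ m.Om, ‖m.Tt S g y‖^2 ≤ ∑ x ∈ G, ∑ s ∈ S x, ∑ x' ∈ G, ∑ s' ∈ S x', m.pk s x s' x' := by
  have e : ∀ y, m.Tt S g y = ∑ x ∈ G, ∑ s ∈ S x, m.ker s x y * g x := by
    intro y
    rw [Tt, ← Finset.sum_subset hGO]
    intro x _ hx
    rw [hG x hx]; simp
  have e2 : ((∑ y ∈ m.Om, ‖m.Tt S g y‖^2 : ℝ) : ℂ) = ∑ x ∈ G, ∑ s ∈ S x, ∑ x' ∈ G, ∑ s' ∈ S x',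
      (g x * (starRingEnd ℂ) (g x')) * ∑ y ∈ m.Om, m.ker s x y * (starRingEnd ℂ) (m.ker s' x' y) := by
    push_cast
    have : ∀ y ∈ m.Om, ((‖m.Tt S g y‖ : ℂ)^2) = ∑ x ∈ G, ∑ s ∈ S x, ∑ x' ∈ G, ∑ s' ∈ S x',
       (m.ker s x y * g x) * (starRingEnd ℂ) (m.ker s' x' y * g x') := by
      intro y _
      rw [← Complex.mul_conj', e, map_sum, Finset.sum_mul_sum]
      simp only [map_sum, Finset.sum_mul_sum]
      apply Finset.sum_congr rfl; intro x _
      rw [Finset.sum_comm]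
    rw [Finset.sum_congr rfl this, Finset.sum_comm]
    apply Finset.sum_congr rfl; intro x _
    rw [Finset.sum_comm]
    apply Finset.sum_congr rfl; intro s _
    rw [Finset.sum_comm]
    apply Finset.sum_congr rfl; intro x' _
    rw [Finset.sum_comm]
    apply Finset.sum_congr rfl; intro s' _
    rw [Finset.mul_sum]
    apply Finset.sum_congr rfl; intro y _
    rw [map_mul]; ring
  have e3 : ∑ y ∈ m.Om, ‖m.Tt S g y‖^2 = ‖((∑ y ∈ m.Om, ‖m.Tt S g y‖^2 : ℝ) : ℂ)‖ := by
    rw [Complex.norm_real, Real.norm_of_nonneg (Finset.sum_nonneg fun _ _ => by positivity)]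
  rw [e3, e2]
  refine (norm_sum_le _ _).trans (Finset.sum_le_sum fun x _ => ?_)
  refine (norm_sum_le _ _).trans (Finset.sum_le_sum fun s _ => ?_)
  refine (norm_sum_le _ _).trans (Finset.sum_le_sum fun x' _ => ?_)
  refine (norm_sum_le _ _).trans (Finset.sum_le_sum fun s' _ => ?_)
  rw [norm_mul, ← pk, norm_mul, Complex.norm_conj]
  have h1 : ‖g x‖ * ‖g x'‖ ≤ 1 := mul_le_one₀ (hg x) (norm_nonneg _) (hg x')
  exact mul_le_of_le_one_left (norm_nonneg _) h1

theorem estD (hC0 : 1 ≤ C0) (hκ : 0 < κ) (hκ1 : κ ≤ 1) {n L : ℕ} (S : ℕ → Finset ℕ) (hGO : G ⊆ m.Om)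
    (hS : ∀ x ∈ G, ∀ s ∈ S x, m.s0 + 2 ≤ s ∧ s ≤ m.M ∧ ¬ m.H G n s x) (hL : ∀ x ∈ G, (S x).card ≤ L)
    (g : ℕ → ℂ) (hg : ∀ x, ‖g x‖ ≤ 1) (hG : ∀ x, x ∉ G → g x = 0) {R : ℝ} (hR : 1 ≤ R) :
    ∑ y ∈ m.Om, ‖m.Tt S g y‖^2 ≤ 2 * L^2 * (C0 * (KK d * 4^d) * R^(-κ) + 2 * R^d * (1/2)^n) * G.card := by
  classical
  set B := C0 * (KK d * 4^d) * R^(-κ) with hB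
  have hKK := KK_one d
  have hB0 : 0 ≤ B := by positivity
  refine (m.Tt_sq S g hg hG hGO).trans ?_
  -- ordered pairs
  have hord : ∑ x ∈ G, ∑ s ∈ S x, ∑ x' ∈ G, ∑ s' ∈ S x', m.pk s x s' x' ≤
      2 * ∑ x ∈ G, ∑ s ∈ S x, ∑ x' ∈ G, ∑ s' ∈ S x', (if s' ≤ s then m.pk s x s' x' else 0) := by
    have h1 : ∑ x ∈ G, ∑ s ∈ S x, ∑ x' ∈ G, ∑ s' ∈ S x', m.pk s x s' x' ≤
       ∑ x ∈ G, ∑ s ∈ S x, ∑ x' ∈ G, ∑ s' ∈ S x', ((if s' ≤ s then m.pk s x s' x' else 0) +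
          (if s ≤ s' then m.pk s' x' s x else 0)) := by
      refine Finset.sum_le_sum fun x _ => Finset.sum_le_sum fun s _ => Finset.sum_le_sum fun x' _ => Finset.sum_le_sum fun s' _ => ?_
      have p1 : 0 ≤ m.pk s x s' x' := norm_nonneg _
      have p2 := m.pk_symm s x s' x'
      rcases le_total s s' with h | h
      · rw [if_pos h]; split_ifs <;> linarith
      · rw [if_pos h]; split_ifs <;> linarith
    refine h1.trans (le_of_eq ?_)
    simp only [Finset.sum_add_distrib]
    rw [two_mul]
    congr 1
    have : ∀ (F : ℕ → ℕ → ℕ → ℕ → ℝ), ∑ x ∈ G, ∑ s ∈ S x, ∑ x' ∈ G, ∑ s' ∈ S x', F x s x' s' =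
        ∑ x' ∈ G, ∑ s' ∈ S x', ∑ x ∈ G, ∑ s ∈ S x, F x s x' s' := by
      intro F
      calc _ = ∑ x ∈ G, ∑ x' ∈ G, ∑ s ∈ S x, ∑ s' ∈ S x', F x s x' s' := by
            apply Finset.sum_congr rfl; intro x _; rw [Finset.sum_comm]
        _ = ∑ x' ∈ G, ∑ x ∈ G, ∑ s ∈ S x, ∑ s' ∈ S x', F x s x' s' := Finset.sum_comm
        _ = _ := by
            apply Finset.sum_congr rfl; intro x' _
            rw [Finset.sum_comm]
            conv_rhs => rw [Finset.sum_comm]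
            rw [Finset.sum_comm]
            apply Finset.sum_congr rfl; intro x _
            rw [Finset.sum_comm]
    rw [this]
  refine hord.trans ?_
  have hin : ∀ x ∈ G, ∀ s ∈ S x, ∑ x' ∈ G, ∑ s' ∈ S x', (if s' ≤ s then m.pk s x s' x' else 0) ≤
      L * (B + 2 * R^d * (1/2)^n) := by
    intro x hx s hs
    obtain ⟨hs0, hsM, hH⟩ := hS x hx s hs
    set Z := G.filter fun x' => ∃ t ≤ s, ¬ m.H G n t x' ∧ os t x' (m.Q x' - m.Q x) ≤ R with hZ
    have hZc : ((Z ∩ cell s x).card : ℝ) ≤ 2 * R^d * (1/2)^n * 2^s := by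
      apply m.dens_card (G := G) (z := x) hsM (Finset.filter_subset _ _) _ hR
      intro x' hx'
      exact (Finset.mem_filter.1 hx').2
    have hterm : ∀ x' ∈ G, ∑ s' ∈ S x', (if s' ≤ s then m.pk s x s' x' else 0) ≤
       L * ((if x' ∈ cell s x then B / 2^s else 0) + if x' ∈ Z ∩ cell s x then 1/2^s else 0) := by
      intro x' hx'
      set c : ℝ := ((if x' ∈ cell s x then B / 2^s else 0) + if x' ∈ Z ∩ cell s x then 1/2^s else 0) with hc
      have hc0 : 0 ≤ c := by
        apply add_nonneg <;> split_ifs <;> positivity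
      have : ∀ s' ∈ S x', (if s' ≤ s then m.pk s x s' x' else 0) ≤ c := by
        intro s' hs'
        obtain ⟨hs0', hsM', hH'⟩ := hS x' hx' s' hs'
        split_ifs with hle
        swap
        · exact hc0
        by_cases hxc : x' ∈ cell s x
        swap
        · rw [m.pk_zero hle hxc]; exact hc0
        by_cases hos : R ≤ os s' x' (m.Q x - m.Q x')
        · refine (m.pk_vdc hC0 hκ hκ1 hle hsM hs0' (hGO hx) (hGO hx') hR hos).trans ?_
          rw [hc, if_pos hxc]
          apply le_add_of_nonneg_right
          split_ifs <;> positivity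
        · push Not at hos
          have hz : x' ∈ Z ∩ cell s x := by
            rw [Finset.mem_inter, hZ, Finset.mem_filter]
            refine ⟨⟨hx', s', hle, hH', ?_⟩, hxc⟩
            rw [os_comm]; exact hos.le
          refine (m.pk_le hsM' (hGO hx')).trans ?_
          rw [hc, if_pos hz]
          apply le_add_of_nonneg_left
          split_ifs <;> positivity
      refine (Finset.sum_le_card_nsmul _ _ _ this).trans ?_
      rw [nsmul_eq_mul]
      apply mul_le_mul_of_nonneg_right _ hc0
      exact_mod_cast hL x' hx'
    refine (Finset.sum_le_sum hterm).trans ?_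
    rw [← Finset.mul_sum]
    apply mul_le_mul_of_nonneg_left _ (by positivity)
    rw [Finset.sum_add_distrib]
    have c1 : ((G ∩ cell s x).card : ℝ) ≤ 2^s := by
      have := Finset.card_le_card (Finset.inter_subset_right : G ∩ cell s x ⊆ cell s x)
      rw [cell_card] at this
      exact_mod_cast this
    have c2 : ((G ∩ (Z ∩ cell s x)).card : ℝ) ≤ 2 * R^d * (1/2)^n * 2^s := by
      refine le_trans ?_ hZc
      exact_mod_cast Finset.card_le_card Finset.inter_subset_right
    rw [Finset.sum_ite_mem, Finset.sum_ite_mem, Finset.sum_const, Finset.sum_const, nsmul_eq_mul, nsmul_eq_mul]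
    have h2 : (0:ℝ) < 2^s := by positivity
    apply add_le_add
    · rw [mul_div_assoc', div_le_iff₀ h2]; nlinarith
    · rw [mul_one_div, div_le_iff₀ h2]; exact c2
  have hfin : ∑ x ∈ G, ∑ s ∈ S x, ∑ x' ∈ G, ∑ s' ∈ S x', (if s' ≤ s then m.pk s x s' x' else 0) ≤
     ∑ x ∈ G, (L:ℝ) * (L * (B + 2 * R^d * (1/2)^n)) := by
    apply Finset.sum_le_sum; intro x hx
    refine (Finset.sum_le_card_nsmul _ _ _ (hin x hx)).trans ?_
    rw [nsmul_eq_mul]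
    apply mul_le_mul_of_nonneg_right _ (by positivity)
    exact_mod_cast hL x hx
  rw [Finset.sum_const, nsmul_eq_mul] at hfin
  nlinarith

end Mdl

end

section

/-- complex average -/
def cav (s : ℕ) (u : ℕ → ℂ) (x : ℕ) : ℂ := (∑ y ∈ cell s x, u y) / 2^s

theorem cav_congr {s x y : ℕ} (u : ℕ → ℂ) (h : y ∈ cell s x) : cav s u y = cav s u x := by
  rw [cav, cav, cell_eq h]

theorem norm_cav_le (s : ℕ) (u : ℕ → ℂ) (x : ℕ) : ‖cav s u x‖ ≤ av s (fun y => ‖u y‖) x := by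
  rw [cav, av, norm_div]
  have : ‖(2:ℂ)^s‖ = 2^s := by simp
  rw [this]
  gcongr
  exact norm_sum_le _ _

theorem cav_succ (s : ℕ) (u : ℕ → ℂ) (x : ℕ) : cav (s+1) u x = (cav s u (lc s x) + cav s u (rc s x)) / 2 := by
  rw [cav, cav, cav, sum_cell_succ, pow_succ]; field_simp

theorem cav_sg (s : ℕ) (u : ℕ → ℂ) (x : ℕ) :
    cav (s+1) (fun y => (sg s y : ℂ) * u y) x = (cav s u (lc s x) - cav s u (rc s x)) / 2 := by
  have e1 : ∑ y ∈ cell s (lc s x), (sg s y : ℂ) * u y = ∑ y ∈ cell s (lc s x), u y := by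
    apply Finset.sum_congr rfl; intro y hy
    rw [sg_congr le_rfl hy, sg_lc]; simp
  have e2 : ∑ y ∈ cell s (rc s x), (sg s y : ℂ) * u y = -∑ y ∈ cell s (rc s x), u y := by
    rw [← Finset.sum_neg_distrib]
    apply Finset.sum_congr rfl; intro y hy
    rw [sg_congr le_rfl hy, sg_rc]; simp
  rw [cav, cav, cav, sum_cell_succ, e1, e2, pow_succ]; field_simp; ring

theorem par_id (a b : ℂ) : ‖(a+b)/2‖^2 + ‖(a-b)/2‖^2 = (‖a‖^2 + ‖b‖^2)/2 := by
  have := parallelogram_law_with_norm ℂ a b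
  rw [norm_div, norm_div, Complex.norm_ofNat]
  nlinarith

theorem par_le (a b : ℂ) : ‖(a-b)/2‖^2 ≤ (‖a‖^2 + ‖b‖^2)/2 := by
  have := par_id a b
  have : 0 ≤ ‖(a+b)/2‖^2 := by positivity
  linarith

/-- a tree -/
structure Tree {d : ℕ} {C0 κ : ℝ} (m : Mdl d C0 κ) (G : Finset ℕ) (n : ℕ) where
  σ : ℕ
  x0 : ℕ
  hσ : σ ≤ m.M
  hx0 : x0 ∈ m.Om
  E : Finset ℕ
  hE : E ⊆ G
  hEc : E ⊆ cell σ x0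
  α : ℕ → ℕ
  β : ℕ → ℕ
  h2 : ∀ x ∈ E, m.s0 + 2 ≤ α x ∧ α x ≤ β x ∧ β x ≤ σ ∧ os (β x) x (m.Q x - m.Q x0) ≤ 2 ∧ ¬ m.H G n (α x) x

namespace Tree
variable {d : ℕ} {C0 κ : ℝ} {m : Mdl d C0 κ} {G : Finset ℕ} {n : ℕ} (t : Tree m G n)

def S (x : ℕ) : Finset ℕ := if x ∈ t.E then Finset.Icc (t.α x) (t.β x) else ∅

def V (s y : ℕ) : Prop := s ≤ t.σ ∧ y ∈ cell t.σ t.x0 ∧ ∃ x ∈ t.E ∩ cell s y, t.α x ≤ s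

variable {t}
theorem V_congr {s x y : ℕ} (h : y ∈ cell s x) : t.V s y ↔ t.V s x := by
  have key : ∀ {x y : ℕ}, y ∈ cell s x → t.V s x → t.V s y := by
    rintro x y hy ⟨h1, h2, x', hx', h3⟩
    refine ⟨h1, ?_, x', by rwa [cell_eq hy], h3⟩
    have := cell_mono h1 hy
    rwa [cell_eq h2] at this
  exact ⟨key (cell_symm h), key h⟩

theorem V_up {s s' y : ℕ} (h : t.V s y) (hs : s ≤ s') (hs' : s' ≤ t.σ) : t.V s' y := by
  obtain ⟨h1, h2, x', hx', h3⟩ := h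
  rw [Finset.mem_inter] at hx'
  exact ⟨hs', h2, x', Finset.mem_inter.2 ⟨hx'.1, cell_mono hs hx'.2⟩, h3.trans hs⟩

theorem V_two {s y : ℕ} (h : t.V s y) : 2 ≤ s := by
  obtain ⟨h1, h2, x', hx', h3⟩ := h
  have := (t.h2 x' (Finset.mem_inter.1 hx').1).1
  omega

theorem V_of_mem {x : ℕ} (hx : x ∈ t.E) {s : ℕ} (h : t.α x ≤ s) (hs : s ≤ t.σ) : t.V s x :=
  ⟨hs, t.hEc hx, x, Finset.mem_inter.2 ⟨hx, self_mem_cell _ _⟩, h⟩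

variable (t)
/-- minimal scale -/
def a (y : ℕ) : ℕ := sInf {s | t.V s y}

variable {t}
theorem a_eq {s y : ℕ} (h1 : t.V (s+1) y) (h2 : ¬ t.V s y) : t.a y = s+1 := by
  apply le_antisymm (Nat.sInf_le h1)
  by_contra hc
  push Not at hc
  have hm : t.V (t.a y) y := Nat.sInf_mem (s := {s | t.V s y}) ⟨s+1, h1⟩
  have hc' : t.a y ≤ s := Nat.lt_succ_iff.1 hc
  exact h2 (V_up hm hc' (by have := h1.1; omega))

variable (t)
/-- leaf averages -/
def lft (u : ℕ → ℝ) (y : ℕ) : ℝ := av (t.a y - 1) u y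

variable {t}
theorem lft_nonneg {u : ℕ → ℝ} (hu : ∀ y, 0 ≤ u y) (y : ℕ) : 0 ≤ t.lft u y := av_nonneg hu

theorem lft_leaf {s y : ℕ} (h1 : t.V (s+1) y) (h2 : ¬ t.V s y) (u : ℕ → ℝ) {y' : ℕ} (hy : y' ∈ cell s y) :
    t.lft u y' = av s u y := by
  have e : t.a y' = s + 1 := a_eq ((V_congr (cell_mono (by omega) hy)).2 h1) (by rwa [V_congr hy])
  rw [lft, e, Nat.add_sub_cancel, av_congr u hy]

theorem lft_sum (u : ℕ → ℝ) (s : ℕ) : ∀ x, t.V s x → ∑ y ∈ cell s x, t.lft u y = ∑ y ∈ cell s x, u y := by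
  induction s with
  | zero => intro x hx; have := V_two hx; omega
  | succ s ih =>
    intro x hx
    have key : ∀ z ∈ cell (s+1) x, ∑ y ∈ cell s z, t.lft u y = ∑ y ∈ cell s z, u y := by
      intro z hz
      by_cases hV : t.V s z
      · exact ih z hV
      · rw [Finset.sum_congr rfl fun y hy => lft_leaf ((V_congr hz).2 hx) hV u hy, Finset.sum_const, cell_card, nsmul_eq_mul, av]
        push_cast; field_simp
    rw [sum_cell_succ, sum_cell_succ, key _ (lc_mem s x), key _ (rc_mem s x)]

theorem av_le_MFlft (u : ℕ → ℝ) {s x : ℕ} (h : t.V s x) : av s u x ≤ MF (t.lft u) t.σ x := by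
  have : av s u x = av s (t.lft u) x := by rw [av, av, lft_sum u s x h]
  rw [this]; exact av_le_MF _ h.1

variable (t)
def phi (f : ℕ → ℂ) (y : ℕ) : ℂ := ex (m.Q t.x0) y * f y
open Classical in
def Dd (f : ℕ → ℂ) (s y : ℕ) : ℂ := if t.V s y then (hh s y : ℂ) * cav s (fun w => (gg s w : ℂ) * t.phi f w) y else 0
def Ss (f : ℕ → ℂ) (k y : ℕ) : ℂ := ∑ s ∈ Finset.range (k+1), t.Dd f s y
variable {t}

theorem norm_phi (f : ℕ → ℂ) (y : ℕ) : ‖t.phi f y‖ = ‖f y‖ := by rw [phi, norm_mul, norm_ex, one_mul]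

theorem Dd_congr (f : ℕ → ℂ) {s k x y : ℕ} (hk : k + 1 ≤ s) (h : y ∈ cell k x) : t.Dd f s y = t.Dd f s x := by
  have h' : y ∈ cell s x := cell_mono (by omega) h
  rw [Dd, Dd, hh_congr hk h, cav_congr _ h']
  by_cases hV : t.V s x
  · rw [if_pos hV, if_pos ((V_congr h').2 hV)]
  · rw [if_neg hV, if_neg (by rwa [V_congr h'])]

theorem Dd_zero (f : ℕ → ℂ) (y : ℕ) : t.Dd f 0 y = 0 := by
  rw [Dd, if_neg]
  intro h; have := V_two h; omega

theorem Dd_sum (f : ℕ → ℂ) (s : ℕ) (x : ℕ) : ∑ y ∈ cell s x, t.Dd f s y = 0 := by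
  cases s with
  | zero => exact Finset.sum_eq_zero fun y _ => Dd_zero f y
  | succ s =>
    by_cases hV : t.V (s+1) x
    swap
    · apply Finset.sum_eq_zero; intro y hy
      rw [Dd, if_neg]; rwa [V_congr hy]
    have e : ∀ y ∈ cell (s+1) x, t.Dd f (s+1) y = (sg s y : ℂ) * cav (s+1) (fun w => (gg (s+1) w : ℂ) * t.phi f w) x := by
      intro y hy
      rw [Dd, if_pos ((V_congr hy).2 hV), cav_congr _ hy, hh, Nat.add_sub_cancel]
    rw [Finset.sum_congr rfl e, ← Finset.sum_mul, sum_cell_succ]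
    have e1 : ∑ y ∈ cell s (lc s x), (sg s y : ℂ) = 2^s := by
      rw [Finset.sum_congr rfl fun y hy => by rw [sg_congr le_rfl hy, sg_lc]]; simp [cell_card]
    have e2 : ∑ y ∈ cell s (rc s x), (sg s y : ℂ) = -2^s := by
      rw [Finset.sum_congr rfl fun y hy => by rw [sg_congr le_rfl hy, sg_rc]]; simp [cell_card]
    rw [e1, e2]; simp

theorem Dd_sum' (f : ℕ → ℂ) {s k : ℕ} (hk : s ≤ k) : ∀ (x : ℕ), ∑ y ∈ cell k x, t.Dd f s y = 0 := by
  induction k, hk using Nat.le_induction with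
  | base => exact Dd_sum f s
  | succ k _ ih => intro x; rw [sum_cell_succ, ih, ih, add_zero]

theorem Ss_sum (f : ℕ → ℂ) (k x : ℕ) : ∑ y ∈ cell k x, t.Ss f k y = 0 := by
  simp only [Ss]
  rw [Finset.sum_comm]
  apply Finset.sum_eq_zero
  intro s hs
  exact Dd_sum' f (by simp at hs; omega) x

theorem cav_Ss (f : ℕ → ℂ) (k x : ℕ) :
    cav k (t.Ss f t.σ) x = ∑ s ∈ (Finset.range (t.σ+1)).filter (fun s => k + 1 ≤ s), t.Dd f s x := by
  rw [cav]
  simp only [Ss]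
  rw [Finset.sum_comm, Finset.sum_filter, Finset.sum_div]
  apply Finset.sum_congr rfl
  intro s _
  split_ifs with h
  · rw [Finset.sum_congr rfl fun y hy => Dd_congr f h hy, Finset.sum_const, cell_card, nsmul_eq_mul]
    push_cast; field_simp
  · rw [Dd_sum' f (by omega) x, zero_div]

theorem Dd_partial (f : ℕ → ℂ) {α β x : ℕ} (hα : 1 ≤ α) (hαβ : α ≤ β) (hβ : β ≤ t.σ) :
    ∑ s ∈ Finset.Icc α β, t.Dd f s x = cav (α-1) (t.Ss f t.σ) x - cav β (t.Ss f t.σ) x := by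
  rw [cav_Ss, cav_Ss, eq_sub_iff_add_eq, ← Finset.sum_union]
  · apply Finset.sum_congr _ fun _ _ => rfl
    ext s; simp; omega
  · rw [Finset.disjoint_left]; intro s; simp; omega

theorem energy (f : ℕ → ℂ) (s : ℕ) : ∀ x, t.V s x →
    ∑ y ∈ cell s x, ‖t.Ss f s y‖^2 + 2^s * (‖cav s (t.phi f) x‖^2 + ‖cav s (fun w => (hh s w : ℂ) * t.phi f w) x‖^2) ≤
     2 * ∑ y ∈ cell s x, (t.lft (fun y => ‖f y‖) y)^2 := by
  induction s with
  | zero => intro x hx; have := V_two hx; omega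
  | succ s ih =>
    intro x hx
    have hs1 : 1 ≤ s := by have := V_two hx; omega
    set u := fun y => ‖f y‖ with hu
    have key : ∀ z ∈ cell (s+1) x, ∑ y ∈ cell s z, ‖t.Ss f s y‖^2 + 2^s * (‖cav s (t.phi f) z‖^2 + ‖cav s (fun w => (hh s w : ℂ) * t.phi f w) z‖^2) ≤
     2 * ∑ y ∈ cell s z, (t.lft u y)^2 := by
      intro z hz
      by_cases hV : t.V s z
      · exact ih z hV
      · have e1 : ∑ y ∈ cell s z, ‖t.Ss f s y‖^2 = 0 := by
          apply Finset.sum_eq_zero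
          intro y hy
          have : t.Ss f s y = 0 := by
            rw [Ss]; apply Finset.sum_eq_zero
            intro k hk
            rw [Dd, if_neg]
            intro hc
            exact hV ((V_congr hy).1 (V_up hc (by simp at hk; omega) (by have := hx.1; omega)))
          rw [this]; simp
        have e2 : ∑ y ∈ cell s z, (t.lft u y)^2 = 2^s * (av s u z)^2 := by
          rw [Finset.sum_congr rfl fun y hy => by rw [lft_leaf ((V_congr hz).2 hx) hV u hy], Finset.sum_const, cell_card, nsmul_eq_mul]
          push_cast; rfl
        rw [e1, e2, zero_add]
        have h1 : ‖cav s (t.phi f) z‖ ≤ av s u z := by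
          refine (norm_cav_le _ _ _).trans (le_of_eq ?_)
          simp only [norm_phi, hu]
        have h2 : ‖cav s (fun w => (hh s w : ℂ) * t.phi f w) z‖ ≤ av s u z := by
          refine (norm_cav_le _ _ _).trans (le_of_eq ?_)
          simp only [norm_phi, hu, norm_mul, Complex.norm_real, Real.norm_eq_abs, abs_hh, one_mul]
        have h3 := pow_le_pow_left₀ (norm_nonneg _) h1 2
        have h4 := pow_le_pow_left₀ (norm_nonneg _) h2 2
        have : (0:ℝ) < 2^s := by positivity
        nlinarith
    have kl := key _ (lc_mem s x)
    have kr := key _ (rc_mem s x)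
    set c := cav (s+1) (fun w => (gg (s+1) w : ℂ) * t.phi f w) x with hc
    have hD : ∀ z ∈ cell (s+1) x, ∑ y ∈ cell s z, ‖t.Ss f (s+1) y‖^2 = ∑ y ∈ cell s z, ‖t.Ss f s y‖^2 + 2^s * ‖c‖^2 := by
      intro z hz
      have hDn : ‖t.Dd f (s+1) z‖ = ‖c‖ := by
        rw [Dd, if_pos ((V_congr hz).2 hx), norm_mul, Complex.norm_real, Real.norm_eq_abs, abs_hh, one_mul, cav_congr _ hz]
      have e : ∀ y ∈ cell s z, ‖t.Ss f (s+1) y‖^2 = ‖t.Ss f s y‖^2 + 2 * (t.Ss f s y * (starRingEnd ℂ) (t.Dd f (s+1) z)).re + ‖c‖^2 := by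
        intro y hy
        have : t.Ss f (s+1) y = t.Ss f s y + t.Dd f (s+1) z := by
          rw [Ss, Finset.sum_range_succ, ← Ss, Dd_congr f le_rfl hy]
        rw [this, ← hDn, Complex.sq_norm, Complex.sq_norm, Complex.sq_norm, Complex.normSq_add]; ring
      rw [Finset.sum_congr rfl e, Finset.sum_add_distrib, Finset.sum_add_distrib, ← Finset.mul_sum, ← Complex.re_sum, ← Finset.sum_mul,
        Ss_sum, zero_mul, Complex.zero_re, Finset.sum_const, cell_card, nsmul_eq_mul]
      push_cast; ring
    rw [sum_cell_succ, sum_cell_succ, hD _ (lc_mem s x), hD _ (rc_mem s x)]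
    have hcle : ‖c‖^2 ≤ (‖cav s (fun w => (hh s w : ℂ) * t.phi f w) (lc s x)‖^2 + ‖cav s (fun w => (hh s w : ℂ) * t.phi f w) (rc s x)‖^2)/2 := by
      have : c = cav (s+1) (fun w => (sg s w : ℂ) * ((hh s w : ℂ) * t.phi f w)) x := by
        rw [hc]; congr 1; ext w
        rw [gg, hh, Nat.add_sub_cancel, show s + 1 - 2 = s - 1 by omega]; push_cast; ring
      rw [this, cav_sg]; exact par_le _ _
    have hA : ‖cav (s+1) (t.phi f) x‖^2 + ‖cav (s+1) (fun w => (hh (s+1) w : ℂ) * t.phi f w) x‖^2 =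
       (‖cav s (t.phi f) (lc s x)‖^2 + ‖cav s (t.phi f) (rc s x)‖^2)/2 := by
      have : cav (s+1) (fun w => (hh (s+1) w : ℂ) * t.phi f w) x = (cav s (t.phi f) (lc s x) - cav s (t.phi f) (rc s x)) / 2 := by
        rw [← cav_sg]; rfl
      rw [this, cav_succ, par_id]
    rw [hA]
    have h2 : (0:ℝ) < 2^s := by positivity
    have h3 := mul_le_mul_of_nonneg_left hcle h2.le
    rw [pow_succ (2:ℝ) s]
    linarith

theorem geom_sum_le (α β : ℕ) : ∑ s ∈ Finset.Icc α β, (1:ℝ)/2^(β-s) ≤ 2 := by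
  have h1 : ∑ s ∈ Finset.Icc α β, (1:ℝ)/2^(β-s) ≤ ∑ s ∈ Finset.range (β+1), (1:ℝ)/2^(β-s) := by
    apply Finset.sum_le_sum_of_subset_of_nonneg
    · intro s hs; simp at hs ⊢; omega
    · intros; positivity
  refine h1.trans ?_
  have := Finset.sum_range_reflect (fun s => (1:ℝ)/2^s) (β+1)
  simp only [Nat.add_sub_cancel] at this
  rw [show ∑ s ∈ Finset.range (β+1), (1:ℝ)/2^(β-s) = ∑ j ∈ Finset.range (β+1), (1:ℝ)/2^(β+1-1-j) by simp]
  simp only [Nat.add_sub_cancel]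
  rw [this]
  have := sum_geometric_two_le (β+1)
  simpa using this

/-- pointwise bound -/
theorem T_le {x : ℕ} (hx : x ∈ t.E) (f : ℕ → ℂ) :
    ‖m.T t.S f x‖ ≤ 4 * KK d * MF (t.lft fun y => ‖f y‖) t.σ x + 2 * MF (fun y => ‖t.Ss f t.σ y‖) t.σ x := by
  obtain ⟨hα, hαβ, hβ, hos, hH⟩ := t.h2 x hx
  have hxO : x ∈ m.Om := m.cell_sub t.hσ t.hx0 (t.hEc hx)
  set u := fun y => ‖f y‖ with hu
  set c := ex (m.Q x - m.Q t.x0) x with hc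
  have hSx : t.S x = Finset.Icc (t.α x) (t.β x) := by rw [S, if_pos hx]
  have hterm : ∀ s ∈ Finset.Icc (t.α x) (t.β x), ‖∑ y ∈ m.Om, m.ker s x y * f y - c * t.Dd f s x‖ ≤
      (2 * KK d * MF (t.lft u) t.σ x) * (1/2^(t.β x - s)) := by
    intro s hs
    rw [Finset.mem_Icc] at hs
    have hV : t.V s x := V_of_mem hx hs.1 (hs.2.trans hβ)
    rw [m.sum_ker (by have := t.hσ; omega) hxO, Dd, if_pos hV, cav, Finset.sum_div, Finset.mul_sum, Finset.mul_sum, ← Finset.sum_sub_distrib]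
    have hoss : os s x (m.Q x - m.Q t.x0) ≤ KK d / 2^(t.β x - s) * 2 := by
      have h1 := os_contract (m.degs x t.x0) s (t.β x - s) x
      rw [Nat.add_sub_cancel' hs.2] at h1
      refine h1.trans ?_
      have := KK_one d
      gcongr
    calc _ ≤ ∑ y ∈ cell s x, os s x (m.Q x - m.Q t.x0) * (u y / 2^s) := by
          refine (norm_sum_le _ _).trans (Finset.sum_le_sum fun y hy => ?_)
          have e : ((hh s x * gg s y / 2^s : ℝ) : ℂ) * ex (m.Q x) y * f y - c * ((hh s x : ℂ) * ((gg s y : ℂ) * t.phi f y / 2^s)) =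
             ((hh s x * gg s y / 2^s : ℝ) : ℂ) * (ex (m.Q t.x0) y * f y) * (ex (m.Q x - m.Q t.x0) y - c) := by
            have : ex (m.Q x) y = ex (m.Q t.x0) y * ex (m.Q x - m.Q t.x0) y := by
              rw [← ex_add]; congr 1; ring
            rw [this, phi]; push_cast; ring
          rw [e, norm_mul, norm_mul, norm_mul, norm_ex, one_mul, Complex.norm_real, Real.norm_eq_abs, abs_div, abs_mul, abs_hh, abs_gg,
            abs_of_pos (by positivity : (0:ℝ) < 2^s), one_mul]
          have h1 := (ex_diff (m.Q x - m.Q t.x0) y x).trans (os_pt hy (self_mem_cell s x) _)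
          calc _ ≤ 1/2^s * u y * os s x (m.Q x - m.Q t.x0) := by gcongr
            _ = _ := by ring
      _ = os s x (m.Q x - m.Q t.x0) * av s u x := by
          rw [← Finset.mul_sum, av, Finset.sum_div]
      _ ≤ (KK d / 2^(t.β x - s) * 2) * MF (t.lft u) t.σ x := by
          have := KK_one d
          apply mul_le_mul hoss (av_le_MFlft u hV) (av_nonneg fun y => norm_nonneg _) (by positivity)
      _ = _ := by ring
  have e : m.T t.S f x = ∑ s ∈ Finset.Icc (t.α x) (t.β x), (∑ y ∈ m.Om, m.ker s x y * f y - c * t.Dd f s x) +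
      c * ∑ s ∈ Finset.Icc (t.α x) (t.β x), t.Dd f s x := by
    rw [Mdl.T, hSx, Finset.sum_sub_distrib, Finset.mul_sum]; ring
  rw [e]
  refine (norm_add_le _ _).trans (add_le_add ?_ ?_)
  · refine (norm_sum_le _ _).trans ((Finset.sum_le_sum hterm).trans ?_)
    rw [← Finset.mul_sum]
    have h1 := geom_sum_le (t.α x) (t.β x)
    have h0 : 0 ≤ 2 * KK d * MF (t.lft u) t.σ x := by
      have := KK_one d
      have := MF_nonneg (lft_nonneg (t := t) (u := u) fun y => norm_nonneg _) t.σ x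
      positivity
    nlinarith
  · rw [norm_mul, hc, norm_ex, one_mul, Dd_partial f (by omega) hαβ hβ]
    have h1 := (norm_cav_le (t.α x - 1) (t.Ss f t.σ) x).trans (av_le_MF (fun y => ‖t.Ss f t.σ y‖) (show t.α x - 1 ≤ t.σ by omega))
    have h2 := (norm_cav_le (t.β x) (t.Ss f t.σ) x).trans (av_le_MF (fun y => ‖t.Ss f t.σ y‖) hβ)
    refine (norm_sub_le _ _).trans ?_
    linarith

/-- number of points of a tree -/
theorem card_E : (t.E.card : ℝ) ≤ 2 * 2^d * (1/2)^n * 2^t.σ := by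
  have := m.dens_card (x0 := t.x0) (G := G) (n := n) (R := 2) (z := t.x0) t.hσ t.hE (fun x hx => ⟨t.α x, ?_, ?_, ?_⟩) (by norm_num)
  · rwa [Finset.inter_eq_left.2 t.hEc] at this
  all_goals obtain ⟨hα, hαβ, hβ, hos, hH⟩ := t.h2 x hx
  · omega
  · exact hH
  · exact (os_mono hαβ _ _).trans hos

/-- constant of the tree estimate -/
def CE (d : ℕ) : ℝ := 2 * 2^d * (512 * KK d^2 + 256)

theorem tree_est (f : ℕ → ℂ) :
    ∑ x ∈ t.E, ‖m.T t.S f x‖^2 ≤ CE d * (1/2)^n * ∑ y ∈ cell t.σ t.x0, (t.lft (fun y => ‖f y‖) y)^2 := by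
  by_cases hne : t.E.Nonempty
  swap
  · rw [Finset.not_nonempty_iff_eq_empty.1 hne, Finset.sum_empty, CE]
    positivity
  obtain ⟨x1, hx1⟩ := hne
  set u := fun y => ‖f y‖ with hu
  have hKK := KK_one d
  have hl0 := lft_nonneg (t := t) (u := u) fun y => norm_nonneg _
  set W : ℕ → ℝ := fun y => (4 * KK d * MF (t.lft u) t.σ y + 2 * MF (fun y => ‖t.Ss f t.σ y‖) t.σ y)^2 with hW
  have h1 : ∑ y ∈ t.E ∩ cell t.σ t.x0, W y ≤ 2 * 2^d * (1/2)^n * ∑ y ∈ cell t.σ t.x0, W y := by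
    apply m.dens_leaf (G := G) t.hσ t.hE t.α _ (by norm_num) t.x0
    · intro x hx
      obtain ⟨hα, hαβ, hβ, hos, hH⟩ := t.h2 x hx
      exact (os_mono hαβ _ _).trans hos
    · intro y; positivity
    · intro s y hs hy h1 h2 w hw
      have hV1 : t.V (s+1) y := ⟨hs, hy, h2⟩
      have hV2 : ¬ t.V s y := by
        rintro ⟨_, _, x, hx, h3⟩
        have := h1 x hx; omega
      have e1 : MF (t.lft u) t.σ w = MF (t.lft u) t.σ y := by
        apply MF_const (l := s) _ _ hw
        intro z hz
        rw [lft_leaf hV1 hV2 u hz, lft_leaf hV1 hV2 u (self_mem_cell s y)]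
      have e2 : MF (fun y => ‖t.Ss f t.σ y‖) t.σ w = MF (fun y => ‖t.Ss f t.σ y‖) t.σ y := by
        apply MF_const (l := s) _ _ hw
        intro z hz
        congr 1
        rw [Ss, Ss]
        apply Finset.sum_congr rfl
        intro k hk
        rcases Nat.lt_or_ge s k with h | h
        · exact Dd_congr f h hz
        · have : ∀ z ∈ cell s y, t.Dd f k z = 0 := by
            intro z hz
            rw [Dd, if_neg]
            intro hc
            exact hV2 ((V_congr hz).1 (V_up hc h (by omega)))
          rw [this z hz, this y (self_mem_cell s y)]
      simp only [hW]
      rw [e1, e2]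
    · intro x hx
      obtain ⟨hα, hαβ, hβ, hos, hH⟩ := t.h2 x hx
      exact ⟨by omega, hH⟩
  rw [Finset.inter_eq_left.2 t.hEc] at h1
  have h2 : ∑ x ∈ t.E, ‖m.T t.S f x‖^2 ≤ ∑ x ∈ t.E, W x := by
    apply Finset.sum_le_sum; intro x hx
    exact pow_le_pow_left₀ (norm_nonneg _) (T_le hx f) 2
  refine h2.trans (h1.trans ?_)
  have hV : t.V t.σ t.x0 := by
    have h := t.h2 x1 hx1
    exact (V_congr (t.hEc hx1)).1 (V_of_mem hx1 (by omega) le_rfl)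
  have h3 := doob2 hl0 t.σ t.x0
  have h4 := doob2 (u := fun y => ‖t.Ss f t.σ y‖) (fun y => norm_nonneg _) t.σ t.x0
  have h5 := energy f t.σ t.x0 hV
  have h6 : ∑ y ∈ cell t.σ t.x0, W y ≤ ∑ y ∈ cell t.σ t.x0, (32 * KK d^2 * (MF (t.lft u) t.σ y)^2 + 8 * (MF (fun y => ‖t.Ss f t.σ y‖) t.σ y)^2) := by
    apply Finset.sum_le_sum; intro y _
    simp only [hW]
    nlinarith [sq_nonneg (4 * KK d * MF (t.lft u) t.σ y - 2 * MF (fun y => ‖t.Ss f t.σ y‖) t.σ y)]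
  rw [Finset.sum_add_distrib, ← Finset.mul_sum, ← Finset.mul_sum] at h6
  have h7 : (0:ℝ) ≤ 2^t.σ * (‖cav t.σ (t.phi f) t.x0‖^2 + ‖cav t.σ (fun w => (hh t.σ w : ℂ) * t.phi f w) t.x0‖^2) := by positivity
  have h8 : ∑ y ∈ cell t.σ t.x0, W y ≤ (512 * KK d^2 + 256) * ∑ y ∈ cell t.σ t.x0, (t.lft u y)^2 := by
    have : 32 * KK d^2 * ∑ y ∈ cell t.σ t.x0, (MF (t.lft u) t.σ y)^2 ≤ 32 * KK d^2 * (16 * ∑ y ∈ cell t.σ t.x0, (t.lft u y)^2) := by gcongr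
    linarith
  rw [CE]
  calc _ ≤ 2 * 2^d * (1/2)^n * ((512 * KK d^2 + 256) * ∑ y ∈ cell t.σ t.x0, (t.lft u y)^2) := by gcongr
    _ = _ := by ring

theorem lft_le_MF (u : ℕ → ℝ) {y : ℕ} (hy : t.V t.σ y) : t.lft u y ≤ MF u t.σ y := by
  apply av_le_MF
  have : t.a y ≤ t.σ := Nat.sInf_le hy
  omega

theorem V_top (hne : t.E.Nonempty) {y : ℕ} (hy : y ∈ cell t.σ t.x0) : t.V t.σ y := by
  obtain ⟨x1, hx1⟩ := hne
  have h := t.h2 x1 hx1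
  exact (V_congr hy).2 ((V_congr (t.hEc hx1)).1 (V_of_mem hx1 (by omega) le_rfl))

theorem tree_L2 (f : ℕ → ℂ) :
    ∑ x ∈ t.E, ‖m.T t.S f x‖^2 ≤ 16 * CE d * (1/2)^n * ∑ y ∈ cell t.σ t.x0, ‖f y‖^2 := by
  have hCE : 0 ≤ CE d := by rw [CE]; positivity
  by_cases hne : t.E.Nonempty
  swap
  · rw [Finset.not_nonempty_iff_eq_empty.1 hne, Finset.sum_empty]
    positivity
  refine (tree_est f).trans ?_
  have h1 : ∑ y ∈ cell t.σ t.x0, (t.lft (fun y => ‖f y‖) y)^2 ≤ ∑ y ∈ cell t.σ t.x0, (MF (fun y => ‖f y‖) t.σ y)^2 := by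
    apply Finset.sum_le_sum; intro y hy
    exact pow_le_pow_left₀ (lft_nonneg (fun y => norm_nonneg _) y) (lft_le_MF _ (V_top hne hy)) 2
  have h2 := doob2 (u := fun y => ‖f y‖) (fun y => norm_nonneg _) t.σ t.x0
  calc _ ≤ CE d * (1/2)^n * (16 * ∑ y ∈ cell t.σ t.x0, ‖f y‖^2) := by
        gcongr; exact h1.trans h2
    _ = _ := by ring

/-- L1 bound -/
theorem tree_L1 (f : ℕ → ℂ) {δ : ℝ} (hδ : 0 ≤ δ) (hf : ∀ x ∈ t.E, ∀ s ≤ m.M, av s (fun y => ‖f y‖) x ≤ δ) :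
    ∑ x ∈ t.E, ‖m.T t.S f x‖ ≤ (2 * CE d + 2 * 2^d) * δ * (1/2)^n * 2^t.σ := by
  have hCE : 0 ≤ CE d := by rw [CE]; positivity
  by_cases hne : t.E.Nonempty
  swap
  · rw [Finset.not_nonempty_iff_eq_empty.1 hne, Finset.sum_empty]
    positivity
  rcases hδ.eq_or_lt with h0 | h0
  · -- zero case
    have : ∀ x ∈ t.E, ‖m.T t.S f x‖ = 0 := by
      intro x hx
      obtain ⟨hα, hαβ, hβ, hos, hH⟩ := t.h2 x hx
      have hxO : x ∈ m.Om := m.cell_sub t.hσ t.hx0 (t.hEc hx)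
      rw [norm_eq_zero, Mdl.T]
      apply Finset.sum_eq_zero
      intro s hs
      rw [S, if_pos hx, Finset.mem_Icc] at hs
      have hsM : s ≤ m.M := by have := t.hσ; omega
      rw [← norm_le_zero_iff]
      refine (m.norm_sum_ker_le hsM hxO f).trans ?_
      rw [h0]; exact hf x hx s hsM
    rw [Finset.sum_eq_zero this, ← h0]; simp
  have hl : ∀ y ∈ cell t.σ t.x0, t.lft (fun y => ‖f y‖) y ≤ 2 * δ := by
    intro y hy
    have hm : t.V (t.a y) y := Nat.sInf_mem (s := {s | t.V s y}) ⟨t.σ, V_top hne hy⟩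
    obtain ⟨k, hk⟩ : ∃ k, t.a y = k + 1 := ⟨t.a y - 1, by have := V_two hm; omega⟩
    rw [lft, hk, Nat.add_sub_cancel]
    rw [hk] at hm
    obtain ⟨h1, h2, x, hx, h3⟩ := hm
    rw [Finset.mem_inter] at hx
    have h4 := hf x hx.1 (k+1) (h1.trans t.hσ)
    rw [av_congr _ hx.2, av, div_le_iff₀ (by positivity)] at h4
    rw [av, div_le_iff₀ (by positivity)]
    have h5 : ∑ z ∈ cell k y, ‖f z‖ ≤ ∑ z ∈ cell (k+1) y, ‖f z‖ :=
      Finset.sum_le_sum_of_subset_of_nonneg (cell_mono (by omega)) fun _ _ _ => norm_nonneg _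
    rw [pow_succ] at h4
    linarith
  have h1 : ∑ y ∈ cell t.σ t.x0, (t.lft (fun y => ‖f y‖) y)^2 ≤ 4 * δ^2 * 2^t.σ := by
    calc _ ≤ ∑ y ∈ cell t.σ t.x0, (2*δ)^2 := by
          apply Finset.sum_le_sum; intro y hy
          exact pow_le_pow_left₀ (lft_nonneg (fun y => norm_nonneg _) y) (hl y hy) 2
      _ = _ := by rw [Finset.sum_const, cell_card, nsmul_eq_mul]; push_cast; ring
  have h2 := tree_est f (t := t)
  have h3 := card_E (t := t)
  have h4 : ∀ x ∈ t.E, ‖m.T t.S f x‖ ≤ ‖m.T t.S f x‖^2 / (2*δ) + δ := by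
    intro x _
    have : ‖m.T t.S f x‖^2 / (2*δ) + δ - ‖m.T t.S f x‖ = ((‖m.T t.S f x‖ - δ)^2 + δ^2)/(2*δ) := by field_simp; ring
    have : 0 ≤ ((‖m.T t.S f x‖ - δ)^2 + δ^2)/(2*δ) := by positivity
    linarith
  refine (Finset.sum_le_sum h4).trans ?_
  rw [Finset.sum_add_distrib, ← Finset.sum_div, Finset.sum_const, nsmul_eq_mul]
  have h5 : (∑ x ∈ t.E, ‖m.T t.S f x‖^2) / (2*δ) ≤ 2 * CE d * δ * (1/2)^n * 2^t.σ := by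
    rw [div_le_iff₀ (by positivity)]
    refine h2.trans ?_
    calc _ ≤ CE d * (1/2)^n * (4 * δ^2 * 2^t.σ) := by gcongr
      _ = _ := by ring
  have h6 : (t.E.card : ℝ) * δ ≤ 2 * 2^d * (1/2)^n * 2^t.σ * δ := by gcongr
  linarith

/-- dual L2 bound -/
theorem tree_dual (g : ℕ → ℂ) :
    ∑ y ∈ m.Om, ‖m.Tt t.S g y‖^2 ≤ 16 * CE d * (1/2)^n * ∑ x ∈ t.E, ‖g x‖^2 := by
  have hCE : 0 ≤ CE d := by rw [CE]; positivity
  set f : ℕ → ℂ := fun y => (starRingEnd ℂ) (m.Tt t.S g y) with hf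
  have hEO : t.E ⊆ m.Om := t.hEc.trans (m.cell_sub t.hσ t.hx0)
  set A := ∑ y ∈ m.Om, ‖m.Tt t.S g y‖^2 with hA
  have hA0 : 0 ≤ A := Finset.sum_nonneg fun _ _ => by positivity
  have e1 : (A : ℂ) = ∑ x ∈ t.E, g x * m.T t.S f x := by
    have : ∑ x ∈ t.E, g x * m.T t.S f x = ∑ x ∈ m.Om, g x * m.T t.S f x := by
      apply Finset.sum_subset hEO
      intro x _ hx
      rw [Mdl.T, S, if_neg hx]; simp
    rw [this, m.duality, hA]
    push_cast
    apply Finset.sum_congr rfl; intro y _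
    rw [← Complex.conj_mul']
  have e2 : A ≤ ∑ x ∈ t.E, ‖g x‖ * ‖m.T t.S f x‖ := by
    have : A = ‖(A:ℂ)‖ := by rw [Complex.norm_real, Real.norm_of_nonneg hA0]
    rw [this, e1]
    refine (norm_sum_le _ _).trans (le_of_eq ?_)
    simp only [norm_mul]
  have e3 := Finset.sum_mul_sq_le_sq_mul_sq t.E (fun x => ‖g x‖) (fun x => ‖m.T t.S f x‖)
  have e4 := tree_L2 (t := t) f
  have e5 : ∑ y ∈ cell t.σ t.x0, ‖f y‖^2 ≤ A := by
    rw [hA]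
    simp only [hf, Complex.norm_conj]
    exact Finset.sum_le_sum_of_subset_of_nonneg (m.cell_sub t.hσ t.hx0) fun _ _ _ => by positivity
  have e6 : A^2 ≤ (∑ x ∈ t.E, ‖g x‖^2) * (16 * CE d * (1/2)^n * A) := by
    calc A^2 ≤ (∑ x ∈ t.E, ‖g x‖ * ‖m.T t.S f x‖)^2 := pow_le_pow_left₀ hA0 e2 2
      _ ≤ _ := e3
      _ ≤ _ := by
        apply mul_le_mul_of_nonneg_left _ (Finset.sum_nonneg fun _ _ => by positivity)
        refine e4.trans ?_
        gcongr
  rcases hA0.eq_or_lt with h | h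
  · rw [← h]
    exact mul_nonneg (by positivity) (Finset.sum_nonneg fun _ _ => by positivity)
  · have : A * A ≤ (16 * CE d * (1/2)^n * ∑ x ∈ t.E, ‖g x‖^2) * A := by nlinarith
    exact le_of_mul_le_mul_right this h

end Tree

end

section

namespace Tree
variable {d : ℕ} {C0 κ : ℝ} {m : Mdl d C0 κ} {G : Finset ℕ} {n : ℕ}

/-- restricted size function -/
def gE (t : Tree m G n) (g : ℕ → ℂ) (x : ℕ) : ℝ := if x ∈ t.E then ‖g x‖ else 0

theorem gE_nonneg (t : Tree m G n) (g : ℕ → ℂ) (x : ℕ) : 0 ≤ t.gE g x := by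
  rw [gE]; split_ifs <;> simp

/-- demodulated dual function -/
def A (t : Tree m G n) (g : ℕ → ℂ) (y : ℕ) : ℂ := (starRingEnd ℂ) (ex (m.Q t.x0) y) * m.Tt t.S g y

theorem Tt_eq (t : Tree m G n) (g : ℕ → ℂ) (y : ℕ) : m.Tt t.S g y = ex (m.Q t.x0) y * t.A g y := by
  rw [A, ← mul_assoc, Complex.mul_conj', norm_ex]; simp

theorem norm_A (t : Tree m G n) (g : ℕ → ℂ) (y : ℕ) : ‖t.A g y‖ = ‖m.Tt t.S g y‖ := by
  rw [Tt_eq, norm_mul, norm_ex, one_mul]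

theorem Tt_sum (t : Tree m G n) (g : ℕ → ℂ) (y : ℕ) :
    m.Tt t.S g y = ∑ x ∈ t.E, ∑ s ∈ Finset.Icc (t.α x) (t.β x), m.ker s x y * g x := by
  have hEO : t.E ⊆ m.Om := t.hEc.trans (m.cell_sub t.hσ t.hx0)
  rw [Mdl.Tt, ← Finset.sum_subset hEO]
  · apply Finset.sum_congr rfl; intro x hx
    rw [S, if_pos hx]
  · intro x _ hx
    rw [S, if_neg hx]; simp

theorem Tt_supp (t : Tree m G n) (g : ℕ → ℂ) {y : ℕ} (hy : y ∉ cell t.σ t.x0) : m.Tt t.S g y = 0 := by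
  rw [Tt_sum]
  apply Finset.sum_eq_zero; intro x hx
  apply Finset.sum_eq_zero; intro s hs
  rw [Finset.mem_Icc] at hs
  have h2 := t.h2 x hx
  rw [Mdl.ker, if_neg, zero_mul]
  intro hc
  apply hy
  have := cell_mono (show s ≤ t.σ by omega) hc
  rwa [cell_eq (t.hEc hx)] at this

theorem geom2 (a M k : ℕ) : ∑ s ∈ (Finset.range M).filter (fun s => a + k ≤ s), (1:ℝ)/2^(s-a) ≤ 2 / 2^k := by
  have h1 : ∑ s ∈ (Finset.range M).filter (fun s => a + k ≤ s), (1:ℝ)/2^(s-a) ≤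
      ∑ i ∈ Finset.range M, (1:ℝ)/2^k * (1/2)^i := by
    have : (Finset.range M).filter (fun s => a + k ≤ s) ⊆ (Finset.range M).image (fun i => a + k + i) := by
      intro s hs
      simp only [Finset.mem_filter, Finset.mem_range, Finset.mem_image] at hs ⊢
      exact ⟨s - (a+k), by omega, by omega⟩
    refine (Finset.sum_le_sum_of_subset_of_nonneg this fun _ _ _ => by positivity).trans ?_
    rw [Finset.sum_image (by intro x _ y _ h; simpa using h)]
    apply le_of_eq
    apply Finset.sum_congr rfl; intro i _
    rw [show a + k + i - a = k + i by omega, pow_add, one_div_pow]; field_simp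
  refine h1.trans ?_
  rw [← Finset.mul_sum]
  have := sum_geometric_two_le M
  calc _ ≤ (1:ℝ)/2^k * 2 := by gcongr
    _ = _ := by ring

theorem near (t : Tree m G n) (g : ℕ → ℂ) {j k y0 : ℕ} (hk : 2 ≤ k)
    (hfar : ∀ x ∈ t.E, ∀ s, t.α x ≤ s → s ≤ t.β x → ∀ w ∈ cell j y0, w ∈ cell s x → j + k ≤ s)
    {y z : ℕ} (hy : y ∈ cell j y0) (hz : z ∈ cell j y0) :
    ‖t.A g y - t.A g z‖ ≤ 4 * KK d / 2^k * MF (t.gE g) m.M y := by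
  have hKK := KK_one d
  have hEO : t.E ⊆ m.Om := t.hEc.trans (m.cell_sub t.hσ t.hx0)
  have hterm : ∀ x ∈ t.E, ∀ s ∈ Finset.Icc (t.α x) (t.β x),
      ‖(starRingEnd ℂ) (ex (m.Q t.x0) y) * (m.ker s x y * g x) - (starRingEnd ℂ) (ex (m.Q t.x0) z) * (m.ker s x z * g x)‖ ≤
       if x ∈ cell s y ∧ j + k ≤ s then 2 * KK d * (1/2^(s-j)) * (t.gE g x / 2^s) else 0 := by
    intro x hx s hs
    rw [Finset.mem_Icc] at hs
    obtain ⟨hα, hαβ, hβ, hos, hH⟩ := t.h2 x hx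
    by_cases hyx : y ∈ cell s x
    · have hjk := hfar x hx s hs.1 hs.2 y hy hyx
      have hzy : z ∈ cell j y := by rw [cell_eq hy]; exact hz
      have hzx : z ∈ cell s x := by
        rw [← cell_eq hyx]; exact cell_mono (by omega) hzy
      rw [if_pos ⟨cell_symm hyx, hjk⟩, Mdl.ker, Mdl.ker, if_pos hyx, if_pos hzx, gg_congr (s' := j) (by omega) hzy]
      have e : (starRingEnd ℂ) (ex (m.Q t.x0) y) * (((hh s x * gg s y / 2^s : ℝ) : ℂ) * ex (m.Q x) y * g x) -
          (starRingEnd ℂ) (ex (m.Q t.x0) z) * (((hh s x * gg s y / 2^s : ℝ) : ℂ) * ex (m.Q x) z * g x) =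
          ((hh s x * gg s y / 2^s : ℝ) : ℂ) * g x * (ex (m.Q x - m.Q t.x0) y - ex (m.Q x - m.Q t.x0) z) := by
        rw [ex_sub, ex_sub]; ring
      rw [e, norm_mul, norm_mul, Complex.norm_real, Real.norm_eq_abs, abs_div, abs_mul, abs_hh, abs_gg,
        abs_of_pos (by positivity : (0:ℝ) < 2^s), one_mul, gE, if_pos hx]
      have h1 : ‖ex (m.Q x - m.Q t.x0) y - ex (m.Q x - m.Q t.x0) z‖ ≤ 2 * KK d * (1/2^(s-j)) := by
        refine (ex_diff _ _ _).trans ((os_pt (self_mem_cell j y) hzy _).trans ?_)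
        have h3 := os_contract (m.degs x t.x0) j (s-j) y
        rw [Nat.add_sub_cancel' (by omega : j ≤ s)] at h3
        refine h3.trans ?_
        rw [os_congr hyx]
        have h4 : os s x (m.Q x - m.Q t.x0) ≤ 2 := (os_mono hs.2 _ _).trans hos
        calc _ ≤ KK d / 2^(s-j) * 2 := by gcongr
          _ = _ := by ring
      calc _ ≤ 1/2^s * ‖g x‖ * (2 * KK d * (1/2^(s-j))) := by gcongr
        _ = _ := by ring
    · have hzx : z ∉ cell s x := by
        intro hzx
        have hjk := hfar x hx s hs.1 hs.2 z hz hzx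
        apply hyx
        have : y ∈ cell j z := by rw [cell_eq hz]; exact hy
        rw [← cell_eq hzx]; exact cell_mono (by omega) this
      rw [Mdl.ker, Mdl.ker, if_neg hyx, if_neg hzx]
      simp only [zero_mul, mul_zero, sub_zero, norm_zero]
      have := t.gE_nonneg g x
      split_ifs <;> positivity
  have e : t.A g y - t.A g z = ∑ x ∈ t.E, ∑ s ∈ Finset.Icc (t.α x) (t.β x),
     ((starRingEnd ℂ) (ex (m.Q t.x0) y) * (m.ker s x y * g x) - (starRingEnd ℂ) (ex (m.Q t.x0) z) * (m.ker s x z * g x)) := by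
    rw [A, A, Tt_sum, Tt_sum]
    simp only [Finset.mul_sum, Finset.sum_sub_distrib]
  rw [e]
  calc _ ≤ ∑ x ∈ t.E, ∑ s ∈ Finset.Icc (t.α x) (t.β x),
        (if x ∈ cell s y ∧ j + k ≤ s then 2 * KK d * (1/2^(s-j)) * (t.gE g x / 2^s) else 0) := by
        refine (norm_sum_le _ _).trans (Finset.sum_le_sum fun x hx => ?_)
        exact (norm_sum_le _ _).trans (Finset.sum_le_sum fun s hs => hterm x hx s hs)
    _ ≤ ∑ x ∈ t.E, ∑ s ∈ Finset.range (m.M+1),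
        (if x ∈ cell s y ∧ j + k ≤ s then 2 * KK d * (1/2^(s-j)) * (t.gE g x / 2^s) else 0) := by
        apply Finset.sum_le_sum; intro x hx
        have h2 := t.h2 x hx
        apply Finset.sum_le_sum_of_subset_of_nonneg
        · intro s hs
          rw [Finset.mem_Icc] at hs
          rw [Finset.mem_range]
          have := t.hσ; omega
        · intro s _ _
          have := t.gE_nonneg g x
          split_ifs <;> positivity
    _ = ∑ s ∈ Finset.range (m.M+1), ∑ x ∈ t.E,
        (if x ∈ cell s y ∧ j + k ≤ s then 2 * KK d * (1/2^(s-j)) * (t.gE g x / 2^s) else 0) := Finset.sum_comm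
    _ ≤ ∑ s ∈ Finset.range (m.M+1), if j + k ≤ s then 1/2^(s-j) * (2 * KK d * MF (t.gE g) m.M y) else 0 := by
        apply Finset.sum_le_sum; intro s hs
        rw [Finset.mem_range] at hs
        by_cases hjk : j + k ≤ s
        swap
        · simp [hjk]
        simp only [hjk, and_true, if_true]
        rw [← Finset.sum_filter, ← Finset.mul_sum]
        have h1 : ∑ x ∈ t.E with x ∈ cell s y, t.gE g x / 2^s ≤ av s (t.gE g) y := by
          rw [av, Finset.sum_div]
          apply Finset.sum_le_sum_of_subset_of_nonneg
          · intro x hx; exact (Finset.mem_filter.1 hx).2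
          · intro x _ _
            have := t.gE_nonneg g x
            positivity
        have h2 := h1.trans (av_le_MF (t.gE g) (show s ≤ m.M by omega))
        calc _ ≤ 2 * KK d * (1/2^(s-j)) * MF (t.gE g) m.M y := by gcongr
          _ = _ := by ring
    _ ≤ _ := by
        rw [← Finset.sum_filter, ← Finset.sum_mul]
        have h0 := MF_nonneg (t.gE_nonneg g) m.M y
        calc _ ≤ 2 / 2^k * (2 * KK d * MF (t.gE g) m.M y) := by
              gcongr; exact geom2 j (m.M+1) k
          _ = _ := by ring

/-- majorant -/
def Bm (t : Tree m G n) (g : ℕ → ℂ) (y : ℕ) : ℝ := ‖m.Tt t.S g y‖ + MF (t.gE g) m.M y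

theorem Bm_nonneg (t : Tree m G n) (g : ℕ → ℂ) (y : ℕ) : 0 ≤ t.Bm g y :=
  add_nonneg (norm_nonneg _) (MF_nonneg (t.gE_nonneg g) _ _)

def eps (d : ℕ) (C0 κ : ℝ) (k : ℕ) : ℝ := C0 * ((2:ℝ)^(k-1))^(-κ) + 8 * KK d / 2^k

theorem leaf_pair (t t' : Tree m G n) (g : ℕ → ℂ) {j k y : ℕ} (hk : 2 ≤ k) (hk4 : 4 * KK d ≤ 2^k)
    (hfar : ∀ x ∈ t.E, ∀ s, t.α x ≤ s → s ≤ t.β x → ∀ w ∈ cell j y, w ∈ cell s x → j + k ≤ s)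
    (hfar' : ∀ x ∈ t'.E, ∀ s, t'.α x ≤ s → s ≤ t'.β x → ∀ w ∈ cell j y, w ∈ cell s x → j + k ≤ s)
    (hy : y ∈ m.Om) (hj : m.s0 ≤ j) (hjM : j ≤ m.M) (hos : 2^(k-1) ≤ os j y (m.Q t.x0 - m.Q t'.x0)) :
    ‖∑ w ∈ cell j y, m.Tt t.S g w * (starRingEnd ℂ) (m.Tt t'.S g w)‖ ≤
      eps d C0 κ k * ∑ w ∈ cell j y, t.Bm g w * t'.Bm g w := by
  have hKK := KK_one d
  set e1 := 4 * KK d / 2^k with he1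
  have he1' : e1 ≤ 1 := by rw [he1, div_le_one (by positivity)]; exact hk4
  have he0 : 0 ≤ e1 := by positivity
  have hys := self_mem_cell j y
  set a := t.A g y
  set a' := t'.A g y
  have n1 : ∀ w ∈ cell j y, ‖t.A g w - a‖ ≤ e1 * MF (t.gE g) m.M w := fun w hw => t.near g hk hfar hw hys
  have n2 : ∀ w ∈ cell j y, ‖t'.A g w - a'‖ ≤ e1 * MF (t'.gE g) m.M w := fun w hw => t'.near g hk hfar' hw hys
  have b1 : ∀ w ∈ cell j y, ‖a‖ ≤ t.Bm g w := by
    intro w hw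
    have h1 := n1 w hw
    have h2 : ‖a‖ ≤ ‖t.A g w‖ + ‖t.A g w - a‖ := by
      have := norm_sub_le (t.A g w) (t.A g w - a); simpa using this
    have h0 := MF_nonneg (t.gE_nonneg g) m.M w
    rw [Bm, ← norm_A]
    nlinarith
  have b2 : ∀ w ∈ cell j y, ‖a'‖ ≤ t'.Bm g w := by
    intro w hw
    have h1 := n2 w hw
    have h2 : ‖a'‖ ≤ ‖t'.A g w‖ + ‖t'.A g w - a'‖ := by
      have := norm_sub_le (t'.A g w) (t'.A g w - a'); simpa using this
    have h0 := MF_nonneg (t'.gE_nonneg g) m.M w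
    rw [Bm, ← norm_A]
    nlinarith
  have e : ∑ w ∈ cell j y, m.Tt t.S g w * (starRingEnd ℂ) (m.Tt t'.S g w) =
     (a * (starRingEnd ℂ) a') * ∑ w ∈ cell j y, ex (m.Q t.x0 - m.Q t'.x0) w +
     ∑ w ∈ cell j y, ex (m.Q t.x0 - m.Q t'.x0) w * ((t.A g w - a) * (starRingEnd ℂ) (t'.A g w) +
        a * (starRingEnd ℂ) (t'.A g w - a')) := by
    rw [Finset.mul_sum, ← Finset.sum_add_distrib]
    apply Finset.sum_congr rfl; intro w _
    rw [Tt_eq, Tt_eq, ex_sub, map_mul, map_sub]; ring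
  rw [e]
  refine (norm_add_le _ _).trans ?_
  rw [eps, add_mul]
  apply add_le_add
  · have hyM : y < 2^m.M := by simpa [Mdl.Om] using hy
    have hv := m.vdc t.x0 t'.x0 y j hyM hj hjM (2^(k-1)) (one_le_pow₀ (by norm_num)) hos
    rw [norm_mul, norm_mul, Complex.norm_conj]
    have hs : ‖a‖ * ‖a'‖ * 2^j ≤ ∑ w ∈ cell j y, t.Bm g w * t'.Bm g w := by
      have : ∑ w ∈ cell j y, ‖a‖ * ‖a'‖ = ‖a‖ * ‖a'‖ * 2^j := by
        rw [Finset.sum_const, cell_card, nsmul_eq_mul]; push_cast; ring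
      rw [← this]
      apply Finset.sum_le_sum; intro w hw
      exact mul_le_mul (b1 w hw) (b2 w hw) (norm_nonneg _) (t.Bm_nonneg g w)
    have hC : 0 ≤ C0 * ((2:ℝ)^(k-1))^(-κ) := by
      have h1 : 0 ≤ C0 * 2^j * ((2:ℝ)^(k-1))^(-κ) := (norm_nonneg _).trans hv
      have h2 : (0:ℝ) < 2^j := by positivity
      by_contra hc
      push Not at hc
      nlinarith
    calc _ ≤ ‖a‖ * ‖a'‖ * (C0 * 2^j * ((2:ℝ)^(k-1))^(-κ)) := by gcongr
      _ = (C0 * ((2:ℝ)^(k-1))^(-κ)) * (‖a‖ * ‖a'‖ * 2^j) := by ring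
      _ ≤ _ := by gcongr
  · rw [Finset.mul_sum]
    refine (norm_sum_le _ _).trans (Finset.sum_le_sum fun w hw => ?_)
    rw [norm_mul, norm_ex, one_mul]
    refine (norm_add_le _ _).trans ?_
    rw [norm_mul, norm_mul, Complex.norm_conj, Complex.norm_conj]
    have h1 := n1 w hw
    have h2 := n2 w hw
    have h3 := b1 w hw
    have h0 := MF_nonneg (t.gE_nonneg g) m.M w
    have h0' := MF_nonneg (t'.gE_nonneg g) m.M w
    have hB := t.Bm_nonneg g w
    have hB' := t'.Bm_nonneg g w
    have k1 : ‖t'.A g w‖ ≤ t'.Bm g w := by rw [norm_A, Bm]; linarith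
    have k2 : MF (t.gE g) m.M w ≤ t.Bm g w := by rw [Bm]; linarith [norm_nonneg (m.Tt t.S g w)]
    have k3 : MF (t'.gE g) m.M w ≤ t'.Bm g w := by rw [Bm]; linarith [norm_nonneg (m.Tt t'.S g w)]
    calc _ ≤ (e1 * t.Bm g w) * t'.Bm g w + t.Bm g w * (e1 * t'.Bm g w) := by
          apply add_le_add
          · exact mul_le_mul (h1.trans (by gcongr)) k1 (norm_nonneg _) (by positivity)
          · exact mul_le_mul h3 (h2.trans (by gcongr)) (norm_nonneg _) hB
      _ = _ := by rw [he1]; ring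

theorem sep_pair (hd : 1 ≤ d) (hC0 : 0 ≤ C0) (t t' : Tree m G n) (g : ℕ → ℂ) {k : ℕ} (hk : 2 ≤ k) (hk4 : 4 * KK d ≤ 2^k)
    (hsep : ∀ x ∈ t.E, (KK d * 2^(k*d))^2 < os (t.α x) x (m.Q t.x0 - m.Q t'.x0))
    (hsep' : ∀ x ∈ t'.E, x ∈ cell t.σ t.x0 → t'.α x ≤ t.σ → (KK d * 2^(k*d))^2 < os (t'.α x) x (m.Q t.x0 - m.Q t'.x0)) :
    ‖∑ w ∈ cell t.σ t.x0, m.Tt t.S g w * (starRingEnd ℂ) (m.Tt t'.S g w)‖ ≤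
      eps d C0 κ k * ∑ w ∈ cell t.σ t.x0, t.Bm g w * t'.Bm g w := by
  have hKK := KK_one d
  have heps : 0 ≤ eps d C0 κ k := by rw [eps]; positivity
  by_cases hne : t.E.Nonempty
  swap
  · have : ∀ y, m.Tt t.S g y = 0 := by
      intro y
      rw [Tt_sum, Finset.not_nonempty_iff_eq_empty.1 hne, Finset.sum_empty]
    simp only [this, zero_mul, Finset.sum_const_zero, norm_zero]
    exact mul_nonneg heps (Finset.sum_nonneg fun w _ => mul_nonneg (t.Bm_nonneg g w) (t'.Bm_nonneg g w))
  obtain ⟨x1, hx1⟩ := hne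
  set P := m.Q t.x0 - m.Q t'.x0 with hP
  have hPd : P.natDegree ≤ d := m.degs _ _
  set r := KK d * 2^(k*d) with hr
  have hr1 : 1 ≤ r := by
    have : (1:ℝ) ≤ 2^(k*d) := one_le_pow₀ (by norm_num)
    nlinarith
  have hrr : r ≤ r^2 := by nlinarith
  have htop : ∀ w ∈ cell t.σ t.x0, r^2 < os t.σ w P := by
    intro w hw
    have h2 := t.h2 x1 hx1
    have h3 := (hsep x1 hx1).trans_le (os_mono (show t.α x1 ≤ t.σ by omega) _ _)
    rw [os_congr (t.hEc hx1)] at h3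
    rwa [os_congr hw]
  have main : ∀ s ≤ t.σ, ∀ y ∈ cell t.σ t.x0, r < os s y P →
     ‖∑ w ∈ cell s y, m.Tt t.S g w * (starRingEnd ℂ) (m.Tt t'.S g w)‖ ≤
      eps d C0 κ k * ∑ w ∈ cell s y, t.Bm g w * t'.Bm g w := by
    intro s
    induction s with
    | zero =>
      intro _ y hy hos
      exfalso
      have h1 : os 0 y P ≤ os m.s0 y P := os_mono (Nat.zero_le _) _ _
      have h2 := m.small t.x0 t'.x0 y (by simpa [Mdl.Om] using m.cell_sub t.hσ t.hx0 hy)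
      linarith
    | succ j ih =>
      intro hj y hy hos
      have key : ∀ z ∈ cell (j+1) y, ‖∑ w ∈ cell j z, m.Tt t.S g w * (starRingEnd ℂ) (m.Tt t'.S g w)‖ ≤
          eps d C0 κ k * ∑ w ∈ cell j z, t.Bm g w * t'.Bm g w := by
        intro z hz
        have hzt : z ∈ cell t.σ t.x0 := by
          rw [← cell_eq hy]; exact cell_mono hj hz
        by_cases hlt : r < os j z P
        · exact ih (by omega) z hzt hlt
        push Not at hlt
        have hzO := m.cell_sub t.hσ t.hx0 hzt
        -- scales with large oscillation are far
        have hscale : ∀ s, ∀ w ∈ cell j z, r^2 < os s w P → j + k ≤ s := by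
          intro s w hw hs
          rw [← os_congr hw] at hlt
          by_contra hc
          push Not at hc
          rcases Nat.lt_or_ge s j with h | h
          · have := os_mono h.le w P; linarith
          obtain ⟨i, rfl⟩ := Nat.exists_eq_add_of_le h
          have h1 := os_double hPd j i w
          have h2 : KK d * (2^i)^d ≤ r := by
            rw [hr, ← pow_mul]
            gcongr
            · norm_num
            · omega
          have : os (j+i) w P ≤ r * r := h1.trans (mul_le_mul h2 hlt (os_nonneg _ _ _) (by linarith))
          nlinarith
        have hjk : j + k ≤ t.σ := hscale _ z (self_mem_cell _ _) (htop z hzt)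
        have hwt : ∀ w ∈ cell j z, w ∈ cell t.σ t.x0 := by
          intro w hw
          rw [← cell_eq hzt]; exact cell_mono (by omega) hw
        apply leaf_pair t t' g hk hk4 _ _ hzO
        · by_contra hc
          push Not at hc
          have h1 := m.small t.x0 t'.x0 z (by simpa [Mdl.Om] using hzO)
          have h2 : os (j+1) z P ≤ os m.s0 z P := os_mono hc _ _
          rw [os_congr hz] at h2
          linarith
        · have := t.hσ; omega
        · have h1 := os_double hPd j 1 z
          rw [os_congr hz] at h1
          have h2 : KK d * 2^(k*d) < KK d * (2^1)^d * os j z P := hos.trans_le h1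
          rw [mul_assoc, mul_lt_mul_iff_right₀ (by linarith), pow_one] at h2
          have h3 : (2:ℝ)^(k*d) = 2^d * 2^((k-1)*d) := by
            rw [← pow_add]; congr 1
            obtain ⟨k', rfl⟩ : ∃ k', k = k' + 1 := ⟨k-1, by omega⟩
            simp; ring
          rw [h3, mul_lt_mul_iff_right₀ (by positivity)] at h2
          refine le_trans ?_ h2.le
          exact pow_le_pow_right₀ (by norm_num) (Nat.le_mul_of_pos_right _ hd)
        · intro x hx s hs1 hs2 w hw hwx
          apply hscale s w hw
          rw [os_congr hwx]
          exact (hsep x hx).trans_le (os_mono hs1 _ _)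
        · intro x hx s hs1 hs2 w hw hwx
          rcases Nat.lt_or_ge t.σ s with h | h
          · omega
          apply hscale s w hw
          rw [os_congr hwx]
          refine (hsep' x hx ?_ (hs1.trans h)).trans_le (os_mono hs1 _ _)
          rw [← cell_eq (hwt w hw)]
          exact cell_mono h (cell_symm hwx)
      rw [sum_cell_succ, sum_cell_succ, mul_add]
      exact (norm_add_le _ _).trans (add_le_add (key _ (lc_mem j y)) (key _ (rc_mem j y)))
  apply main t.σ le_rfl t.x0 (self_mem_cell _ _)
  exact hrr.trans_lt (htop _ (self_mem_cell _ _))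

theorem Bm_sq (t : Tree m G n) (g : ℕ → ℂ) :
    ∑ y ∈ m.Om, (t.Bm g y)^2 ≤ (32 * CE d + 32) * ∑ x ∈ t.E, ‖g x‖^2 := by
  have hCE : 0 ≤ CE d := by rw [CE]; positivity
  have hEO : t.E ⊆ m.Om := t.hEc.trans (m.cell_sub t.hσ t.hx0)
  have h1 := tree_dual (t := t) g
  have h2 : ∑ y ∈ m.Om, (MF (t.gE g) m.M y)^2 ≤ 16 * ∑ x ∈ t.E, ‖g x‖^2 := by
    have h3 := doob2 (t.gE_nonneg g) m.M 0
    rw [cell_top (by positivity)] at h3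
    refine h3.trans (le_of_eq ?_)
    congr 1
    have : ∑ x ∈ t.E, ‖g x‖^2 = ∑ x ∈ t.E, (t.gE g x)^2 := by
      apply Finset.sum_congr rfl; intro x hx; rw [gE, if_pos hx]
    rw [this, Finset.sum_subset hEO]
    · rfl
    · intro x _ hx; rw [gE, if_neg hx]; simp
  have h3 : ∑ y ∈ m.Om, (t.Bm g y)^2 ≤ ∑ y ∈ m.Om, (2 * ‖m.Tt t.S g y‖^2 + 2 * (MF (t.gE g) m.M y)^2) := by
    apply Finset.sum_le_sum; intro y _
    rw [Bm]; nlinarith [sq_nonneg (‖m.Tt t.S g y‖ - MF (t.gE g) m.M y)]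
  rw [Finset.sum_add_distrib, ← Finset.mul_sum, ← Finset.mul_sum] at h3
  have h4 : (1/2:ℝ)^n ≤ 1 := pow_le_one₀ (by norm_num) (by norm_num)
  have h5 : 16 * CE d * (1/2)^n * ∑ x ∈ t.E, ‖g x‖^2 ≤ 16 * CE d * 1 * ∑ x ∈ t.E, ‖g x‖^2 := by gcongr
  linarith

/-- a separated forest -/
theorem forest_dual (hd : 1 ≤ d) (hC0 : 0 ≤ C0) {ι : Type} [DecidableEq ι] (Vs : Finset ι) (t : ι → Tree m G n) (g : ℕ → ℂ)
    (hg : ∀ x, ‖g x‖ ≤ 1) {k : ℕ} (hk : 2 ≤ k) (hk4 : 4 * KK d ≤ 2^k)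
    (hdisj : ∀ v ∈ Vs, ∀ v' ∈ Vs, v ≠ v' → Disjoint (t v).E (t v').E)
    (hsep : ∀ v ∈ Vs, ∀ v' ∈ Vs, v ≠ v' → ∀ x ∈ (t v).E, x ∈ cell (t v').σ (t v').x0 → (t v).α x ≤ (t v').σ →
       (KK d * 2^(k*d))^2 < os ((t v).α x) x (m.Q (t v).x0 - m.Q (t v').x0))
    {N : ℝ} (hN : ∀ y, ((Vs.filter fun v => y ∈ cell (t v).σ (t v).x0).card : ℝ) ≤ N) :
    ∑ y ∈ m.Om, ‖∑ v ∈ Vs, m.Tt (t v).S g y‖^2 ≤ (16 * CE d * (1/2)^n + eps d C0 κ k * N * (32 * CE d + 32)) * G.card := by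
  have hCE : 0 ≤ CE d := by rw [CE]; positivity
  have hKK := KK_one d
  have heps : 0 ≤ eps d C0 κ k := by rw [eps]; positivity
  have hN0 : 0 ≤ N := le_trans (by positivity) (hN 0)
  set X := fun v y => m.Tt (t v).S g y with hX
  have hGs : ∑ v ∈ Vs, ∑ x ∈ (t v).E, ‖g x‖^2 ≤ G.card := by
    rw [← Finset.sum_biUnion]
    · calc _ ≤ ∑ x ∈ Vs.biUnion fun v => (t v).E, (1:ℝ) := by
            apply Finset.sum_le_sum; intro x _
            exact pow_le_one₀ (norm_nonneg _) (hg x)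
        _ = ((Vs.biUnion fun v => (t v).E).card : ℝ) := by simp
        _ ≤ _ := by
            have : (Vs.biUnion fun v => (t v).E) ⊆ G := by
              intro x hx
              obtain ⟨v, _, hx⟩ := Finset.mem_biUnion.1 hx
              exact (t v).hE hx
            exact_mod_cast Finset.card_le_card this
    · intro v hv v' hv' hne
      exact hdisj v hv v' hv' hne
  -- pairing bound
  have hpair : ∀ v ∈ Vs, ∀ v' ∈ Vs, v ≠ v' → ‖∑ y ∈ m.Om, X v y * (starRingEnd ℂ) (X v' y)‖ ≤
      eps d C0 κ k * ∑ y ∈ m.Om, (if y ∈ cell (t v).σ (t v).x0 then (t v).Bm g y else 0) *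
        (if y ∈ cell (t v').σ (t v').x0 then (t v').Bm g y else 0) := by
    have key : ∀ v ∈ Vs, ∀ v' ∈ Vs, v ≠ v' → (t v).σ ≤ (t v').σ → ‖∑ y ∈ m.Om, X v y * (starRingEnd ℂ) (X v' y)‖ ≤
      eps d C0 κ k * ∑ y ∈ m.Om, (if y ∈ cell (t v).σ (t v).x0 then (t v).Bm g y else 0) *
        (if y ∈ cell (t v').σ (t v').x0 then (t v').Bm g y else 0) := by
      intro v hv v' hv' hne hle
      have hnn : 0 ≤ ∑ y ∈ m.Om, (if y ∈ cell (t v).σ (t v).x0 then (t v).Bm g y else 0) *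
        (if y ∈ cell (t v').σ (t v').x0 then (t v').Bm g y else 0) := by
        apply Finset.sum_nonneg; intro y _
        apply mul_nonneg <;> split_ifs <;> first | exact le_rfl | exact Bm_nonneg _ g y
      by_cases hin : (t v).x0 ∈ cell (t v').σ (t v').x0
      · have hsub : cell (t v).σ (t v).x0 ⊆ cell (t v').σ (t v').x0 := by
          rw [← cell_eq hin]; exact cell_mono hle
        have e1 : ∑ y ∈ m.Om, X v y * (starRingEnd ℂ) (X v' y) = ∑ y ∈ cell (t v).σ (t v).x0, X v y * (starRingEnd ℂ) (X v' y) := by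
          symm
          apply Finset.sum_subset (m.cell_sub (t v).hσ (t v).hx0)
          intro y _ hy
          simp only [hX]; rw [Tt_supp _ g hy, zero_mul]
        have e2 : ∑ y ∈ m.Om, (if y ∈ cell (t v).σ (t v).x0 then (t v).Bm g y else 0) *
          (if y ∈ cell (t v').σ (t v').x0 then (t v').Bm g y else 0) = ∑ y ∈ cell (t v).σ (t v).x0, (t v).Bm g y * (t v').Bm g y := by
          symm
          rw [← Finset.sum_subset (m.cell_sub (t v).hσ (t v).hx0)]
          · apply Finset.sum_congr rfl; intro y hy
            rw [if_pos hy, if_pos (hsub hy)]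
          · intro y _ hy; rw [if_neg hy, zero_mul]
        rw [e1, e2]
        apply sep_pair hd hC0 (t v) (t v') g hk hk4
        · intro x hx
          have h2 := (t v).h2 x hx
          exact hsep v hv v' hv' hne x hx (hsub ((t v).hEc hx)) (by omega)
        · intro x hx hxc hα
          rw [os_comm]
          exact hsep v' hv' v hv hne.symm x hx hxc hα
      · rw [Finset.sum_eq_zero, norm_zero]
        · exact mul_nonneg heps hnn
        · intro y _
          simp only [hX]
          by_cases hy : y ∈ cell (t v).σ (t v).x0
          · rw [Tt_supp (t v'), map_zero, mul_zero]
            intro hy'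
            apply hin
            have := cell_mono hle (cell_symm hy)
            rwa [cell_eq hy'] at this
          · rw [Tt_supp _ g hy, zero_mul]
    intro v hv v' hv' hne
    rcases le_total (t v).σ (t v').σ with h | h
    · exact key v hv v' hv' hne h
    · have := key v' hv' v hv hne.symm h
      have e1 : ‖∑ y ∈ m.Om, X v y * (starRingEnd ℂ) (X v' y)‖ = ‖∑ y ∈ m.Om, X v' y * (starRingEnd ℂ) (X v y)‖ := by
        rw [← Complex.norm_conj, map_sum]
        congr 1
        apply Finset.sum_congr rfl; intro y _
        rw [map_mul, Complex.conj_conj, mul_comm]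
      rw [e1]
      refine this.trans (le_of_eq ?_)
      congr 1
      apply Finset.sum_congr rfl; intro y _
      rw [mul_comm]
  have e0 : ((∑ y ∈ m.Om, ‖∑ v ∈ Vs, X v y‖^2 : ℝ) : ℂ) = ∑ v ∈ Vs, ∑ v' ∈ Vs, ∑ y ∈ m.Om, X v y * (starRingEnd ℂ) (X v' y) := by
    push_cast
    have : ∀ y ∈ m.Om, ((‖∑ v ∈ Vs, X v y‖ : ℂ)^2) = ∑ v ∈ Vs, ∑ v' ∈ Vs, X v y * (starRingEnd ℂ) (X v' y) := by
      intro y _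
      rw [← Complex.mul_conj', map_sum, Finset.sum_mul_sum]
    rw [Finset.sum_congr rfl this, Finset.sum_comm]
    apply Finset.sum_congr rfl; intro v _
    rw [Finset.sum_comm]
  have e3 : ∑ y ∈ m.Om, ‖∑ v ∈ Vs, X v y‖^2 = ‖((∑ y ∈ m.Om, ‖∑ v ∈ Vs, X v y‖^2 : ℝ) : ℂ)‖ := by
    rw [Complex.norm_real, Real.norm_of_nonneg (Finset.sum_nonneg fun _ _ => by positivity)]
  rw [show ∑ y ∈ m.Om, ‖∑ v ∈ Vs, m.Tt (t v).S g y‖^2 = ∑ y ∈ m.Om, ‖∑ v ∈ Vs, X v y‖^2 from rfl, e3, e0]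
  set b : ι → ℕ → ℝ := fun v y => if y ∈ cell (t v).σ (t v).x0 then (t v).Bm g y else 0 with hb
  have hb0 : ∀ v y, 0 ≤ b v y := by
    intro v y; simp only [hb]; split_ifs; exacts [Bm_nonneg _ g y, le_rfl]
  calc _ ≤ ∑ v ∈ Vs, ∑ v' ∈ Vs, ((if v = v' then ∑ y ∈ m.Om, ‖X v y‖^2 else 0) + eps d C0 κ k * ∑ y ∈ m.Om, b v y * b v' y) := by
        refine (norm_sum_le _ _).trans (Finset.sum_le_sum fun v hv => ?_)
        refine (norm_sum_le _ _).trans (Finset.sum_le_sum fun v' hv' => ?_)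
        by_cases hvv : v = v'
        · subst hvv
          rw [if_pos rfl]
          have h1 : ‖∑ y ∈ m.Om, X v y * (starRingEnd ℂ) (X v y)‖ ≤ ∑ y ∈ m.Om, ‖X v y‖^2 := by
            refine (norm_sum_le _ _).trans (le_of_eq ?_)
            apply Finset.sum_congr rfl; intro y _
            rw [norm_mul, Complex.norm_conj, sq]
          have h2 : 0 ≤ eps d C0 κ k * ∑ y ∈ m.Om, b v y * b v y :=
            mul_nonneg heps (Finset.sum_nonneg fun y _ => mul_nonneg (hb0 _ _) (hb0 _ _))
          linarith
        · rw [if_neg hvv, zero_add]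
          exact hpair v hv v' hv' hvv
    _ = ∑ v ∈ Vs, ∑ y ∈ m.Om, ‖X v y‖^2 + eps d C0 κ k * ∑ y ∈ m.Om, (∑ v ∈ Vs, b v y)^2 := by
        simp only [Finset.sum_add_distrib, Finset.sum_ite_eq]
        congr 1
        · apply Finset.sum_congr rfl; intro v hv; rw [if_pos hv]
        · simp only [← Finset.mul_sum]
          congr 1
          simp only [sq, Finset.sum_mul_sum]
          conv_rhs => rw [Finset.sum_comm]
          apply Finset.sum_congr rfl; intro v _
          rw [Finset.sum_comm]
    _ ≤ ∑ v ∈ Vs, 16 * CE d * (1/2)^n * ∑ x ∈ (t v).E, ‖g x‖^2 + eps d C0 κ k * (N * ((32 * CE d + 32) * G.card)) := by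
        apply add_le_add
        · exact Finset.sum_le_sum fun v _ => tree_dual (t := t v) g
        · apply mul_le_mul_of_nonneg_left _ heps
          have h1 : ∀ y ∈ m.Om, (∑ v ∈ Vs, b v y)^2 ≤ N * ∑ v ∈ Vs, ((t v).Bm g y)^2 := by
            intro y _
            have e : ∑ v ∈ Vs, b v y = ∑ v ∈ Vs.filter (fun v => y ∈ cell (t v).σ (t v).x0), (t v).Bm g y := by
              rw [Finset.sum_filter]
            rw [e]
            refine (sq_sum_le_card_mul_sum_sq).trans ?_
            apply mul_le_mul (hN y) _ (Finset.sum_nonneg fun _ _ => by positivity) hN0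
            exact Finset.sum_le_sum_of_subset_of_nonneg (Finset.filter_subset _ _) fun _ _ _ => by positivity
          refine (Finset.sum_le_sum h1).trans ?_
          rw [← Finset.mul_sum, Finset.sum_comm]
          apply mul_le_mul_of_nonneg_left _ hN0
          refine (Finset.sum_le_sum fun v _ => (t v).Bm_sq g).trans ?_
          rw [← Finset.mul_sum]
          gcongr
    _ ≤ _ := by
        rw [← Finset.mul_sum]
        have : 16 * CE d * (1/2)^n * ∑ v ∈ Vs, ∑ x ∈ (t v).E, ‖g x‖^2 ≤ 16 * CE d * (1/2)^n * G.card := by gcongr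
        nlinarith

end Tree

end

section

namespace Mdl
variable {d : ℕ} {C0 κ : ℝ} (m : Mdl d C0 κ)

/-- order relation between tiles -/
def Rel (v v' : ℕ × ℕ) : Prop := v.1 ≤ v'.1 ∧ v.2 ∈ cell v'.1 v'.2 ∧ os v.1 v.2 (m.Q v.2 - m.Q v'.2) ≤ 2

theorem Rel_refl (v : ℕ × ℕ) : m.Rel v v := ⟨le_rfl, self_mem_cell _ _, by rw [os_self]; norm_num⟩

theorem greedy (A : Finset (ℕ × ℕ)) : ∃ S ⊆ A, (∀ v ∈ S, ∀ v' ∈ S, m.Rel v v' → v = v') ∧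
    ∀ a ∈ A, ∃ v ∈ S, m.Rel a v := by
  classical
  induction A using Finset.induction_on_min_value (fun v : ℕ × ℕ => v.1) with
  | empty => exact ⟨∅, by simp, by simp, by simp⟩
  | insert a s ha hmin ih =>
    obtain ⟨S, hS, h1, h2⟩ := ih
    by_cases hex : ∃ v ∈ S, m.Rel a v
    · refine ⟨S, hS.trans (Finset.subset_insert _ _), h1, ?_⟩
      intro b hb
      rcases Finset.mem_insert.1 hb with rfl | hb
      · exact hex
      · exact h2 b hb
    · push Not at hex
      refine ⟨insert a S, Finset.insert_subset_insert _ hS, ?_, ?_⟩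
      · intro v hv v' hv' hr
        rcases Finset.mem_insert.1 hv with rfl | hvS
        · rcases Finset.mem_insert.1 hv' with rfl | hv'
          · rfl
          · exact absurd hr (hex _ hv')
        · rcases Finset.mem_insert.1 hv' with rfl | hv'
          · exfalso
            apply hex v hvS
            obtain ⟨r1, r2, r3⟩ := hr
            have e : v.1 = v'.1 := le_antisymm r1 (hmin v (hS hvS))
            refine ⟨e.ge, ?_, ?_⟩
            · rw [e]; exact cell_symm r2
            · rw [os_comm, ← os_congr r2]; rwa [e] at r3
          · exact h1 v hvS v' hv' hr
      · intro b hb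
        rcases Finset.mem_insert.1 hb with rfl | hb
        · exact ⟨b, Finset.mem_insert_self _ _, m.Rel_refl b⟩
        · obtain ⟨v, hv, hr⟩ := h2 b hb
          exact ⟨v, Finset.mem_insert_of_mem hv, hr⟩

variable {G : Finset ℕ}

theorem pigeon {s x : ℕ} (z : ℕ) {lam : ℝ} (hl : 1 ≤ lam) {c : ℝ} (hc : 0 ≤ c)
    (h : lam^d * c < ((m.Es G s x (m.Q z) lam).card : ℝ)) :
    ∃ w ∈ m.Es G s x (m.Q z) lam, c / KK d ≤ ((m.Es G s w (m.Q w) 1).card : ℝ) := by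
  classical
  have hK := KK_one d
  obtain ⟨key, S, hS, h1, h2⟩ := os_key (d := d) s x (m.deg z) hl
  set E := m.Es G s x (m.Q z) lam with hE
  have hmap : ∀ w ∈ E, key (m.Q w) ∈ S := by
    intro w hw
    rw [hE, Es, Finset.mem_filter] at hw
    exact h1 _ (m.deg w) hw.2
  have hlam : 0 < lam^d := by positivity
  have hSpos : 0 < S.card := by
    have : 0 < E.card := by
      have : (0:ℝ) < E.card := lt_of_le_of_lt (by positivity) h
      exact_mod_cast this
    obtain ⟨w, hw⟩ := Finset.card_pos.1 this
    exact Finset.card_pos.2 ⟨_, hmap w hw⟩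
  obtain ⟨k, hk, hcard⟩ := Finset.exists_le_card_fiber_of_nsmul_le_card_of_maps_to (b := c / KK d) hmap
    (Finset.card_pos.1 hSpos) (by
      rw [nsmul_eq_mul]
      have : (S.card:ℝ) * (c / KK d) ≤ KK d * lam^d * (c / KK d) := by gcongr
      have e : KK d * lam^d * (c / KK d) = lam^d * c := by field_simp
      linarith)
  rcases (E.filter fun w => key (m.Q w) = k).eq_empty_or_nonempty with he | ⟨w, hw⟩
  · rw [he] at hcard
    have hEp : 0 < E.card := by
      have : (0:ℝ) < E.card := lt_of_le_of_lt (by positivity) h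
      exact_mod_cast this
    obtain ⟨w, hw⟩ := Finset.card_pos.1 hEp
    refine ⟨w, hw, hcard.trans ?_⟩
    simp
  · refine ⟨w, (Finset.mem_filter.1 hw).1, hcard.trans ?_⟩
    norm_cast
    apply Finset.card_le_card
    intro y hy
    rw [Finset.mem_filter] at hy hw
    have hw1 := hw.1; have hy1 := hy.1
    rw [hE, Es, Finset.mem_filter, Finset.mem_inter] at hw1 hy1
    rw [Es, Finset.mem_filter, Finset.mem_inter, cell_eq hw1.1.2, os_congr hw1.1.2]
    exact ⟨hy1.1, h2 _ _ (m.deg _) (m.deg _) (by rw [hy.2, hw.2])⟩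

/-- selected dense tiles -/
theorem dense_tiles (hd : 1 ≤ d) (n : ℕ) : ∃ Ms : Finset (ℕ × ℕ),
    (∀ v ∈ Ms, v.1 ≤ m.M ∧ v.2 ∈ G) ∧
    (∑ v ∈ Ms, (2:ℝ)^v.1 ≤ 2 * KK d * 2^n * G.card) ∧
    (∀ s x, m.H G (n+1) s x → ∃ v ∈ Ms, s ≤ v.1 ∧ x ∈ cell v.1 v.2 ∧ os s x (m.Q x - m.Q v.2) ≤ 2^(n+3)) := by
  classical
  have hK := KK_one d
  set c : ℝ := (1/2)^(n+1) / KK d with hc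
  have hc0 : 0 < c := by positivity
  obtain ⟨Ms, hsub, hind, hdom⟩ := m.greedy (((Finset.range (m.M+1)) ×ˢ G).filter fun v =>
    c * 2^v.1 ≤ ((m.Es G v.1 v.2 (m.Q v.2) 1).card : ℝ))
  have hmem : ∀ v ∈ Ms, v.1 ≤ m.M ∧ v.2 ∈ G ∧ c * 2^v.1 ≤ ((m.Es G v.1 v.2 (m.Q v.2) 1).card : ℝ) := by
    intro v hv
    have := hsub hv
    rw [Finset.mem_filter, Finset.mem_product, Finset.mem_range] at this
    exact ⟨by omega, this.1.2, this.2⟩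
  refine ⟨Ms, fun v hv => ⟨(hmem v hv).1, (hmem v hv).2.1⟩, ?_, ?_⟩
  · have hdisj : (Ms : Set (ℕ × ℕ)).PairwiseDisjoint fun v => m.Es G v.1 v.2 (m.Q v.2) 1 := by
      have key : ∀ v ∈ Ms, ∀ v' ∈ Ms, v.1 ≤ v'.1 → ∀ y, y ∈ m.Es G v.1 v.2 (m.Q v.2) 1 →
          y ∈ m.Es G v'.1 v'.2 (m.Q v'.2) 1 → v = v' := by
        intro v hv v' hv' hle y hy hy'
        rw [Es, Finset.mem_filter, Finset.mem_inter] at hy hy'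
        apply hind v hv v' hv'
        have hvc : v.2 ∈ cell v'.1 v'.2 := by
          rw [← cell_eq hy'.1.2]
          exact cell_mono hle (cell_symm hy.1.2)
        refine ⟨hle, hvc, ?_⟩
        have h1 := os_tri v.1 v.2 (m.Q v.2) (m.Q y) (m.Q v'.2)
        have h2 : os v.1 v.2 (m.Q y - m.Q v'.2) ≤ 1 := by
          refine (os_mono hle _ _).trans ?_
          rw [os_congr hvc]; exact hy'.2
        have h3 := hy.2
        rw [os_comm] at h3
        linarith
      intro v hv v' hv' hne
      rw [Function.onFun, Finset.disjoint_left]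
      intro y hy hy'
      apply hne
      rcases le_total v.1 v'.1 with h | h
      · exact key v hv v' hv' h y hy hy'
      · exact (key v' hv' v hv h y hy' hy).symm
    have h1 : ∑ v ∈ Ms, ((m.Es G v.1 v.2 (m.Q v.2) 1).card : ℝ) ≤ G.card := by
      rw [← Nat.cast_sum, ← Finset.card_biUnion hdisj]
      norm_cast
      apply Finset.card_le_card
      rw [Finset.biUnion_subset]
      intro v _
      exact (Finset.filter_subset _ _).trans Finset.inter_subset_left
    have h2 : c * ∑ v ∈ Ms, (2:ℝ)^v.1 ≤ G.card := by
      rw [Finset.mul_sum]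
      exact (Finset.sum_le_sum fun v hv => (hmem v hv).2.2).trans h1
    have e : 2 * KK d * 2^n = 1 / c := by
      rw [hc, one_div_div, one_div, inv_pow, pow_succ]; field_simp
    rw [e, one_div_mul_eq_div, le_div_iff₀ hc0]; linarith
  · rintro s x ⟨s', hss, hsM, lam, hl, z, hz, hcard⟩
    rw [mul_assoc] at hcard
    have hlam : lam ≤ 2^(n+1) := by
      have h1 := m.Es_card_le (G := G) s' x (m.Q z) lam
      have h2 : lam ≤ lam^d := le_self_pow₀ hl (by omega)
      have h3 : lam^d * ((1/2)^(n+1) * 2^s') < 2^s' := lt_of_lt_of_le hcard h1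
      have h4 : (0:ℝ) < 2^s' := by positivity
      have h5 : lam^d * (1/2)^(n+1) < 1 := by
        by_contra hcon
        push Not at hcon
        nlinarith
      have e : (1/2:ℝ)^(n+1) * 2^(n+1) = 1 := by rw [← mul_pow]; norm_num
      have : lam^d * ((1/2)^(n+1) * 2^(n+1)) < 1 * 2^(n+1) := by
        rw [← mul_assoc]; gcongr
      rw [e] at this
      linarith
    obtain ⟨w, hw, hwc⟩ := m.pigeon z hl (by positivity) hcard
    rw [Es, Finset.mem_filter, Finset.mem_inter] at hw
    obtain ⟨v, hv, r1, r2, r3⟩ := hdom (s', w) (by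
      rw [Finset.mem_filter, Finset.mem_product, Finset.mem_range]
      refine ⟨⟨by simp only; omega, hw.1.1⟩, ?_⟩
      have e : c * 2^s' = (1/2)^(n+1) * 2^s' / KK d := by rw [hc]; ring
      simp only; rw [e]; exact hwc)
    simp only at r1 r2 r3
    refine ⟨v, hv, hss.trans r1, ?_, ?_⟩
    · rw [← cell_eq r2]
      exact cell_mono r1 (cell_symm hw.1.2)
    · have t1 := os_tri s x (m.Q x) (m.Q z) (m.Q v.2)
      have t2 := os_tri s x (m.Q z) (m.Q w) (m.Q v.2)
      have t3 : os s x (m.Q z - m.Q w) ≤ lam := by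
        refine (os_mono hss _ _).trans ?_
        rw [os_comm]; exact hw.2
      have t4 : os s x (m.Q w - m.Q v.2) ≤ 2 := by
        refine (os_mono hss _ _).trans ?_
        rw [← os_congr hw.1.2]; exact r3
      rw [os_comm] at hz
      have e : (2:ℝ)^(n+3) = 4 * 2^(n+1) := by ring
      have : (1:ℝ) ≤ 2^(n+1) := one_le_pow₀ (by norm_num)
      rw [e]; linarith
end Mdl

end

section

/-- data for the decomposition of density level `n` -/
structure Lay {d : ℕ} {C0 κ : ℝ} (m : Mdl d C0 κ) (G : Finset ℕ) (n : ℕ) where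
  G' : Finset ℕ
  hG : G ⊆ m.Om
  hG' : G' ⊆ G
  Ms : Finset (ℕ × ℕ)
  hMs : ∀ v ∈ Ms, v.1 ≤ m.M ∧ v.2 ∈ G
  W : ℝ
  hW : ∑ v ∈ Ms, (2:ℝ)^v.1 ≤ W
  hH : ∀ s x, m.H G (n+1) s x → ∃ v ∈ Ms, s ≤ v.1 ∧ x ∈ cell v.1 v.2 ∧ os s x (m.Q x - m.Q v.2) ≤ 2^(n+3)
  MN : ℝ
  hMN : ∀ x ∈ G', ((Ms.filter fun v => x ∈ cell v.1 v.2).card : ℝ) ≤ MN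

namespace Lay
open Classical
variable {d : ℕ} {C0 κ : ℝ} {m : Mdl d C0 κ} {G : Finset ℕ} {n : ℕ} (l : Lay m G n)

/-- all scales of density level n -/
def Sn (x : ℕ) : Finset ℕ := if x ∈ l.G' then
  (Finset.Icc (m.s0+2) m.M).filter fun s => m.H G (n+1) s x ∧ ¬ m.H G n s x else ∅

theorem mem_Sn {s x : ℕ} : s ∈ l.Sn x ↔ x ∈ l.G' ∧ m.s0 + 2 ≤ s ∧ s ≤ m.M ∧ m.H G (n+1) s x ∧ ¬ m.H G n s x := by
  rw [Sn]; split_ifs with h <;> simp [h, and_assoc]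

def b (s x : ℕ) : Finset (ℕ × ℕ) := l.Ms.filter fun v => s ≤ v.1 ∧ x ∈ cell v.1 v.2 ∧ os s x (m.Q x - m.Q v.2) ≤ 1

theorem mem_b {s x : ℕ} {v : ℕ × ℕ} : v ∈ l.b s x ↔ v ∈ l.Ms ∧ s ≤ v.1 ∧ x ∈ cell v.1 v.2 ∧ os s x (m.Q x - m.Q v.2) ≤ 1 := by
  rw [b, Finset.mem_filter]

theorem b_anti {s t x : ℕ} (h : s ≤ t) : l.b t x ⊆ l.b s x := by
  intro v hv
  rw [mem_b] at *
  exact ⟨hv.1, h.trans hv.2.1, hv.2.2.1, (os_mono h _ _).trans hv.2.2.2⟩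

theorem b_card {s x : ℕ} (hx : x ∈ l.G') : ((l.b s x).card : ℝ) ≤ l.MN := by
  refine le_trans ?_ (l.hMN x hx)
  norm_cast
  apply Finset.card_le_card
  intro v hv
  rw [mem_b] at hv
  rw [Finset.mem_filter]
  exact ⟨hv.1, hv.2.2.1⟩

def L0 (x : ℕ) : Finset ℕ := (l.Sn x).filter fun s => l.b s x = ∅
def C (j x : ℕ) : Finset ℕ := (l.Sn x).filter fun s => l.b s x ≠ ∅ ∧ Nat.log 2 (l.b s x).card = j
def Cs (L j x : ℕ) : Finset ℕ := (l.C j x).filter fun s => ∃ t ∈ l.C j x, t + L ≤ s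

theorem mem_C {j s x : ℕ} : s ∈ l.C j x ↔ s ∈ l.Sn x ∧ 2^j ≤ (l.b s x).card ∧ (l.b s x).card < 2^(j+1) := by
  rw [C, Finset.mem_filter]
  constructor
  · rintro ⟨h1, h2, h3⟩
    have : (l.b s x).card ≠ 0 := by rw [Ne, Finset.card_eq_zero]; exact h2
    exact ⟨h1, (Nat.log_eq_iff (Or.inr ⟨by norm_num, this⟩)).1 h3⟩
  · rintro ⟨h1, h2⟩
    have : (l.b s x).card ≠ 0 := by
      have : 0 < 2^j := by positivity
      omega
    exact ⟨h1, by rwa [Ne, ← Finset.card_eq_zero], (Nat.log_eq_iff (Or.inr ⟨by norm_num, this⟩)).2 h2⟩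

theorem mem_Cs {L j s x : ℕ} : s ∈ l.Cs L j x ↔ s ∈ l.C j x ∧ ∃ t ∈ l.C j x, t + L ≤ s := by
  rw [Cs, Finset.mem_filter]

theorem os_contr {s t x L : ℕ} (h : t + L ≤ s) (y z : ℕ) {c B : ℝ} (hB : os s x (m.Q y - m.Q z) ≤ B) (hc : KK d * B ≤ c * 2^L) :
    os t x (m.Q y - m.Q z) ≤ c := by
  obtain ⟨k, rfl⟩ := Nat.exists_eq_add_of_le h
  have h1 := os_contract (m.degs y z) t (L+k) x
  rw [← add_assoc] at h1
  have hK := KK_one d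
  refine h1.trans ?_
  rw [div_mul_eq_mul_div, div_le_iff₀ (by positivity)]
  have h0 := os_nonneg (t+L+k) x (m.Q y - m.Q z)
  have h2 : KK d * os (t+L+k) x (m.Q y - m.Q z) ≤ c * 2^L := le_trans (by gcongr) hc
  have h3 : 0 ≤ c * 2^L := le_trans (by positivity) h2
  have h4 : (1:ℝ) ≤ 2^k := one_le_pow₀ (by norm_num)
  rw [pow_add, ← mul_assoc]
  nlinarith

theorem L0_card {k : ℕ} (hk : KK d * 2^(n+3) ≤ 2^k) (x : ℕ) : (l.L0 x).card ≤ k := by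
  rcases (l.L0 x).eq_empty_or_nonempty with h | hne
  · rw [h]; simp
  set t := (l.L0 x).max' hne with ht
  have htm : t ∈ l.L0 x := Finset.max'_mem _ _
  rw [L0, Finset.mem_filter, mem_Sn] at htm
  obtain ⟨v, hv, h1, h2, h3⟩ := l.hH t x htm.1.2.2.2.1
  have hsub : l.L0 x ⊆ Finset.Ioc (t - k) t := by
    intro s hs
    have hst : s ≤ t := Finset.le_max' _ _ hs
    rw [Finset.mem_Ioc]
    refine ⟨?_, hst⟩
    by_contra hc
    push Not at hc
    rw [L0, Finset.mem_filter, mem_Sn] at hs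
    have hpos : 2 ≤ s := by omega
    have : v ∈ l.b s x := by
      rw [mem_b]
      refine ⟨hv, hst.trans h1, h2, ?_⟩
      exact os_contr (L := k) (by omega) x v.2 h3 (by linarith)
    rw [hs.2] at this
    simp at this
  refine (Finset.card_le_card hsub).trans ?_
  rw [Nat.card_Ioc]; omega

theorem Cd_card (L j x : ℕ) : (l.C j x \ l.Cs L j x).card ≤ L := by
  rcases (l.C j x).eq_empty_or_nonempty with h | hne
  · rw [h]; simp
  set t := (l.C j x).min' hne with ht
  have htm : t ∈ l.C j x := Finset.min'_mem _ _
  have hsub : l.C j x \ l.Cs L j x ⊆ Finset.Ico t (t + L) := by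
    intro s hs
    rw [Finset.mem_sdiff, mem_Cs] at hs
    rw [Finset.mem_Ico]
    refine ⟨Finset.min'_le _ _ hs.1, ?_⟩
    by_contra hc
    push Not at hc
    exact hs.2 ⟨hs.1, t, htm, hc⟩
  refine (Finset.card_le_card hsub).trans ?_
  rw [Nat.card_Ico]; omega

theorem Cs_conv {L j x s1 s s2 : ℕ} (h1 : s1 ∈ l.Cs L j x) (h2 : s2 ∈ l.Cs L j x) (ha : s1 ≤ s) (hb : s ≤ s2) :
    s ∈ l.Cs L j x := by
  rw [mem_Cs, mem_C, mem_Sn] at *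
  obtain ⟨⟨⟨a1, a2, a3, a4, a5⟩, a6, a7⟩, t, ht, htL⟩ := h1
  obtain ⟨⟨⟨b1, b2, b3, b4, b5⟩, b6, b7⟩, _⟩ := h2
  refine ⟨⟨⟨a1, by omega, by omega, m.H_down hb b4, fun h => a5 (m.H_down ha h)⟩, ?_, ?_⟩, t, ht, by omega⟩
  · exact b6.trans (Finset.card_le_card (l.b_anti hb))
  · exact lt_of_le_of_lt (Finset.card_le_card (l.b_anti ha)) a7

/-- candidates for tops -/
def A (j : ℕ) : Finset (ℕ × ℕ) := ((Finset.range (m.M+1)) ×ˢ l.G').filter fun v => v.1 ∈ l.C j v.2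

theorem mem_A {j : ℕ} {v : ℕ × ℕ} : v ∈ l.A j ↔ v.1 ∈ l.C j v.2 := by
  rw [A, Finset.mem_filter, Finset.mem_product, Finset.mem_range]
  refine ⟨fun h => h.2, fun h => ⟨?_, h⟩⟩
  have := (l.mem_C.1 h).1
  rw [mem_Sn] at this
  exact ⟨by omega, this.1⟩

/-- tops -/
def V (j : ℕ) : Finset (ℕ × ℕ) := (m.greedy (l.A j)).choose

theorem V_sub {j : ℕ} {v : ℕ × ℕ} (h : v ∈ l.V j) : v.1 ∈ l.C j v.2 :=
  l.mem_A.1 ((m.greedy (l.A j)).choose_spec.1 h)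
theorem V_ind {j : ℕ} : ∀ v ∈ l.V j, ∀ v' ∈ l.V j, m.Rel v v' → v = v' := (m.greedy (l.A j)).choose_spec.2.1
theorem V_dom {j s x : ℕ} (h : s ∈ l.C j x) : ∃ v ∈ l.V j, m.Rel (s, x) v :=
  (m.greedy (l.A j)).choose_spec.2.2 (s, x) (l.mem_A.2 h)

theorem V_G {j : ℕ} {v : ℕ × ℕ} (h : v ∈ l.V j) : v.2 ∈ l.G' ∧ v.1 ≤ m.M := by
  have := (l.mem_C.1 (l.V_sub h)).1
  rw [mem_Sn] at this
  exact ⟨this.1, this.2.2.1⟩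

/-- the B sets of two tops over a common point are disjoint -/
theorem b_disj {j y : ℕ} {v v' : ℕ × ℕ} (hv : v ∈ l.V j) (hv' : v' ∈ l.V j) (hy : y ∈ cell v.1 v.2) (hy' : y ∈ cell v'.1 v'.2)
    (hne : v ≠ v') : Disjoint (l.b v.1 v.2) (l.b v'.1 v'.2) := by
  have key : ∀ v ∈ l.V j, ∀ v' ∈ l.V j, y ∈ cell v.1 v.2 → y ∈ cell v'.1 v'.2 → v.1 ≤ v'.1 →
      ∀ w, w ∈ l.b v.1 v.2 → w ∈ l.b v'.1 v'.2 → v = v' := by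
    intro v hv v' hv' hy hy' hle w hw hw'
    rw [mem_b] at hw hw'
    apply l.V_ind v hv v' hv'
    have hc : v.2 ∈ cell v'.1 v'.2 := by
      rw [← cell_eq hy']; exact cell_mono hle (cell_symm hy)
    refine ⟨hle, hc, ?_⟩
    have h1 := os_tri v.1 v.2 (m.Q v.2) (m.Q w.2) (m.Q v'.2)
    have h2 : os v.1 v.2 (m.Q w.2 - m.Q v'.2) ≤ 1 := by
      refine (os_mono hle _ _).trans ?_
      rw [os_congr hc, os_comm]; exact hw'.2.2.2
    linarith [hw.2.2.2]
  rw [Finset.disjoint_left]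
  intro w hw hw'
  rcases le_total v.1 v'.1 with h | h
  · exact hne (key v hv v' hv' hy hy' h w hw hw')
  · exact hne (key v' hv' v hv hy' hy h w hw' hw).symm

/-- Fefferman's trick -/
theorem trick {L j s x : ℕ} {R0 : ℝ} (hR : KK d * (R0 + 1) ≤ 2^L) (hs : s ∈ l.Cs L j x) {v v' : ℕ × ℕ}
    (hv : v ∈ l.V j) (hv' : v' ∈ l.V j) (h1 : s ≤ v.1) (h1' : s ≤ v'.1) (h2 : x ∈ cell v.1 v.2) (h2' : x ∈ cell v'.1 v'.2)
    (h3 : os s x (m.Q x - m.Q v.2) ≤ R0) (h3' : os s x (m.Q x - m.Q v'.2) ≤ R0) : v = v' := by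
  by_contra hne
  obtain ⟨hsC, t, ht, htL⟩ := l.mem_Cs.1 hs
  have hsub : ∀ v ∈ l.V j, s ≤ v.1 → x ∈ cell v.1 v.2 → os s x (m.Q x - m.Q v.2) ≤ R0 → l.b v.1 v.2 ⊆ l.b t x := by
    intro v hv h1 h2 h3 w hw
    rw [mem_b] at *
    have hxw : x ∈ cell w.1 w.2 := by rw [← cell_eq hw.2.2.1]; exact cell_mono hw.2.1 h2
    refine ⟨hw.1, by omega, hxw, ?_⟩
    apply os_contr htL (B := R0 + 1)
    · have t1 := os_tri s x (m.Q x) (m.Q v.2) (m.Q w.2)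
      have t2 : os s x (m.Q v.2 - m.Q w.2) ≤ 1 := by
        refine (os_mono h1 _ _).trans ?_
        rw [os_congr h2]; exact hw.2.2.2
      linarith
    · linarith
  have hd := l.b_disj hv hv' h2 h2' hne
  have hu : (l.b v.1 v.2 ∪ l.b v'.1 v'.2).card ≤ (l.b t x).card :=
    Finset.card_le_card (Finset.union_subset (hsub v hv h1 h2 h3) (hsub v' hv' h1' h2' h3'))
  rw [Finset.card_union_of_disjoint hd] at hu
  have c1 := (l.mem_C.1 (l.V_sub hv)).2.1
  have c2 := (l.mem_C.1 (l.V_sub hv')).2.1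
  have c3 := (l.mem_C.1 ht).2.2
  rw [pow_succ] at c3
  omega

theorem count {j y : ℕ} : ((l.V j).filter fun v => y ∈ cell v.1 v.2).card ≤ (l.Ms.filter fun v => y ∈ cell v.1 v.2).card := by
  have h1 : ((l.V j).filter fun v => y ∈ cell v.1 v.2).card ≤ (((l.V j).filter fun v => y ∈ cell v.1 v.2).biUnion fun v => l.b v.1 v.2).card := by
    rw [Finset.card_biUnion]
    · rw [Finset.card_eq_sum_ones]
      apply Finset.sum_le_sum
      intro v hv
      have := (l.mem_C.1 (l.V_sub (Finset.mem_filter.1 hv).1)).2.1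
      have : 0 < 2^j := by positivity
      omega
    · intro v hv v' hv' hne
      rw [Finset.mem_coe, Finset.mem_filter] at hv hv'
      exact l.b_disj hv.1 hv'.1 hv.2 hv'.2 hne
  refine h1.trans (Finset.card_le_card ?_)
  rw [Finset.biUnion_subset]
  intro v hv w hw
  rw [Finset.mem_filter] at *
  rw [mem_b] at hw
  exact ⟨hw.1, by rw [← cell_eq hw.2.2.1]; exact cell_mono hw.2.1 hv.2⟩

theorem hN (hMN0 : 0 ≤ l.MN) {j : ℕ} (y : ℕ) : (((l.V j).filter fun v => y ∈ cell v.1 v.2).card : ℝ) ≤ l.MN := by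
  rcases ((l.V j).filter fun v => y ∈ cell v.1 v.2).eq_empty_or_nonempty with h | hne
  · rw [h]; simpa using hMN0
  obtain ⟨v0, hv0, hmin⟩ := Finset.exists_min_image _ (fun v : ℕ × ℕ => v.1) hne
  rw [Finset.mem_filter] at hv0
  refine le_trans ?_ (l.hMN v0.2 (l.V_G hv0.1).1)
  refine le_trans ?_ (Nat.cast_le.2 (l.count (j := j)))
  norm_cast
  apply Finset.card_le_card
  intro v hv
  have := hmin v hv
  rw [Finset.mem_filter] at *
  exact ⟨hv.1, by rw [← cell_eq hv.2]; exact cell_mono this (cell_symm hv0.2)⟩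

theorem sum_cells (A : Finset (ℕ × ℕ)) (hA : ∀ v ∈ A, v.1 ≤ m.M ∧ v.2 ∈ m.Om) :
    ∑ v ∈ A, 2^v.1 = ∑ y ∈ m.Om, (A.filter fun v => y ∈ cell v.1 v.2).card := by
  have : ∀ v ∈ A, 2^v.1 = (m.Om.filter fun y => y ∈ cell v.1 v.2).card := by
    intro v hv
    rw [← cell_card v.1 v.2]
    congr 1
    ext y
    rw [Finset.mem_filter]
    exact ⟨fun h => ⟨m.cell_sub (hA v hv).1 (hA v hv).2 h, h⟩, fun h => h.2⟩
  rw [Finset.sum_congr rfl this]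
  exact Finset.sum_card_bipartiteAbove_eq_sum_card_bipartiteBelow (fun v y => y ∈ cell (v:ℕ × ℕ).1 v.2)

theorem V_sum {j : ℕ} : ∑ v ∈ l.V j, (2:ℝ)^v.1 ≤ l.W := by
  refine le_trans ?_ l.hW
  have h1 := sum_cells (m := m) (l.V j) (fun v hv => ⟨(l.V_G hv).2, l.hG (l.hG' (l.V_G hv).1)⟩)
  have h2 := sum_cells (m := m) l.Ms (fun v hv => ⟨(l.hMs v hv).1, l.hG (l.hMs v hv).2⟩)
  have h3 : ∑ v ∈ l.V j, 2^v.1 ≤ ∑ v ∈ l.Ms, 2^v.1 := by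
    rw [h1, h2]
    exact Finset.sum_le_sum fun y _ => l.count
  exact_mod_cast h3

end Lay

end

section

namespace Mdl
variable {d : ℕ} {C0 κ : ℝ} (m : Mdl d C0 κ)

/-- from the dual estimate to an L1 bound -/
theorem dual_bound (S : ℕ → Finset ℕ) {G' : Finset ℕ} (hG : G' ⊆ m.Om) {A : ℝ}
    (hA : ∀ g : ℕ → ℂ, (∀ x, ‖g x‖ ≤ 1) → (∀ x, x ∉ G' → g x = 0) → ∑ y ∈ m.Om, ‖m.Tt S g y‖^2 ≤ A) (f : ℕ → ℂ) :
    ∑ x ∈ G', ‖m.T S f x‖ ≤ √(∑ y ∈ m.Om, ‖f y‖^2) * √A := by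
  classical
  set g : ℕ → ℂ := fun x => if x ∈ G' then (starRingEnd ℂ) (m.T S f x) / ‖m.T S f x‖ else 0 with hg
  have hgT : ∀ x ∈ G', g x * m.T S f x = (‖m.T S f x‖ : ℂ) := by
    intro x hx
    rw [hg]; simp only [if_pos hx]
    by_cases h0 : m.T S f x = 0
    · rw [h0]; simp
    · have : (‖m.T S f x‖ : ℂ) ≠ 0 := by simpa using h0
      rw [div_mul_eq_mul_div, div_eq_iff this, mul_comm, Complex.mul_conj']
      ring
  have h1 : ((∑ x ∈ G', ‖m.T S f x‖ : ℝ) : ℂ) = ∑ y ∈ m.Om, f y * m.Tt S g y := by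
    rw [← m.duality, ← Finset.sum_subset hG]
    · push_cast
      exact Finset.sum_congr rfl fun x hx => (hgT x hx).symm
    · intro x _ hx; rw [hg]; simp [hx]
  have h2 : ∑ x ∈ G', ‖m.T S f x‖ ≤ ∑ y ∈ m.Om, ‖f y‖ * ‖m.Tt S g y‖ := by
    have h0 : 0 ≤ ∑ x ∈ G', ‖m.T S f x‖ := Finset.sum_nonneg fun _ _ => norm_nonneg _
    have := congrArg norm h1
    rw [Complex.norm_real, Real.norm_of_nonneg h0] at this
    rw [this]
    refine (norm_sum_le _ _).trans (le_of_eq ?_)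
    simp
  refine h2.trans ((Real.sum_mul_le_sqrt_mul_sqrt _ _ _).trans ?_)
  gcongr
  apply hA g
  · intro x
    rw [hg]; simp only
    split_ifs
    · rw [norm_div, Complex.norm_conj, Complex.norm_real, norm_norm]
      exact div_self_le_one _
    · simp
  · intro x hx; rw [hg]; simp [hx]

theorem T_union {S S1 S2 : ℕ → Finset ℕ} {x : ℕ} (h : S x = S1 x ∪ S2 x) (hd : Disjoint (S1 x) (S2 x)) (f : ℕ → ℂ) :
    m.T S f x = m.T S1 f x + m.T S2 f x := by
  rw [T, h, Finset.sum_union hd]; rfl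
end Mdl

namespace Lay
open Classical
variable {d : ℕ} {C0 κ : ℝ} {m : Mdl d C0 κ} {G : Finset ℕ} {n : ℕ} (l : Lay m G n)

/-- chosen top -/
def top (L j x : ℕ) : ℕ × ℕ := if h : (l.Cs L j x).Nonempty then
  (l.V_dom (l.mem_Cs.1 (Finset.max'_mem _ h)).1).choose else (0, 0)

theorem top_mem {L j x : ℕ} (h : (l.Cs L j x).Nonempty) : l.top L j x ∈ l.V j := by
  rw [top, dif_pos h]
  exact (l.V_dom (l.mem_Cs.1 (Finset.max'_mem _ h)).1).choose_spec.1

theorem top_rel {L j x : ℕ} (h : (l.Cs L j x).Nonempty) : m.Rel ((l.Cs L j x).max' h, x) (l.top L j x) := by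
  rw [top, dif_pos h]
  exact (l.V_dom (l.mem_Cs.1 (Finset.max'_mem _ h)).1).choose_spec.2

def al (L j x : ℕ) : ℕ := if h : (l.Cs L j x).Nonempty then (l.Cs L j x).min' h else 0
def be (L j x : ℕ) : ℕ := if h : (l.Cs L j x).Nonempty then (l.Cs L j x).max' h else 0

theorem Cs_eq {L j x : ℕ} (h : (l.Cs L j x).Nonempty) : l.Cs L j x = Finset.Icc (l.al L j x) (l.be L j x) := by
  rw [al, be, dif_pos h, dif_pos h]
  ext s
  rw [Finset.mem_Icc]
  exact ⟨fun hs => ⟨Finset.min'_le _ _ hs, Finset.le_max' _ _ hs⟩,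
    fun hs => l.Cs_conv (Finset.min'_mem _ h) (Finset.max'_mem _ h) hs.1 hs.2⟩

theorem al_mem {L j x : ℕ} (h : (l.Cs L j x).Nonempty) : l.al L j x ∈ l.Cs L j x := by
  rw [al, dif_pos h]; exact Finset.min'_mem _ h
theorem be_mem {L j x : ℕ} (h : (l.Cs L j x).Nonempty) : l.be L j x ∈ l.Cs L j x := by
  rw [be, dif_pos h]; exact Finset.max'_mem _ h
theorem al_le_be {L j x : ℕ} (h : (l.Cs L j x).Nonempty) : l.al L j x ≤ l.be L j x := by
  have := l.be_mem h
  rw [l.Cs_eq h, Finset.mem_Icc] at this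
  exact this.1

theorem Cs_G {L j x : ℕ} (h : (l.Cs L j x).Nonempty) : x ∈ l.G' := by
  obtain ⟨s, hs⟩ := h
  exact (l.mem_Sn.1 (l.mem_C.1 (l.mem_Cs.1 hs).1).1).1

def E (L j : ℕ) (v : ℕ × ℕ) : Finset ℕ := l.G'.filter fun x => (l.Cs L j x).Nonempty ∧ l.top L j x = v

theorem mem_E {L j x : ℕ} {v : ℕ × ℕ} : x ∈ l.E L j v ↔ (l.Cs L j x).Nonempty ∧ l.top L j x = v := by
  rw [E, Finset.mem_filter]
  exact ⟨fun h => h.2, fun h => ⟨l.Cs_G h.1, h⟩⟩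

def tr (L j : ℕ) (v : {v // v ∈ l.V j}) : Tree m G n where
  σ := v.1.1
  x0 := v.1.2
  hσ := (l.V_G v.2).2
  hx0 := l.hG (l.hG' (l.V_G v.2).1)
  E := l.E L j v.1
  hE := (Finset.filter_subset _ _).trans l.hG'
  hEc := by
    intro x hx
    rw [mem_E] at hx
    rw [← hx.2]
    exact (l.top_rel hx.1).2.1
  α := l.al L j
  β := l.be L j
  h2 := by
    intro x hx
    rw [mem_E] at hx
    have ha := l.mem_Sn.1 (l.mem_C.1 (l.mem_Cs.1 (l.al_mem hx.1)).1).1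
    have hr := l.top_rel hx.1
    rw [← hx.2]
    have e : l.be L j x = (l.Cs L j x).max' hx.1 := by rw [be, dif_pos hx.1]
    refine ⟨ha.2.1, l.al_le_be hx.1, ?_, ?_, ha.2.2.2.2⟩
    · rw [e]; exact hr.1
    · rw [e]; exact hr.2.2

theorem Cs_tr {L j x : ℕ} (v : {v // v ∈ l.V j}) (hx : x ∈ l.E L j v.1) : l.Cs L j x = (l.tr L j v).S x := by
  rw [Tree.S, if_pos (show x ∈ (l.tr L j v).E from hx)]
  exact l.Cs_eq (l.mem_E.1 hx).1

theorem Tt_forest (L j : ℕ) (g : ℕ → ℂ) (y : ℕ) :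
    m.Tt (l.Cs L j) g y = ∑ v ∈ (l.V j).attach, m.Tt (l.tr L j v).S g y := by
  simp only [Mdl.Tt]
  rw [Finset.sum_comm]
  apply Finset.sum_congr rfl
  intro x hx
  by_cases h : (l.Cs L j x).Nonempty
  · have hv := l.top_mem h
    rw [Finset.sum_eq_single_of_mem (⟨l.top L j x, hv⟩ : {v // v ∈ l.V j}) (Finset.mem_attach _ _)]
    · rw [l.Cs_tr ⟨l.top L j x, hv⟩ (l.mem_E.2 ⟨h, rfl⟩)]
    · intro v _ hne
      rw [Tree.S, if_neg, Finset.sum_empty]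
      intro hc
      have := l.mem_E.1 (show x ∈ l.E L j v.1 from hc)
      exact hne (Subtype.ext this.2.symm)
  · rw [Finset.not_nonempty_iff_eq_empty.1 h, Finset.sum_empty]
    symm
    apply Finset.sum_eq_zero
    intro v _
    rw [Tree.S, if_neg, Finset.sum_empty]
    intro hc
    exact h (l.mem_E.1 (show x ∈ l.E L j v.1 from hc)).1

theorem forest_L2 (hd : 1 ≤ d) (hC0 : 0 ≤ C0) (hMN0 : 0 ≤ l.MN) {L k : ℕ} (hk : 2 ≤ k) (hk4 : 4 * KK d ≤ 2^k)
    (hL : KK d * ((KK d * 2^(k*d))^2 + 3) ≤ 2^L) (j : ℕ) (f : ℕ → ℂ) :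
    ∑ x ∈ l.G', ‖m.T (l.Cs L j) f x‖ ≤ √(∑ y ∈ m.Om, ‖f y‖^2) *
      √((16 * Tree.CE d * (1/2)^n + Tree.eps d C0 κ k * l.MN * (32 * Tree.CE d + 32)) * G.card) := by
  apply m.dual_bound _ (l.hG'.trans l.hG)
  intro g hg _
  simp only [l.Tt_forest]
  refine Tree.forest_dual hd hC0 (l.V j).attach (l.tr L j) g hg hk hk4 ?_ ?_ ?_
  · intro v _ v' _ hne
    rw [Finset.disjoint_left]
    intro x hx hx'
    have h1 := l.mem_E.1 (show x ∈ l.E L j v.1 from hx)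
    have h2 := l.mem_E.1 (show x ∈ l.E L j v'.1 from hx')
    exact hne (Subtype.ext (h1.2.symm.trans h2.2))
  · intro v _ v' _ hne x hx hx' hα
    by_contra hc
    push Not at hc
    have h1 := l.mem_E.1 (show x ∈ l.E L j v.1 from hx)
    obtain ⟨g1, g2, g3, g4, g5⟩ := (l.tr L j v).h2 x hx
    have g6 : os ((l.tr L j v).α x) x (m.Q x - m.Q v.1.2) ≤ 2 := (os_mono g2 _ _).trans g4
    have t1 := os_tri ((l.tr L j v).α x) x (m.Q x) (m.Q v.1.2) (m.Q v'.1.2)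
    have hc' : os ((l.tr L j v).α x) x (m.Q v.1.2 - m.Q v'.1.2) ≤ (KK d * 2^(k*d))^2 := hc
    apply hne
    apply Subtype.ext
    refine l.trick (R0 := (KK d * 2^(k*d))^2 + 2) (by convert hL using 2; ring) (l.al_mem h1.1) v.2 v'.2
      (g2.trans g3) hα ((l.tr L j v).hEc hx) hx' ?_ ?_
    · refine g6.trans ?_
      nlinarith [sq_nonneg (KK d * 2^(k*d))]
    · refine t1.trans ?_
      linarith
  · intro y
    refine le_trans ?_ (l.hN hMN0 (j := j) y)
    norm_cast
    apply Finset.card_le_card_of_injOn Subtype.val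
    · intro v hv
      rw [Finset.mem_coe, Finset.mem_filter] at *
      exact ⟨v.2, hv.2⟩
    · exact fun a _ b _ h => Subtype.ext h

theorem forest_L1 (L j : ℕ) (f : ℕ → ℂ) {δ : ℝ} (hδ : 0 ≤ δ) (hf : ∀ x ∈ l.G', ∀ s ≤ m.M, av s (fun y => ‖f y‖) x ≤ δ) :
    ∑ x ∈ l.G', ‖m.T (l.Cs L j) f x‖ ≤ (2 * Tree.CE d + 2 * 2^d) * δ * (1/2)^n * l.W := by
  have hCE : 0 ≤ Tree.CE d := by rw [Tree.CE]; positivity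
  have h1 : ∑ x ∈ l.G', ‖m.T (l.Cs L j) f x‖ ≤ ∑ v ∈ (l.V j).attach, ∑ x ∈ (l.tr L j v).E, ‖m.T (l.tr L j v).S f x‖ := by
    have e : ∑ v ∈ (l.V j).attach, ∑ x ∈ (l.tr L j v).E, ‖m.T (l.tr L j v).S f x‖ =
        ∑ v ∈ (l.V j).attach, ∑ x ∈ l.G', if x ∈ l.E L j v.1 then ‖m.T (l.Cs L j) f x‖ else 0 := by
      apply Finset.sum_congr rfl
      intro v _
      rw [← Finset.sum_filter]
      have : l.G'.filter (fun x => x ∈ l.E L j v.1) = (l.tr L j v).E := by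
        ext x
        rw [Finset.mem_filter]
        exact ⟨fun h => h.2, fun h => ⟨l.Cs_G (l.mem_E.1 h).1, h⟩⟩
      rw [this]
      apply Finset.sum_congr rfl
      intro x hx
      rw [Mdl.T, Mdl.T, l.Cs_tr v hx]
    rw [e, Finset.sum_comm]
    apply Finset.sum_le_sum
    intro x hx
    by_cases h : (l.Cs L j x).Nonempty
    · have hv := l.top_mem h
      have := Finset.single_le_sum (f := fun v : {v // v ∈ l.V j} => if x ∈ l.E L j v.1 then ‖m.T (l.Cs L j) f x‖ else 0)
        (s := (l.V j).attach) (fun v _ => by split_ifs <;> positivity) (Finset.mem_attach _ (⟨l.top L j x, hv⟩ : {v // v ∈ l.V j}))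
      simp only at this
      rwa [if_pos (l.mem_E.2 ⟨h, rfl⟩)] at this
    · rw [Mdl.T, Finset.not_nonempty_iff_eq_empty.1 h, Finset.sum_empty, norm_zero]
      exact Finset.sum_nonneg fun v _ => by split_ifs <;> positivity
  refine h1.trans ?_
  calc _ ≤ ∑ v ∈ (l.V j).attach, (2 * Tree.CE d + 2 * 2^d) * δ * (1/2)^n * 2^v.1.1 := by
        apply Finset.sum_le_sum
        intro v _
        apply Tree.tree_L1 f hδ
        intro x hx
        exact hf x (l.Cs_G (l.mem_E.1 (show x ∈ l.E L j v.1 from hx)).1)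
    _ = (2 * Tree.CE d + 2 * 2^d) * δ * (1/2)^n * ∑ v ∈ l.V j, (2:ℝ)^v.1 := by
        rw [← Finset.mul_sum, Finset.sum_attach (l.V j) (fun v => (2:ℝ)^v.1)]
    _ ≤ _ := by
        gcongr
        exact l.V_sum

/-- the short part -/
def Sh (L J x : ℕ) : Finset ℕ := l.L0 x ∪ (Finset.range J).biUnion fun j => l.C j x \ l.Cs L j x

theorem Sh_sub (L J x : ℕ) : l.Sh L J x ⊆ l.Sn x := by
  rw [Sh]
  apply Finset.union_subset (Finset.filter_subset _ _)
  rw [Finset.biUnion_subset]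
  intro j _
  exact Finset.sdiff_subset.trans (Finset.filter_subset _ _)

theorem Sh_card {L J k : ℕ} (hk : KK d * 2^(n+3) ≤ 2^k) (x : ℕ) : (l.Sh L J x).card ≤ k + J * L := by
  rw [Sh]
  refine (Finset.card_union_le _ _).trans ?_
  apply add_le_add (l.L0_card hk x)
  refine Finset.card_biUnion_le.trans ?_
  refine (Finset.sum_le_sum fun j _ => l.Cd_card L j x).trans ?_
  simp

theorem Sn_split {L J x : ℕ} (hJ : l.MN < 2^J) (f : ℕ → ℂ) (hx : x ∈ l.G') :
    m.T l.Sn f x = m.T (l.Sh L J) f x + ∑ j ∈ Finset.range J, m.T (l.Cs L j) f x := by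
  have e : l.Sn x = l.Sh L J x ∪ (Finset.range J).biUnion fun j => l.Cs L j x := by
    ext s
    simp only [Sh, Finset.mem_union, Finset.mem_biUnion, Finset.mem_range, Finset.mem_sdiff, L0, Finset.mem_filter]
    constructor
    · intro hs
      by_cases hb : l.b s x = ∅
      · exact Or.inl (Or.inl ⟨hs, hb⟩)
      · set j := Nat.log 2 (l.b s x).card with hj
        have hsC : s ∈ l.C j x := by
          rw [C, Finset.mem_filter]; exact ⟨hs, hb, rfl⟩
        have hjJ : j < J := by
          have h1 : ((2:ℝ)^j) ≤ (l.b s x).card := by exact_mod_cast (l.mem_C.1 hsC).2.1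
          have h2 : (2:ℝ)^j < 2^J := lt_of_le_of_lt (h1.trans (l.b_card hx)) hJ
          exact (pow_lt_pow_iff_right₀ (by norm_num)).1 h2
        by_cases hcs : s ∈ l.Cs L j x
        · exact Or.inr ⟨j, hjJ, hcs⟩
        · exact Or.inl (Or.inr ⟨j, hjJ, hsC, hcs⟩)
    · rintro ((h | ⟨j, _, h, _⟩) | ⟨j, _, h⟩)
      · exact h.1
      · exact (l.mem_C.1 h).1
      · exact (l.mem_C.1 (l.mem_Cs.1 h).1).1
  have hu : ∀ {i j s}, s ∈ l.C i x → s ∈ l.C j x → i = j := by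
    intro i j s h1 h2
    rw [C, Finset.mem_filter] at h1 h2
    exact h1.2.2.symm.trans h2.2.2
  rw [m.T_union (S1 := l.Sh L J) (S2 := fun x => (Finset.range J).biUnion fun j => l.Cs L j x) e]
  · congr 1
    simp only [Mdl.T]
    rw [Finset.sum_biUnion]
    intro i _ j _ hne
    rw [Function.onFun, Finset.disjoint_left]
    intro s h1 h2
    exact hne (hu (l.mem_Cs.1 h1).1 (l.mem_Cs.1 h2).1)
  · rw [Finset.disjoint_left]
    intro s h1 h2
    rw [Finset.mem_biUnion] at h2
    obtain ⟨j, _, h2⟩ := h2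
    have h2C := (l.mem_Cs.1 h2).1
    rw [Sh, Finset.mem_union, Finset.mem_biUnion] at h1
    rcases h1 with h1 | ⟨i, _, h1⟩
    · rw [L0, Finset.mem_filter] at h1
      rw [C, Finset.mem_filter] at h2C
      exact h2C.2.1 h1.2
    · rw [Finset.mem_sdiff] at h1
      have := hu h1.1 h2C
      subst this
      exact h1.2 h2

theorem short_L2 (hC0 : 1 ≤ C0) (hκ : 0 < κ) (hκ1 : κ ≤ 1) {L J k : ℕ} (hk : KK d * 2^(n+3) ≤ 2^k) {R : ℝ} (hR : 1 ≤ R) (f : ℕ → ℂ) :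
    ∑ x ∈ l.G', ‖m.T (l.Sh L J) f x‖ ≤ √(∑ y ∈ m.Om, ‖f y‖^2) *
      √(2 * ((k + J * L : ℕ):ℝ)^2 * (C0 * (KK d * 4^d) * R^(-κ) + 2 * R^d * (1/2)^n) * G.card) := by
  apply m.dual_bound _ (l.hG'.trans l.hG)
  intro g hg hg0
  refine m.estD hC0 hκ hκ1 (l.Sh L J) l.hG ?_ (fun x _ => l.Sh_card hk x) g hg ?_ hR
  · intro x _ s hs
    have := l.mem_Sn.1 (l.Sh_sub L J x hs)
    exact ⟨this.2.1, this.2.2.1, this.2.2.2.2⟩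
  · intro x hx; exact hg0 x fun h => hx (l.hG' h)

theorem short_L1 {L J k : ℕ} (hk : KK d * 2^(n+3) ≤ 2^k) (f : ℕ → ℂ) {δ : ℝ} (hδ : 0 ≤ δ)
    (hf : ∀ x ∈ l.G', ∀ s ≤ m.M, av s (fun y => ‖f y‖) x ≤ δ) :
    ∑ x ∈ l.G', ‖m.T (l.Sh L J) f x‖ ≤ ((k + J * L : ℕ):ℝ) * δ * G.card := by
  calc _ ≤ ∑ x ∈ l.G', ((k + J * L : ℕ):ℝ) * δ := by
        apply Finset.sum_le_sum
        intro x hx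
        rw [Mdl.T]
        refine (norm_sum_le _ _).trans ?_
        calc _ ≤ ∑ s ∈ l.Sh L J x, δ := by
              apply Finset.sum_le_sum
              intro s hs
              have hs' := l.mem_Sn.1 (l.Sh_sub L J x hs)
              exact (m.norm_sum_ker_le hs'.2.2.1 (l.hG (l.hG' hx)) f).trans (hf x hx s hs'.2.2.1)
          _ ≤ _ := by
              rw [Finset.sum_const, nsmul_eq_mul]
              gcongr
              exact l.Sh_card hk x
    _ ≤ _ := by
        rw [Finset.sum_const, nsmul_eq_mul, mul_comm]
        gcongr
        exact l.hG'
end Lay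

end

section

theorem sqrt_aux {a Fc c ρ g : ℝ} (n : ℕ) (ha : 0 ≤ a) (hF : a ≤ Fc) (hc : 0 ≤ c) (hρ : 0 ≤ ρ) :
    √a * √(c * (ρ^2)^n * g) ≤ √c * ρ^n * √(Fc * g) := by
  rw [Real.sqrt_mul (by positivity), Real.sqrt_mul hc, Real.sqrt_mul (ha.trans hF),
    ← pow_mul, mul_comm 2 n, pow_mul, Real.sqrt_sq (by positivity)]
  have : √a ≤ √Fc := Real.sqrt_le_sqrt hF
  calc √a * (√c * ρ^n * √g) = √c * ρ^n * (√a * √g) := by ring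
    _ ≤ _ := by gcongr

set_option maxHeartbeats 2000000 in
theorem level_est {d : ℕ} (hd : 1 ≤ d) {C0 κ : ℝ} (hC0 : 1 ≤ C0) (hκ : 0 < κ) (hκ1 : κ ≤ 1) :
    ∃ A ρ : ℝ, 0 ≤ A ∧ 0 < ρ ∧ ρ < 1 ∧ ∀ (m : Mdl d C0 κ) (G : Finset ℕ) (n : ℕ) (l : Lay m G n),
      l.MN = 32 * KK d * 4^n → l.W = 2 * KK d * 2^n * G.card → ∀ (f : ℕ → ℂ) (δ : ℝ), 0 ≤ δ →
      (∀ x ∈ l.G', ∀ s ≤ m.M, av s (fun y => ‖f y‖) x ≤ δ) → ∀ Fc : ℝ, ∑ y ∈ m.Om, ‖f y‖^2 ≤ Fc →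
      ∑ x ∈ l.G', ‖m.T l.Sn f x‖ ≤ A * (n+1)^2 * min (δ * G.card) (ρ^n * √(Fc * G.card)) := by
  have hK := KK_one d
  obtain ⟨k0, hk0⟩ := pow_unbounded_of_one_lt (KK d) (one_lt_two)
  have hk0 := hk0.le
  set Z : ℕ := ⌈3/κ⌉₊ + k0 + 2 with hZ
  have hZκ : 3 ≤ Z * κ := by
    have h1 : 3/κ ≤ Z := (Nat.le_ceil _).trans (by rw [hZ]; push_cast; linarith [Nat.cast_nonneg (α := ℝ) k0])
    rwa [div_le_iff₀ hκ] at h1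
  have hZ3 : 3 ≤ Z := by
    have : (3:ℝ) ≤ Z := hZκ.trans (by nlinarith [Nat.cast_nonneg (α := ℝ) Z])
    exact_mod_cast this
  have hdp : (0:ℝ) < d + κ := by positivity
  set τ : ℝ := (2:ℝ)^(-(κ/(d+κ))) with hτ
  set ρ : ℝ := (2:ℝ)^(-(κ/(d+κ))/2) with hρ
  have hρτ : ρ^2 = τ := by
    rw [hρ, hτ, ← Real.rpow_natCast, ← Real.rpow_mul (by norm_num)]; congr 1; push_cast; ring
  have hρ0 : 0 < ρ := by positivity
  have hτ0 : 0 < τ := by positivity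
  have hρ1 : ρ < 1 := Real.rpow_lt_one_of_one_lt_of_neg (by norm_num) (by
    have : 0 < κ/(d+κ) := by positivity
    linarith)
  have hτh : 1/2 ≤ τ := by
    have : (1/2:ℝ) = (2:ℝ)^(-1:ℝ) := by rw [Real.rpow_neg_one]; norm_num
    rw [this, hτ]
    apply Real.rpow_le_rpow_of_exponent_le (by norm_num)
    rw [neg_le_neg_iff, div_le_one hdp]
    linarith [Nat.cast_nonneg (α := ℝ) d]
  have hCE : 0 ≤ Tree.CE d := by rw [Tree.CE]; positivity
  set A2 : ℝ := (2*C0 + 8*KK d) * (32 * KK d) with hA2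
  have hA20 : 0 ≤ A2 := by positivity
  set A3 : ℝ := 16 * Tree.CE d + A2 * (32 * Tree.CE d + 32) with hA3
  have hA30 : 0 ≤ A3 := by positivity
  set A1 : ℝ := (4 + k0) + (6+k0) * (2 + 3*k0 + 2*Z*d) with hA1
  have hA10 : 0 ≤ A1 := by positivity
  set A4 : ℝ := 2 * (C0 * (KK d * 4^d) + 2) with hA4
  have hA40 : 0 ≤ A4 := by positivity
  set A5 : ℝ := (2 * Tree.CE d + 2 * 2^d) * (2 * KK d) with hA5
  have hA50 : 0 ≤ A5 := by positivity
  refine ⟨A1 * (√A4 + 1) + (6+k0) * (√A3 + A5), ρ, by positivity, hρ0, hρ1, ?_⟩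
  clear_value A1 A2 A3 A4 A5 ρ τ Z
  intro m G n l hMN hW f δ hδ hf Fc hFc
  set k : ℕ := Z * (n+1) with hk
  set ks : ℕ := n + 3 + k0 with hks
  set J : ℕ := 2 * n + 6 + k0 with hJ
  set L : ℕ := 2 + 3 * k0 + 2 * (k * d) with hL
  have hk2 : 2 ≤ k := by rw [hk]; nlinarith
  have hk4 : 4 * KK d ≤ 2^k := by
    have h1 : k0 + 2 ≤ k := by
      rw [hk]
      have : k0 + 2 ≤ Z := by rw [hZ]; omega
      nlinarith
    calc 4 * KK d ≤ 4 * 2^k0 := by gcongr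
      _ = 2^(k0+2) := by ring
      _ ≤ 2^k := pow_le_pow_right₀ (by norm_num) h1
  have hksb : KK d * 2^(n+3) ≤ 2^ks := by
    rw [hks, pow_add _ (n+3), mul_comm]; gcongr
  have hJb : l.MN < 2^J := by
    rw [hMN]
    calc 32 * KK d * 4^n ≤ 32 * 2^k0 * 4^n := by gcongr
      _ = 2^(2*n+5+k0) := by
        rw [show (4:ℝ) = 2^2 by norm_num, ← pow_mul]; ring
      _ < 2^J := pow_lt_pow_right₀ (by norm_num) (by omega)
  have hLb : KK d * ((KK d * 2^(k*d))^2 + 3) ≤ 2^L := by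
    have h1 : 1 ≤ (KK d * 2^(k*d))^2 := one_le_pow₀ (one_le_mul_of_one_le_of_one_le hK (one_le_pow₀ (by norm_num)))
    calc KK d * ((KK d * 2^(k*d))^2 + 3) ≤ KK d * (4 * (KK d * 2^(k*d))^2) := by gcongr; linarith
      _ ≤ 2^k0 * (4 * (2^k0 * 2^(k*d))^2) := by gcongr
      _ = 2^L := by rw [hL]; ring
  have hn1 : (1:ℝ) ≤ (n:ℝ)+1 := by linarith [Nat.cast_nonneg (α := ℝ) n]
  have hJn : (J:ℝ) ≤ (6+k0) * (n+1) := by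
    rw [hJ]; push_cast
    linarith [Nat.cast_nonneg (α := ℝ) n, Nat.cast_nonneg (α := ℝ) k0, mul_nonneg (Nat.cast_nonneg (α := ℝ) n) (Nat.cast_nonneg (α := ℝ) k0)]
  have hLn : (L:ℝ) ≤ (2 + 3*k0 + 2*Z*d) * (n+1) := by
    rw [hL, hk]; push_cast
    linarith [Nat.cast_nonneg (α := ℝ) n, Nat.cast_nonneg (α := ℝ) k0, mul_nonneg (Nat.cast_nonneg (α := ℝ) n) (Nat.cast_nonneg (α := ℝ) k0)]
  have hksn : (ks:ℝ) ≤ (4 + k0) * (n+1) := by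
    rw [hks]; push_cast
    linarith [Nat.cast_nonneg (α := ℝ) n, Nat.cast_nonneg (α := ℝ) k0, mul_nonneg (Nat.cast_nonneg (α := ℝ) n) (Nat.cast_nonneg (α := ℝ) k0)]
  have hn2 : (n:ℝ)+1 ≤ (n+1)^2 := by nlinarith
  set T : ℝ := ((ks + J * L : ℕ):ℝ) with hT
  have hTn : T ≤ A1 * (n+1)^2 := by
    rw [hT]; push_cast
    have h1 : (J:ℝ) * L ≤ ((6+k0) * (n+1)) * ((2 + 3*k0 + 2*Z*d) * (n+1)) := by gcongr
    have h2 : (4 + (k0:ℝ)) * (n+1) ≤ (4+k0) * (n+1)^2 := by gcongr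
    have e : A1 * ((n:ℝ)+1)^2 = (4+k0) * (n+1)^2 + ((6+k0) * (n+1)) * ((2 + 3*k0 + 2*Z*d) * (n+1)) := by rw [hA1]; ring
    rw [e]; linarith
  have hT0 : 0 ≤ T := by positivity
  have hg0 : (0:ℝ) ≤ G.card := by positivity
  have ha0 : 0 ≤ ∑ y ∈ m.Om, ‖f y‖^2 := Finset.sum_nonneg fun _ _ => by positivity
  have hhalf : (1/2:ℝ)^n ≤ τ^n := by gcongr
  have hMN0 : 0 ≤ l.MN := by rw [hMN]; positivity
  -- eps
  have heps : Tree.eps d C0 κ k * l.MN ≤ A2 * (1/2)^n := by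
    rw [Tree.eps, hMN]
    have e1 : ((2:ℝ)^(k-1))^(-κ) ≤ 2 * (1/8)^n := by
      rw [← Real.rpow_natCast 2 (k-1), ← Real.rpow_mul (by norm_num)]
      have h8 : 2 * (1/8:ℝ)^n = (2:ℝ)^(1 - 3*(n:ℝ)) := by
        rw [Real.rpow_sub (by norm_num), Real.rpow_mul (by norm_num), Real.rpow_natCast, Real.rpow_one]
        rw [show (2:ℝ)^(3:ℝ) = 8 by norm_num, one_div, inv_pow]
        ring
      rw [h8]
      apply Real.rpow_le_rpow_of_exponent_le (by norm_num)
      rw [Nat.cast_sub (by omega), hk]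
      push_cast
      have := mul_le_mul_of_nonneg_right hZκ (by positivity : (0:ℝ) ≤ (n:ℝ)+1)
      nlinarith
    have e2 : (1:ℝ)/2^k ≤ (1/8)^n := by
      rw [one_div, ← inv_pow, show (1/8:ℝ) = (2⁻¹)^3 by norm_num, ← pow_mul]
      apply pow_le_pow_of_le_one (by norm_num) (by norm_num)
      rw [hk]; nlinarith
    calc (C0 * ((2:ℝ)^(k-1))^(-κ) + 8 * KK d / 2^k) * (32 * KK d * 4^n)
        ≤ (C0 * (2 * (1/8)^n) + 8 * KK d * (1/8)^n) * (32 * KK d * 4^n) := by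
          gcongr
          rw [div_eq_mul_one_div]; gcongr
      _ = A2 * ((1/8)^n * 4^n) := by rw [hA2]; ring
      _ = A2 * (1/2)^n := by rw [← mul_pow]; norm_num
  -- R
  set R : ℝ := (2:ℝ)^((n:ℝ)/(d+κ)) with hR
  have hR1 : 1 ≤ R := Real.one_le_rpow (by norm_num) (by positivity)
  have hRκ : R^(-κ) = τ^n := by
    rw [hR, hτ, ← Real.rpow_natCast, ← Real.rpow_mul (by norm_num), ← Real.rpow_mul (by norm_num)]
    congr 1; ring
  have hRd : R^d * (1/2)^n = τ^n := by
    rw [hR, hτ, ← Real.rpow_natCast, ← Real.rpow_mul (by norm_num), ← Real.rpow_natCast (2 ^ (-(κ/(d+κ)))), ← Real.rpow_mul (by norm_num),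
      show (1/2:ℝ) = (2:ℝ)^(-1:ℝ) by rw [Real.rpow_neg_one]; norm_num, ← Real.rpow_natCast _ n, ← Real.rpow_mul (by norm_num),
      ← Real.rpow_add (by norm_num)]
    congr 1
    field_simp
    ring
  set X := ρ^n * √(Fc * G.card) with hX
  have hX0 : 0 ≤ X := by positivity
  set Y := min (δ * G.card) X with hY
  have hY0 : 0 ≤ Y := le_min (by positivity) hX0
  -- short
  have short : ∑ x ∈ l.G', ‖m.T (l.Sh L J) f x‖ ≤ A1 * (√A4 + 1) * (n+1)^2 * Y := by
    have s1 := l.short_L1 (L := L) (J := J) hksb f hδ hf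
    have s2 := l.short_L2 (L := L) (J := J) hC0 hκ hκ1 hksb hR1 f
    rw [hRκ, mul_assoc 2 (R^d), hRd] at s2
    have s3 : √(∑ y ∈ m.Om, ‖f y‖^2) * √(2 * T^2 * (C0 * (KK d * 4^d) * τ^n + 2 * τ^n) * G.card) ≤ T * √A4 * X := by
      have e : 2 * T^2 * (C0 * (KK d * 4^d) * τ^n + 2 * τ^n) * G.card = (T^2 * A4) * (ρ^2)^n * G.card := by
        rw [hρτ, hA4]; ring
      rw [e]
      refine (sqrt_aux n ha0 hFc (by positivity) hρ0.le).trans (le_of_eq ?_)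
      rw [Real.sqrt_mul (by positivity), Real.sqrt_sq hT0, hX]; ring
    have s4 := s2.trans s3
    have hsq := Real.sqrt_nonneg A4
    have h5 : ∑ x ∈ l.G', ‖m.T (l.Sh L J) f x‖ ≤ T * (√A4 + 1) * Y := by
      rw [hY, mul_min_of_nonneg _ _ (by positivity)]
      apply le_min
      · refine s1.trans ?_
        rw [← hT]
        have : 0 ≤ T * √A4 * (δ * G.card) := by positivity
        have e : T * (√A4 + 1) * (δ * G.card) = T * √A4 * (δ * G.card) + T * δ * G.card := by ring
        rw [e]; linarith
      · refine s4.trans ?_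
        have : 0 ≤ T * X := by positivity
        have e : T * (√A4 + 1) * X = T * √A4 * X + T * X := by ring
        rw [e]; linarith
    refine h5.trans ?_
    calc T * (√A4 + 1) * Y ≤ A1 * (n+1)^2 * (√A4 + 1) * Y := by gcongr
      _ = _ := by ring
  -- forests
  have forest : ∀ j, ∑ x ∈ l.G', ‖m.T (l.Cs L j) f x‖ ≤ (√A3 + A5) * Y := by
    intro j
    have s1 := l.forest_L1 L j f hδ hf
    have s2 := l.forest_L2 hd (by linarith) hMN0 hk2 hk4 hLb j f
    have s3 : √(∑ y ∈ m.Om, ‖f y‖^2) * √((16 * Tree.CE d * (1/2)^n + Tree.eps d C0 κ k * l.MN * (32 * Tree.CE d + 32)) * G.card) ≤ √A3 * X := by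
      refine le_trans ?_ ((sqrt_aux (g := G.card) n ha0 hFc hA30 hρ0.le).trans (le_of_eq ?_))
      · gcongr
        rw [hρτ]
        calc _ ≤ 16 * Tree.CE d * (1/2)^n + A2 * (1/2)^n * (32 * Tree.CE d + 32) := by gcongr
          _ = A3 * (1/2)^n := by rw [hA3]; ring
          _ ≤ A3 * τ^n := by gcongr
      · rw [hX]; ring
    have s4 := s2.trans s3
    have hsq := Real.sqrt_nonneg A3
    rw [hY, mul_min_of_nonneg _ _ (by positivity)]
    apply le_min
    · refine s1.trans ?_
      rw [hW]
      have e : (1/2:ℝ)^n * 2^n = 1 := by rw [← mul_pow]; norm_num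
      have : (2 * Tree.CE d + 2 * 2^d) * δ * (1/2)^n * (2 * KK d * 2^n * G.card) = A5 * (δ * G.card) * ((1/2)^n * 2^n) := by
        rw [hA5]; ring
      rw [this, e]
      have : 0 ≤ √A3 * (δ * G.card) := by positivity
      rw [add_mul, mul_one]; linarith
    · refine s4.trans ?_
      have : 0 ≤ A5 * X := by positivity
      rw [add_mul]; linarith
  calc ∑ x ∈ l.G', ‖m.T l.Sn f x‖ ≤ ∑ x ∈ l.G', (‖m.T (l.Sh L J) f x‖ + ∑ j ∈ Finset.range J, ‖m.T (l.Cs L j) f x‖) := by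
        apply Finset.sum_le_sum
        intro x hx
        rw [l.Sn_split hJb f hx]
        exact (norm_add_le _ _).trans (add_le_add le_rfl (norm_sum_le _ _))
    _ ≤ A1 * (√A4 + 1) * (n+1)^2 * Y + ∑ j ∈ Finset.range J, (√A3 + A5) * Y := by
        rw [Finset.sum_add_distrib, Finset.sum_comm]
        gcongr with j _
        exact forest j
    _ = A1 * (√A4 + 1) * (n+1)^2 * Y + J * ((√A3 + A5) * Y) := by
        rw [Finset.sum_const, nsmul_eq_mul, Finset.card_range]
    _ ≤ A1 * (√A4 + 1) * (n+1)^2 * Y + ((6+k0) * (n+1)^2) * ((√A3 + A5) * Y) := by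
        gcongr
        exact hJn.trans (by gcongr)
    _ = _ := by ring

end

section

theorem weak11 {u : ℕ → ℝ} (hu : ∀ y, 0 ≤ u y) {δ : ℝ} (hδ : 0 ≤ δ) (s : ℕ) : ∀ x,
    δ * (((cell s x).filter fun y => δ < MF u s y).card : ℝ) ≤ ∑ y ∈ cell s x, u y := by
  have big : ∀ s x, δ < av s u x → δ * (((cell s x).filter fun y => δ < MF u s y).card : ℝ) ≤ ∑ y ∈ cell s x, u y := by
    intro s x h
    rw [av, lt_div_iff₀ (by positivity)] at h
    refine le_trans ?_ h.le
    gcongr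
    have := Finset.card_filter_le (cell s x) (fun y => δ < MF u s y)
    rw [cell_card] at this
    exact_mod_cast this
  induction s with
  | zero =>
    intro x
    by_cases h : δ < av 0 u x
    · exact big 0 x h
    · rw [Finset.filter_eq_empty_iff.2]
      · simpa using Finset.sum_nonneg fun y _ => hu y
      · intro y hy
        rw [cell_zero, Finset.mem_singleton] at hy
        subst hy; exact h
  | succ s ih =>
    intro x
    by_cases h : δ < av (s+1) u x
    · exact big _ x h
    · rw [sum_cell_succ]
      have e : ((cell (s+1) x).filter fun y => δ < MF u (s+1) y) =
          ((cell s (lc s x)).filter fun y => δ < MF u s y) ∪ ((cell s (rc s x)).filter fun y => δ < MF u s y) := by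
        rw [← Finset.filter_union, ← cell_succ]
        apply Finset.filter_congr
        intro y hy
        rw [MF, lt_max_iff, av_congr u hy]
        tauto
      rw [e]
      have h1 := ih (lc s x)
      have h2 := ih (rc s x)
      have h3 := Finset.card_union_le ((cell s (lc s x)).filter fun y => δ < MF u s y) ((cell s (rc s x)).filter fun y => δ < MF u s y)
      have h4 : ((((cell s (lc s x)).filter fun y => δ < MF u s y) ∪ ((cell s (rc s x)).filter fun y => δ < MF u s y)).card : ℝ) ≤
        (((cell s (lc s x)).filter fun y => δ < MF u s y).card : ℝ) + (((cell s (rc s x)).filter fun y => δ < MF u s y).card : ℝ) := by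
        exact_mod_cast h3
      nlinarith

theorem geom_bound {r : ℝ} (h0 : 0 ≤ r) (h1 : r < 1) : ∃ B : ℝ, 0 ≤ B ∧ ∀ N : ℕ, ∑ n ∈ Finset.range N, ((n:ℝ)+1)^2 * r^n ≤ B := by
  have hr : ‖r‖ < 1 := by rwa [Real.norm_of_nonneg h0]
  have s0 := summable_pow_mul_geometric_of_norm_lt_one 0 hr
  have s1 := summable_pow_mul_geometric_of_norm_lt_one 1 hr
  have s2 := summable_pow_mul_geometric_of_norm_lt_one 2 hr
  have s : Summable fun n : ℕ => ((n:ℝ)+1)^2 * r^n := by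
    have := (s2.add (s1.mul_left 2)).add s0
    refine this.congr fun n => ?_
    simp only [pow_zero, pow_one]; ring
  refine ⟨∑' n : ℕ, ((n:ℝ)+1)^2 * r^n, tsum_nonneg fun n => by positivity, fun N => s.sum_le_tsum _ fun n _ => by positivity⟩

/-- interpolation of the two bounds -/
theorem interp_aux {x y θ q : ℝ} (hx : 0 < x) (hy : 0 < y) (hθ0 : 0 < θ) (hθ1 : θ < 1) (hq : 0 < q) (n : ℕ) :
    min ((if x ≤ y then 4 * x / y else 1) * y) (q^n * √(x * y)) ≤ 4 * (q^(min θ (1-θ)))^n * (x^θ * y^(1-θ)) := by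
  set t := min θ (1-θ) with ht
  have ht0 : 0 < t := lt_min hθ0 (by linarith)
  have ht1 : t ≤ θ := min_le_left _ _
  have ht2 : t ≤ 1 - θ := min_le_right _ _
  have hmin : ∀ a b : ℝ, 0 < a → 0 < b → min a b ≤ a^(1-t) * b^t := by
    intro a b ha hb
    have hm : 0 < min a b := lt_min ha hb
    calc min a b = (min a b)^(1-t) * (min a b)^t := by
          rw [← Real.rpow_add hm]; simp
      _ ≤ _ := by
          apply mul_le_mul
          · exact Real.rpow_le_rpow hm.le (min_le_left _ _) (by linarith)
          · exact Real.rpow_le_rpow hm.le (min_le_right _ _) ht0.le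
          · positivity
          · positivity
  have hb : (q^n * √(x*y))^t = (q^t)^n * (x^(t/2) * y^(t/2)) := by
    rw [Real.mul_rpow (by positivity) (by positivity), ← Real.rpow_natCast, ← Real.rpow_mul hq.le, ← Real.rpow_natCast (q^t),
      ← Real.rpow_mul hq.le, mul_comm (n:ℝ) t, Real.sqrt_eq_rpow, ← Real.rpow_mul (by positivity), Real.mul_rpow hx.le hy.le]
    congr 3 <;> ring
  have hqn : 0 < (q^t)^n := by positivity
  split_ifs with h
  · have e : 4 * x / y * y = 4 * x := by field_simp
    rw [e]
    refine (hmin _ _ (by positivity) (by positivity)).trans ?_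
    rw [hb, Real.mul_rpow (by norm_num) hx.le]
    have h4 : (4:ℝ)^(1-t) ≤ 4 := by
      calc (4:ℝ)^(1-t) ≤ 4^(1:ℝ) := Real.rpow_le_rpow_of_exponent_le (by norm_num) (by linarith)
        _ = 4 := by norm_num
    have hxy : x^(1-t) * (x^(t/2) * y^(t/2)) ≤ x^θ * y^(1-θ) := by
      have e1 : x^(1-t) * (x^(t/2) * y^(t/2)) = x^θ * (x^(1-t/2-θ) * y^(t/2)) := by
        rw [← mul_assoc, ← Real.rpow_add hx, ← mul_assoc, ← Real.rpow_add hx]; congr 2; ring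
      have e2 : y^(1-θ) = y^(1-t/2-θ) * y^(t/2) := by rw [← Real.rpow_add hy]; congr 1; ring
      rw [e1, e2]
      have := Real.rpow_le_rpow hx.le h (by linarith : 0 ≤ 1 - t/2 - θ)
      gcongr
    calc 4^(1-t) * x^(1-t) * ((q^t)^n * (x^(t/2) * y^(t/2))) = 4^(1-t) * (q^t)^n * (x^(1-t) * (x^(t/2) * y^(t/2))) := by ring
      _ ≤ _ := by gcongr
  · push Not at h
    rw [one_mul]
    refine (hmin _ _ (by positivity) (by positivity)).trans ?_
    rw [hb]
    have hxy : y^(1-t) * (x^(t/2) * y^(t/2)) ≤ x^θ * y^(1-θ) := by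
      have e1 : y^(1-t) * (x^(t/2) * y^(t/2)) = y^(θ - t/2) * (x^(t/2) * y^(1-θ)) := by
        rw [mul_left_comm, ← Real.rpow_add hy, mul_left_comm, ← Real.rpow_add hy]; congr 2; ring
      have e2 : x^θ = x^(θ-t/2) * x^(t/2) := by rw [← Real.rpow_add hx]; congr 1; ring
      rw [e1, e2, mul_assoc]
      have := Real.rpow_le_rpow hy.le h.le (by linarith : 0 ≤ θ - t/2)
      gcongr
    calc y^(1-t) * ((q^t)^n * (x^(t/2) * y^(t/2))) = 1 * (q^t)^n * (y^(1-t) * (x^(t/2) * y^(t/2))) := by ring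
      _ ≤ _ := by gcongr; norm_num

namespace Mdl
variable {d : ℕ} {C0 κ : ℝ} (m : Mdl d C0 κ)

/-- all scales -/
def Sf (_ : ℕ) : Finset ℕ := Finset.Icc (m.s0+2) m.M

theorem H_mono {G : Finset ℕ} {n n' s x : ℕ} (hn : n ≤ n') (h : m.H G n s x) : m.H G n' s x := by
  induction hn with
  | refl => exact h
  | step _ ih => exact m.H_succ ih

open Classical in
theorem T_levels {G : Finset ℕ} (l : ∀ n, Lay m G n) (f : ℕ → ℂ) {x : ℕ} (hx : ∀ n, x ∈ (l n).G') :
    m.T m.Sf f x = ∑ n ∈ Finset.range (m.M+1), m.T (l n).Sn f x := by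
  have e : m.Sf x = (Finset.range (m.M+1)).biUnion fun n => (l n).Sn x := by
    ext s
    simp only [Finset.mem_biUnion, Finset.mem_range, Lay.mem_Sn, Sf, Finset.mem_Icc]
    constructor
    · rintro ⟨h1, h2⟩
      have hex : ∃ n, m.H G n s x := ⟨m.M+1, m.H_top ((l 0).hG' (hx 0)) h2⟩
      have hfs := Nat.find_spec hex
      have hpos : Nat.find hex ≠ 0 := by
        intro h0
        rw [h0] at hfs
        exact m.H_zero _ _ hfs
      obtain ⟨k, hk⟩ := Nat.exists_eq_succ_of_ne_zero hpos
      have hle : Nat.find hex ≤ m.M + 1 := Nat.find_min' hex (m.H_top ((l 0).hG' (hx 0)) h2)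
      refine ⟨k, by omega, hx k, h1, h2, ?_, ?_⟩
      · rw [hk] at hfs; exact hfs
      · exact Nat.find_min hex (by omega)
    · rintro ⟨n, _, _, h1, h2, _⟩; exact ⟨h1, h2⟩
  simp only [T]
  rw [e, Finset.sum_biUnion]
  intro n _ n' _ hne
  rw [Function.onFun, Finset.disjoint_left]
  intro s h1 h2
  rw [Lay.mem_Sn] at h1 h2
  rcases lt_or_gt_of_ne hne with h | h
  · exact h2.2.2.2.2 (m.H_mono h h1.2.2.2.1)
  · exact h1.2.2.2.2 (m.H_mono h h2.2.2.2.1)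
end Mdl

open Classical in
/-- restricted weak type estimate -/
theorem rwt {d : ℕ} (hd : 1 ≤ d) {C0 κ : ℝ} (hC0 : 1 ≤ C0) (hκ : 0 < κ) (hκ1 : κ ≤ 1) {θ : ℝ} (hθ0 : 0 < θ) (hθ1 : θ < 1) :
    ∃ A : ℝ, 0 ≤ A ∧ ∀ (m : Mdl d C0 κ) (F G : Finset ℕ), F ⊆ m.Om → G ⊆ m.Om → F.Nonempty → G.Nonempty →
      ∃ G' ⊆ G, (G.card : ℝ) ≤ 2 * G'.card ∧ ∀ f : ℕ → ℂ, (∀ y, ‖f y‖ ≤ if y ∈ F then 1 else 0) →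
        ∑ x ∈ G', ‖m.T m.Sf f x‖ ≤ A * ((F.card:ℝ)^θ * (G.card:ℝ)^(1-θ)) := by
  obtain ⟨A, ρ, hA, hρ0, hρ1, hlev⟩ := level_est hd hC0 hκ hκ1
  set t := min θ (1-θ) with ht
  have ht0 : 0 < t := lt_min hθ0 (by linarith)
  obtain ⟨B, hB, hgeom⟩ := geom_bound (r := ρ^t) (by positivity) (Real.rpow_lt_one hρ0.le hρ1 ht0)
  have hK := KK_one d
  refine ⟨A * 4 * B, by positivity, ?_⟩
  intro m F G hF hG hFn hGn
  have hx : (0:ℝ) < F.card := by exact_mod_cast Finset.card_pos.2 hFn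
  have hy : (0:ℝ) < G.card := by exact_mod_cast Finset.card_pos.2 hGn
  choose Ms hMs hsum hdom using m.dense_tiles (G := G) hd
  set δ : ℝ := if (F.card:ℝ) ≤ G.card then 4 * F.card / G.card else 1 with hδ
  have hδ0 : 0 < δ := by rw [hδ]; split_ifs <;> positivity
  set u : ℕ → ℝ := fun y => if y ∈ F then 1 else 0 with hu
  have hu0 : ∀ y, 0 ≤ u y := fun y => by rw [hu]; simp only; split_ifs <;> norm_num
  have hu1 : ∀ y, u y ≤ 1 := fun y => by rw [hu]; simp only; split_ifs <;> norm_num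
  set G1 := G.filter fun y => δ < MF u m.M y with hG1
  set An : ℕ → Finset ℕ := fun n => G.filter fun x => 32 * KK d * 4^n < (((Ms n).filter fun v => x ∈ cell v.1 v.2).card : ℝ) with hAn
  set G' := G \ (G1 ∪ (Finset.range (m.M+1)).biUnion An) with hG'
  have hG'G : G' ⊆ G := Finset.sdiff_subset
  have cG1 : (G1.card:ℝ) ≤ G.card / 4 := by
    by_cases hle : (F.card:ℝ) ≤ G.card
    · have h0 : (0:ℕ) < 2^m.M := by positivity
      have h1 := weak11 hu0 hδ0.le m.M 0
      have e : cell m.M 0 = m.Om := by rw [cell_top h0]; rfl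
      rw [e] at h1
      have h2 : ∑ y ∈ m.Om, u y = F.card := by
        rw [hu, Finset.sum_ite_mem, Finset.inter_eq_right.2 hF]; simp
      have h3 : (G1.card:ℝ) ≤ ((m.Om.filter fun y => δ < MF u m.M y).card : ℝ) := by
        norm_cast
        exact Finset.card_le_card (Finset.filter_subset_filter _ hG)
      have h4 : δ * G1.card ≤ F.card := by
        rw [h2] at h1
        exact le_trans (by gcongr) h1
      rw [hδ, if_pos hle] at h4
      have : 4 * (F.card:ℝ) / G.card * G1.card = F.card * (4 * G1.card / G.card) := by ring
      rw [this] at h4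
      have h5 : 4 * (G1.card:ℝ) / G.card ≤ 1 := by
        by_contra hc
        push Not at hc
        nlinarith
      rw [div_le_one hy] at h5
      linarith
    · have : G1 = ∅ := by
        rw [hG1, Finset.filter_eq_empty_iff]
        intro y _
        rw [hδ, if_neg hle, not_lt]
        apply MF_le
        intro s _
        rw [av, div_le_one (by positivity)]
        refine (Finset.sum_le_sum fun y _ => hu1 y).trans ?_
        rw [Finset.sum_const, cell_card]; simp
      rw [this]; simp; positivity
  have cAn : ∀ n, ((An n).card:ℝ) ≤ (1/2)^n * (G.card / 16) := by
    intro n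
    have h1 := Lay.sum_cells (m := m) (Ms n) (fun v hv => ⟨(hMs n v hv).1, hG (hMs n v hv).2⟩)
    have h2 : ∑ v ∈ Ms n, (2:ℝ)^v.1 = ∑ y ∈ m.Om, (((Ms n).filter fun v => y ∈ cell v.1 v.2).card : ℝ) := by exact_mod_cast h1
    have h3 : ∑ y ∈ An n, (32 * KK d * 4^n) ≤ ∑ y ∈ m.Om, (((Ms n).filter fun v => y ∈ cell v.1 v.2).card : ℝ) := by
      calc _ ≤ ∑ y ∈ An n, (((Ms n).filter fun v => y ∈ cell v.1 v.2).card : ℝ) := by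
            apply Finset.sum_le_sum
            intro y hy
            exact (Finset.mem_filter.1 hy).2.le
        _ ≤ _ := Finset.sum_le_sum_of_subset_of_nonneg ((Finset.filter_subset _ _).trans hG) fun _ _ _ => by positivity
    rw [← h2, Finset.sum_const, nsmul_eq_mul] at h3
    have h4 := h3.trans (hsum n)
    have e : (1/2:ℝ)^n * (G.card/16) = 2 * KK d * 2^n * G.card / (32 * KK d * 4^n) := by
      rw [show (4:ℝ) = 2 * 2 by norm_num, mul_pow, one_div, inv_pow]; field_simp; norm_num
    rw [e, le_div_iff₀ (by positivity)]
    exact h4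
  have cG' : (G.card:ℝ) ≤ 2 * G'.card := by
    have h1 : (((Finset.range (m.M+1)).biUnion An).card:ℝ) ≤ G.card / 8 := by
      calc _ ≤ ∑ n ∈ Finset.range (m.M+1), ((An n).card:ℝ) := by exact_mod_cast Finset.card_biUnion_le
        _ ≤ ∑ n ∈ Finset.range (m.M+1), (1/2)^n * ((G.card:ℝ) / 16) := Finset.sum_le_sum fun n _ => cAn n
        _ = (∑ n ∈ Finset.range (m.M+1), (1/2:ℝ)^n) * (G.card / 16) := by rw [Finset.sum_mul]
        _ ≤ 2 * (G.card / 16) := by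
            gcongr
            rw [geom_sum_eq (by norm_num)]
            have : (0:ℝ) < (1/2)^(m.M+1) := by positivity
            rw [div_le_iff_of_neg (by norm_num)]
            linarith
        _ = _ := by ring
    have h2 : G.card ≤ G'.card + (G1 ∪ (Finset.range (m.M+1)).biUnion An).card := by
      rw [hG']
      have := Finset.le_card_sdiff (G1 ∪ (Finset.range (m.M+1)).biUnion An) G
      omega
    have h3 := Finset.card_union_le G1 ((Finset.range (m.M+1)).biUnion An)
    have h4 : (G.card:ℝ) ≤ G'.card + (G1.card + ((Finset.range (m.M+1)).biUnion An).card) := by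
      exact_mod_cast h2.trans (by omega)
    linarith
  refine ⟨G', hG'G, cG', ?_⟩
  intro f hf
  -- levels
  set l : ∀ n, Lay m G n := fun n =>
    { G' := G', hG := hG, hG' := hG'G, Ms := Ms n, hMs := hMs n, W := 2 * KK d * 2^n * G.card, hW := hsum n,
      hH := hdom n, MN := if n ∈ Finset.range (m.M+1) then 32 * KK d * 4^n else ((Ms n).card : ℝ),
      hMN := by
        intro x hx
        split_ifs with hn
        · by_contra hc
          push Not at hc
          rw [hG', Finset.mem_sdiff, Finset.mem_union, Finset.mem_biUnion] at hx
          exact hx.2 (Or.inr ⟨n, hn, Finset.mem_filter.2 ⟨hx.1, hc⟩⟩)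
        · exact_mod_cast Finset.card_filter_le _ _ } with hl
  have hav : ∀ x ∈ G', ∀ s ≤ m.M, av s (fun y => ‖f y‖) x ≤ δ := by
    intro x hx s hs
    rw [hG', Finset.mem_sdiff, Finset.mem_union] at hx
    have h1 : MF u m.M x ≤ δ := by
      by_contra hc
      push Not at hc
      exact hx.2 (Or.inl (Finset.mem_filter.2 ⟨hx.1, hc⟩))
    refine le_trans ?_ ((av_le_MF u hs).trans h1)
    rw [av, av]
    gcongr with y
    exact hf y
  have hFc : ∑ y ∈ m.Om, ‖f y‖^2 ≤ (F.card:ℝ) := by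
    have h2 : ∑ y ∈ m.Om, u y = F.card := by
      rw [hu, Finset.sum_ite_mem, Finset.inter_eq_right.2 hF]; simp
    rw [← h2]
    apply Finset.sum_le_sum
    intro y _
    have h3 : ‖f y‖ ≤ u y := hf y
    have h4 := hu1 y
    have h5 := norm_nonneg (f y)
    nlinarith
  have hP : 0 ≤ (F.card:ℝ)^θ * (G.card:ℝ)^(1-θ) := by positivity
  calc ∑ x ∈ G', ‖m.T m.Sf f x‖ ≤ ∑ x ∈ G', ∑ n ∈ Finset.range (m.M+1), ‖m.T (l n).Sn f x‖ := by
        apply Finset.sum_le_sum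
        intro x hx
        rw [m.T_levels l f (fun n => hx)]
        exact norm_sum_le _ _
    _ = ∑ n ∈ Finset.range (m.M+1), ∑ x ∈ G', ‖m.T (l n).Sn f x‖ := Finset.sum_comm
    _ ≤ ∑ n ∈ Finset.range (m.M+1), A * 4 * (((n:ℝ)+1)^2 * (ρ^t)^n) * ((F.card:ℝ)^θ * (G.card:ℝ)^(1-θ)) := by
        apply Finset.sum_le_sum
        intro n hn
        have h1 := hlev m G n (l n) (by simp only [hl]; rw [if_pos hn]) rfl f δ hδ0.le hav F.card hFc
        refine h1.trans ?_
        have h2 := interp_aux hx hy hθ0 hθ1 hρ0 n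
        have h3 : 0 ≤ A * ((n:ℝ)+1)^2 := by positivity
        calc _ ≤ A * ((n:ℝ)+1)^2 * (4 * (ρ^t)^n * ((F.card:ℝ)^θ * (G.card:ℝ)^(1-θ))) := mul_le_mul_of_nonneg_left h2 h3
          _ = _ := by ring
    _ = A * 4 * (∑ n ∈ Finset.range (m.M+1), (((n:ℝ)+1)^2 * (ρ^t)^n)) * ((F.card:ℝ)^θ * (G.card:ℝ)^(1-θ)) := by
        rw [Finset.mul_sum, Finset.sum_mul]
    _ ≤ _ := by
        gcongr
        exact hgeom _

end

section

theorem int_geom {r : ℝ} (h0 : 0 ≤ r) (h1 : r < 1) : ∃ B : ℝ, 1 ≤ B ∧ ∀ (K : Finset ℤ) (j : ℤ),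
    ∑ k ∈ K, r^(j - k).natAbs ≤ B := by
  have s : Summable fun i : ℤ => r^i.natAbs := by
    apply Summable.of_nat_of_neg
    · simpa using summable_geometric_of_lt_one h0 h1
    · simpa using summable_geometric_of_lt_one h0 h1
  refine ⟨max 1 (∑' i : ℤ, r^i.natAbs), le_max_left _ _, fun K j => le_trans ?_ (le_max_right _ _)⟩
  have hinj : Function.Injective fun k : ℤ => j - k := fun a b h => by simpa using h
  have e : ∑ k ∈ K, r^(j-k).natAbs = ∑ i ∈ K.map ⟨_, hinj⟩, r^i.natAbs := by
    rw [Finset.sum_map]; rfl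
  rw [e]
  exact s.sum_le_tsum _ fun i _ => by positivity

theorem marc_exp {p c : ℝ} (hp : 1 < p) (hc : 0 < c) : ∃ C : ℝ, 0 ≤ C ∧ ∀ j k : ℤ,
    ∃ q : ℝ, (q = (1+p)/2 ∨ q = 4*p) ∧
    (2:ℝ)^(((j:ℝ)+1)*p) * (c * (2:ℝ)^((j:ℝ)-k) * (2:ℝ)^(-((p-1)/(2*(p+1))) * |(j:ℝ)-k|))^(-q) ≤
      C * (2:ℝ)^((k:ℝ)*p) * ((2:ℝ)^(-((p-1)/4)))^(j-k).natAbs := by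
  set δ := (p-1)/(2*(p+1)) with hδ
  have hδ1 : δ * (2 * (p+1)) = p - 1 := by rw [hδ]; field_simp
  have hδ0 : 0 < δ := by rw [hδ]; apply div_pos <;> linarith
  have hδ2 : δ ≤ 1/2 := by nlinarith
  have key : ∀ j k : ℤ, ∀ q : ℝ, (2:ℝ)^(((j:ℝ)+1)*p) * (c * (2:ℝ)^((j:ℝ)-k) * (2:ℝ)^(-δ * |(j:ℝ)-k|))^(-q) =
      2^p * c^(-q) * (2:ℝ)^((k:ℝ)*p) * (2:ℝ)^(((j:ℝ)-k)*p - ((j:ℝ)-k)*q + δ*|(j:ℝ)-k| * q) := by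
    intro j k q
    rw [Real.mul_rpow (by positivity) (by positivity), Real.mul_rpow (by positivity) (by positivity),
      ← Real.rpow_mul (by norm_num), ← Real.rpow_mul (by norm_num)]
    have : ((j:ℝ)+1)*p = p + ((k:ℝ)*p + ((j:ℝ)-k)*p) := by ring
    rw [this, Real.rpow_add (by norm_num), Real.rpow_add (by norm_num)]
    have : ((j:ℝ)-k)*p - ((j:ℝ)-k)*q + δ*|(j:ℝ)-k| * q = ((j:ℝ)-k)*p + (((j:ℝ)-k)*(-q) + (-δ*|(j:ℝ)-k|) * (-q)) := by ring
    rw [this, Real.rpow_add (by norm_num), Real.rpow_add (by norm_num)]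
    ring
  have hn : ∀ j k : ℤ, ((2:ℝ)^(-((p-1)/4)))^(j-k).natAbs = (2:ℝ)^(-((p-1)/4) * |(j:ℝ)-k|) := by
    intro j k
    rw [← Real.rpow_natCast, ← Real.rpow_mul (by norm_num)]
    congr 2
    rw [Nat.cast_natAbs]; push_cast; rfl
  refine ⟨2^p * max (c^(-((1+p)/2))) (c^(-(4*p))), by positivity, fun j k => ?_⟩
  rcases le_total (k:ℝ) j with h | h
  · refine ⟨4*p, Or.inr rfl, ?_⟩
    rw [key, hn]
    have ha : |(j:ℝ)-k| = (j:ℝ)-k := abs_of_nonneg (by linarith)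
    rw [ha]
    have hi : 0 ≤ (j:ℝ)-k := by linarith
    gcongr
    · exact le_max_right _ _
    · norm_num
    · have : 0 ≤ ((j:ℝ)-k)*p := by positivity
      nlinarith
  · refine ⟨(1+p)/2, Or.inl rfl, ?_⟩
    rw [key, hn]
    have ha : |(j:ℝ)-k| = -((j:ℝ)-k) := abs_of_nonpos (by linarith)
    rw [ha]
    gcongr
    · exact le_max_left _ _
    · norm_num
    · have e : ((j:ℝ)-k)*p - ((j:ℝ)-k)*((1+p)/2) + δ*(-((j:ℝ)-k))*((1+p)/2) = -((p-1)/4) * -((j:ℝ)-k) := by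
        have : δ*(-((j:ℝ)-k))*((1+p)/2) = -((j:ℝ)-k)/4 * (δ * (2*(p+1))) := by ring
        rw [this, hδ1]; ring
      rw [e]

open Classical in
/-- Marcinkiewicz interpolation from restricted weak type, finite version -/
theorem marc {p A : ℝ} (hp : 1 < p) (hA : 0 ≤ A) : ∃ B : ℝ, 0 ≤ B ∧ ∀ (Om : Finset ℕ) (T : (ℕ → ℂ) → ℕ → ℂ),
    (∀ (K : Finset ℤ) (g : ℤ → ℕ → ℂ) (x : ℕ), T (fun y => ∑ k ∈ K, g k y) x = ∑ k ∈ K, T (g k) x) →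
    (∀ (c : ℂ) (g : ℕ → ℂ) (x : ℕ), T (fun y => c * g y) x = c * T g x) →
    (∀ F ⊆ Om, ∀ f : ℕ → ℂ, (∀ y, ‖f y‖ ≤ if y ∈ F then 1 else 0) → ∀ q, (q = (1+p)/2 ∨ q = 4*p) → ∀ t : ℝ, 0 < t →
      ((Om.filter fun x => t ≤ ‖T f x‖).card : ℝ) ≤ A * t^(-q) * F.card) →
    ∀ f : ℕ → ℂ, (∀ y, y ∉ Om → f y = 0) → ∑ x ∈ Om, ‖T f x‖^p ≤ B * ∑ x ∈ Om, ‖f x‖^p := by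
  set δ := (p-1)/(2*(p+1)) with hδ
  have hδ0 : 0 < δ := by rw [hδ]; apply div_pos <;> linarith
  obtain ⟨B1, hB1, hg1⟩ := int_geom (r := (2:ℝ)^(-δ)) (by positivity) (Real.rpow_lt_one_of_one_lt_of_neg (by norm_num) (by linarith))
  obtain ⟨B2, hB2, hg2⟩ := int_geom (r := (2:ℝ)^(-((p-1)/4))) (by positivity) (Real.rpow_lt_one_of_one_lt_of_neg (by norm_num) (by linarith))
  obtain ⟨C, hC, hexp⟩ := marc_exp (c := 1/(4*B1)) hp (by positivity)
  refine ⟨A * C * B2, by positivity, ?_⟩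
  intro Om T hadd hmul hweak f hf0
  have hp0 : 0 < p := by linarith
  set Fk : ℤ → Finset ℕ := fun k => Om.filter fun y => f y ≠ 0 ∧ Int.log 2 ‖f y‖ = k with hFk
  set g : ℤ → ℕ → ℂ := fun k y => if y ∈ Fk k then f y else 0 with hg
  set K := Om.image fun y => Int.log 2 ‖f y‖ with hK
  set J := Om.image fun y => Int.log 2 ‖T f y‖ with hJ
  have hfsum : f = fun y => ∑ k ∈ K, g k y := by
    funext y
    by_cases hy : y ∈ Om
    · by_cases h0 : f y = 0
      · rw [h0]; symm; apply Finset.sum_eq_zero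
        intro k _; simp only [hg, hFk]; rw [if_neg]; simp [h0]
      · rw [Finset.sum_eq_single (Int.log 2 ‖f y‖)]
        · simp only [hg, hFk]; rw [if_pos]; simp [h0, hy]
        · intro k _ hk
          simp only [hg, hFk]; rw [if_neg]; simp [h0, hy]; exact fun h => hk h.symm
        · intro h; exact absurd (Finset.mem_image_of_mem _ hy) h
    · rw [hf0 y hy]; symm; apply Finset.sum_eq_zero
      intro k _; simp only [hg, hFk]; rw [if_neg]; simp [hy]
  have hlog : ∀ v : ℝ, 0 < v → (2:ℝ)^((Int.log 2 v : ℤ):ℝ) ≤ v ∧ v < (2:ℝ)^(((Int.log 2 v : ℤ):ℝ)+1) := by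
    intro v hv
    have h1 := Int.zpow_log_le_self (b := 2) (by norm_num) hv
    have h2 := Int.lt_zpow_succ_log_self (b := 2) (by norm_num) v
    rw [← Real.rpow_intCast] at h1 h2
    push_cast at h1 h2
    exact ⟨h1, h2⟩
  -- level set bound
  have hlev : ∀ j : ℤ, ((Om.filter fun x => (2:ℝ)^(j:ℝ) ≤ ‖T f x‖).card : ℝ) ≤
      ∑ k ∈ K, ((Om.filter fun x => 1/(4*B1) * (2:ℝ)^((j:ℝ)-k) * (2:ℝ)^(-δ * |(j:ℝ)-k|) ≤ ‖T (fun y => ((((2:ℝ)^(-((k:ℝ)+1)):ℝ)):ℂ) * g k y) x‖).card : ℝ) := by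
    intro j
    have hsub : (Om.filter fun x => (2:ℝ)^(j:ℝ) ≤ ‖T f x‖) ⊆ K.biUnion fun k =>
        (Om.filter fun x => 1/(4*B1) * (2:ℝ)^((j:ℝ)-k) * (2:ℝ)^(-δ * |(j:ℝ)-k|) ≤ ‖T (fun y => ((((2:ℝ)^(-((k:ℝ)+1)):ℝ)):ℂ) * g k y) x‖) := by
      intro x hx
      rw [Finset.mem_filter] at hx
      rw [Finset.mem_biUnion]
      by_contra hcon
      push Not at hcon
      have h1 : ∀ k ∈ K, ‖T (g k) x‖ ≤ 1/(2*B1) * (2:ℝ)^(j:ℝ) * ((2:ℝ)^(-δ))^(j-k).natAbs := by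
        intro k hk
        have h2 := hcon k hk
        rw [Finset.mem_filter, not_and] at h2
        have h3 := h2 hx.1
        rw [not_le, hmul, norm_mul, Complex.norm_real, Real.norm_of_nonneg (by positivity)] at h3
        have hn : ((2:ℝ)^(-δ))^(j-k).natAbs = (2:ℝ)^(-δ * |(j:ℝ)-k|) := by
          rw [← Real.rpow_natCast, ← Real.rpow_mul (by norm_num)]
          congr 2
          rw [Nat.cast_natAbs]; push_cast; rfl
        rw [hn]
        have e : ‖T (g k) x‖ = 2^((k:ℝ)+1) * (2^(-((k:ℝ)+1)) * ‖T (g k) x‖) := by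
          rw [← mul_assoc, ← Real.rpow_add (by norm_num)]; simp
        rw [e]
        calc _ ≤ 2^((k:ℝ)+1) * (1/(4*B1) * (2:ℝ)^((j:ℝ)-k) * (2:ℝ)^(-δ * |(j:ℝ)-k|)) := by gcongr
          _ = (2^((k:ℝ)+1) * (2:ℝ)^((j:ℝ)-k)) * (1/(4*B1) * (2:ℝ)^(-δ * |(j:ℝ)-k|)) := by ring
          _ = _ := by
            rw [← Real.rpow_add (by norm_num), show (k:ℝ)+1+((j:ℝ)-k) = j + 1 by ring, Real.rpow_add (by norm_num), Real.rpow_one]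
            field_simp; norm_num
      have h2 : ‖T f x‖ ≤ 1/2 * (2:ℝ)^(j:ℝ) := by
        rw [hfsum, hadd]
        calc _ ≤ ∑ k ∈ K, ‖T (g k) x‖ := norm_sum_le _ _
          _ ≤ ∑ k ∈ K, 1/(2*B1) * (2:ℝ)^(j:ℝ) * ((2:ℝ)^(-δ))^(j-k).natAbs := Finset.sum_le_sum h1
          _ = 1/(2*B1) * (2:ℝ)^(j:ℝ) * ∑ k ∈ K, ((2:ℝ)^(-δ))^(j-k).natAbs := by rw [Finset.mul_sum]
          _ ≤ 1/(2*B1) * (2:ℝ)^(j:ℝ) * B1 := by gcongr; exact hg1 K j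
          _ = _ := by field_simp
      have h3 : (0:ℝ) < 2^(j:ℝ) := by positivity
      linarith [hx.2]
    calc _ ≤ ((K.biUnion fun k => _).card : ℝ) := by exact_mod_cast Finset.card_le_card hsub
      _ ≤ _ := by exact_mod_cast Finset.card_biUnion_le
  have hgk : ∀ (k : ℤ) (y : ℕ), ‖((((2:ℝ)^(-((k:ℝ)+1)):ℝ)):ℂ) * g k y‖ ≤ if y ∈ Fk k then 1 else 0 := by
    intro k y
    simp only [hg]
    split_ifs with h
    · rw [norm_mul, Complex.norm_real, Real.norm_of_nonneg (by positivity)]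
      rw [hFk, Finset.mem_filter] at h
      have h1 := (hlog ‖f y‖ (norm_pos_iff.2 h.2.1)).2
      rw [h.2.2] at h1
      calc _ ≤ (2:ℝ)^(-((k:ℝ)+1)) * (2:ℝ)^((k:ℝ)+1) := by gcongr
        _ = 1 := by rw [← Real.rpow_add (by norm_num)]; simp
    · simp
  calc ∑ x ∈ Om, ‖T f x‖^p ≤ ∑ x ∈ Om, ∑ j ∈ J, (2:ℝ)^(((j:ℝ)+1)*p) * (if (2:ℝ)^(j:ℝ) ≤ ‖T f x‖ then 1 else 0) := by
        apply Finset.sum_le_sum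
        intro x hx
        by_cases h0 : ‖T f x‖ = 0
        · rw [h0, Real.zero_rpow hp0.ne']
          apply Finset.sum_nonneg; intro j _; positivity
        · have hpos : 0 < ‖T f x‖ := lt_of_le_of_ne (norm_nonneg _) (Ne.symm h0)
          have hl := hlog _ hpos
          refine le_trans ?_ (Finset.single_le_sum (fun j _ => by positivity) (Finset.mem_image_of_mem _ hx))
          rw [if_pos hl.1, mul_one, Real.rpow_mul (by norm_num)]
          exact Real.rpow_le_rpow hpos.le hl.2.le hp0.le
    _ = ∑ j ∈ J, (2:ℝ)^(((j:ℝ)+1)*p) * ((Om.filter fun x => (2:ℝ)^(j:ℝ) ≤ ‖T f x‖).card : ℝ) := by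
        rw [Finset.sum_comm]
        apply Finset.sum_congr rfl
        intro j _
        rw [← Finset.mul_sum, Finset.sum_boole]
    _ ≤ ∑ j ∈ J, (2:ℝ)^(((j:ℝ)+1)*p) * ∑ k ∈ K, ((Om.filter fun x => 1/(4*B1) * (2:ℝ)^((j:ℝ)-k) * (2:ℝ)^(-δ * |(j:ℝ)-k|) ≤ ‖T (fun y => ((((2:ℝ)^(-((k:ℝ)+1)):ℝ)):ℂ) * g k y) x‖).card : ℝ) := by
        gcongr with j _
        exact hlev j
    _ ≤ ∑ j ∈ J, ∑ k ∈ K, A * C * (2:ℝ)^((k:ℝ)*p) * (Fk k).card * ((2:ℝ)^(-((p-1)/4)))^(j-k).natAbs := by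
        apply Finset.sum_le_sum
        intro j _
        rw [Finset.mul_sum]
        apply Finset.sum_le_sum
        intro k _
        obtain ⟨q, hq, hle⟩ := hexp j k
        have h1 := hweak (Fk k) (Finset.filter_subset _ _) _ (hgk k) q hq (1/(4*B1) * (2:ℝ)^((j:ℝ)-k) * (2:ℝ)^(-δ * |(j:ℝ)-k|)) (by positivity)
        calc _ ≤ (2:ℝ)^(((j:ℝ)+1)*p) * (A * (1/(4*B1) * (2:ℝ)^((j:ℝ)-k) * (2:ℝ)^(-δ * |(j:ℝ)-k|))^(-q) * (Fk k).card) := mul_le_mul_of_nonneg_left h1 (by positivity)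
          _ = A * (Fk k).card * ((2:ℝ)^(((j:ℝ)+1)*p) * (1/(4*B1) * (2:ℝ)^((j:ℝ)-k) * (2:ℝ)^(-δ * |(j:ℝ)-k|))^(-q)) := by ring
          _ ≤ A * (Fk k).card * (C * (2:ℝ)^((k:ℝ)*p) * ((2:ℝ)^(-((p-1)/4)))^(j-k).natAbs) := mul_le_mul_of_nonneg_left hle (mul_nonneg hA (Nat.cast_nonneg _))
          _ = _ := by ring
    _ = ∑ k ∈ K, A * C * (2:ℝ)^((k:ℝ)*p) * (Fk k).card * ∑ j ∈ J, ((2:ℝ)^(-((p-1)/4)))^(k-j).natAbs := by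
        rw [Finset.sum_comm]
        apply Finset.sum_congr rfl
        intro k _
        rw [Finset.mul_sum]
        apply Finset.sum_congr rfl
        intro j _
        rw [← Int.natAbs_neg, neg_sub]
    _ ≤ ∑ k ∈ K, A * C * (2:ℝ)^((k:ℝ)*p) * (Fk k).card * B2 := by
        exact Finset.sum_le_sum fun k _ => mul_le_mul_of_nonneg_left (hg2 J k) (mul_nonneg (by positivity) (Nat.cast_nonneg _))
    _ = A * C * B2 * ∑ k ∈ K, ∑ x ∈ Om, (if x ∈ Fk k then (2:ℝ)^((k:ℝ)*p) else 0) := by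
        rw [Finset.mul_sum]
        apply Finset.sum_congr rfl
        intro k _
        rw [Finset.sum_ite_mem, Finset.inter_eq_right.2 (Finset.filter_subset _ _), Finset.sum_const, nsmul_eq_mul]
        ring
    _ ≤ _ := by
        gcongr
        rw [Finset.sum_comm]
        apply Finset.sum_le_sum
        intro x hx
        by_cases h0 : f x = 0
        · rw [Finset.sum_eq_zero]
          · positivity
          · intro k _; rw [if_neg]; simp [hFk, h0]
        · rw [Finset.sum_eq_single (Int.log 2 ‖f x‖)]
          · rw [if_pos (by simp [hFk, h0, hx]), Real.rpow_mul (by norm_num)]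
            exact Real.rpow_le_rpow (by positivity) (hlog _ (norm_pos_iff.2 h0)).1 hp0.le
          · intro k _ hk
            rw [if_neg]; simp [hFk, h0, hx]; exact fun h => hk h.symm
          · intro h; exact absurd (Finset.mem_image_of_mem _ hx) h

open Classical in
theorem weak_type {d : ℕ} (hd : 1 ≤ d) {C0 κ : ℝ} (hC0 : 1 ≤ C0) (hκ : 0 < κ) (hκ1 : κ ≤ 1) {q : ℝ} (hq : 1 < q) :
    ∃ A : ℝ, 0 ≤ A ∧ ∀ (m : Mdl d C0 κ) (F : Finset ℕ), F ⊆ m.Om → ∀ f : ℕ → ℂ, (∀ y, ‖f y‖ ≤ if y ∈ F then 1 else 0) →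
      ∀ t : ℝ, 0 < t → ((m.Om.filter fun x => t ≤ ‖m.T m.Sf f x‖).card : ℝ) ≤ A * t^(-q) * F.card := by
  have hq0 : 0 < q := by linarith
  obtain ⟨A, hA, h⟩ := rwt hd hC0 hκ hκ1 (θ := 1/q) (by positivity) (by rw [div_lt_one hq0]; exact hq)
  refine ⟨(2*A)^q, by positivity, ?_⟩
  intro m F hF f hf t ht
  set G := m.Om.filter fun x => t ≤ ‖m.T m.Sf f x‖ with hG
  rcases G.eq_empty_or_nonempty with h0 | hGn
  · rw [h0]; simp; positivity
  rcases F.eq_empty_or_nonempty with h0 | hFn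
  · exfalso
    obtain ⟨x, hx⟩ := hGn
    have hx2 := (Finset.mem_filter.1 hx).2
    have : f = 0 := by
      funext y
      have := hf y
      rw [h0] at this
      simpa using this
    rw [this] at hx2
    simp [Mdl.T] at hx2
    linarith
  obtain ⟨G', hG', hc, hb⟩ := h m F G hF (Finset.filter_subset _ _) hFn hGn
  have h1 := hb f hf
  have hx : (0:ℝ) < F.card := by exact_mod_cast Finset.card_pos.2 hFn
  have hy : (0:ℝ) < G.card := by exact_mod_cast Finset.card_pos.2 hGn
  have h2 : t * G'.card ≤ ∑ x ∈ G', ‖m.T m.Sf f x‖ := by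
    rw [mul_comm, ← nsmul_eq_mul]
    exact Finset.card_nsmul_le_sum _ _ _ fun x hx => (Finset.mem_filter.1 (hG' hx)).2
  have h3 : t * G.card ≤ 2 * A * ((F.card:ℝ)^(1/q) * (G.card:ℝ)^(1-1/q)) := by nlinarith
  have h4 : (G.card:ℝ)^(1/q) ≤ 2 * A * t⁻¹ * (F.card:ℝ)^(1/q) := by
    have e : (G.card:ℝ) = (G.card:ℝ)^(1/q) * (G.card:ℝ)^(1-1/q) := by rw [← Real.rpow_add hy]; simp
    have hP : (0:ℝ) < (G.card:ℝ)^(1-1/q) := by positivity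
    have h5 : t * (G.card:ℝ)^(1/q) ≤ 2 * A * (F.card:ℝ)^(1/q) := by
      refine le_of_mul_le_mul_right ?_ hP
      calc _ = t * ((G.card:ℝ)^(1/q) * (G.card:ℝ)^(1-1/q)) := by ring
        _ = t * G.card := by rw [← e]
        _ ≤ _ := h3
        _ = _ := by ring
    calc (G.card:ℝ)^(1/q) = t⁻¹ * (t * (G.card:ℝ)^(1/q)) := by rw [← mul_assoc, inv_mul_cancel₀ ht.ne', one_mul]
      _ ≤ t⁻¹ * (2 * A * (F.card:ℝ)^(1/q)) := by gcongr
      _ = _ := by ring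
  have h5 := Real.rpow_le_rpow (by positivity) h4 hq0.le
  rw [← Real.rpow_mul hy.le, one_div_mul_cancel hq0.ne', Real.rpow_one, Real.mul_rpow (by positivity) (by positivity),
    ← Real.rpow_mul hx.le, one_div_mul_cancel hq0.ne', Real.rpow_one, Real.mul_rpow (by positivity) (by positivity),
    Real.inv_rpow ht.le, ← Real.rpow_neg ht.le] at h5
  exact h5

theorem strong_discrete {d : ℕ} (hd : 1 ≤ d) {C0 κ : ℝ} (hC0 : 1 ≤ C0) (hκ : 0 < κ) (hκ1 : κ ≤ 1) {p : ℝ} (hp : 1 < p) :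
    ∃ B : ℝ, 0 ≤ B ∧ ∀ (m : Mdl d C0 κ) (f : ℕ → ℂ),
      ∑ x ∈ m.Om, ‖m.T m.Sf f x‖^p ≤ B * ∑ x ∈ m.Om, ‖f x‖^p := by
  obtain ⟨A0, hA0, h0⟩ := weak_type hd hC0 hκ hκ1 (q := (1+p)/2) (by linarith)
  obtain ⟨A1, hA1, h1⟩ := weak_type hd hC0 hκ hκ1 (q := 4*p) (by linarith)
  obtain ⟨B, hB, hm⟩ := marc (A := A0 + A1) hp (by positivity)
  refine ⟨B, hB, ?_⟩
  intro m f
  have hh := hm m.Om (fun f x => m.T m.Sf f x) ?_ ?_ ?_ (fun y => if y ∈ m.Om then f y else 0) ?_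
  · have e1 : ∀ x, m.T m.Sf (fun y => if y ∈ m.Om then f y else 0) x = m.T m.Sf f x := by
      intro x
      rw [Mdl.T, Mdl.T]
      apply Finset.sum_congr rfl
      intro s _
      apply Finset.sum_congr rfl
      intro y hy
      rw [if_pos hy]
    have e2 : ∑ x ∈ m.Om, ‖(if x ∈ m.Om then f x else 0)‖^p = ∑ x ∈ m.Om, ‖f x‖^p := by
      apply Finset.sum_congr rfl
      intro y hy
      rw [if_pos hy]
    rw [e2] at hh
    simpa only [e1] using hh
  · intro K g x
    simp only [Mdl.T]
    simp only [Finset.mul_sum]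
    rw [Finset.sum_comm (s := K)]
    apply Finset.sum_congr rfl
    intro s _
    rw [Finset.sum_comm]
  · intro c g x
    simp only [Mdl.T, Finset.mul_sum]
    apply Finset.sum_congr rfl
    intro s _
    apply Finset.sum_congr rfl
    intro y _
    ring
  · intro F hF f hf q hq t ht
    rcases hq with rfl | rfl
    · refine (h0 m F hF f hf t ht).trans ?_
      gcongr; linarith
    · refine (h1 m F hF f hf t ht).trans ?_
      gcongr; linarith
  · intro y hy
    rw [if_neg hy]

end

section

/-- continuous Haar kernel profile -/
def psi (a b : ℝ) : ℝ := if ⌊a⌋ = ⌊b⌋ then (-1:ℝ)^⌊2*a⌋ * ((-1:ℝ)^⌊2*b⌋ * (-1:ℝ)^⌊4*b⌋) else 0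

theorem floor_scale {M j : ℕ} (hj : j ≤ M) {v : ℝ} (hv : 0 ≤ v) : ⌊2^j * v⌋ = ((⌊2^M * v⌋₊ / 2^(M-j) : ℕ) : ℤ) := by
  have h1 : (2:ℝ)^j * v = (2^M * v) / ((2^(M-j) : ℕ) : ℝ) := by
    push_cast
    rw [eq_div_iff (by positivity), mul_right_comm, ← pow_add, Nat.add_sub_cancel' hj]
  rw [← Int.natCast_floor_eq_floor (by positivity), h1, Nat.floor_div_natCast]

theorem psi_disc {M k : ℕ} (hk : k + 2 ≤ M) {v w : ℝ} (hv : 0 ≤ v) (hw : 0 ≤ w) :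
    psi (2^k * v) (2^k * w) = if ⌊2^M * w⌋₊ ∈ cell (M-k) ⌊2^M * v⌋₊ then hh (M-k) ⌊2^M * v⌋₊ * gg (M-k) ⌊2^M * w⌋₊ else 0 := by
  rw [psi, show 2 * ((2:ℝ)^k * v) = 2^(k+1) * v by ring, show 2 * ((2:ℝ)^k * w) = 2^(k+1) * w by ring,
    show 4 * ((2:ℝ)^k * w) = 2^(k+2) * w by ring, floor_scale (by omega : k ≤ M) hv, floor_scale (by omega : k ≤ M) hw,
    floor_scale (by omega : k+1 ≤ M) hv, floor_scale (by omega : k+1 ≤ M) hw, floor_scale (by omega : k+2 ≤ M) hw]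
  simp only [zpow_natCast, Nat.cast_inj, mem_cell, hh, gg, sg]
  rw [show M - (k+1) = M - k - 1 by omega, show M - (k+2) = M - k - 2 by omega]
  congr 1
  exact propext eq_comm

theorem abs_psi_le (a b : ℝ) : |psi a b| ≤ 1 := by
  rw [psi]
  split_ifs
  · rw [abs_mul, abs_mul, abs_zpow, abs_zpow, abs_zpow]; simp
  · simp

theorem psi_shift (a b : ℝ) (n : ℤ) : psi (a + n) (b + n) = psi a b := by
  rw [psi, psi]
  have h1 : ∀ c : ℝ, (-1:ℝ)^⌊2*(c+n)⌋ = (-1:ℝ)^⌊2*c⌋ := by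
    intro c
    rw [show 2*(c+(n:ℝ)) = 2*c + ((2*n : ℤ):ℝ) by push_cast; ring, Int.floor_add_intCast, zpow_add₀ (by norm_num), zpow_mul]
    norm_num
  have h2 : ∀ c : ℝ, (-1:ℝ)^⌊4*(c+n)⌋ = (-1:ℝ)^⌊4*c⌋ := by
    intro c
    rw [show 4*(c+(n:ℝ)) = 4*c + ((2*(2*n) : ℤ):ℝ) by push_cast; ring, Int.floor_add_intCast, zpow_add₀ (by norm_num), zpow_mul]
    norm_num
  simp only [h1, h2, Int.floor_add_intCast, add_left_inj]

theorem psi_meas : Measurable fun z : ℝ × ℝ => psi z.1 z.2 := by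
  unfold psi
  have hz : ∀ g : ℝ × ℝ → ℤ, Measurable g → Measurable fun z => (-1:ℝ)^(g z) := fun g hg =>
    (measurable_from_top (f := fun n : ℤ => (-1:ℝ)^n)).comp hg
  apply Measurable.ite
  · exact measurableSet_eq_fun (Int.measurable_floor.comp measurable_fst) (Int.measurable_floor.comp measurable_snd)
  · refine (hz _ (Int.measurable_floor.comp (measurable_fst.const_mul 2))).mul ((hz _ (Int.measurable_floor.comp (measurable_snd.const_mul 2))).mul
      (hz _ (Int.measurable_floor.comp (measurable_snd.const_mul 4))))
  · exact measurable_const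

theorem step_mem {a h : ℝ} (hh : 0 < h) {n : ℕ} {x : ℝ} (hx : x ∈ Ico (a + n*h) (a + (n+1:ℕ)*h)) : ⌊(x-a)/h⌋₊ = n := by
  push_cast at hx
  rw [Nat.floor_eq_iff (div_nonneg (by have := hx.1; nlinarith [show 0 ≤ n*h by positivity]) hh.le), le_div_iff₀ hh, div_lt_iff₀ hh]
  constructor <;> [linarith [hx.1]; linarith [hx.2]]

theorem step_union {a h : ℝ} (hh : 0 < h) (n : ℕ) : Ico a (a + (n+1:ℕ)*h) = Ico a (a+n*h) ∪ Ico (a + n*h) (a + (n+1:ℕ)*h) := by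
  rw [Ico_union_Ico_eq_Ico]
  · have : 0 ≤ n*h := by positivity
    linarith
  · push_cast; nlinarith

theorem step_disj {a h : ℝ} (n : ℕ) : Disjoint (Ico a (a+n*h)) (Ico (a + n*h) (a + (n+1:ℕ)*h)) := by
  rw [Set.disjoint_left]; intro x h1 h2; exact absurd h1.2 (not_lt.2 h2.1)

theorem step_lint (a : ℝ) {h : ℝ} (hh : 0 < h) (u : ℕ → ℝ≥0∞) (L : ℕ) :
    ∫⁻ x in Ico a (a + L*h), u ⌊(x-a)/h⌋₊ = ENNReal.ofReal h * ∑ n ∈ Finset.range L, u n := by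
  induction L with
  | zero => simp
  | succ n ih =>
    rw [step_union hh, lintegral_union measurableSet_Ico (step_disj n), ih, Finset.sum_range_succ, mul_add]
    congr 1
    rw [setLIntegral_congr_fun measurableSet_Ico (fun x hx => by rw [step_mem hh hx]), setLIntegral_const, Real.volume_Ico]
    rw [mul_comm]; congr 2; push_cast; ring

theorem step_int (a : ℝ) {h : ℝ} (hh : 0 < h) (u : ℕ → ℂ) (L : ℕ) :
    IntegrableOn (fun x => u ⌊(x-a)/h⌋₊) (Ico a (a + L*h)) ∧
    ∫ x in Ico a (a + L*h), u ⌊(x-a)/h⌋₊ = (h:ℂ) * ∑ n ∈ Finset.range L, u n := by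
  induction L with
  | zero => simp
  | succ n ih =>
    have h1 : IntegrableOn (fun x => u ⌊(x-a)/h⌋₊) (Ico (a + n*h) (a + (n+1:ℕ)*h)) := by
      rw [integrableOn_congr_fun (g := fun _ => u n) (fun x hx => by simp only; rw [step_mem hh hx]) measurableSet_Ico]
      exact integrableOn_const (by simp)
    rw [step_union hh]
    refine ⟨ih.1.union h1, ?_⟩
    rw [setIntegral_union (step_disj n) measurableSet_Ico ih.1 h1, ih.2, Finset.sum_range_succ, mul_add]
    congr 1
    rw [setIntegral_congr_fun measurableSet_Ico (fun x hx => by rw [step_mem hh hx]), setIntegral_const, measureReal_def, Real.volume_Ico]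
    rw [ENNReal.toReal_ofReal (by push_cast; nlinarith)]
    rw [Complex.real_smul]
    congr 2; push_cast; ring

/-- exponential at real points -/
def er (q : Polynomial ℝ) (y : ℝ) : ℂ := Complex.exp (Complex.I * (q.eval y : ℝ))

theorem norm_er (q : Polynomial ℝ) (y : ℝ) : ‖er q y‖ = 1 := by
  rw [er, mul_comm, Complex.norm_exp_ofReal_mul_I]

theorem er_cont (q : Polynomial ℝ) : Continuous (er q) := by
  unfold er; fun_prop

theorem exp_sub_le (a b : ℝ) : ‖Complex.exp (Complex.I * (a:ℝ)) - Complex.exp (Complex.I * (b:ℝ))‖ ≤ |a - b| := by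
  have : Complex.exp (Complex.I * (a:ℝ)) - Complex.exp (Complex.I * (b:ℝ)) =
      Complex.exp (Complex.I * (b:ℝ)) * (Complex.exp (Complex.I * ((a-b:ℝ):ℂ)) - 1) := by
    rw [mul_sub, ← Complex.exp_add, mul_one]; congr 2; push_cast; ring
  rw [this, norm_mul, mul_comm Complex.I (b:ℂ), Complex.norm_exp_ofReal_mul_I, one_mul]
  exact Real.norm_exp_I_mul_ofReal_sub_one_le

/-- dyadic operator with parameters -/
def Dk (N : ℕ) (q : Polynomial ℝ) (f : ℝ → ℂ) (ρ τ x : ℝ) : ℂ :=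
  ∑ k ∈ Finset.range (N+1), (2:ℂ)^k * ∫ y in Icc (-4:ℝ) 4, (psi (2^k * (ρ*x-τ)) (2^k * (ρ*y-τ)) : ℂ) * (er q y * f y)

theorem sum_cell_int {p : Polynomial ℝ} {s z : ℕ} {η : ℝ}
    (h : ∀ x ∈ Ico (lo s z) (lo s z + 2^s), ∀ y ∈ Ico (lo s z) (lo s z + 2^s), |x - y| ≤ 1 → |p.eval x - p.eval y| ≤ η) :
    ‖∑ w ∈ cell s z, ex p w - ∫ x in Ico (lo s z) (lo s z + 2^s), Complex.exp (Complex.I * (p.eval x : ℝ))‖ ≤ η * 2^s := by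
  have h1 := step_int (lo s z) one_pos (fun n => er p (lo s z + n)) (2^s)
  have e1 : lo s z + ((2^s:ℕ):ℝ) * 1 = lo s z + 2^s := by push_cast; ring
  rw [e1] at h1
  have e2 : ∑ w ∈ cell s z, ex p w = ∫ x in Ico (lo s z) (lo s z + 2^s), er p (lo s z + ⌊(x - lo s z)/1⌋₊) := by
    rw [h1.2, cell, Finset.sum_Ico_eq_sum_range]
    simp only [Complex.ofReal_one, one_mul, add_tsub_cancel_left]
    apply Finset.sum_congr rfl
    intro n _
    rw [ex, er, lo]; push_cast; rfl
  rw [e2, ← integral_sub h1.1]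
  · have hv : volume.real (Ico (lo s z) (lo s z + 2^s)) = 2^s := by
      rw [measureReal_def, Real.volume_Ico, add_sub_cancel_left, ENNReal.toReal_ofReal (by positivity)]
    refine (norm_setIntegral_le_of_norm_le_const (C := η) (by rw [Real.volume_Ico]; exact ENNReal.ofReal_lt_top) ?_).trans (by rw [hv])
    intro x hx
    refine (exp_sub_le _ _).trans ?_
    rw [div_one]
    have h2 : 0 ≤ x - lo s z := by linarith [hx.1]
    have h3 := Nat.floor_le h2
    have h4 := Nat.lt_floor_add_one (x - lo s z)
    apply h _ ⟨by linarith [show (0:ℝ) ≤ ⌊x - lo s z⌋₊ by positivity], by linarith [hx.2]⟩ x hx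
    rw [abs_le]; constructor <;> linarith
  · have : Continuous fun x => Complex.exp (Complex.I * (p.eval x : ℝ)) := er_cont p
    exact (this.integrableOn_Icc).mono_set Ico_subset_Icc_self

/-- rescaled polynomial -/
def rs (ρ τ : ℝ) (M : ℕ) (q : Polynomial ℝ) : Polynomial ℝ :=
  q.comp (Polynomial.C (1/(ρ*2^M)) * Polynomial.X + Polynomial.C (τ/ρ))

theorem rs_eval (ρ τ : ℝ) (M : ℕ) (q : Polynomial ℝ) (x : ℝ) : (rs ρ τ M q).eval x = q.eval (τ/ρ + x * (1/(ρ*2^M))) := by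
  rw [rs]; simp; congr 1; ring

theorem rs_deg {ρ τ : ℝ} {M d : ℕ} {q : Polynomial ℝ} (h : q.natDegree ≤ d) : (rs ρ τ M q).natDegree ≤ d := by
  rw [rs]
  refine Polynomial.natDegree_comp_le.trans ?_
  have h1 : (Polynomial.C (1/(ρ*2^M)) * Polynomial.X + Polynomial.C (τ/ρ)).natDegree ≤ 1 := Polynomial.natDegree_linear_le
  calc _ ≤ q.natDegree * 1 := by gcongr
    _ ≤ d := by omega

theorem mk_model {d : ℕ} (hd : 1 ≤ d) {C κ : ℝ} (hC : 1 ≤ C) (hκ : 0 < κ) (hκ1 : κ ≤ 1)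
    (hv : ∀ q : Polynomial ℝ, q.natDegree ≤ d → ∀ a b : ℝ, a < b → ∀ R : ℝ, 1 ≤ R → R ≤ osc a b q →
      ‖∫ x in Ico a b, Complex.exp (Complex.I * (q.eval x : ℝ))‖ ≤ C * (b - a) * R^(-κ))
    {ρ τ L : ℝ} (hρ : 0 < ρ) (hL : 0 ≤ L) {ι : Type*} (q : ι → Polynomial ℝ) (hq : ∀ i, (q i).natDegree ≤ d)
    (hLip : ∀ i j, ∀ u ∈ Ico (τ/ρ) ((τ+1)/ρ), ∀ v ∈ Ico (τ/ρ) ((τ+1)/ρ), |(q i - q j).eval u - (q i - q j).eval v| ≤ L * |u - v|)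
    {N : ℕ} (hN : L * (1/ρ) ≤ 2^(N+2)) :
    ∀ᶠ M in atTop, N + 2 ≤ M ∧ ∀ sel : ℕ → ι, ∃ m : Mdl d (2*C) κ, m.M = M ∧ m.s0 = M - N - 2 ∧ ∀ x, m.Q x = rs ρ τ M (q (sel x)) := by
  have ht : Tendsto (fun M : ℕ => L * (1/ρ) * max 1 (L*(1/ρ)) * (1/2)^M) atTop (𝓝 (L * (1/ρ) * max 1 (L*(1/ρ)) * 0)) :=
    (tendsto_pow_atTop_nhds_zero_of_lt_one (by norm_num) (by norm_num)).const_mul _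
  rw [mul_zero] at ht
  filter_upwards [ht.eventually_le_const (show (0:ℝ) < 1 by norm_num), eventually_ge_atTop (N+2)] with M hM hMN
  refine ⟨hMN, fun sel => ?_⟩
  have hsub : ∀ x y, rs ρ τ M (q (sel x)) - rs ρ τ M (q (sel y)) = rs ρ τ M (q (sel x) - q (sel y)) := by
    intro x y; rw [rs, rs, rs, Polynomial.sub_comp]
  -- points
  have hpt : ∀ s z, s ≤ M → z < 2^M → ∀ x ∈ Ico (lo s z) (lo s z + 2^s), τ/ρ + x * (1/(ρ*2^M)) ∈ Ico (τ/ρ) ((τ+1)/ρ) := by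
    intro s z hs hz x hx
    have h0 : (0:ℝ) ≤ lo s z := by rw [lo]; positivity
    have h1 : lo s z + 2^s ≤ 2^M := by
      rw [lo]
      have h2 : z / 2^s < 2^(M-s) := by
        rw [Nat.div_lt_iff_lt_mul (by positivity), ← pow_add, Nat.sub_add_cancel hs]; exact hz
      have h3 : z / 2^s * 2^s + 2^s ≤ 2^M := by
        calc _ = (z/2^s + 1) * 2^s := by ring
          _ ≤ 2^(M-s) * 2^s := by gcongr; omega
          _ = 2^M := by rw [← pow_add, Nat.sub_add_cancel hs]
      exact_mod_cast h3
    have hx0 : 0 ≤ x := h0.trans hx.1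
    refine ⟨by linarith [show 0 ≤ x * (1/(ρ*2^M)) by positivity], ?_⟩
    have h4 : x < 2^M := by linarith [hx.2]
    have h5 : x * (1/(ρ*2^M)) < 1/ρ := by
      rw [mul_one_div, div_lt_div_iff₀ (by positivity) hρ]
      nlinarith
    rw [add_div]; linarith
  have hdiff : ∀ i j s z, s ≤ M → z < 2^M → ∀ x ∈ Ico (lo s z) (lo s z + 2^s), ∀ y ∈ Ico (lo s z) (lo s z + 2^s),
      |(rs ρ τ M (q i - q j)).eval x - (rs ρ τ M (q i - q j)).eval y| ≤ L * (1/ρ) * (1/2)^M * |x - y| := by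
    intro i j s z hs hz x hx y hy
    rw [rs_eval, rs_eval]
    refine (hLip i j _ (hpt s z hs hz x hx) _ (hpt s z hs hz y hy)).trans ?_
    rw [add_sub_add_left_eq_sub, ← sub_mul, abs_mul, abs_of_pos (show 0 < 1/(ρ*2^M) by positivity), one_div_pow]
    apply le_of_eq; field_simp
  have hosc : ∀ i j s z, s ≤ M → z < 2^M → os s z (rs ρ τ M (q i - q j)) ≤ L * (1/ρ) * (1/2)^M * 2^s := by
    intro i j s z hs hz
    apply osc_le _ (by positivity)
    intro x hx y hy
    refine (hdiff i j s z hs hz x hx y hy).trans ?_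
    gcongr
    rw [abs_le]; constructor <;> linarith [hx.1, hx.2, hy.1, hy.2]
  refine ⟨⟨M, M-N-2, fun x => rs ρ τ M (q (sel x)), fun x => rs_deg (hq _), ?_, ?_⟩, rfl, rfl, fun x => rfl⟩
  · intro x y z hz
    rw [hsub]
    refine (hosc _ _ _ _ (by omega) hz).trans ?_
    calc L * (1/ρ) * (1/2)^M * 2^(M-N-2) ≤ 2^(N+2) * (1/2)^M * 2^(M-N-2) := by gcongr
      _ = (1/2)^M * (2^(N+2) * 2^(M-N-2)) := by ring
      _ = 1 := by rw [← pow_add, show N+2+(M-N-2) = M by omega, ← mul_pow]; norm_num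
  · intro x y z s hz _ hs R hR hRo
    rw [hsub] at hRo ⊢
    have h1 := hv _ (rs_deg ((Polynomial.natDegree_sub_le _ _).trans (max_le (hq (sel x)) (hq (sel y))))) (lo s z) (lo s z + 2^s)
      (by linarith [show (0:ℝ) < 2^s by positivity]) R hR hRo
    have h2 := sum_cell_int (p := rs ρ τ M (q (sel x) - q (sel y))) (s := s) (z := z) (η := L * (1/ρ) * (1/2)^M) (by
      intro u hu v hv huv
      refine (hdiff _ _ s z hs hz u hu v hv).trans ?_
      exact mul_le_of_le_one_right (by positivity) huv)
    have hR0 : 0 < R := by linarith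
    have h3 : R ≤ max 1 (L * (1/ρ)) := by
      refine (hRo.trans (hosc _ _ _ _ hs hz)).trans (le_trans ?_ (le_max_right _ _))
      rw [mul_assoc]
      apply mul_le_of_le_one_right (by positivity)
      rw [one_div_pow, one_div, inv_mul_le_one₀ (by positivity)]
      gcongr; norm_num
    have h4 : L * (1/ρ) * (1/2)^M ≤ C * R^(-κ) := by
      have h5 : R^(-(1:ℝ)) ≤ R^(-κ) := Real.rpow_le_rpow_of_exponent_le hR (by linarith)
      rw [Real.rpow_neg_one] at h5
      have h6 : L * (1/ρ) * (1/2)^M ≤ R⁻¹ := by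
        rw [← one_div, le_div_iff₀ hR0]
        calc _ ≤ L * (1/ρ) * (1/2)^M * max 1 (L * (1/ρ)) := by gcongr
          _ = L * (1/ρ) * max 1 (L * (1/ρ)) * (1/2)^M := by ring
          _ ≤ 1 := hM
      have h7 : 0 ≤ R^(-κ) := by positivity
      nlinarith
    rw [add_sub_cancel_left] at h1
    calc ‖∑ w ∈ cell s z, ex (rs ρ τ M (q (sel x) - q (sel y))) w‖ ≤ _ := norm_le_norm_add_norm_sub' _ _
      _ ≤ C * 2^s * R^(-κ) + L * (1/ρ) * (1/2)^M * 2^s := add_le_add h1 h2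
      _ ≤ C * 2^s * R^(-κ) + C * R^(-κ) * 2^s := by gcongr
      _ = _ := by ring

end

section

/-- discrete sum with a single polynomial -/
def TM (M N : ℕ) (P : Polynomial ℝ) (F : ℕ → ℂ) (X : ℕ) : ℂ :=
  ∑ s ∈ Finset.Icc (M-N) M, ∑ y ∈ Finset.range (2^M),
    (if y ∈ cell s X then ((hh s X * gg s y / 2^s : ℝ) : ℂ) * ex P y else 0) * F y

theorem psi_off {k : ℕ} {v w : ℝ} (hv : v ∈ Ico (0:ℝ) 1) (hw : w ∉ Ico (0:ℝ) 1) : psi (2^k*v) (2^k*w) = 0 := by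
  rw [psi, if_neg]
  intro h
  have hk : (0:ℝ) < 2^k := by positivity
  have h1 : 0 ≤ ⌊2^k*v⌋ := Int.floor_nonneg.2 (mul_nonneg hk.le hv.1)
  have h2 : ⌊2^k*v⌋ < (2^k : ℤ) := by
    rw [Int.floor_lt]; push_cast; nlinarith [hv.2]
  rw [h] at h1 h2
  have h3 := Int.floor_nonneg.1 h1
  rw [Int.floor_lt] at h2; push_cast at h2
  exact hw ⟨nonneg_of_mul_nonneg_right h3 hk, by nlinarith⟩

theorem disc_eq {M k : ℕ} (hk : k + 2 ≤ M) {ρ τ x : ℝ} (hρ : 0 < ρ) (hx : 0 ≤ ρ*x-τ) (q : Polynomial ℝ) (f : ℝ → ℂ) :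
    (2:ℂ)^k * ∫ y in Ico (τ/ρ) ((τ+1)/ρ), (psi (2^k * (ρ*x-τ)) (2^k * (ρ*y-τ)) : ℂ) *
        (er q (τ/ρ + ⌊(y-τ/ρ)/(1/(ρ*2^M))⌋₊ * (1/(ρ*2^M))) * f (τ/ρ + ⌊(y-τ/ρ)/(1/(ρ*2^M))⌋₊ * (1/(ρ*2^M)))) =
      ((1/ρ:ℝ):ℂ) * ∑ y ∈ Finset.range (2^M), (if y ∈ cell (M-k) ⌊2^M * (ρ*x-τ)⌋₊ then
        ((hh (M-k) ⌊2^M * (ρ*x-τ)⌋₊ * gg (M-k) y / 2^(M-k) : ℝ) : ℂ) * ex (rs ρ τ M q) y else 0) * f (τ/ρ + y * (1/(ρ*2^M))) := by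
  have hh0 : 0 < 1/(ρ*2^M) := by positivity
  set X := ⌊2^M * (ρ*x-τ)⌋₊ with hX
  have key := (step_int (τ/ρ) hh0 (fun y => (if y ∈ cell (M-k) X then ((hh (M-k) X * gg (M-k) y : ℝ):ℂ) else 0) *
    (er q (τ/ρ + y * (1/(ρ*2^M))) * f (τ/ρ + y * (1/(ρ*2^M))))) (2^M)).2
  have eb : τ/ρ + ((2^M:ℕ):ℝ) * (1/(ρ*2^M)) = (τ+1)/ρ := by push_cast; field_simp
  rw [eb] at key
  refine (congrArg (fun z => (2:ℂ)^k * z) (Eq.trans ?_ key)).trans ?_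
  · apply setIntegral_congr_fun measurableSet_Ico
    intro y hy
    have hw : 0 ≤ ρ*y-τ := by
      have := hy.1; rw [div_le_iff₀ hρ] at this; linarith
    have e2 : 2^M * (ρ*y-τ) = (y-τ/ρ)/(1/(ρ*2^M)) := by field_simp
    have := psi_disc hk hx hw
    rw [e2, ← hX] at this
    simp only
    rw [this]
    congr 1
    split_ifs <;> simp
  rw [Finset.mul_sum, Finset.mul_sum, Finset.mul_sum]
  apply Finset.sum_congr rfl
  intro y _
  rw [er, ex, rs_eval]
  split_ifs
  · have : (2:ℂ)^M = 2^k * 2^(M-k) := by rw [← pow_add]; congr 1; omega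
    have h2 : (2:ℂ)^(M-k) ≠ 0 := pow_ne_zero _ two_ne_zero
    have h3 : (2:ℂ)^k ≠ 0 := pow_ne_zero _ two_ne_zero
    have h4 : (ρ:ℂ) ≠ 0 := by exact_mod_cast hρ.ne'
    push_cast
    rw [this]
    field_simp
  · simp

theorem Dk_conv {N : ℕ} {ρ τ x : ℝ} (hρ : 0 < ρ) (hsub : Ico (τ/ρ) ((τ+1)/ρ) ⊆ Icc (-4) 4) (hx : x ∈ Ico (τ/ρ) ((τ+1)/ρ))
    (q : Polynomial ℝ) {f : ℝ → ℂ} (hf : Continuous f) :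
    Tendsto (fun M : ℕ => ((1/ρ:ℝ):ℂ) * TM M N (rs ρ τ M q) (fun y => f (τ/ρ + y * (1/(ρ*2^M)))) ⌊2^M * (ρ*x-τ)⌋₊) atTop
      (𝓝 (Dk N q f ρ τ x)) := by
  have hI : ∀ {y}, y ∈ Ico (τ/ρ) ((τ+1)/ρ) ↔ ρ*y-τ ∈ Ico (0:ℝ) 1 := by
    intro y
    rw [mem_Ico, mem_Ico, div_le_iff₀ hρ, lt_div_iff₀ hρ]
    constructor <;> rintro ⟨h1, h2⟩ <;> constructor <;> linarith
  have hx' := hI.1 hx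
  have e0 : ∀ᶠ M in atTop, ∑ k ∈ Finset.range (N+1), (2:ℂ)^k * ∫ y in Ico (τ/ρ) ((τ+1)/ρ), (psi (2^k * (ρ*x-τ)) (2^k * (ρ*y-τ)) : ℂ) *
        (er q (τ/ρ + ⌊(y-τ/ρ)/(1/(ρ*2^M))⌋₊ * (1/(ρ*2^M))) * f (τ/ρ + ⌊(y-τ/ρ)/(1/(ρ*2^M))⌋₊ * (1/(ρ*2^M)))) =
      ((1/ρ:ℝ):ℂ) * TM M N (rs ρ τ M q) (fun y => f (τ/ρ + y * (1/(ρ*2^M)))) ⌊2^M * (ρ*x-τ)⌋₊ := by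
    filter_upwards [eventually_ge_atTop (N+2)] with M hM
    rw [TM, Finset.mul_sum]
    refine Finset.sum_bij' (fun k _ => M - k) (fun s _ => M - s) ?_ ?_ ?_ ?_ ?_
    · intro k hk; simp at hk ⊢; omega
    · intro k hk; simp at hk ⊢; omega
    · intro k hk; simp at hk ⊢; omega
    · intro k hk; simp at hk ⊢; omega
    · intro k hk
      simp at hk
      exact disc_eq (by omega) hρ hx'.1 q f
  refine Tendsto.congr' e0 ?_
  rw [Dk]
  apply tendsto_finsetSum
  intro k _
  apply Tendsto.const_mul
  have e1 : ∫ y in Icc (-4:ℝ) 4, (psi (2^k * (ρ*x-τ)) (2^k * (ρ*y-τ)) : ℂ) * (er q y * f y) =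
      ∫ y in Ico (τ/ρ) ((τ+1)/ρ), (psi (2^k * (ρ*x-τ)) (2^k * (ρ*y-τ)) : ℂ) * (er q y * f y) := by
    apply setIntegral_eq_of_subset_of_forall_sdiff_eq_zero measurableSet_Icc hsub
    intro y hy
    rw [psi_off hx' (fun h => hy.2 (hI.2 h))]; simp
  rw [e1]
  have hG : Continuous fun y => er q y * f y := (er_cont q).mul hf
  obtain ⟨B, hB⟩ := (isCompact_Icc (a := (-4:ℝ)) (b := 4)).exists_bound_of_continuousOn hG.continuousOn
  have hpos : ∀ M : ℕ, 0 < 1/(ρ*2^M) := fun M => by positivity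
  have hφ : ∀ M : ℕ, ∀ y ∈ Ico (τ/ρ) ((τ+1)/ρ), τ/ρ + ⌊(y-τ/ρ)/(1/(ρ*2^M))⌋₊ * (1/(ρ*2^M)) ∈ Ico (τ/ρ) ((τ+1)/ρ) ∧
      |τ/ρ + ⌊(y-τ/ρ)/(1/(ρ*2^M))⌋₊ * (1/(ρ*2^M)) - y| ≤ 1/(ρ*2^M) := by
    intro M y hy
    have h0 : 0 ≤ (y-τ/ρ)/(1/(ρ*2^M)) := div_nonneg (by linarith [hy.1]) (hpos M).le
    have h1 := Nat.floor_le h0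
    have h2 := Nat.lt_floor_add_one ((y-τ/ρ)/(1/(ρ*2^M)))
    rw [le_div_iff₀ (hpos M)] at h1
    rw [div_lt_iff₀ (hpos M)] at h2
    have h3 : 0 ≤ (⌊(y-τ/ρ)/(1/(ρ*2^M))⌋₊:ℝ) * (1/(ρ*2^M)) := mul_nonneg (Nat.cast_nonneg _) (hpos M).le
    refine ⟨⟨by linarith, by linarith [hy.2]⟩, ?_⟩
    rw [abs_le]; constructor <;> nlinarith [hpos M]
  have hlim : Tendsto (fun M : ℕ => 1/(ρ*2^M)) atTop (𝓝 0) := by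
    have := (tendsto_pow_atTop_nhds_zero_of_lt_one (r := (1/2:ℝ)) (by norm_num) (by norm_num)).const_mul (1/ρ)
    rw [mul_zero] at this
    refine this.congr fun M => ?_
    rw [one_div_pow]; field_simp
  apply tendsto_integral_of_dominated_convergence (fun _ => B)
  · intro M
    apply Measurable.aestronglyMeasurable
    apply Measurable.mul
    · apply Complex.measurable_ofReal.comp
      exact psi_meas.comp (f := fun y : ℝ => (2^k * (ρ*x-τ), 2^k * (ρ*y-τ))) (by fun_prop)
    · exact (measurable_from_top (f := fun n : ℕ => er q (τ/ρ + n * (1/(ρ*2^M))) * f (τ/ρ + n * (1/(ρ*2^M))))).comp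
        (Nat.measurable_floor.comp (by fun_prop))
  · exact integrableOn_const (by simp)
  · intro M
    filter_upwards [ae_restrict_mem measurableSet_Ico] with y hy
    rw [norm_mul, Complex.norm_real, Real.norm_eq_abs]
    calc _ ≤ 1 * B := by
          apply mul_le_mul (abs_psi_le _ _) (hB _ (hsub (hφ M y hy).1)) (norm_nonneg _) zero_le_one
      _ = B := one_mul _
  · filter_upwards [ae_restrict_mem measurableSet_Ico] with y hy
    apply Tendsto.const_mul
    refine (hG.tendsto y).comp ?_
    rw [tendsto_iff_dist_tendsto_zero]
    refine squeeze_zero (fun _ => dist_nonneg) (fun M => ?_) hlim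
    rw [Real.dist_eq]; exact (hφ M y hy).2

theorem DS {d : ℕ} (hd : 1 ≤ d) {p : ℝ} (hp : 1 < p) : ∃ B : ℝ, 0 ≤ B ∧ ∀ (ρ τ L : ℝ) (N : ℕ) (f : ℝ → ℂ) (ι : Type) [Finite ι] [Nonempty ι]
    (q : ι → Polynomial ℝ), ρ ∈ Icc (1/2:ℝ) 1 → Ico (τ/ρ) ((τ+1)/ρ) ⊆ Icc (-4) 4 → Continuous f → (∀ i, (q i).natDegree ≤ d) → 0 ≤ L →
    (∀ i j, ∀ u ∈ Icc (-4:ℝ) 4, ∀ v ∈ Icc (-4:ℝ) 4, |(q i - q j).eval u - (q i - q j).eval v| ≤ L * |u - v|) →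
    L * 2 ≤ 2^(N+2) →
    ∫⁻ x in Ico (τ/ρ) ((τ+1)/ρ), ⨆ i, ‖Dk N (q i) f ρ τ x‖ₑ^p ≤ ENNReal.ofReal B * ∫⁻ x in Ico (τ/ρ) ((τ+1)/ρ), ‖f x‖ₑ^p := by
  obtain ⟨C, κ, hC, hκ, hκ1, hv⟩ := vdc d hd
  obtain ⟨B, hB, hS⟩ := strong_discrete hd (by linarith : 1 ≤ 2*C) hκ hκ1 hp
  have hp0 : 0 < p := by linarith
  refine ⟨2^p * B, by positivity, ?_⟩
  intro ρ τ L N f ι _ _ q hρ hsub hf hq hL hLip hN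
  have hρ0 : 0 < ρ := by linarith [hρ.1]
  have hmod := mk_model hd hC hκ hκ1 hv (ρ := ρ) (τ := τ) hρ0 hL q hq (fun i j u hu v hv => hLip i j u (hsub hu) v (hsub hv))
    (N := N) (by
      have : 1/ρ ≤ 2 := by rw [div_le_iff₀ hρ0]; linarith [hρ.1]
      nlinarith)
  set F : ℕ → ℝ → ℝ≥0∞ := fun M x => ⨆ i, ‖((1/ρ:ℝ):ℂ) * TM M N (rs ρ τ M (q i)) (fun y => f (τ/ρ + y * (1/(ρ*2^M)))) ⌊2^M * (ρ*x-τ)⌋₊‖ₑ^p with hF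
  have hFm : ∀ M, Measurable (F M) := fun M =>
    (measurable_from_top (f := fun X : ℕ => ⨆ i, ‖((1/ρ:ℝ):ℂ) * TM M N (rs ρ τ M (q i)) (fun y => f (τ/ρ + y * (1/(ρ*2^M)))) X‖ₑ^p)).comp
      (Nat.measurable_floor.comp (by fun_prop))
  have hpos : ∀ M : ℕ, 0 < 1/(ρ*2^M) := fun M => by positivity
  have hle : ∀ x ∈ Ico (τ/ρ) ((τ+1)/ρ), ⨆ i, ‖Dk N (q i) f ρ τ x‖ₑ^p ≤ liminf (fun M => F M x) atTop := by
    intro x hx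
    apply iSup_le
    intro i
    have h1 := (ENNReal.continuous_rpow_const (y := p)).tendsto _ |>.comp ((continuous_enorm.tendsto _).comp (Dk_conv (N := N) hρ0 hsub hx (q i) hf))
    rw [← h1.liminf_eq]
    refine liminf_le_liminf ?_
    · filter_upwards with M
      exact le_iSup (fun i => ‖((1/ρ:ℝ):ℂ) * TM M N (rs ρ τ M (q i)) (fun y => f (τ/ρ + y * (1/(ρ*2^M)))) ⌊2^M * (ρ*x-τ)⌋₊‖ₑ^p) i
  have hlin : ∀ M (u : ℕ → ℝ≥0∞), ∫⁻ x in Ico (τ/ρ) ((τ+1)/ρ), u ⌊(x-τ/ρ)/(1/(ρ*2^M))⌋₊ = ENNReal.ofReal (1/(ρ*2^M)) * ∑ n ∈ Finset.range (2^M), u n := by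
    intro M u
    have := step_lint (τ/ρ) (hpos M) u (2^M)
    rwa [show τ/ρ + ((2^M:ℕ):ℝ) * (1/(ρ*2^M)) = (τ+1)/ρ by push_cast; field_simp] at this
  have hbd : ∀ᶠ M in atTop, ∫⁻ x in Ico (τ/ρ) ((τ+1)/ρ), F M x ≤ ENNReal.ofReal (2^p*B) *
      ∫⁻ x in Ico (τ/ρ) ((τ+1)/ρ), ‖f (τ/ρ + ⌊(x-τ/ρ)/(1/(ρ*2^M))⌋₊ * (1/(ρ*2^M)))‖ₑ^p := by
    filter_upwards [hmod] with M hM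
    obtain ⟨hMN, hM⟩ := hM
    set G : ℕ → ℂ := fun y => f (τ/ρ + y * (1/(ρ*2^M))) with hG
    have h1 := hlin M (fun X => ⨆ i, ‖((1/ρ:ℝ):ℂ) * TM M N (rs ρ τ M (q i)) G X‖ₑ^p)
    have h2 := hlin M (fun X => ‖G X‖ₑ^p)
    have e : ∀ x, 2^M * (ρ*x-τ) = (x-τ/ρ)/(1/(ρ*2^M)) := by intro x; field_simp
    simp only [hF, e]
    rw [h1, h2]
    choose sel hsel using fun X : ℕ => exists_eq_ciSup_of_finite (f := fun i => ‖((1/ρ:ℝ):ℂ) * TM M N (rs ρ τ M (q i)) G X‖ₑ^p)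
    obtain ⟨m, hmM, hms, hmQ⟩ := hM sel
    have hT : ∀ X, TM M N (rs ρ τ M (q (sel X))) G X = m.T m.Sf G X := by
      intro X
      rw [TM, Mdl.T, Mdl.Sf, Mdl.Om, hmM, hms, show M - N - 2 + 2 = M - N by omega]
      simp only [Mdl.ker, hmQ]
    have hS' := hS m G
    rw [mul_left_comm]
    gcongr
    simp only [← hsel, hT]
    rw [show m.Om = Finset.range (2^M) by rw [Mdl.Om, hmM]] at hS'
    have en : ∀ z : ℂ, ‖z‖ₑ^p = ENNReal.ofReal (‖z‖^p) := by
      intro z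
      rw [← ofReal_norm, ENNReal.ofReal_rpow_of_nonneg (norm_nonneg _) hp0.le]
    simp only [en]
    rw [← ENNReal.ofReal_sum_of_nonneg (fun _ _ => by positivity), ← ENNReal.ofReal_sum_of_nonneg (fun _ _ => by positivity),
      ← ENNReal.ofReal_mul (by positivity)]
    apply ENNReal.ofReal_le_ofReal
    calc ∑ X ∈ Finset.range (2^M), ‖((1/ρ:ℝ):ℂ) * m.T m.Sf G X‖^p = (1/ρ)^p * ∑ X ∈ Finset.range (2^M), ‖m.T m.Sf G X‖^p := by
          rw [Finset.mul_sum]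
          apply Finset.sum_congr rfl
          intro X _
          rw [norm_mul, Complex.norm_real, Real.norm_of_nonneg (by positivity), Real.mul_rpow (by positivity) (norm_nonneg _)]
      _ ≤ 2^p * (B * ∑ X ∈ Finset.range (2^M), ‖G X‖^p) := by
          have : 1/ρ ≤ 2 := by rw [div_le_iff₀ hρ0]; linarith [hρ.1]
          gcongr
      _ = _ := by ring
  have hlimf : Tendsto (fun M : ℕ => ENNReal.ofReal (2^p*B) *
      ∫⁻ x in Ico (τ/ρ) ((τ+1)/ρ), ‖f (τ/ρ + ⌊(x-τ/ρ)/(1/(ρ*2^M))⌋₊ * (1/(ρ*2^M)))‖ₑ^p) atTop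
      (𝓝 (ENNReal.ofReal (2^p*B) * ∫⁻ x in Ico (τ/ρ) ((τ+1)/ρ), ‖f x‖ₑ^p)) := by
    apply ENNReal.Tendsto.const_mul _ (Or.inr ENNReal.ofReal_ne_top)
    have hφ : ∀ M : ℕ, ∀ y ∈ Ico (τ/ρ) ((τ+1)/ρ), τ/ρ + ⌊(y-τ/ρ)/(1/(ρ*2^M))⌋₊ * (1/(ρ*2^M)) ∈ Ico (τ/ρ) ((τ+1)/ρ) ∧
        |τ/ρ + ⌊(y-τ/ρ)/(1/(ρ*2^M))⌋₊ * (1/(ρ*2^M)) - y| ≤ 1/(ρ*2^M) := by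
      intro M y hy
      have h0 : 0 ≤ (y-τ/ρ)/(1/(ρ*2^M)) := div_nonneg (by linarith [hy.1]) (hpos M).le
      have h1 := Nat.floor_le h0
      have h2 := Nat.lt_floor_add_one ((y-τ/ρ)/(1/(ρ*2^M)))
      rw [le_div_iff₀ (hpos M)] at h1
      rw [div_lt_iff₀ (hpos M)] at h2
      have h3 : 0 ≤ (⌊(y-τ/ρ)/(1/(ρ*2^M))⌋₊:ℝ) * (1/(ρ*2^M)) := mul_nonneg (Nat.cast_nonneg _) (hpos M).le
      refine ⟨⟨by linarith, by linarith [hy.2]⟩, ?_⟩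
      rw [abs_le]; constructor <;> nlinarith [hpos M]
    have hlim : Tendsto (fun M : ℕ => 1/(ρ*2^M)) atTop (𝓝 0) := by
      have := (tendsto_pow_atTop_nhds_zero_of_lt_one (r := (1/2:ℝ)) (by norm_num) (by norm_num)).const_mul (1/ρ)
      rw [mul_zero] at this
      refine this.congr fun M => ?_
      rw [one_div_pow]; field_simp
    obtain ⟨K, hK⟩ := (isCompact_Icc (a := (-4:ℝ)) (b := 4)).exists_bound_of_continuousOn hf.continuousOn
    apply tendsto_lintegral_of_dominated_convergence (fun _ => ENNReal.ofReal K ^ p)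
    · intro M
      exact (measurable_from_top (f := fun n : ℕ => ‖f (τ/ρ + n * (1/(ρ*2^M)))‖ₑ^p)).comp
        (Nat.measurable_floor.comp (by fun_prop))
    · intro M
      filter_upwards [ae_restrict_mem measurableSet_Ico] with y hy
      apply ENNReal.rpow_le_rpow _ hp0.le
      rw [← ofReal_norm]
      exact ENNReal.ofReal_le_ofReal (hK _ (hsub (hφ M y hy).1))
    · rw [lintegral_const]
      apply ENNReal.mul_ne_top
      · exact ENNReal.rpow_ne_top_of_nonneg hp0.le ENNReal.ofReal_ne_top
      · simp
    · filter_upwards [ae_restrict_mem measurableSet_Ico] with y hy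
      refine ((ENNReal.continuous_rpow_const (y := p)).tendsto _).comp (((continuous_enorm.comp hf).tendsto y).comp ?_)
      rw [tendsto_iff_dist_tendsto_zero]
      refine squeeze_zero (fun _ => dist_nonneg) (fun M => ?_) hlim
      rw [Real.dist_eq]; exact (hφ M y hy).2
  calc ∫⁻ x in Ico (τ/ρ) ((τ+1)/ρ), ⨆ i, ‖Dk N (q i) f ρ τ x‖ₑ^p ≤ ∫⁻ x in Ico (τ/ρ) ((τ+1)/ρ), liminf (fun M => F M x) atTop :=
        setLIntegral_mono' measurableSet_Ico hle
    _ ≤ liminf (fun M => ∫⁻ x in Ico (τ/ρ) ((τ+1)/ρ), F M x) atTop := lintegral_liminf_le hFm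
    _ ≤ liminf (fun M : ℕ => ENNReal.ofReal (2^p*B) *
      ∫⁻ x in Ico (τ/ρ) ((τ+1)/ρ), ‖f (τ/ρ + ⌊(x-τ/ρ)/(1/(ρ*2^M))⌋₊ * (1/(ρ*2^M)))‖ₑ^p) atTop := liminf_le_liminf hbd
    _ = _ := hlimf.liminf_eq

theorem Dk_shift (N : ℕ) (q : Polynomial ℝ) (f : ℝ → ℂ) (ρ τ x : ℝ) (m : ℤ) : Dk N q f ρ (τ + m) x = Dk N q f ρ τ x := by
  rw [Dk, Dk]
  apply Finset.sum_congr rfl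
  intro k _
  congr 1
  apply integral_congr_ae
  filter_upwards with y
  have h := psi_shift (2^k * (ρ*x-τ)) (2^k * (ρ*y-τ)) (-(2^k*m))
  rw [← h]
  push_cast
  congr 3 <;> ring

theorem DS3 {d : ℕ} (hd : 1 ≤ d) {p : ℝ} (hp : 1 < p) : ∃ B : ℝ, 0 ≤ B ∧ ∀ (ρ τ L : ℝ) (N : ℕ) (f : ℝ → ℂ) (ι : Type) [Finite ι] [Nonempty ι]
    (q : ι → Polynomial ℝ), ρ ∈ Icc (1/2:ℝ) 1 → τ ∈ Icc (0:ℝ) 1 → Continuous f → (∀ i, (q i).natDegree ≤ d) → 0 ≤ L →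
    (∀ i j, ∀ u ∈ Icc (-4:ℝ) 4, ∀ v ∈ Icc (-4:ℝ) 4, |(q i - q j).eval u - (q i - q j).eval v| ≤ L * |u - v|) →
    L * 2 ≤ 2^(N+2) →
    ∫⁻ x in Icc (-(1/2):ℝ) (1/2), ⨆ i, ‖Dk N (q i) f ρ τ x‖ₑ^p ≤ ENNReal.ofReal B * ∫⁻ x in Icc (-4) 4, ‖f x‖ₑ^p := by
  obtain ⟨B, hB, h⟩ := DS hd hp
  refine ⟨3*B, by positivity, ?_⟩
  intro ρ τ L N f ι _ _ q hρ hτ hf hq hL hLip hN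
  have hρ0 : 0 < ρ := by linarith [hρ.1]
  have hsub : ∀ m ∈ Finset.Icc (-2:ℤ) 0, Ico ((τ+m)/ρ) ((τ+m+1)/ρ) ⊆ Icc (-4) 4 := by
    intro m hm
    rw [Finset.mem_Icc] at hm
    have h1 : (-2:ℝ) ≤ m := by exact_mod_cast hm.1
    have h2 : (m:ℝ) ≤ 0 := by exact_mod_cast hm.2
    refine Ico_subset_Icc_self.trans (Icc_subset_Icc ?_ ?_)
    · rw [le_div_iff₀ hρ0]; nlinarith [hρ.1, hτ.1]
    · rw [div_le_iff₀ hρ0]; nlinarith [hρ.1, hτ.2]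
  have hcov : Icc (-(1/2):ℝ) (1/2) ⊆ ⋃ m ∈ Finset.Icc (-2:ℤ) 0, Ico ((τ+m)/ρ) ((τ+m+1)/ρ) := by
    intro x hx
    have a1 : -(1/2) ≤ ρ*x := by nlinarith [hρ.1, hρ.2, hx.1]
    have a2 : ρ*x ≤ 1/2 := by nlinarith [hρ.1, hρ.2, hx.2]
    simp only [mem_iUnion]
    refine ⟨⌊ρ*x-τ⌋, ?_, ?_⟩
    · rw [Finset.mem_Icc]
      constructor
      · rw [Int.le_floor]; push_cast; linarith [hτ.2]
      · rw [← Int.lt_add_one_iff, Int.floor_lt]; push_cast; linarith [hτ.1]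
    · have := Int.floor_le (ρ*x-τ)
      have := Int.lt_floor_add_one (ρ*x-τ)
      constructor
      · rw [div_le_iff₀ hρ0]; linarith
      · rw [lt_div_iff₀ hρ0]; linarith
  calc ∫⁻ x in Icc (-(1/2):ℝ) (1/2), ⨆ i, ‖Dk N (q i) f ρ τ x‖ₑ^p
      ≤ ∫⁻ x in ⋃ m ∈ Finset.Icc (-2:ℤ) 0, Ico ((τ+m)/ρ) ((τ+m+1)/ρ), ⨆ i, ‖Dk N (q i) f ρ τ x‖ₑ^p := lintegral_mono_set hcov
    _ ≤ ∑ m ∈ Finset.Icc (-2:ℤ) 0, ∫⁻ x in Ico ((τ+m)/ρ) ((τ+m+1)/ρ), ⨆ i, ‖Dk N (q i) f ρ τ x‖ₑ^p := by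
        have : ∀ S : Finset ℤ, ∫⁻ x in ⋃ m ∈ S, Ico ((τ+m)/ρ) ((τ+m+1)/ρ), ⨆ i, ‖Dk N (q i) f ρ τ x‖ₑ^p ≤
            ∑ m ∈ S, ∫⁻ x in Ico ((τ+m)/ρ) ((τ+m+1)/ρ), ⨆ i, ‖Dk N (q i) f ρ τ x‖ₑ^p := by
          intro S
          induction S using Finset.induction_on with
          | empty => simp
          | insert a S ha ih =>
            rw [Finset.set_biUnion_insert, Finset.sum_insert ha]
            exact (lintegral_union_le _ _ _).trans (by gcongr)
        exact this _
    _ ≤ ∑ m ∈ Finset.Icc (-2:ℤ) 0, ENNReal.ofReal B * ∫⁻ x in Icc (-4) 4, ‖f x‖ₑ^p := by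
        apply Finset.sum_le_sum
        intro m hm
        have := h ρ (τ+m) L N f ι q hρ (hsub m hm) hf hq hL hLip hN
        simp only [Dk_shift] at this
        refine this.trans ?_
        gcongr
        exact hsub m hm
    _ = _ := by
        rw [Finset.sum_const, show (Finset.Icc (-2:ℤ) 0).card = 3 by rfl, nsmul_eq_mul, ENNReal.ofReal_mul (by norm_num), mul_assoc]
        norm_num

end

section

/-- averaged profile -/
def Lam (s : ℝ) : ℝ := ∫ a in (0:ℝ)..1, psi a (a+s)

theorem psi_meas1 (s : ℝ) : Measurable fun a => psi a (a+s) :=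
  psi_meas.comp (f := fun a : ℝ => (a, a+s)) (by fun_prop)

theorem psi_ii (s u v : ℝ) : IntervalIntegrable (fun a => psi a (a+s)) volume u v := by
  rw [intervalIntegrable_iff]
  apply Measure.integrableOn_of_bounded (M := 1)
  · simp
  · exact (psi_meas1 s).aestronglyMeasurable
  · filter_upwards with a
    exact abs_psi_le _ _

theorem psi_per (s : ℝ) : Function.Periodic (fun a => psi a (a+s)) 1 := by
  intro a
  have := psi_shift a (a+s) 1
  simp only
  rw [← this]; push_cast; congr 1; ring

theorem Lam_meas : Measurable Lam := by
  unfold Lam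
  simp only [intervalIntegral.integral_of_le zero_le_one]
  have h : StronglyMeasurable (fun z : ℝ × ℝ => psi z.2 (z.2 + z.1)) :=
    (psi_meas.comp (f := fun z : ℝ × ℝ => (z.2, z.2+z.1)) (by fun_prop)).stronglyMeasurable
  exact (h.integral_prod_right (ν := volume.restrict (Ioc (0:ℝ) 1))).measurable

theorem abs_Lam (s : ℝ) : |Lam s| ≤ 1 := by
  have := intervalIntegral.norm_integral_le_of_norm_le_const (a := 0) (b := 1) (f := fun a => psi a (a+s)) (C := 1)
    (fun a _ => abs_psi_le _ _)
  simpa [Lam] using this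

theorem Lam_zero {s : ℝ} (hs : 1 ≤ |s|) : Lam s = 0 := by
  rw [Lam]
  have : ∀ a, psi a (a+s) = 0 := by
    intro a
    rw [psi, if_neg]
    intro h
    have h1 := Int.abs_sub_lt_one_of_floor_eq_floor h
    rw [show a - (a+s) = -s by ring, abs_neg] at h1
    linarith
  simp [this]

theorem psi_neg {a b : ℝ} (ha : ∀ n : ℤ, 4*a ≠ n) (hb : ∀ n : ℤ, 4*b ≠ n) : psi (-a) (-b) = - psi a b := by
  have hf : ∀ c : ℝ, (∀ n : ℤ, c ≠ n) → ⌊-c⌋ = -⌊c⌋ - 1 := by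
    intro c hc
    rw [Int.floor_neg]
    have h1 : ⌈c⌉ = ⌊c⌋ + 1 := by
      rw [Int.ceil_eq_iff]
      push_cast
      refine ⟨?_, (Int.lt_floor_add_one c).le⟩
      have := Int.floor_le c
      have h3 := hc ⌊c⌋
      rcases this.lt_or_eq with h | h
      · linarith
      · exact absurd h.symm h3
    rw [h1]; ring
  have q1 : ∀ c : ℝ, (∀ n : ℤ, 4*c ≠ n) → (∀ n : ℤ, c ≠ n) ∧ (∀ n : ℤ, 2*c ≠ n) := by
    intro c hc
    constructor
    · intro n h; apply hc (4*n); rw [h]; push_cast; ring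
    · intro n h; apply hc (2*n); push_cast; rw [← h]; ring
  have q2 : ∀ n : ℤ, (-1:ℝ)^(-n-1) = - (-1:ℝ)^n := by
    intro n
    rw [zpow_sub₀ (by norm_num), zpow_neg, zpow_one, div_neg, div_one]
    rcases Int.even_or_odd n with h | h
    · rw [h.neg_one_zpow]; simp
    · rw [h.neg_one_zpow]; norm_num
  rw [psi, psi, mul_neg, mul_neg, mul_neg, hf a (q1 a ha).1, hf b (q1 b hb).1, hf _ (q1 a ha).2, hf _ (q1 b hb).2, hf _ hb, q2, q2, q2]
  by_cases h : ⌊a⌋ = ⌊b⌋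
  · rw [if_pos (by rw [h]), if_pos h]; ring
  · rw [if_neg (by omega), if_neg h]; simp

theorem Lam_odd (s : ℝ) : Lam (-s) = - Lam s := by
  have hbad : ∀ t : ℝ, ∀ᵐ a : ℝ, ∀ n : ℤ, 4*(a+t) ≠ n := by
    intro t
    rw [ae_all_iff]
    intro n
    filter_upwards [compl_mem_ae_iff.2 (measure_singleton ((n:ℝ)/4 - t))] with a ha h
    apply ha
    rw [mem_singleton_iff, ← h]; ring
  have e1 : Lam (-s) = ∫ a in (0:ℝ)..1, - psi (-a) (-a+s) := by
    rw [Lam]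
    apply intervalIntegral.integral_congr_ae
    filter_upwards [hbad 0, hbad (-s)] with a h1 h2 _
    rw [add_zero] at h1
    rw [show -a+s = -(a+-s) by ring, psi_neg h1 h2, neg_neg]
  rw [e1, intervalIntegral.integral_neg, intervalIntegral.integral_comp_neg (fun a => psi a (a+s)), Lam]
  have := (psi_per s).intervalIntegral_add_eq (-1) 0
  simp only [zero_add] at this
  rw [neg_zero, ← this]; norm_num

theorem Lam_avg (k : ℕ) (A B : ℝ) : ∫ τ in (0:ℝ)..1, psi (A - 2^k*τ) (B - 2^k*τ) = Lam (B - A) := by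
  have e : ∀ τ, psi (A - 2^k*τ) (B - 2^k*τ) = (fun a => psi a (a + (B-A))) (A - 2^k*τ) := by
    intro τ; simp only; congr 1; ring
  simp only [e]
  have h2 : (2:ℝ)^k ≠ 0 := by positivity
  rw [intervalIntegral.integral_comp_sub_mul (fun a => psi a (a + (B-A))) h2]
  have h := (psi_per (B-A)).intervalIntegral_add_zsmul_eq (2^k) (A - 2^k) (fun u v => psi_ii _ u v)
  simp only [zsmul_eq_mul, mul_one] at h
  push_cast at h
  rw [mul_one, mul_zero, sub_zero]
  rw [show A - 2^k + 2^k = A by ring] at h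
  rw [h, Lam, smul_eq_mul]
  have h5 := (psi_per (B-A)).intervalIntegral_add_eq (A - 2^k) 0
  simp only [zero_add] at h5
  rw [h5]
  field_simp

theorem Lam_ii (u v : ℝ) : IntervalIntegrable Lam volume u v := by
  rw [intervalIntegrable_iff]
  apply Measure.integrableOn_of_bounded (M := 1)
  · simp
  · exact Lam_meas.aestronglyMeasurable
  · filter_upwards with a
    exact abs_Lam _

/-- primitive -/
def LL (v : ℝ) : ℝ := ∫ s in (0:ℝ)..v, Lam s
def cc : ℝ := LL 1

theorem LL_even (v : ℝ) : LL (-v) = LL v := by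
  rw [LL, LL]
  have := intervalIntegral.integral_comp_neg (a := 0) (b := v) Lam
  rw [neg_zero] at this
  rw [intervalIntegral.integral_symm, ← this]
  simp only [Lam_odd]
  rw [intervalIntegral.integral_neg, neg_neg]

theorem LL_big {v : ℝ} (hv : 1 ≤ |v|) : LL v = cc := by
  wlog h0 : 0 ≤ v generalizing v with H
  · rw [← LL_even]; exact H (by rwa [abs_neg]) (by linarith)
  rw [abs_of_nonneg h0] at hv
  rw [LL, cc, LL, ← intervalIntegral.integral_add_adjacent_intervals (Lam_ii 0 1) (Lam_ii 1 v)]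
  have : ∫ s in (1:ℝ)..v, Lam s = ∫ s in (1:ℝ)..v, 0 := by
    apply intervalIntegral.integral_congr
    intro s hs
    rw [uIcc_of_le hv] at hs
    exact Lam_zero (by rw [abs_of_nonneg (by linarith [hs.1])]; exact hs.1)
  rw [this]; simp

theorem abs_LL (v : ℝ) : |LL v| ≤ |v| := by
  have := intervalIntegral.norm_integral_le_of_norm_le_const (a := 0) (b := v) (f := Lam) (C := 1)
    (fun a _ => abs_Lam _)
  simpa [LL] using this

theorem abs_LL_one (v : ℝ) : |LL v| ≤ 1 := by
  by_cases h : 1 ≤ |v|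
  · rw [LL_big h, cc]; simpa using abs_LL 1
  · exact (abs_LL v).trans (not_le.1 h).le

theorem LL_cont : Continuous LL := intervalIntegral.continuous_primitive (fun a b => Lam_ii a b) 0

/-- averaged kernel -/
def KN (N : ℕ) (w : ℝ) : ℝ := ∑ k ∈ Finset.range (N+1), 2^k * ∫ ρ in (1/2:ℝ)..1, Lam (2^k * (ρ*w))

theorem mul_KN (N : ℕ) (w : ℝ) : w * KN N w = LL (2^N*w) - LL (w/2) := by
  have h1 : ∀ k : ℕ, w * (2^k * ∫ ρ in (1/2:ℝ)..1, Lam (2^k * (ρ*w))) = LL (2^k*w) - LL (2^k*w/2) := by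
    intro k
    have := intervalIntegral.mul_integral_comp_mul_left (a := 1/2) (b := 1) (f := Lam) (2^k*w)
    rw [LL, LL, intervalIntegral.integral_interval_sub_left (Lam_ii _ _) (Lam_ii _ _)]
    rw [show 2^k*w*(1/2) = 2^k*w/2 by ring, mul_one] at this
    rw [← this, mul_left_comm, ← mul_assoc]
    simp only [show ∀ ρ : ℝ, 2^k * w * ρ = 2^k * (ρ*w) by intro ρ; ring]
  rw [KN, Finset.mul_sum]
  simp only [h1]
  induction N with
  | zero => simp
  | succ n ih =>
    rw [Finset.sum_range_succ, ih]
    rw [show 2^(n+1)*w/2 = 2^n*w by ring]; ring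

theorem KN_odd (N : ℕ) (w : ℝ) : KN N (-w) = - KN N w := by
  simp only [KN, mul_neg, Lam_odd, intervalIntegral.integral_neg, Finset.sum_neg_distrib]

end

section

theorem psi_val {a b : ℝ} (ha : a ∈ Ico (0:ℝ) 1) {i j : ℕ} (hi : ⌊2*a⌋ = (i:ℤ)) (hj : j < 4) (hb : b ∈ Ioo ((j:ℝ)/4) ((j+1:ℝ)/4)) :
    psi a b = (-1)^i * ((-1)^(j/2) * (-1)^j) := by
  have hj' : (j:ℝ) ≤ 3 := by exact_mod_cast (show j ≤ 3 by omega)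
  have h4 : ⌊4*b⌋ = (j:ℤ) := by
    rw [Int.floor_eq_iff]; push_cast; constructor <;> linarith [hb.1, hb.2]
  have h2 : ⌊2*b⌋ = ((j/2:ℕ):ℤ) := by
    rw [Int.floor_eq_iff]
    have := hb.1
    have := hb.2
    interval_cases j <;> norm_num at * <;> constructor <;> linarith
  have hb0 : ⌊b⌋ = 0 := by
    rw [Int.floor_eq_iff]; push_cast
    constructor <;> linarith [hb.1, hb.2, show (0:ℝ) ≤ j by positivity]
  have ha0 : ⌊a⌋ = 0 := by
    rw [Int.floor_eq_iff]; push_cast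
    constructor <;> linarith [ha.1, ha.2]
  rw [psi, if_pos (by rw [ha0, hb0]), hi, h2, h4, zpow_natCast, zpow_natCast, zpow_natCast]

theorem psi_piece {a : ℝ} (ha : a ∈ Ico (0:ℝ) 1) {i j : ℕ} (hi : ⌊2*a⌋ = (i:ℤ)) (hj : j < 4) {u v : ℝ} (huv : u ≤ v)
    (hu : (j:ℝ)/4 ≤ u) (hv : v ≤ (j+1:ℝ)/4) : ∫ b in u..v, psi a b = (-1)^i * ((-1)^(j/2) * (-1)^j) * (v - u) := by
  rw [intervalIntegral.integral_congr_Ioo_of_le (g := fun _ => (-1)^i * ((-1)^(j/2) * (-1)^j)) huv]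
  · simp; ring
  · intro b hb
    exact psi_val ha hi hj ⟨by linarith [hb.1], by linarith [hb.2]⟩

theorem psi_ii2 (a u v : ℝ) : IntervalIntegrable (fun b => psi a b) volume u v := by
  rw [intervalIntegrable_iff]
  apply Measure.integrableOn_of_bounded (M := 1)
  · simp
  · exact (psi_meas.comp (f := fun b : ℝ => (a, b)) (by fun_prop)).aestronglyMeasurable
  · filter_upwards with b
    exact abs_psi_le _ _

theorem psi_tail {a : ℝ} (ha : a ∈ Ico (0:ℝ) 1) : ∫ s in (0:ℝ)..1, psi a (a+s) = ∫ b in a..1, psi a b := by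
  rw [intervalIntegral.integral_comp_add_left (fun b => psi a b), add_zero,
    ← intervalIntegral.integral_add_adjacent_intervals (psi_ii2 a a 1) (psi_ii2 a 1 (a+1))]
  have : ∫ b in (1:ℝ)..(a+1), psi a b = ∫ b in (1:ℝ)..(a+1), 0 := by
    apply intervalIntegral.integral_congr_Ioo_of_le (by linarith [ha.1])
    intro b hb
    simp only [psi]
    rw [if_neg]
    have h1 : ⌊a⌋ < 1 := by rw [Int.floor_lt]; push_cast; exact ha.2
    have h2 : 1 ≤ ⌊b⌋ := by rw [Int.le_floor]; push_cast; exact hb.1.le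
    omega
  rw [this]; simp

theorem psi_tot {a : ℝ} {i j : ℕ} (hi : ⌊2*a⌋ = (i:ℤ)) (hj : j < 4) (ha : a ∈ Ioo ((j:ℝ)/4) ((j+1:ℝ)/4)) :
    ∫ s in (0:ℝ)..1, psi a (a+s) = (-1)^i * (((-1)^(j/2) * (-1)^j) * ((j+1:ℝ)/4 - a) + ∑ l ∈ Finset.Ico (j+1) 4, (-1)^(l/2) * (-1)^l / 4) := by
  have hj' : (j:ℝ) ≤ 3 := by exact_mod_cast (show j ≤ 3 by omega)
  have ha' : a ∈ Ico (0:ℝ) 1 := ⟨by linarith [ha.1, show (0:ℝ) ≤ j by positivity], by linarith [ha.2]⟩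
  rw [psi_tail ha']
  have h1 : ∀ l : ℕ, l < 4 → ∫ b in ((l:ℝ)/4)..((l+1:ℕ):ℝ)/4, psi a b = (-1)^i * ((-1)^(l/2) * (-1)^l / 4) := by
    intro l hl
    rw [psi_piece ha' hi hl (by push_cast; linarith) le_rfl (by push_cast; rfl)]
    push_cast; ring
  have h2 := intervalIntegral.sum_integral_adjacent_intervals_Ico (f := psi a) (μ := volume) (a := fun l : ℕ => (l:ℝ)/4) (m := j+1) (n := 4) (by omega)
    (fun k _ => psi_ii2 a _ _)
  rw [← intervalIntegral.integral_add_adjacent_intervals (psi_ii2 a a (((j+1:ℕ):ℝ)/4)) (psi_ii2 a _ 1)]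
  norm_num at h2
  rw [psi_piece ha' hi hj (by push_cast; linarith [ha.2]) ha.1.le (by push_cast; rfl)]
  push_cast
  rw [← h2, mul_add, Finset.mul_sum]
  congr 1
  · ring
  · apply Finset.sum_congr rfl
    intro l hl
    have := h1 l (Finset.mem_Ico.1 hl).2
    push_cast at this
    exact this

theorem cc_val : cc = -(1/8) := by
  rw [cc, LL]
  unfold Lam
  have hIntg : Integrable (Function.uncurry fun s a : ℝ => psi a (a+s)) ((volume.restrict (Ioc (0:ℝ) 1)).prod (volume.restrict (Ioc (0:ℝ) 1))) := by
    refine Integrable.of_bound (C := 1) ?_ ?_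
    · exact (psi_meas.comp (f := fun z : ℝ × ℝ => (z.2, z.2+z.1)) (by fun_prop)).aestronglyMeasurable
    · filter_upwards with z
      exact abs_psi_le _ _
  have h0 : ∫ s in (0:ℝ)..1, ∫ a in (0:ℝ)..1, psi a (a+s) = ∫ a in (0:ℝ)..1, ∫ s in (0:ℝ)..1, psi a (a+s) := by
    simp only [intervalIntegral.integral_of_le zero_le_one]
    exact integral_integral_swap hIntg
  rw [h0]
  have hii : ∀ u v, 0 ≤ u → v ≤ 1 → u ≤ v → IntervalIntegrable (fun a => ∫ s in (0:ℝ)..1, psi a (a+s)) volume u v := by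
    intro u v hu hv huv
    rw [intervalIntegrable_iff, uIoc_of_le huv]
    have := hIntg.integral_prod_right
    simp only [Function.uncurry] at this
    simp only [intervalIntegral.integral_of_le zero_le_one]
    exact IntegrableOn.mono_set this (Ioc_subset_Ioc hu hv)
  rw [← intervalIntegral.integral_add_adjacent_intervals (hii 0 (1/4) (by norm_num) (by norm_num) (by norm_num)) (hii (1/4) 1 (by norm_num) (by norm_num) (by norm_num)),
    ← intervalIntegral.integral_add_adjacent_intervals (hii (1/4) (1/2) (by norm_num) (by norm_num) (by norm_num)) (hii (1/2) 1 (by norm_num) (by norm_num) (by norm_num)),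
    ← intervalIntegral.integral_add_adjacent_intervals (hii (1/2) (3/4) (by norm_num) (by norm_num) (by norm_num)) (hii (3/4) 1 (by norm_num) (by norm_num) (by norm_num))]
  rw [intervalIntegral.integral_congr_Ioo_of_le (a := 0) (b := 1/4) (g := fun a => -a) (by norm_num),
    intervalIntegral.integral_congr_Ioo_of_le (a := 1/4) (b := 1/2) (g := fun a => a-1/2) (by norm_num),
    intervalIntegral.integral_congr_Ioo_of_le (a := 1/2) (b := 3/4) (g := fun a => 1/2-a) (by norm_num),
    intervalIntegral.integral_congr_Ioo_of_le (a := 3/4) (b := 1) (g := fun a => a-1) (by norm_num)]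
  · have hc : ∀ u v w : ℝ, IntervalIntegrable (fun _ : ℝ => w) volume u v := fun u v w => intervalIntegrable_const
    have hx : ∀ u v : ℝ, IntervalIntegrable (fun x : ℝ => x) volume u v := fun u v => continuous_id.intervalIntegrable u v
    rw [intervalIntegral.integral_neg, intervalIntegral.integral_sub (hx _ _) (hc _ _ _), intervalIntegral.integral_sub (hx _ _) (hc _ _ _),
      intervalIntegral.integral_sub (hc _ _ _) (hx _ _)]
    simp only [integral_id, intervalIntegral.integral_const, smul_eq_mul]
    norm_num
  · intro a ha
    simp only
    rw [psi_tot (i := 1) (j := 3) (by rw [Int.floor_eq_iff]; push_cast; constructor <;> linarith [ha.1, ha.2]) (by norm_num) (by norm_num; exact ⟨ha.1, ha.2⟩)]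
    norm_num
  · intro a ha
    simp only
    rw [psi_tot (i := 1) (j := 2) (by rw [Int.floor_eq_iff]; push_cast; constructor <;> linarith [ha.1, ha.2]) (by norm_num) (by norm_num; exact ⟨ha.1, ha.2⟩)]
    norm_num [Finset.sum_Ico_succ_top]; ring
  · intro a ha
    simp only
    rw [psi_tot (i := 0) (j := 1) (by rw [Int.floor_eq_iff]; push_cast; constructor <;> linarith [ha.1, ha.2]) (by norm_num) (by norm_num; exact ⟨ha.1, ha.2⟩)]
    norm_num [Finset.sum_Ico_succ_top]
  · intro a ha
    simp only
    rw [psi_tot (i := 0) (j := 0) (by rw [Int.floor_eq_iff]; push_cast; constructor <;> linarith [ha.1, ha.2]) (by norm_num) (by norm_num; exact ⟨ha.1, ha.2⟩)]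
    norm_num [Finset.sum_Ico_succ_top]; ring

end

section

/-- averaging measure -/
def mu : Measure (ℝ × ℝ) := (volume.restrict (Icc (1/2:ℝ) 1)).prod (volume.restrict (Icc (0:ℝ) 1))

instance : IsFiniteMeasure mu := by unfold mu; infer_instance

theorem mu_univ : mu univ ≤ 1 := by
  rw [mu, ← univ_prod_univ, Measure.prod_prod]
  simp

theorem mu_ae : ∀ᵐ z ∂mu, z.1 ∈ Icc (1/2:ℝ) 1 ∧ z.2 ∈ Icc (0:ℝ) 1 := by
  rw [mu, Measure.prod_restrict]
  filter_upwards [ae_restrict_mem (measurableSet_Icc.prod measurableSet_Icc)] with z hz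
  exact hz

theorem Dk_meas (N : ℕ) (q : Polynomial ℝ) {f : ℝ → ℂ} (hf : Continuous f) :
    Measurable fun u : ℝ × (ℝ × ℝ) => Dk N q f u.2.1 u.2.2 u.1 := by
  unfold Dk
  apply Finset.measurable_sum
  intro k _
  apply Measurable.const_mul
  have h : StronglyMeasurable (fun v : (ℝ × (ℝ × ℝ)) × ℝ => (psi (2^k * (v.1.2.1*v.1.1-v.1.2.2)) (2^k * (v.1.2.1*v.2-v.1.2.2)) : ℂ) * (er q v.2 * f v.2)) := by
    apply Measurable.stronglyMeasurable
    apply Measurable.mul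
    · exact Complex.measurable_ofReal.comp (psi_meas.comp
        (f := fun v : (ℝ × (ℝ × ℝ)) × ℝ => (2^k * (v.1.2.1*v.1.1-v.1.2.2), 2^k * (v.1.2.1*v.2-v.1.2.2))) (by fun_prop))
    · exact (((er_cont q).mul hf).comp continuous_snd).measurable
  exact (h.integral_prod_right (ν := volume.restrict (Icc (-4:ℝ) 4))).measurable

theorem psi_int_mu (k : ℕ) (x y : ℝ) : ∫ z, psi (2^k * (z.1*x-z.2)) (2^k * (z.1*y-z.2)) ∂mu = ∫ ρ in (1/2:ℝ)..1, Lam (2^k * (ρ*(y-x))) := by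
  have hm : Measurable fun z : ℝ × ℝ => psi (2^k * (z.1*x-z.2)) (2^k * (z.1*y-z.2)) :=
    psi_meas.comp (f := fun z : ℝ × ℝ => (2^k * (z.1*x-z.2), 2^k * (z.1*y-z.2))) (by fun_prop)
  have hi : Integrable (fun z : ℝ × ℝ => psi (2^k * (z.1*x-z.2)) (2^k * (z.1*y-z.2))) mu :=
    Integrable.of_bound (C := 1) hm.aestronglyMeasurable (by filter_upwards with z; exact abs_psi_le _ _)
  rw [mu] at hi ⊢
  rw [integral_prod _ hi, intervalIntegral.integral_of_le (by norm_num), integral_Icc_eq_integral_Ioc]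
  apply integral_congr_ae
  filter_upwards with ρ
  rw [integral_Icc_eq_integral_Ioc, ← intervalIntegral.integral_of_le zero_le_one]
  have := Lam_avg k (2^k*(ρ*x)) (2^k*(ρ*y))
  simp only [← mul_sub] at this
  exact this

theorem Dk_avg (N : ℕ) (q : Polynomial ℝ) {f : ℝ → ℂ} (hf : Continuous f) (x : ℝ) :
    ∫ z, Dk N q f z.1 z.2 x ∂mu = ∫ y in Icc (-4:ℝ) 4, (KN N (y-x) : ℂ) * (er q y * f y) := by
  have hG : Continuous fun y => er q y * f y := (er_cont q).mul hf
  have hGi : Integrable (fun y => er q y * f y) (volume.restrict (Icc (-4:ℝ) 4)) := hG.integrableOn_Icc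
  have hK : ∀ k : ℕ, Integrable (fun v : (ℝ × ℝ) × ℝ => (psi (2^k * (v.1.1*x-v.1.2)) (2^k * (v.1.1*v.2-v.1.2)) : ℂ) * (er q v.2 * f v.2))
      (mu.prod (volume.restrict (Icc (-4:ℝ) 4))) := by
    intro k
    have h1 : Integrable (fun v : (ℝ × ℝ) × ℝ => er q v.2 * f v.2) (mu.prod (volume.restrict (Icc (-4:ℝ) 4))) := hGi.comp_snd mu
    apply h1.bdd_mul (c := 1)
    · exact (Complex.measurable_ofReal.comp (psi_meas.comp
        (f := fun v : (ℝ × ℝ) × ℝ => (2^k * (v.1.1*x-v.1.2), 2^k * (v.1.1*v.2-v.1.2))) (by fun_prop))).aestronglyMeasurable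
    · filter_upwards with v
      rw [Complex.norm_real]; exact abs_psi_le _ _
  have hk : ∀ k : ℕ, Integrable (fun z : ℝ × ℝ => ∫ y in Icc (-4:ℝ) 4, (psi (2^k * (z.1*x-z.2)) (2^k * (z.1*y-z.2)) : ℂ) * (er q y * f y)) mu :=
    fun k => (hK k).integral_prod_left
  have hk2 : ∀ k : ℕ, ∫ z, (∫ y in Icc (-4:ℝ) 4, (psi (2^k * (z.1*x-z.2)) (2^k * (z.1*y-z.2)) : ℂ) * (er q y * f y)) ∂mu =
      ∫ y in Icc (-4:ℝ) 4, ((∫ ρ in (1/2:ℝ)..1, Lam (2^k * (ρ*(y-x))) : ℝ) : ℂ) * (er q y * f y) := by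
    intro k
    rw [integral_integral_swap (f := fun (z : ℝ × ℝ) (y:ℝ) => (psi (2^k * (z.1*x-z.2)) (2^k * (z.1*y-z.2)) : ℂ) * (er q y * f y)) (hK k)]
    apply integral_congr_ae
    filter_upwards with y
    rw [integral_mul_const, ← psi_int_mu, integral_complex_ofReal]
  have hk3 : ∀ k : ℕ, Integrable (fun y => ((∫ ρ in (1/2:ℝ)..1, Lam (2^k * (ρ*(y-x))) : ℝ) : ℂ) * (er q y * f y)) (volume.restrict (Icc (-4:ℝ) 4)) := by
    intro k
    have := (hK k).integral_prod_right
    refine this.congr ?_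
    filter_upwards with y
    rw [integral_mul_const, ← psi_int_mu, integral_complex_ofReal]
  unfold Dk
  rw [integral_finsetSum _ (fun k _ => (hk k).const_mul _)]
  simp only [integral_const_mul, hk2]
  simp only [← integral_const_mul]
  rw [← integral_finsetSum _ (fun k _ => (hk3 k).const_mul _)]
  apply integral_congr_ae
  filter_upwards with y
  rw [KN]; push_cast
  rw [Finset.sum_mul]
  apply Finset.sum_congr rfl
  intro k _
  ring

theorem jensen {α : Type*} [MeasurableSpace α] {ν : Measure α} (hν : ν univ ≤ 1) {p : ℝ} (hp : 1 < p) {g : α → ℝ≥0∞} (hg : AEMeasurable g ν) :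
    (∫⁻ a, g a ∂ν)^p ≤ ∫⁻ a, g a ^ p ∂ν := by
  have hpq := Real.HolderConjugate.conjExponent hp
  have h := ENNReal.lintegral_mul_le_Lp_mul_Lq ν hpq hg (aemeasurable_const (b := (1:ℝ≥0∞)))
  simp only [Pi.mul_apply, mul_one, ENNReal.one_rpow, lintegral_one] at h
  have h2 : ν univ ^ (1/(Real.conjExponent p)) ≤ 1 := ENNReal.rpow_le_one hν (by have := hpq.symm.pos; positivity)
  have h3 : ∫⁻ a, g a ∂ν ≤ (∫⁻ a, g a ^ p ∂ν)^(1/p) := h.trans (by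
    calc _ ≤ (∫⁻ a, g a ^ p ∂ν)^(1/p) * 1 := by gcongr
      _ = _ := mul_one _)
  have hp0 : 0 < p := by linarith
  calc _ ≤ ((∫⁻ a, g a ^ p ∂ν)^(1/p))^p := ENNReal.rpow_le_rpow h3 hp0.le
    _ = _ := by rw [← ENNReal.rpow_mul, one_div_mul_cancel hp0.ne', ENNReal.rpow_one]

/-- averaged operator -/
def PN (N : ℕ) (q : Polynomial ℝ) (f : ℝ → ℂ) (x : ℝ) : ℂ := ∫ y in Icc (-4:ℝ) 4, (KN N (y-x) : ℂ) * (er q y * f y)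

theorem PN_meas (N : ℕ) (q : Polynomial ℝ) {f : ℝ → ℂ} (hf : Continuous f) : Measurable (PN N q f) := by
  have : PN N q f = fun x => ∫ z, Dk N q f z.1 z.2 x ∂mu := by
    funext x; rw [Dk_avg N q hf, PN]
  rw [this]
  exact ((Dk_meas N q hf).stronglyMeasurable.integral_prod_right (ν := mu)).measurable

theorem PN_strong {d : ℕ} (hd : 1 ≤ d) {p : ℝ} (hp : 1 < p) : ∃ B : ℝ, 0 ≤ B ∧ ∀ (L : ℝ) (N : ℕ) (f : ℝ → ℂ) (ι : Type) [Finite ι] [Nonempty ι]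
    (q : ι → Polynomial ℝ), Continuous f → (∀ i, (q i).natDegree ≤ d) → 0 ≤ L →
    (∀ i j, ∀ u ∈ Icc (-4:ℝ) 4, ∀ v ∈ Icc (-4:ℝ) 4, |(q i - q j).eval u - (q i - q j).eval v| ≤ L * |u - v|) →
    L * 2 ≤ 2^(N+2) →
    ∫⁻ x in Icc (-(1/2):ℝ) (1/2), ⨆ i, ‖PN N (q i) f x‖ₑ^p ≤ ENNReal.ofReal B * ∫⁻ x in Icc (-4) 4, ‖f x‖ₑ^p := by
  obtain ⟨B, hB, h⟩ := DS3 hd hp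
  refine ⟨B, hB, ?_⟩
  intro L N f ι _ _ q hf hq hL hLip hN
  have hm : Measurable (fun u : ℝ × (ℝ × ℝ) => ⨆ i, ‖Dk N (q i) f u.2.1 u.2.2 u.1‖ₑ^p) :=
    Measurable.iSup fun i => (Dk_meas N (q i) hf).enorm.pow_const p
  calc ∫⁻ x in Icc (-(1/2):ℝ) (1/2), ⨆ i, ‖PN N (q i) f x‖ₑ^p
      ≤ ∫⁻ x in Icc (-(1/2):ℝ) (1/2), ∫⁻ z, ⨆ i, ‖Dk N (q i) f z.1 z.2 x‖ₑ^p ∂mu := by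
        apply lintegral_mono
        intro x
        apply iSup_le
        intro i
        rw [PN, ← Dk_avg N (q i) hf]
        have h1 : Measurable fun z : ℝ × ℝ => Dk N (q i) f z.1 z.2 x :=
          Measurable.comp (g := fun u : ℝ × (ℝ × ℝ) => Dk N (q i) f u.2.1 u.2.2 u.1) (f := fun z : ℝ × ℝ => (x, z)) (Dk_meas N (q i) hf) (by fun_prop)
        calc _ ≤ (∫⁻ z, ‖Dk N (q i) f z.1 z.2 x‖ₑ ∂mu)^p := ENNReal.rpow_le_rpow (enorm_integral_le_lintegral_enorm _) (by linarith)
          _ ≤ ∫⁻ z, ‖Dk N (q i) f z.1 z.2 x‖ₑ^p ∂mu := jensen mu_univ hp h1.enorm.aemeasurable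
          _ ≤ _ := lintegral_mono fun z => le_iSup (fun i => ‖Dk N (q i) f z.1 z.2 x‖ₑ^p) i
    _ = ∫⁻ z, (∫⁻ x in Icc (-(1/2):ℝ) (1/2), ⨆ i, ‖Dk N (q i) f z.1 z.2 x‖ₑ^p) ∂mu :=
        lintegral_lintegral_swap (f := fun x (z : ℝ × ℝ) => ⨆ i, ‖Dk N (q i) f z.1 z.2 x‖ₑ^p) hm.aemeasurable
    _ ≤ ∫⁻ _, (ENNReal.ofReal B * ∫⁻ x in Icc (-4) 4, ‖f x‖ₑ^p) ∂mu := by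
        apply lintegral_mono_ae
        filter_upwards [mu_ae] with z hz
        exact h z.1 z.2 L N f ι q hz.1 hz.2 hf hq hL hLip hN
    _ ≤ _ := by
        rw [lintegral_const]
        calc _ ≤ (ENNReal.ofReal B * ∫⁻ x in Icc (-4) 4, ‖f x‖ₑ^p) * 1 := by gcongr; exact mu_univ
          _ = _ := mul_one _

end

section

/-- symmetric difference quotient -/
def Hq (g : ℝ → ℂ) (x w : ℝ) : ℂ := ((1/w:ℝ):ℂ) * (g (x+w) - g (x-w))

theorem diffq {E : Type*} [NormedAddCommGroup E] [NormedSpace ℝ E] {h : ℝ → E} (hh : ContDiff ℝ 1 h) (x : ℝ) :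
    ∃ K : ℝ, 0 ≤ K ∧ ∀ w ∈ Ioc (0:ℝ) 2, ‖h (x+w) - h (x-w)‖ ≤ K * w := by
  obtain ⟨K, hK⟩ := (isCompact_Icc (a := x-2) (b := x+2)).exists_bound_of_continuousOn (hh.continuous_deriv le_rfl).continuousOn
  have hK0 : 0 ≤ K := (norm_nonneg _).trans (hK x ⟨by linarith, by linarith⟩)
  refine ⟨2*K, by positivity, fun w hw => ?_⟩
  have := Convex.norm_image_sub_le_of_norm_deriv_le (f := h) (s := Icc (x-2) (x+2)) (C := K) (x := x-w) (y := x+w)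
    (fun z _ => (hh.differentiable one_ne_zero).differentiableAt) hK (convex_Icc _ _) ⟨by linarith [hw.2], by linarith [hw.1]⟩ ⟨by linarith [hw.1], by linarith [hw.2]⟩
  refine this.trans ?_
  rw [show x + w - (x-w) = 2*w by ring, Real.norm_of_nonneg (by linarith [hw.1])]
  linarith

theorem Hq_bdd {g : ℝ → ℂ} (hg : ContDiff ℝ 1 g) (x : ℝ) : ∃ K : ℝ, 0 ≤ K ∧ ∀ w ∈ Ioc (0:ℝ) 2, ‖Hq g x w‖ ≤ K := by
  obtain ⟨K, hK, h⟩ := diffq hg x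
  refine ⟨K, hK, fun w hw => ?_⟩
  rw [Hq, norm_mul, Complex.norm_real, Real.norm_of_nonneg (by have := hw.1; positivity)]
  rw [one_div, inv_mul_le_iff₀ hw.1, mul_comm]
  exact h w hw

theorem Hq_meas {g : ℝ → ℂ} (hg : Continuous g) (x : ℝ) : Measurable (Hq g x) := by
  unfold Hq
  apply Measurable.mul
  · exact Complex.measurable_ofReal.comp (by fun_prop)
  · exact Continuous.measurable (by fun_prop)

theorem Hq_int {g : ℝ → ℂ} (hg : ContDiff ℝ 1 g) (x : ℝ) : IntegrableOn (Hq g x) (Ioc (0:ℝ) 2) := by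
  obtain ⟨K, hK, h⟩ := Hq_bdd hg x
  apply Measure.integrableOn_of_bounded (M := K)
  · simp
  · exact (Hq_meas hg.continuous x).aestronglyMeasurable
  · filter_upwards [ae_restrict_mem measurableSet_Ioc] with w hw
    exact h w hw

theorem er_smooth (q : Polynomial ℝ) : ContDiff ℝ 1 (er q) := by
  have h : ContDiff ℝ 1 (fun y => q.eval y) := by
    simpa [Polynomial.aeval_def] using Polynomial.contDiff_aeval (𝕜 := ℝ) q 1
  have h2 : ContDiff ℝ 1 (fun y => ((q.eval y : ℝ):ℂ)) := Complex.ofRealCLM.contDiff.comp h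
  exact (contDiff_const.mul h2).cexp

theorem g_smooth (q : Polynomial ℝ) {f : ℝ → ℂ} (hf : ContDiff ℝ 1 f) : ContDiff ℝ 1 (fun y => er q y * f y) := (er_smooth q).mul hf

theorem pv_eq (Q : Polynomial ℝ) {f : ℝ → ℂ} (hf : ContDiff ℝ 1 f) (x : ℝ) :
    pvCarleson Q f x = - ∫ w in (0:ℝ)..(1/2), Hq (fun y => er (Q.comp (Polynomial.C x - Polynomial.X)) y * f y) x w := by
  set g : ℝ → ℂ := fun y => er (Q.comp (Polynomial.C x - Polynomial.X)) y * f y with hgdef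
  have hg : ContDiff ℝ 1 g := g_smooth _ hf
  obtain ⟨K, hK, hb⟩ := Hq_bdd hg x
  have hHi : ∀ u v : ℝ, 0 ≤ u → u ≤ v → v ≤ 2 → IntervalIntegrable (Hq g x) volume u v := by
    intro u v hu huv hv
    rw [intervalIntegrable_iff, uIoc_of_le huv]
    exact (Hq_int hg x).mono_set (Ioc_subset_Ioc hu hv)
  have hgy : ∀ y, Complex.exp (Complex.I * ((Q.eval y : ℝ) : ℂ)) * f (x-y) = g (x-y) := by
    intro y
    simp only [hgdef, er]
    simp
  rw [pvCarleson]
  apply Tendsto.limUnder_eq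
  have e1 : ∀ ε ∈ Ioo (0:ℝ) (1/2), ∫ y in {y : ℝ | ε < |y| ∧ |y| ≤ 1 / 2},
      ((1 / y : ℝ) : ℂ) * Complex.exp (Complex.I * ((Q.eval y : ℝ) : ℂ)) * f (x - y) = - ∫ w in ε..(1/2), Hq g x w := by
    intro ε hε
    simp only [mul_assoc, hgy]
    have hs : {y : ℝ | ε < |y| ∧ |y| ≤ 1 / 2} = Ioc ε (1/2) ∪ Ico (-(1/2)) (-ε) := by
      ext y
      simp only [mem_ofPred_eq, mem_union, mem_Ioc, mem_Ico]
      constructor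
      · rintro ⟨h1, h2⟩
        rcases le_total 0 y with h | h
        · rw [abs_of_nonneg h] at h1 h2; exact Or.inl ⟨h1, h2⟩
        · rw [abs_of_nonpos h] at h1 h2; exact Or.inr ⟨by linarith, by linarith⟩
      · rintro (⟨h1, h2⟩ | ⟨h1, h2⟩)
        · rw [abs_of_nonneg (by linarith [hε.1])]; exact ⟨h1, h2⟩
        · rw [abs_of_nonpos (by linarith [hε.1])]; exact ⟨by linarith, by linarith⟩
    have hcont : ∀ s : Set ℝ, (∀ y ∈ s, y ≠ 0) → ContinuousOn (fun y : ℝ => ((1/y:ℝ):ℂ) * g (x-y)) s := by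
      intro s hs
      apply ContinuousOn.mul
      · apply Complex.continuous_ofReal.comp_continuousOn
        exact continuousOn_const.div continuousOn_id hs
      · exact (hg.continuous.comp (by fun_prop)).continuousOn
    have i1 : IntegrableOn (fun y : ℝ => ((1/y:ℝ):ℂ) * g (x-y)) (Ioc ε (1/2)) :=
      ((hcont (Icc ε (1/2)) (fun y hy => by linarith [hε.1, hy.1] |> fun (h : 0 < y) => h.ne')).integrableOn_Icc).mono_set Ioc_subset_Icc_self
    have i2 : IntegrableOn (fun y : ℝ => ((1/y:ℝ):ℂ) * g (x-y)) (Ico (-(1/2)) (-ε)) :=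
      ((hcont (Icc (-(1/2)) (-ε)) (fun y hy => by linarith [hε.1, hy.2] |> fun (h : y < 0) => h.ne)).integrableOn_Icc).mono_set Ico_subset_Icc_self
    rw [hs, setIntegral_union _ measurableSet_Ico i1 i2, integral_Ico_eq_integral_Ioc, ← intervalIntegral.integral_of_le hε.2.le,
      ← intervalIntegral.integral_of_le (by linarith [hε.2] : -(1/2) ≤ -ε)]
    · rw [← intervalIntegral.integral_comp_neg, ← intervalIntegral.integral_add, ← intervalIntegral.integral_neg]
      · apply intervalIntegral.integral_congr
        intro y _
        simp only [Hq]
        rw [sub_neg_eq_add]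
        push_cast
        rw [one_div, one_div, inv_neg]; ring
      · rw [intervalIntegrable_iff, uIoc_of_le hε.2.le]; exact i1
      · have : IntervalIntegrable (fun y : ℝ => ((1/y:ℝ):ℂ) * g (x-y)) volume (-ε) (-(1/2)) := by
          apply IntervalIntegrable.symm
          rw [intervalIntegrable_iff_integrableOn_Ico_of_le (by linarith [hε.2])]; exact i2
        have := this.comp_mul_left (c := -1)
        simpa using this
    · rw [Set.disjoint_left]; intro y h1 h2; linarith [h1.1, h2.2, hε.1]
  have e2 : ∀ ε ∈ Ioo (0:ℝ) (1/2), - ∫ w in ε..(1/2), Hq g x w = (∫ w in (0:ℝ)..ε, Hq g x w) - ∫ w in (0:ℝ)..(1/2), Hq g x w := by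
    intro ε hε
    rw [← intervalIntegral.integral_add_adjacent_intervals (hHi 0 ε le_rfl hε.1.le (by linarith [hε.2])) (hHi ε (1/2) hε.1.le hε.2.le (by norm_num))]
    ring
  have e3 : Tendsto (fun ε : ℝ => ∫ w in (0:ℝ)..ε, Hq g x w) (𝓝[>] 0) (𝓝 0) := by
    have hlim : Tendsto (fun ε : ℝ => K * ε) (𝓝[>] 0) (𝓝 0) := by
      have : Tendsto (fun ε : ℝ => K * ε) (𝓝 0) (𝓝 (K*0)) := (continuous_const.mul continuous_id).tendsto 0
      rw [mul_zero] at this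
      exact this.mono_left nhdsWithin_le_nhds
    refine squeeze_zero_norm' ?_ hlim
    filter_upwards [Ioo_mem_nhdsGT (show (0:ℝ) < 2 by norm_num)] with ε hε
    have := intervalIntegral.norm_integral_le_of_norm_le_const (a := 0) (b := ε) (f := Hq g x) (C := K) (fun w hw => by
      rw [uIoc_of_le hε.1.le] at hw
      exact hb w ⟨hw.1, by linarith [hw.2, hε.2]⟩)
    rwa [sub_zero, abs_of_pos hε.1] at this
  have e4 := e3.sub_const (∫ w in (0:ℝ)..(1/2), Hq g x w)
  rw [zero_sub] at e4
  refine e4.congr' ?_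
  filter_upwards [Ioo_mem_nhdsGT (show (0:ℝ) < 1/2 by norm_num)] with ε hε
  rw [e1 ε hε, e2 ε hε]

end

section

theorem KN_eq (N : ℕ) (w : ℝ) : KN N w = (LL (2^N*w) - LL (w/2))/w := by
  by_cases hw : w = 0
  · subst hw
    have := KN_odd N 0
    rw [neg_zero] at this
    rw [div_zero]; linarith
  · rw [← mul_KN, mul_div_cancel_left₀ _ hw]

theorem KN_meas (N : ℕ) : Measurable (KN N) := by
  have : KN N = fun w => (LL (2^N*w) - LL (w/2))/w := funext (KN_eq N)
  rw [this]
  have hL := LL_cont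
  apply Measurable.div _ measurable_id
  exact Continuous.measurable (by fun_prop)

theorem KN_big (N : ℕ) {w : ℝ} (hw : 2 ≤ |w|) : KN N w = 0 := by
  rw [KN_eq, LL_big, LL_big, sub_self, zero_div]
  · rw [abs_div, abs_two]; linarith
  · rw [abs_mul, abs_of_pos (by positivity : (0:ℝ) < 2^N)]
    have : (1:ℝ) ≤ 2^N := one_le_pow₀ (by norm_num)
    nlinarith

theorem abs_KN (N : ℕ) (w : ℝ) : |KN N w| ≤ 2^N + 1 := by
  rw [KN_eq, abs_div]
  apply div_le_of_le_mul₀ (abs_nonneg _) (by positivity)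
  have h1 := abs_LL (2^N*w)
  have h2 := abs_LL (w/2)
  rw [abs_mul, abs_of_pos (by positivity : (0:ℝ) < 2^N)] at h1
  rw [abs_div, abs_two] at h2
  have := abs_sub (LL (2^N*w)) (LL (w/2))
  nlinarith [abs_nonneg w]

theorem PN_eq (N : ℕ) (q : Polynomial ℝ) {f : ℝ → ℂ} (hf : Continuous f) {x : ℝ} (hx : x ∈ Icc (-(1/2):ℝ) (1/2)) :
    PN N q f x = ∫ w in (0:ℝ)..2, ((LL (2^N*w) - LL (w/2) : ℝ):ℂ) * Hq (fun y => er q y * f y) x w := by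
  set g : ℝ → ℂ := fun y => er q y * f y with hgdef
  have hg : Continuous g := (er_cont q).mul hf
  have hIntg : ∀ u v : ℝ, IntervalIntegrable (fun w => (KN N w : ℂ) * g (x+w)) volume u v := by
    intro u v
    have h1 : IntervalIntegrable (fun w => g (x+w)) volume u v := Continuous.intervalIntegrable (by fun_prop) u v
    rw [intervalIntegrable_iff] at h1 ⊢
    apply Integrable.bdd_mul (c := 2^N+1) h1
    · exact (Complex.measurable_ofReal.comp (KN_meas N)).aestronglyMeasurable
    · filter_upwards with w
      rw [Complex.norm_real]; exact abs_KN N w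
  have e1 : PN N q f x = ∫ w in (-2:ℝ)..2, (KN N w : ℂ) * g (x+w) := by
    rw [PN]
    have : ∫ y in Icc (-4:ℝ) 4, (KN N (y-x) : ℂ) * g y = ∫ y in Ioc (-2+x) (2+x), (KN N (y-x) : ℂ) * g y := by
      apply setIntegral_eq_of_subset_of_forall_sdiff_eq_zero measurableSet_Icc
      · intro y hy; exact ⟨by linarith [hy.1, hx.1], by linarith [hy.2, hx.2]⟩
      · intro y hy
        rw [KN_big N, Complex.ofReal_zero, zero_mul]
        by_contra h
        push Not at h
        rw [abs_lt] at h
        exact hy.2 ⟨by linarith [h.1], by linarith [h.2]⟩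
    rw [this, ← intervalIntegral.integral_of_le (by linarith)]
    rw [← intervalIntegral.integral_comp_add_right (fun y => (KN N (y-x) : ℂ) * g y) x]
    apply intervalIntegral.integral_congr
    intro w _
    simp only [add_sub_cancel_right]
    rw [add_comm]
  rw [e1, ← intervalIntegral.integral_add_adjacent_intervals (hIntg (-2) 0) (hIntg 0 2)]
  have e2 : ∫ w in (-2:ℝ)..0, (KN N w : ℂ) * g (x+w) = ∫ w in (0:ℝ)..2, (KN N (-w) : ℂ) * g (x+(-w)) := by
    rw [intervalIntegral.integral_comp_neg (fun w => (KN N w : ℂ) * g (x+w)), neg_zero]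
  have i2 : IntervalIntegrable (fun w => (KN N (-w) : ℂ) * g (x+(-w))) volume 0 2 := by
    have := (hIntg 0 (-2)).comp_mul_left (c := -1)
    simpa using this
  rw [e2, ← intervalIntegral.integral_add i2 (hIntg 0 2)]
  apply intervalIntegral.integral_congr
  intro w _
  simp only [Hq, KN_odd]
  rw [KN_eq, ← sub_eq_add_neg, div_eq_mul_one_div]
  push_cast
  ring

/-- limiting operator -/
def PI (q : Polynomial ℝ) (f : ℝ → ℂ) (x : ℝ) : ℂ :=
  ∫ w in (0:ℝ)..2, ((cc - LL (w/2) : ℝ):ℂ) * Hq (fun y => er q y * f y) x w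

theorem PN_tendsto (q : Polynomial ℝ) {f : ℝ → ℂ} (hf : ContDiff ℝ 1 f) {x : ℝ} (hx : x ∈ Icc (-(1/2):ℝ) (1/2)) :
    Tendsto (fun N => PN N q f x) atTop (𝓝 (PI q f x)) := by
  simp only [PN_eq _ q hf.continuous hx]
  obtain ⟨K, hK, hb⟩ := Hq_bdd (g_smooth q hf) x
  have hL := LL_cont
  apply intervalIntegral.tendsto_integral_filter_of_dominated_convergence (fun _ => 2*K)
  · filter_upwards with N
    apply Measurable.aestronglyMeasurable
    apply Measurable.mul
    · exact Complex.measurable_ofReal.comp (Continuous.measurable (by fun_prop))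
    · exact Hq_meas (g_smooth q hf).continuous x
  · filter_upwards with N
    filter_upwards with w hw
    rw [uIoc_of_le (by norm_num)] at hw
    rw [norm_mul, Complex.norm_real, Real.norm_eq_abs]
    have h1 := abs_LL_one (2^N*w)
    have h2 := abs_LL_one (w/2)
    have h3 := abs_sub (LL (2^N*w)) (LL (w/2))
    exact mul_le_mul (by linarith) (hb w hw) (norm_nonneg _) (by norm_num)
  · exact intervalIntegrable_const
  · filter_upwards with w hw
    rw [uIoc_of_le (by norm_num)] at hw
    apply tendsto_const_nhds.congr'
    have ht : Tendsto (fun N : ℕ => (2:ℝ)^N*w) atTop atTop :=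
      (tendsto_pow_atTop_atTop_of_one_lt (by norm_num)).atTop_mul_const hw.1
    filter_upwards [ht.eventually_ge_atTop 1] with N hN
    rw [LL_big (hN.trans (le_abs_self _))]

end

section

/-- local average -/
def Ee (f : ℝ → ℂ) (x : ℝ) : ℝ≥0∞ := ∫⁻ w in Ioc (0:ℝ) 2, (‖f (x+w)‖ₑ + ‖f (x-w)‖ₑ)

theorem Hq_le (q : Polynomial ℝ) (f : ℝ → ℂ) (x : ℝ) {w : ℝ} (hw : 0 < w) :
    ‖Hq (fun y => er q y * f y) x w‖ ≤ (1/w) * (‖f (x+w)‖ + ‖f (x-w)‖) := by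
  rw [Hq, norm_mul, Complex.norm_real, Real.norm_of_nonneg (by positivity)]
  gcongr
  refine (norm_sub_le _ _).trans ?_
  simp [norm_er]

theorem piece (q : Polynomial ℝ) (f : ℝ → ℂ) (x : ℝ) {u v : ℝ} (hu : 0 ≤ u) (huv : u ≤ v) (hv : v ≤ 2) (m : ℝ → ℝ)
    (hm : ∀ w ∈ Ioc u v, |m w| ≤ w) : ‖∫ w in u..v, (m w : ℂ) * Hq (fun y => er q y * f y) x w‖ₑ ≤ Ee f x := by
  rw [intervalIntegral.integral_of_le huv, Ee]
  refine (enorm_integral_le_lintegral_enorm _).trans ?_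
  refine le_trans ?_ (lintegral_mono_set (Ioc_subset_Ioc hu hv))
  apply setLIntegral_mono' measurableSet_Ioc
  intro w hw
  have hw0 : 0 < w := lt_of_le_of_lt hu hw.1
  rw [← ofReal_norm, ← ofReal_norm, ← ofReal_norm, ← ENNReal.ofReal_add (norm_nonneg _) (norm_nonneg _)]
  apply ENNReal.ofReal_le_ofReal
  rw [norm_mul, Complex.norm_real, Real.norm_eq_abs]
  calc |m w| * _ ≤ w * ((1/w) * (‖f (x+w)‖ + ‖f (x-w)‖)) := mul_le_mul (hm w hw) (Hq_le q f x hw0) (norm_nonneg _) hw0.le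
    _ = _ := by field_simp

theorem pv_le (Q : Polynomial ℝ) {f : ℝ → ℂ} (hf : ContDiff ℝ 1 f) (x : ℝ) :
    ‖pvCarleson Q f x‖ₑ ≤ 8 * (‖PI (Q.comp (Polynomial.C x - Polynomial.X)) f x‖ₑ + 2 * Ee f x) := by
  set q := Q.comp (Polynomial.C x - Polynomial.X) with hq
  have hHi : IntegrableOn (Hq (fun y => er q y * f y) x) (Ioc (0:ℝ) 2) := Hq_int (g_smooth q hf) x
  have hL := LL_cont
  have hmi : ∀ u v : ℝ, 0 ≤ u → u ≤ v → v ≤ 2 → ∀ m : ℝ → ℝ, Measurable m → (∀ w, |m w| ≤ 2) → 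
      IntervalIntegrable (fun w => (m w : ℂ) * Hq (fun y => er q y * f y) x w) volume u v := by
    intro u v hu huv hv m hm hb
    rw [intervalIntegrable_iff, uIoc_of_le huv]
    apply Integrable.bdd_mul (c := 2) (hHi.mono_set (Ioc_subset_Ioc hu hv))
    · exact (Complex.measurable_ofReal.comp hm).aestronglyMeasurable
    · filter_upwards with w
      rw [Complex.norm_real]; exact hb w
  have m1 : Measurable (fun w => cc - LL (w/2)) := Continuous.measurable (by fun_prop)
  have m2 : Measurable (fun w => - LL (w/2)) := Continuous.measurable (by fun_prop)
  have b1 : ∀ w, |cc - LL (w/2)| ≤ 2 := fun w => by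
    have := abs_LL_one (w/2); rw [cc_val]; rw [abs_le] at *; constructor <;> linarith
  have b2 : ∀ w, |-LL (w/2)| ≤ 2 := fun w => by
    have := abs_LL_one (w/2); rw [abs_neg]; linarith
  have key : (cc:ℂ) * pvCarleson Q f x + PI q f x = (∫ w in (0:ℝ)..(1/2), ((-LL (w/2):ℝ):ℂ) * Hq (fun y => er q y * f y) x w) + 
      ∫ w in (1/2:ℝ)..2, ((cc - LL (w/2):ℝ):ℂ) * Hq (fun y => er q y * f y) x w := by
    rw [pv_eq Q hf, PI, ← intervalIntegral.integral_add_adjacent_intervals (hmi 0 (1/2) le_rfl (by norm_num) (by norm_num) _ m1 b1) (hmi (1/2) 2 (by norm_num) (by norm_num) le_rfl _ m1 b1),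
      ← add_assoc]
    congr 1
    have i0 := hmi 0 (1/2) le_rfl (by norm_num) (by norm_num) (fun _ => -cc) measurable_const (fun w => by rw [cc_val]; norm_num [abs_le])
    have e0 : (cc:ℂ) * -∫ w in (0:ℝ)..(1/2), Hq (fun y => er q y * f y) x w = ∫ w in (0:ℝ)..(1/2), ((-cc:ℝ):ℂ) * Hq (fun y => er q y * f y) x w := by
      rw [intervalIntegral.integral_const_mul]; push_cast; ring
    rw [e0, ← intervalIntegral.integral_add i0 (hmi 0 (1/2) le_rfl (by norm_num) (by norm_num) _ m1 b1)]
    apply intervalIntegral.integral_congr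
    intro w _
    simp only
    push_cast; ring
  have hb : ‖(cc:ℂ) * pvCarleson Q f x + PI q f x‖ₑ ≤ 2 * Ee f x := by
    rw [key, two_mul]
    refine (enorm_add_le _ _).trans (add_le_add ?_ ?_)
    · apply piece q f x le_rfl (by norm_num) (by norm_num)
      intro w hw
      have := abs_LL (w/2)
      rw [abs_of_pos (by linarith [hw.1] : 0 < w/2)] at this
      rw [abs_neg]; linarith [hw.1]
    · apply piece q f x (by norm_num) (by norm_num) le_rfl
      intro w hw
      have := abs_LL (w/2)
      rw [abs_of_pos (by linarith [hw.1] : 0 < w/2)] at this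
      rw [cc_val]; rw [abs_le] at *
      constructor <;> linarith [hw.1]
  have e : pvCarleson Q f x = (-8:ℂ) * (((cc:ℂ) * pvCarleson Q f x + PI q f x) - PI q f x) := by
    rw [cc_val]; push_cast; ring
  rw [e, enorm_mul]
  have h8 : ‖(-8:ℂ)‖ₑ = 8 := by
    rw [enorm_neg, ← ofReal_norm]; simp
  rw [h8]
  gcongr
  refine (enorm_sub_le).trans ?_
  rw [add_comm]
  gcongr

/-- polynomial from coefficients -/
def qa (d : ℕ) (a : Fin (d+1) → ℝ) : Polynomial ℝ := ∑ i : Fin (d+1), Polynomial.monomial (i:ℕ) (a i)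

theorem qa_deg (d : ℕ) (a : Fin (d+1) → ℝ) : (qa d a).natDegree ≤ d := by
  apply Polynomial.natDegree_sum_le_of_forall_le
  intro i _
  exact (Polynomial.natDegree_monomial_le _).trans (by omega)

theorem qa_surj {d : ℕ} {q : Polynomial ℝ} (hq : q.natDegree ≤ d) : ∃ a, q = qa d a := by
  refine ⟨fun i => q.coeff i, ?_⟩
  rw [qa, ← Finset.sum_range (fun i => Polynomial.monomial i (q.coeff i))]
  exact q.as_sum_range' (d+1) (by omega)

theorem qa_eval (d : ℕ) (a : Fin (d+1) → ℝ) (y : ℝ) : (qa d a).eval y = ∑ i : Fin (d+1), a i * y^(i:ℕ) := by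
  rw [qa, Polynomial.eval_finsetSum]
  simp

theorem er_sub (q : Polynomial ℝ) (u v : ℝ) : ‖er q u - er q v‖ ≤ |q.eval u - q.eval v| := by
  have : er q u - er q v = er q v * (Complex.exp (Complex.I * ((q.eval u - q.eval v : ℝ):ℂ)) - 1) := by
    rw [mul_sub, er, er, ← Complex.exp_add, mul_one]
    congr 2; push_cast; ring
  rw [this, norm_mul, norm_er, one_mul]
  exact Real.norm_exp_I_mul_ofReal_sub_one_le

theorem PI_cont (d : ℕ) {f : ℝ → ℂ} (hf : ContDiff ℝ 1 f) (x : ℝ) : Continuous (fun a => PI (qa d a) f x) := by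
  rw [continuous_iff_continuousAt]
  intro a₀
  have hL := LL_cont
  obtain ⟨M, hM⟩ := (isCompact_Icc (a := x-2) (b := x+2)).exists_bound_of_continuousOn hf.continuous.continuousOn
  have hM0 : 0 ≤ M := (norm_nonneg _).trans (hM x ⟨by linarith, by linarith⟩)
  obtain ⟨K, hK, hKb⟩ := diffq hf x
  have hp : ∀ i : Fin (d+1), ∃ K : ℝ, 0 ≤ K ∧ ∀ w ∈ Ioc (0:ℝ) 2, ‖(x+w)^(i:ℕ) - (x-w)^(i:ℕ)‖ ≤ K * w :=
    fun i => diffq (h := fun y : ℝ => y^(i:ℕ)) (contDiff_id.pow _) x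
  choose P hP hPb using hp
  set S : ℝ := ∑ i, (|a₀ i| + 1) * P i with hS
  have hev : ∀ᶠ a in 𝓝 a₀, ∀ i, |a i| ≤ |a₀ i| + 1 := by
    rw [eventually_all]
    intro i
    have : Tendsto (fun a : Fin (d+1) → ℝ => |a i|) (𝓝 a₀) (𝓝 |a₀ i|) := ((continuous_apply i).abs).tendsto a₀
    filter_upwards [this.eventually_lt_const (show |a₀ i| < |a₀ i| + 1 by linarith)] with a ha using ha.le
  apply intervalIntegral.continuousAt_of_dominated_interval (bound := fun _ => 2 * (S * M + K))
  · filter_upwards with a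
    apply Measurable.aestronglyMeasurable
    apply Measurable.mul
    · exact Complex.measurable_ofReal.comp (Continuous.measurable (by fun_prop))
    · exact Hq_meas (g_smooth _ hf).continuous x
  · filter_upwards [hev] with a ha
    filter_upwards with w hw
    rw [uIoc_of_le (by norm_num)] at hw
    have b1 : |cc - LL (w/2)| ≤ 2 := by
      have := abs_LL_one (w/2); rw [cc_val]; rw [abs_le] at *; constructor <;> linarith
    rw [norm_mul, Complex.norm_real, Real.norm_eq_abs]
    refine mul_le_mul b1 ?_ (norm_nonneg _) (by norm_num)
    rw [Hq, norm_mul, Complex.norm_real, Real.norm_of_nonneg (by have := hw.1; positivity), one_div, inv_mul_le_iff₀ hw.1]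
    have e : er (qa d a) (x+w) * f (x+w) - er (qa d a) (x-w) * f (x-w) = 
        (er (qa d a) (x+w) - er (qa d a) (x-w)) * f (x+w) + er (qa d a) (x-w) * (f (x+w) - f (x-w)) := by ring
    rw [e]
    refine (norm_add_le _ _).trans ?_
    rw [norm_mul, norm_mul, norm_er, one_mul]
    have h1 : ‖er (qa d a) (x+w) - er (qa d a) (x-w)‖ ≤ S * w := by
      refine (er_sub _ _ _).trans ?_
      rw [qa_eval, qa_eval, ← Finset.sum_sub_distrib, hS, Finset.sum_mul]
      refine (Finset.abs_sum_le_sum_abs _ _).trans ?_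
      apply Finset.sum_le_sum
      intro i _
      rw [← mul_sub, abs_mul, mul_assoc]
      exact mul_le_mul (ha i) (hPb i w hw) (abs_nonneg _) (by positivity)
    have h2 := hM (x+w) ⟨by linarith [hw.1], by linarith [hw.2]⟩
    have h3 := hKb w hw
    have h4 := mul_le_mul h1 h2 (norm_nonneg _) ((norm_nonneg _).trans h1)
    linarith
  · exact intervalIntegrable_const
  · filter_upwards with w _
    apply Continuous.continuousAt
    simp only [Hq, er, qa_eval]
    fun_prop

/-- dense sequence of polynomials -/
def qn (d : ℕ) (n : ℕ) : Polynomial ℝ := qa d (TopologicalSpace.denseSeq (Fin (d+1) → ℝ) n)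

theorem PI_le_sup {d : ℕ} {f : ℝ → ℂ} (hf : ContDiff ℝ 1 f) (x : ℝ) {q : Polynomial ℝ} (hq : q.natDegree ≤ d) :
    ‖PI q f x‖ₑ ≤ ⨆ n, ‖PI (qn d n) f x‖ₑ := by
  obtain ⟨a, rfl⟩ := qa_surj hq
  refine (TopologicalSpace.denseRange_denseSeq (Fin (d+1) → ℝ)).induction_on
    (p := fun a => ‖PI (qa d a) f x‖ₑ ≤ ⨆ n, ‖PI (qn d n) f x‖ₑ) a ?_ ?_
  · exact isClosed_le (PI_cont d hf x).enorm continuous_const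
  · intro n
    exact le_iSup (fun n => ‖PI (qn d n) f x‖ₑ) n

theorem Carleson_le {d : ℕ} {f : ℝ → ℂ} (hf : ContDiff ℝ 1 f) (x : ℝ) :
    CarlesonOp d f x ≤ 8 * ((⨆ n, ‖PI (qn d n) f x‖ₑ) + 2 * Ee f x) := by
  rw [CarlesonOp]
  apply iSup_le
  rintro ⟨Q, hQ⟩
  refine (pv_le Q hf x).trans ?_
  gcongr
  apply PI_le_sup hf
  refine Polynomial.natDegree_comp_le.trans ?_
  have : (Polynomial.C x - Polynomial.X : Polynomial ℝ).natDegree ≤ 1 := by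
    refine (Polynomial.natDegree_sub_le _ _).trans ?_
    simp
  nlinarith

end

section

theorem poly_lip (q : Polynomial ℝ) : ∃ K : ℝ, 0 ≤ K ∧ ∀ u ∈ Icc (-4:ℝ) 4, ∀ v ∈ Icc (-4:ℝ) 4, |q.eval u - q.eval v| ≤ K * |u - v| := by
  obtain ⟨K, hK⟩ := (isCompact_Icc (a := (-4:ℝ)) (b := 4)).exists_bound_of_continuousOn (f := fun y => q.derivative.eval y) q.derivative.continuous.continuousOn
  refine ⟨K, (norm_nonneg _).trans (hK 0 (by norm_num)), fun u hu v hv => ?_⟩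
  exact Convex.norm_image_sub_le_of_norm_deriv_le (f := fun y => q.eval y) (s := Icc (-4:ℝ) 4) (C := K) (x := v) (y := u)
    (fun z _ => q.differentiableAt) (fun z hz => by rw [Polynomial.deriv]; exact hK z hz) (convex_Icc _ _) hv hu

theorem PI_fin {d : ℕ} (hd : 1 ≤ d) {p : ℝ} (hp : 1 < p) : ∃ B : ℝ, 0 ≤ B ∧ ∀ (f : ℝ → ℂ) (m : ℕ), ContDiff ℝ 1 f → 
    ∫⁻ x in Icc (-(1/2):ℝ) (1/2), ⨆ i : Fin (m+1), ‖PI (qn d i) f x‖ₑ^p ≤ ENNReal.ofReal B * ∫⁻ x in Icc (-4:ℝ) 4, ‖f x‖ₑ^p := by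
  obtain ⟨B, hB, h⟩ := PN_strong hd hp
  refine ⟨B, hB, fun f m hf => ?_⟩
  have hl : ∀ i j : Fin (m+1), ∃ K : ℝ, 0 ≤ K ∧ ∀ u ∈ Icc (-4:ℝ) 4, ∀ v ∈ Icc (-4:ℝ) 4, |(qn d i - qn d j).eval u - (qn d i - qn d j).eval v| ≤ K * |u - v| :=
    fun i j => poly_lip _
  choose K hK0 hK using hl
  set L : ℝ := ∑ i, ∑ j, K i j with hLd
  have hL0 : 0 ≤ L := Finset.sum_nonneg fun i _ => Finset.sum_nonneg fun j _ => hK0 i j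
  have hKL : ∀ i j, K i j ≤ L := fun i j =>
    (Finset.single_le_sum (f := fun j => K i j) (fun j _ => hK0 i j) (Finset.mem_univ j)).trans
      (Finset.single_le_sum (f := fun i => ∑ j, K i j) (fun i _ => Finset.sum_nonneg fun j _ => hK0 i j) (Finset.mem_univ i))
  have hp0 : 0 ≤ p := by linarith
  calc ∫⁻ x in Icc (-(1/2):ℝ) (1/2), ⨆ i : Fin (m+1), ‖PI (qn d i) f x‖ₑ^p
      ≤ ∫⁻ x in Icc (-(1/2):ℝ) (1/2), liminf (fun N => ⨆ i : Fin (m+1), ‖PN N (qn d i) f x‖ₑ^p) atTop := by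
        apply setLIntegral_mono' measurableSet_Icc
        intro x hx
        apply iSup_le
        intro i
        have ht : Tendsto (fun N => ‖PN N (qn d i) f x‖ₑ^p) atTop (𝓝 (‖PI (qn d i) f x‖ₑ^p)) :=
          ((ENNReal.continuous_rpow_const (y := p)).tendsto _).comp ((continuous_enorm.tendsto _).comp (PN_tendsto (qn d i) hf hx))
        rw [← ht.liminf_eq]
        refine liminf_le_liminf (Eventually.of_forall fun N => ?_)
        exact le_iSup (fun i : Fin (m+1) => ‖PN N (qn d i) f x‖ₑ^p) i
    _ ≤ liminf (fun N => ∫⁻ x in Icc (-(1/2):ℝ) (1/2), ⨆ i : Fin (m+1), ‖PN N (qn d i) f x‖ₑ^p) atTop := by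
        apply lintegral_liminf_le
        intro N
        exact Measurable.iSup fun i => (PN_meas N _ hf.continuous).enorm.pow_const p
    _ ≤ _ := by
        apply liminf_le_of_frequently_le'
        apply Eventually.frequently
        have ht : Tendsto (fun N : ℕ => (2:ℝ)^N) atTop atTop := tendsto_pow_atTop_atTop_of_one_lt (by norm_num)
        filter_upwards [ht.eventually_ge_atTop (L*2)] with N hN
        apply h L N f (Fin (m+1)) (fun i => qn d i) hf.continuous (fun i => qa_deg _ _) hL0
        · intro i j u hu v hv
          refine (hK i j u hu v hv).trans ?_
          gcongr
          exact hKL i j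
        · rw [pow_add]; nlinarith [pow_pos (show (0:ℝ) < 2 by norm_num) N]

theorem PI_aemeas (q : Polynomial ℝ) {f : ℝ → ℂ} (hf : ContDiff ℝ 1 f) : AEMeasurable (PI q f) (volume.restrict (Icc (-(1/2):ℝ) (1/2))) := by
  apply aemeasurable_of_tendsto_metrizable_ae atTop (f := fun N => PN N q f)
  · intro N; exact (PN_meas N q hf.continuous).aemeasurable
  · filter_upwards [ae_restrict_mem measurableSet_Icc] with x hx
    exact PN_tendsto q hf hx

theorem PI_strong {d : ℕ} (hd : 1 ≤ d) {p : ℝ} (hp : 1 < p) : ∃ B : ℝ, 0 ≤ B ∧ ∀ (f : ℝ → ℂ), ContDiff ℝ 1 f → 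
    ∫⁻ x in Icc (-(1/2):ℝ) (1/2), (⨆ n, ‖PI (qn d n) f x‖ₑ)^p ≤ ENNReal.ofReal B * ∫⁻ x in Icc (-4:ℝ) 4, ‖f x‖ₑ^p := by
  obtain ⟨B, hB, h⟩ := PI_fin hd hp
  refine ⟨B, hB, fun f hf => ?_⟩
  have e : ∀ x, (⨆ n, ‖PI (qn d n) f x‖ₑ)^p = ⨆ m : ℕ, ⨆ i : Fin (m+1), ‖PI (qn d i) f x‖ₑ^p := by
    intro x
    have h1 := (ENNReal.orderIsoRpow p (by linarith)).map_iSup (fun n => ‖PI (qn d n) f x‖ₑ)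
    simp only [ENNReal.orderIsoRpow_apply] at h1
    rw [h1]
    apply le_antisymm
    · apply iSup_le
      intro n
      exact le_iSup_of_le n (le_iSup_of_le (Fin.last n) le_rfl)
    · apply iSup_le
      intro m
      apply iSup_le
      intro i
      exact le_iSup (fun n => ‖PI (qn d n) f x‖ₑ^p) i
  simp only [e]
  rw [lintegral_iSup']
  · exact iSup_le fun m => h f m hf
  · intro m
    exact AEMeasurable.iSup fun i => (PI_aemeas _ hf).enorm.pow_const p
  · filter_upwards with x
    intro m n hmn
    apply iSup_le
    intro i
    exact le_iSup_of_le (Fin.castLE (by omega) i) le_rfl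

theorem per_le {g : ℝ → ℝ≥0∞} (hg : Function.Periodic g 1) :
    ∫⁻ x in Icc (-4:ℝ) 4, g x ≤ 9 * ∫⁻ x in Icc (-(1/2):ℝ) (1/2), g x := by
  have hsub : Icc (-4:ℝ) 4 ⊆ ⋃ k : Fin 9, Icc (((k:ℕ):ℝ) - 4 - 1/2) (((k:ℕ):ℝ) - 4 + 1/2) := by
    intro y hy
    have h0 : 0 ≤ y + 4 + 1/2 := by linarith [hy.1]
    have h1 := Nat.floor_le h0
    have h2 := Nat.lt_floor_add_one (y+4+1/2)
    have h3 : ⌊y+4+1/2⌋₊ < 9 := by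
      rw [Nat.floor_lt h0]; push_cast; linarith [hy.2]
    rw [mem_iUnion]
    exact ⟨⟨_, h3⟩, ⟨by simp only; linarith, by simp only; linarith⟩⟩
  have ht : ∀ k : Fin 9, ∫⁻ x in Icc (((k:ℕ):ℝ) - 4 - 1/2) (((k:ℕ):ℝ) - 4 + 1/2), g x = ∫⁻ x in Icc (-(1/2):ℝ) (1/2), g x := by
    intro k
    rw [← (measurePreserving_add_right volume (((k:ℕ):ℝ) - 4)).setLIntegral_comp_preimage_emb (measurableEmbedding_addRight _)]
    have hp : ∀ x, g (x + (((k:ℕ):ℝ) - 4)) = g x := by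
      intro x
      have := hg.int_mul ((k:ℕ) - 4 : ℤ) x
      push_cast at this
      rwa [mul_one] at this
    simp only [hp]
    congr 2
    ext x
    simp only [mem_preimage, mem_Icc]
    constructor <;> rintro ⟨h1, h2⟩ <;> constructor <;> linarith
  calc _ ≤ ∫⁻ x in ⋃ k : Fin 9, Icc (((k:ℕ):ℝ) - 4 - 1/2) (((k:ℕ):ℝ) - 4 + 1/2), g x := lintegral_mono_set hsub
    _ ≤ ∑' k : Fin 9, ∫⁻ x in Icc (((k:ℕ):ℝ) - 4 - 1/2) (((k:ℕ):ℝ) - 4 + 1/2), g x := lintegral_iUnion_le _ _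
    _ = _ := by simp only [ht]; rw [tsum_fintype]; simp

theorem Ee_le {f : ℝ → ℂ} (hf : Continuous f) (hper : Function.Periodic f 1) {x : ℝ} (hx : x ∈ Icc (-(1/2):ℝ) (1/2)) :
    Ee f x ≤ 18 * ∫⁻ x in Icc (-(1/2):ℝ) (1/2), ‖f x‖ₑ := by
  have hg : Function.Periodic (fun x => ‖f x‖ₑ) 1 := fun y => by simp only [hper y]
  have h0 := per_le hg
  have h1 : ∫⁻ w in Ioc (0:ℝ) 2, ‖f (x+w)‖ₑ ≤ ∫⁻ y in Icc (-4:ℝ) 4, ‖f y‖ₑ := by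
    rw [← (measurePreserving_add_left volume x).setLIntegral_comp_preimage_emb (measurableEmbedding_addLeft _) (fun y => ‖f y‖ₑ)]
    apply lintegral_mono_set
    intro w hw
    exact ⟨by simp only; linarith [hw.1, hx.1], by simp only; linarith [hw.2, hx.2]⟩
  have h2 : ∫⁻ w in Ioc (0:ℝ) 2, ‖f (x-w)‖ₑ ≤ ∫⁻ y in Icc (-4:ℝ) 4, ‖f y‖ₑ := by
    rw [← (Measure.measurePreserving_sub_left volume x).setLIntegral_comp_preimage_emb (MeasurableEquiv.subLeft x).measurableEmbedding (fun y => ‖f y‖ₑ)]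
    apply lintegral_mono_set
    intro w hw
    exact ⟨by simp only; linarith [hw.2, hx.1], by simp only; linarith [hw.1, hx.2]⟩
  rw [Ee, lintegral_add_left (f := fun w => ‖f (x+w)‖ₑ) (hf.enorm.measurable.comp (measurable_const_add x))]
  calc _ ≤ 9 * (∫⁻ x in Icc (-(1/2):ℝ) (1/2), ‖f x‖ₑ) + 9 * ∫⁻ x in Icc (-(1/2):ℝ) (1/2), ‖f x‖ₑ := add_le_add (h1.trans h0) (h2.trans h0)
    _ = _ := by rw [← add_mul]; norm_num


end

/-- **The Polynomial Carleson Theorem.** For `d ≥ 1` and `1 < p < ∞` there is a constant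
`C(p,d) > 0` such that for every `f ∈ C¹(𝕋)` (a `C¹` function of period `1`),
`‖C_d f‖_{L^p(𝕋)} ≤ C(p,d)·‖f‖_{L^p(𝕋)}`, with `𝕋 = [−1/2,1/2]`. -/
theorem polynomial_carleson (d : ℕ) (hd : 1 ≤ d) (p : ℝ) (hp : 1 < p) :
    ∃ C : ℝ, 0 < C ∧
      ∀ f : ℝ → ℂ, ContDiff ℝ 1 f → Function.Periodic f 1 →
        (∫⁻ x in Icc (-(1 / 2) : ℝ) (1 / 2), CarlesonOp d f x ^ p) ^ (1 / p) ≤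
          ENNReal.ofReal C *
            (∫⁻ x in Icc (-(1 / 2) : ℝ) (1 / 2), (‖f x‖₊ : ℝ≥0∞) ^ p) ^ (1 / p) := by
  obtain ⟨B, hB, h⟩ := PI_strong hd hp
  have hp0 : 0 < p := by linarith
  have h1p : 0 ≤ 1/p := by positivity
  set D : ℝ≥0∞ := 8^p * (2^(p-1) * (ENNReal.ofReal B * 9 + 36^p)) with hD
  have hDt : D ≠ ∞ := by
    have h8 : (8:ℝ≥0∞)^p ≠ ∞ := ENNReal.rpow_ne_top_of_nonneg hp0.le (by norm_num)
    have h2 : (2:ℝ≥0∞)^(p-1) ≠ ∞ := ENNReal.rpow_ne_top_of_nonneg (by linarith) (by norm_num)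
    have h36 : (36:ℝ≥0∞)^p ≠ ∞ := ENNReal.rpow_ne_top_of_nonneg hp0.le (by norm_num)
    exact ENNReal.mul_ne_top h8 (ENNReal.mul_ne_top h2 (ENNReal.add_ne_top.2 ⟨ENNReal.mul_ne_top ENNReal.ofReal_ne_top (by norm_num), h36⟩))
  have hDt2 : D^(1/p) ≠ ∞ := ENNReal.rpow_ne_top_of_nonneg h1p hDt
  refine ⟨(D^(1/p)).toReal + 1, by positivity, fun f hf hper => ?_⟩
  have hDC : D^(1/p) ≤ ENNReal.ofReal ((D^(1/p)).toReal + 1) := by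
    rw [← ENNReal.ofReal_toReal hDt2]
    apply ENNReal.ofReal_le_ofReal
    rw [ENNReal.toReal_ofReal ENNReal.toReal_nonneg]
    linarith
  change _ ≤ _ * (∫⁻ x in Icc (-(1 / 2) : ℝ) (1 / 2), ‖f x‖ₑ ^ p) ^ (1 / p)
  set J : ℝ≥0∞ := ∫⁻ x in Icc (-(1 / 2) : ℝ) (1 / 2), ‖f x‖ₑ ^ p with hI
  set A : ℝ≥0∞ := ∫⁻ x in Icc (-(1 / 2) : ℝ) (1 / 2), ‖f x‖ₑ with hA
  have hvol : (volume.restrict (Icc (-(1 / 2) : ℝ) (1 / 2))) univ = 1 := by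
    rw [Measure.restrict_apply_univ, Real.volume_Icc]; norm_num
  have hAI : A^p ≤ J := jensen hvol.le hp (hf.continuous.enorm.measurable.aemeasurable)
  have hSI : ∫⁻ x in Icc (-(1/2):ℝ) (1/2), (⨆ n, ‖PI (qn d n) f x‖ₑ)^p ≤ ENNReal.ofReal B * 9 * J := by
    refine (h f hf).trans ?_
    rw [mul_assoc]
    gcongr
    exact per_le (g := fun x => ‖f x‖ₑ^p) (fun y => by simp only [hper y])
  have main : ∫⁻ x in Icc (-(1 / 2) : ℝ) (1 / 2), CarlesonOp d f x ^ p ≤ D * J := by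
    calc ∫⁻ x in Icc (-(1 / 2) : ℝ) (1 / 2), CarlesonOp d f x ^ p
        ≤ ∫⁻ x in Icc (-(1 / 2) : ℝ) (1 / 2), 8^p * (2^(p-1) * ((⨆ n, ‖PI (qn d n) f x‖ₑ)^p + (36*A)^p)) := by
          apply setLIntegral_mono' measurableSet_Icc
          intro x hx
          calc CarlesonOp d f x ^ p ≤ (8 * ((⨆ n, ‖PI (qn d n) f x‖ₑ) + 36 * A))^p := by
                apply ENNReal.rpow_le_rpow _ hp0.le
                refine (Carleson_le hf x).trans ?_
                refine mul_le_mul_right (add_le_add_right ?_ _) _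
                calc 2 * Ee f x ≤ 2 * (18 * A) := by gcongr; exact Ee_le hf.continuous hper hx
                  _ = 36 * A := by rw [← mul_assoc]; norm_num
            _ = 8^p * ((⨆ n, ‖PI (qn d n) f x‖ₑ) + 36 * A)^p := ENNReal.mul_rpow_of_nonneg _ _ hp0.le
            _ ≤ _ := by
                gcongr
                exact ENNReal.rpow_add_le_mul_rpow_add_rpow _ _ hp.le
      _ = 8^p * (2^(p-1) * ((∫⁻ x in Icc (-(1 / 2) : ℝ) (1 / 2), (⨆ n, ‖PI (qn d n) f x‖ₑ)^p) + (36*A)^p)) := by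
          rw [lintegral_const_mul' _ _ (ENNReal.rpow_ne_top_of_nonneg hp0.le (by norm_num)),
            lintegral_const_mul' _ _ (ENNReal.rpow_ne_top_of_nonneg (by linarith) (by norm_num)),
            lintegral_add_right _ measurable_const, lintegral_const, hvol, mul_one]
      _ ≤ 8^p * (2^(p-1) * (ENNReal.ofReal B * 9 * J + 36^p * J)) := by
          gcongr
          rw [ENNReal.mul_rpow_of_nonneg _ _ hp0.le]
          gcongr
      _ = D * J := by rw [hD]; ring
  calc _ ≤ (D * J)^(1/p) := ENNReal.rpow_le_rpow main h1p
    _ = D^(1/p) * J^(1/p) := ENNReal.mul_rpow_of_nonneg _ _ h1p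
    _ ≤ _ := by gcongr

end PolyCarleson
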